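/- (S-unit lemma) Let k be a number field and n a positive integer. Let Γ be a finitely generated subgroup of the multiplicative group k^*. Then all but finitely many solutions (u_0, u_1, …, u_n) ∈ Γ^{n+1} of the equation u_0 + u_1 + ⋯ + u_n = 1 satisfy an equation of the form Σ_{i∈I} u_i = 0 for some nonempty subset I of {0, …, n}. -/

import Mathlib

open scoped BigOperators

namespace SUnit
open MvPolynomial

section Hasse
variable {σ : Type*} [Fintype σ] {K : Type*} [Field K]

/-- The Hasse derivative of a multivariate integer polynomial. -/
noncomputable def hasse (J : σ →₀ ℕ) : MvPolynomial σ ℤ →ₗ[ℤ] MvPolynomial σ ℤ :=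
  (basisMonomials σ ℤ).constr ℤ fun a => monomial (a - J) ((∏ i, (a i).choose (J i) : ℕ) : ℤ)

lemma hasse_monomial (J a : σ →₀ ℕ) (c : ℤ) :
    hasse J (monomial a c) = monomial (a - J) (c * ((∏ i, (a i).choose (J i) : ℕ) : ℤ)) := by
  have h1 : (monomial a c : MvPolynomial σ ℤ) = c • basisMonomials σ ℤ a := by
    simp [smul_monomial]
  rw [h1, map_smul, hasse, Module.Basis.constr_basis, smul_monomial, smul_eq_mul]

lemma hasse_hasse (I J : σ →₀ ℕ) (p : MvPolynomial σ ℤ) :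
    hasse I (hasse J p) = ((∏ i, (I i + J i).choose (J i) : ℕ) : ℤ) • hasse (I + J) p := by
  induction p using MvPolynomial.induction_on' with
  | add p q hp hq => simp only [map_add, hp, hq, smul_add]
  | monomial a c =>
    simp only [hasse_monomial, smul_monomial]
    have h1 : a - J - I = a - (I + J) := by
      rw [add_comm, tsub_add_eq_tsub_tsub]
    rw [h1]
    congr 1
    rw [smul_eq_mul, mul_assoc, mul_left_comm _ c]
    congr 1
    norm_cast
    rw [← Finset.prod_mul_distrib, ← Finset.prod_mul_distrib]
    refine Finset.prod_congr rfl fun i _ => ?_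
    have := @Nat.choose_mul (a i) (I i + J i) (J i) (by omega)
    simp only [Finsupp.coe_tsub, Pi.sub_apply, Finsupp.coe_add, Pi.add_apply]
    rw [Nat.add_sub_cancel] at this
    rw [← this]
    ring

lemma hasse_zero (p : MvPolynomial σ ℤ) : hasse 0 p = p := by
  induction p using MvPolynomial.induction_on' with
  | add p q hp hq => simp only [map_add, hp, hq]
  | monomial a c => simp [hasse_monomial]

lemma pderiv_eq_hasse (h : σ) (p : MvPolynomial σ ℤ) :
    pderiv h p = hasse (Finsupp.single h 1) p := by
  classical
  induction p using MvPolynomial.induction_on' with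
  | add p q hp hq => simp only [map_add, hp, hq]
  | monomial a c =>
    rw [hasse_monomial, pderiv_monomial]
    congr 2
    rw [Finset.prod_eq_single h]
    · simp
    · intro b _ hb
      simp [hb.symm]
    · simp

lemma pderiv_hasse (h : σ) (J : σ →₀ ℕ) (p : MvPolynomial σ ℤ) :
    pderiv h (hasse J p) = ((J h + 1 : ℕ) : ℤ) • hasse (Finsupp.single h 1 + J) p := by
  classical
  rw [pderiv_eq_hasse, hasse_hasse]
  congr 2
  rw [Finset.prod_eq_single h]
  · simp [add_comm 1]
  · intro b _ hb
    simp [hb.symm]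
  · simp

omit [Fintype σ] in
lemma mem_supported_iff {R : Type*} [CommSemiring R] {S : Set σ} {p : MvPolynomial σ R} :
    p ∈ supported R S ↔ ∀ a ∈ p.support, ∀ i, a i ≠ 0 → i ∈ S := by
  rw [mem_supported]
  constructor
  · intro h a ha i hi
    exact h (by rw [Finset.mem_coe, mem_vars_iff_mem_support]; exact ⟨a, ha, by simpa using hi⟩)
  · intro h i hi
    rw [Finset.mem_coe, mem_vars_iff_mem_support] at hi
    obtain ⟨a, ha, hi⟩ := hi
    exact h a ha i (by simpa using hi)

omit [Fintype σ] in
lemma monomial_mem_supported {R : Type*} [CommSemiring R] {S : Set σ} {a : σ →₀ ℕ}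
    (h : ∀ i, a i ≠ 0 → i ∈ S) (c : R) : monomial a c ∈ supported R S := by
  classical
  rw [mem_supported_iff]
  intro b hb i hi
  rw [mem_support_iff, coeff_monomial] at hb
  have : a = b := by by_contra hh; simp [hh] at hb
  subst this
  exact h i hi

lemma hasse_mem_supported {S : Set σ} (J : σ →₀ ℕ) {p : MvPolynomial σ ℤ}
    (hp : p ∈ supported ℤ S) : hasse J p ∈ supported ℤ S := by
  rw [as_sum p, map_sum]
  refine Subalgebra.sum_mem _ fun a ha => ?_
  rw [hasse_monomial]
  refine monomial_mem_supported (fun i hi => mem_supported_iff.1 hp a ha i ?_) _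
  intro h
  simp [h] at hi

lemma hasse_eq_zero_of_supported {S : Set σ} {J : σ →₀ ℕ} {p : MvPolynomial σ ℤ}
    (hp : p ∈ supported ℤ S) {i : σ} (hi : i ∉ S) (hJ : J i ≠ 0) : hasse J p = 0 := by
  rw [as_sum p, map_sum]
  refine Finset.sum_eq_zero fun a ha => ?_
  rw [hasse_monomial, Finset.prod_eq_zero (Finset.mem_univ i)]
  · simp
  · have : a i = 0 := by
      by_contra h
      exact hi (mem_supported_iff.1 hp a ha i h)
    rw [this]
    exact Nat.choose_eq_zero_of_lt (Nat.pos_of_ne_zero hJ)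

lemma hasse_mul_of_disjoint {S T : Set σ} (hST : Disjoint S T) {f g : MvPolynomial σ ℤ}
    (hf : f ∈ supported ℤ S) (hg : g ∈ supported ℤ T) {I J : σ →₀ ℕ}
    (hI : ∀ i, I i ≠ 0 → i ∈ S) (hJ : ∀ i, J i ≠ 0 → i ∈ T) :
    hasse (I + J) (f * g) = hasse I f * hasse J g := by
  conv_lhs => rw [as_sum f, as_sum g]
  conv_rhs => rw [as_sum f, as_sum g]
  simp only [map_sum, Finset.sum_mul_sum]
  refine Finset.sum_congr rfl fun a ha => Finset.sum_congr rfl fun b hb => ?_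
  have key : ∀ i, (b i = 0 ∧ J i = 0) ∨ (a i = 0 ∧ I i = 0) := by
    intro i
    by_cases hi : i ∈ S
    · left
      have hi' : i ∉ T := fun h => Set.disjoint_left.1 hST hi h
      exact ⟨by by_contra h; exact hi' (mem_supported_iff.1 hg b hb i h),
        by by_contra h; exact hi' (hJ i h)⟩
    · right
      exact ⟨by by_contra h; exact hi (mem_supported_iff.1 hf a ha i h),
        by by_contra h; exact hi (hI i h)⟩
  rw [monomial_mul, hasse_monomial, hasse_monomial, hasse_monomial, monomial_mul]
  have h1 : a + b - (I + J) = a - I + (b - J) := by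
    ext i
    simp only [Finsupp.coe_tsub, Finsupp.coe_add, Pi.sub_apply, Pi.add_apply]
    rcases key i with h | h <;> omega
  have h2 : (∏ i, ((a + b) i).choose ((I + J) i) : ℕ) =
      (∏ i, (a i).choose (I i)) * ∏ i, (b i).choose (J i) := by
    rw [← Finset.prod_mul_distrib]
    refine Finset.prod_congr rfl fun i _ => ?_
    simp only [Finsupp.coe_add, Pi.add_apply]
    rcases key i with ⟨h, h'⟩ | ⟨h, h'⟩ <;> simp [h, h']
  rw [h1, h2]
  congr 1
  push_cast
  ring

/-- Translation of an integer polynomial by a vector `ξ`. -/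
noncomputable def tr (ξ : σ → K) : MvPolynomial σ ℤ →ₐ[ℤ] MvPolynomial σ K :=
  aeval fun i => X i + C (ξ i)

lemma coeff_prod_aeval_X (g : σ → Polynomial K) (J : σ →₀ ℕ) :
    coeff J (∏ i, Polynomial.aeval (X i : MvPolynomial σ K) (g i)) =
      ∏ i, (g i).coeff (J i) := by
  classical
  obtain ⟨N, hN⟩ : ∃ N, ∀ i, (g i).natDegree < N ∧ J i < N := by
    refine ⟨(∑ i, (g i).natDegree) + (∑ i, J i) + 1, fun i => ?_⟩
    have h1 := Finset.single_le_sum (f := fun i => (g i).natDegree) (fun _ _ => Nat.zero_le _)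
      (Finset.mem_univ i)
    have h2 := Finset.single_le_sum (f := fun i => J i) (fun _ _ => Nat.zero_le _)
      (Finset.mem_univ i)
    omega
  have h1 : ∀ i, Polynomial.aeval (X i : MvPolynomial σ K) (g i) =
      ∑ j ∈ Finset.range N, monomial (Finsupp.single i j) ((g i).coeff j) := by
    intro i
    conv_lhs => rw [(g i).as_sum_range' N (hN i).1]
    rw [map_sum]
    refine Finset.sum_congr rfl fun j _ => ?_
    rw [Polynomial.aeval_monomial, X_pow_eq_monomial, algebraMap_eq, C_mul_monomial, mul_one]
  simp only [h1]
  have h2 : ∀ b : σ → ℕ, ∏ i, (monomial (Finsupp.single i (b i)) ((g i).coeff (b i)) :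
      MvPolynomial σ K) = monomial (Finsupp.equivFunOnFinite.symm b) (∏ i, (g i).coeff (b i)) := by
    intro b
    rw [← monomial_sum_prod]
    congr 2
    ext i
    simp [Finsupp.finsetSum_apply, Finsupp.single_apply]
  rw [Finset.prod_univ_sum, coeff_sum, Finset.sum_eq_single (fun i => J i)]
  · rw [h2, coeff_monomial, if_pos]
    ext i
    simp
  · intro b _ hb
    rw [h2, coeff_monomial, if_neg]
    intro h
    apply hb
    funext i
    rw [← h]
    simp
  · intro h
    exact absurd (Fintype.mem_piFinset.2 fun i => Finset.mem_range.2 (hN i).2) h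

lemma coeff_tr (ξ : σ → K) (p : MvPolynomial σ ℤ) (J : σ →₀ ℕ) :
    coeff J (tr ξ p) = aeval ξ (hasse J p) := by
  induction p using MvPolynomial.induction_on' with
  | add p q hp hq => simp only [map_add, hp, hq, coeff_add]
  | monomial a c =>
    have h1 : tr ξ (monomial a c) = C (c : K) *
        ∏ i, Polynomial.aeval (X i : MvPolynomial σ K) ((Polynomial.X + Polynomial.C (ξ i)) ^ a i) := by
      rw [tr, aeval_monomial, Finsupp.prod_fintype _ _ (by simp)]
      simp
    rw [h1, coeff_C_mul, coeff_prod_aeval_X, hasse_monomial, aeval_monomial,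
      Finsupp.prod_fintype _ _ (by simp)]
    simp only [Polynomial.coeff_X_add_C_pow, Finset.prod_mul_distrib]
    simp
    ring

lemma tr_mem_supported {S : Set σ} {p : MvPolynomial σ ℤ} (hp : p ∈ supported ℤ S) (ξ : σ → K) :
    tr ξ p ∈ supported K S := by
  rw [mem_supported_iff]
  intro a ha i hi
  by_contra hS
  rw [mem_support_iff, coeff_tr, hasse_eq_zero_of_supported hp hS hi] at ha
  simp at ha

omit [Fintype σ] in
lemma coeff_add_mul_of_disjoint {S T : Set σ} (hST : Disjoint S T) {R : Type*} [CommSemiring R]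
    {f g : MvPolynomial σ R}
    (hf : f ∈ supported R S) (hg : g ∈ supported R T) {I J : σ →₀ ℕ}
    (hI : ∀ i, I i ≠ 0 → i ∈ S) (hJ : ∀ i, J i ≠ 0 → i ∈ T) :
    coeff (I + J) (f * g) = coeff I f * coeff J g := by
  classical
  rw [coeff_mul]
  refine Finset.sum_eq_single (I, J) ?_ ?_
  · rintro ⟨a, b⟩ hab hne
    rw [Finset.HasAntidiagonal.mem_antidiagonal] at hab
    by_contra h
    have ha : a ∈ f.support := by rw [mem_support_iff]; intro h'; simp [h'] at h
    have hb : b ∈ g.support := by rw [mem_support_iff]; intro h'; simp [h'] at h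
    apply hne
    have key : ∀ i, a i = I i ∧ b i = J i := by
      intro i
      have hi := DFunLike.congr_fun hab i
      simp only [Finsupp.coe_add, Pi.add_apply] at hi
      by_cases hS : i ∈ S
      · have hi' : i ∉ T := fun h => Set.disjoint_left.1 hST hS h
        have h1 : b i = 0 := by by_contra h; exact hi' (mem_supported_iff.1 hg b hb i h)
        have h2 : J i = 0 := by by_contra h; exact hi' (hJ i h)
        omega
      · have h1 : a i = 0 := by by_contra h; exact hS (mem_supported_iff.1 hf a ha i h)
        have h2 : I i = 0 := by by_contra h; exact hS (hI i h)
        omega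
    exact Prod.ext (Finsupp.ext fun i => (key i).1) (Finsupp.ext fun i => (key i).2)
  · intro h
    exact absurd (by rw [Finset.HasAntidiagonal.mem_antidiagonal]) h

end Hasse
end SUnit

namespace SUnit
open MvPolynomial

section Norm
variable {σ : Type*}

/-- The sum of the absolute values of the coefficients. -/
noncomputable def l1 (p : MvPolynomial σ ℤ) : ℝ := ∑ a ∈ p.support, |((coeff a p : ℤ) : ℝ)|

lemma l1_nonneg (p : MvPolynomial σ ℤ) : 0 ≤ l1 p := Finset.sum_nonneg fun _ _ => abs_nonneg _

lemma l1_eq_sum {p : MvPolynomial σ ℤ} {s : Finset (σ →₀ ℕ)} (h : p.support ⊆ s) :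
    l1 p = ∑ a ∈ s, |((coeff a p : ℤ) : ℝ)| := by
  refine Finset.sum_subset h fun a _ ha => ?_
  rw [notMem_support_iff] at ha
  simp [ha]

lemma l1_add_le (p q : MvPolynomial σ ℤ) : l1 (p + q) ≤ l1 p + l1 q := by
  classical
  rw [l1_eq_sum (support_add (p := p) (q := q)), l1_eq_sum (p := p) Finset.subset_union_left,
    l1_eq_sum (p := q) Finset.subset_union_right, ← Finset.sum_add_distrib]
  refine Finset.sum_le_sum fun a _ => ?_
  rw [coeff_add]
  push_cast
  exact abs_add_le _ _

@[simp] lemma l1_zero : l1 (0 : MvPolynomial σ ℤ) = 0 := by simp [l1]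

lemma l1_sum_le {ι : Type*} (s : Finset ι) (f : ι → MvPolynomial σ ℤ) :
    l1 (∑ i ∈ s, f i) ≤ ∑ i ∈ s, l1 (f i) := by
  classical
  induction s using Finset.induction_on with
  | empty => simp
  | insert a s ha ih =>
    rw [Finset.sum_insert ha, Finset.sum_insert ha]
    exact (l1_add_le _ _).trans (by linarith)

lemma l1_monomial (a : σ →₀ ℕ) (c : ℤ) : l1 (monomial a c) = |(c : ℝ)| := by
  classical
  rw [l1_eq_sum support_monomial_subset]
  simp

lemma one_le_l1 {p : MvPolynomial σ ℤ} (hp : p ≠ 0) : 1 ≤ l1 p := by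
  obtain ⟨a, ha⟩ := ne_zero_iff.1 hp
  have h1 : |((coeff a p : ℤ) : ℝ)| ≤ l1 p :=
    Finset.single_le_sum (f := fun a => |((coeff a p : ℤ) : ℝ)|) (fun _ _ => abs_nonneg _)
      (mem_support_iff.2 ha)
  refine le_trans ?_ h1
  exact_mod_cast Int.one_le_abs ha

lemma l1_neg (p : MvPolynomial σ ℤ) : l1 (-p) = l1 p := by
  simp [l1]

lemma l1_zsmul_unit (u : ℤˣ) (p : MvPolynomial σ ℤ) : l1 (u • p) = l1 p := by
  rcases Int.units_eq_one_or u with h | h <;> simp [h, l1_neg]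

lemma l1_mul_le (p q : MvPolynomial σ ℤ) : l1 (p * q) ≤ l1 p * l1 q := by
  conv_lhs => rw [as_sum p, as_sum q, Finset.sum_mul_sum]
  refine (l1_sum_le _ _).trans ?_
  rw [l1, l1, Finset.sum_mul_sum]
  refine Finset.sum_le_sum fun a _ => (l1_sum_le _ _).trans (Finset.sum_le_sum fun b _ => ?_)
  rw [monomial_mul, l1_monomial]
  push_cast
  rw [abs_mul]

lemma l1_prod_le {ι : Type*} (s : Finset ι) (f : ι → MvPolynomial σ ℤ) :
    l1 (∏ i ∈ s, f i) ≤ ∏ i ∈ s, l1 (f i) := by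
  classical
  induction s using Finset.induction_on with
  | empty => simpa using (l1_monomial (0 : σ →₀ ℕ) 1).le
  | insert a s ha ih =>
    rw [Finset.prod_insert ha, Finset.prod_insert ha]
    exact (l1_mul_le _ _).trans (mul_le_mul_of_nonneg_left ih (l1_nonneg _))

lemma l1_det_le {k : ℕ} (M : Matrix (Fin k) (Fin k) (MvPolynomial σ ℤ)) {B : ℝ}
    (h : ∀ i j, l1 (M i j) ≤ B) : l1 M.det ≤ (k * B) ^ k := by
  rw [Matrix.det_apply]
  refine (l1_sum_le _ _).trans ?_
  have h1 : ∀ τ ∈ (Finset.univ : Finset (Equiv.Perm (Fin k))),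
      l1 (Equiv.Perm.sign τ • ∏ i, M (τ i) i) ≤ B ^ k := by
    intro τ _
    rw [l1_zsmul_unit]
    refine (l1_prod_le _ _).trans ?_
    refine (Finset.prod_le_prod (fun _ _ => l1_nonneg _) fun i _ => h _ _).trans ?_
    simp
  refine (Finset.sum_le_sum h1).trans ?_
  rw [Finset.sum_const, Finset.card_univ, Fintype.card_perm, Fintype.card_fin, nsmul_eq_mul,
    mul_pow]
  rcases k.eq_zero_or_pos with rfl | hk
  · simp
  have hB : 0 ≤ B := (l1_nonneg _).trans (h ⟨0, hk⟩ ⟨0, hk⟩)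
  refine mul_le_mul_of_nonneg_right ?_ (pow_nonneg hB _)
  exact_mod_cast Nat.factorial_le_pow k

/-- All exponents of `p` are bounded by `d`. -/
def Box (d : σ → ℕ) (p : MvPolynomial σ ℤ) : Prop := ∀ a ∈ p.support, ∀ i, a i ≤ d i

lemma box_iff {d : σ → ℕ} {p : MvPolynomial σ ℤ} : Box d p ↔ ∀ i, degreeOf i p ≤ d i := by
  simp only [degreeOf_le_iff, Box]
  exact ⟨fun h i a ha => h a ha i, fun h a ha i => h i a ha⟩

lemma Box.sum {d : σ → ℕ} {ι : Type*} {s : Finset ι} {f : ι → MvPolynomial σ ℤ}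
    (h : ∀ i ∈ s, Box d (f i)) : Box d (∑ i ∈ s, f i) := by
  classical
  intro a ha
  obtain ⟨i, hi, h'⟩ := Finset.mem_biUnion.1 (support_sum ha)
  exact h i hi a h'

lemma Box.mul {d e : σ → ℕ} {p q : MvPolynomial σ ℤ} (hp : Box d p) (hq : Box e q) :
    Box (d + e) (p * q) := by
  rw [box_iff] at *
  exact fun i => (degreeOf_mul_le i p q).trans (add_le_add (hp i) (hq i))

lemma Box.prod {d : σ → ℕ} {ι : Type*} {s : Finset ι} {f : ι → MvPolynomial σ ℤ}
    (h : ∀ i ∈ s, Box d (f i)) : Box (s.card • d) (∏ i ∈ s, f i) := by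
  classical
  induction s using Finset.induction_on with
  | empty =>
    rw [box_iff]
    intro i
    rw [Finset.prod_empty, ← C_1, degreeOf_C]
    exact Nat.zero_le _
  | insert a s ha ih =>
    rw [Finset.prod_insert ha, Finset.card_insert_of_notMem ha, add_smul, one_smul, add_comm]
    exact (h a (Finset.mem_insert_self _ _)).mul
      (ih fun i hi => h i (Finset.mem_insert_of_mem hi))

lemma Box.det {d : σ → ℕ} {k : ℕ} {M : Matrix (Fin k) (Fin k) (MvPolynomial σ ℤ)}
    (h : ∀ i j, Box d (M i j)) : Box (k • d) M.det := by
  rw [Matrix.det_apply]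
  refine Box.sum fun τ _ => ?_
  have := Box.prod (s := Finset.univ) fun i _ => h (τ i) i
  rw [Finset.card_univ, Fintype.card_fin] at this
  rcases Int.units_eq_one_or (Equiv.Perm.sign τ) with h | h
  · simpa [h] using this
  · rw [h]
    intro a ha
    refine this a ?_
    simpa using ha

lemma Box.monomial {d : σ → ℕ} {a : σ →₀ ℕ} (h : ∀ i, a i ≤ d i) (c : ℤ) :
    Box d (MvPolynomial.monomial a c) := by
  classical
  intro b hb
  rw [Finset.mem_singleton.1 (support_monomial_subset hb)]
  exact h

lemma Box.hasse [Fintype σ] {d : σ → ℕ} {p : MvPolynomial σ ℤ} (hp : Box d p) (J : σ →₀ ℕ) :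
    Box d (hasse J p) := by
  rw [as_sum p, map_sum]
  refine Box.sum fun a ha => ?_
  rw [hasse_monomial]
  refine Box.monomial (fun i => ?_) _
  rw [Finsupp.coe_tsub, Pi.sub_apply]
  exact (Nat.sub_le _ _).trans (hp a ha i)

lemma l1_hasse_le [Fintype σ] {d : σ → ℕ} {p : MvPolynomial σ ℤ} (hp : Box d p) (J : σ →₀ ℕ) :
    l1 (hasse J p) ≤ 2 ^ (∑ i, d i) * l1 p := by
  conv_lhs => rw [as_sum p, map_sum]
  refine (l1_sum_le _ _).trans ?_
  rw [l1, Finset.mul_sum]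
  refine Finset.sum_le_sum fun a ha => ?_
  rw [hasse_monomial, l1_monomial]
  push_cast
  rw [abs_mul, mul_comm]
  refine mul_le_mul_of_nonneg_right ?_ (abs_nonneg _)
  rw [abs_of_nonneg (Finset.prod_nonneg fun _ _ => Nat.cast_nonneg _), ← Finset.prod_pow_eq_pow_sum]
  refine Finset.prod_le_prod (fun _ _ => by positivity) fun i _ => ?_
  exact_mod_cast (Nat.choose_le_two_pow _ _).trans (Nat.pow_le_pow_right (by norm_num) (hp a ha i))

open scoped Classical in
/-- The coefficient of a monomial `e` in the variables of `S`. -/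
noncomputable def slice (S : Set σ) (e : σ →₀ ℕ) : MvPolynomial σ ℤ →ₗ[ℤ] MvPolynomial σ ℤ :=
  (basisMonomials σ ℤ).constr ℤ fun a =>
    if a.filter (· ∈ S) = e then monomial (a.filter (· ∉ S)) 1 else 0

open scoped Classical in
lemma slice_monomial (S : Set σ) (e a : σ →₀ ℕ) (c : ℤ) :
    slice S e (monomial a c) =
      if a.filter (· ∈ S) = e then monomial (a.filter (· ∉ S)) c else 0 := by
  have h1 : (monomial a c : MvPolynomial σ ℤ) = c • basisMonomials σ ℤ a := by
    simp [smul_monomial]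
  rw [h1, map_smul, slice, Module.Basis.constr_basis]
  split_ifs <;> simp [smul_monomial]

lemma Box.slice {d : σ → ℕ} {p : MvPolynomial σ ℤ} (hp : Box d p) (S : Set σ) (e : σ →₀ ℕ) :
    Box d (slice S e p) := by
  classical
  rw [as_sum p, map_sum]
  refine Box.sum fun a ha => ?_
  rw [slice_monomial]
  split_ifs
  · refine Box.monomial (fun i => ?_) _
    rw [Finsupp.filter_apply]
    split_ifs
    exacts [Nat.zero_le _, hp a ha i]
  · intro b hb
    simp at hb

lemma l1_slice_le (p : MvPolynomial σ ℤ) (S : Set σ) (e : σ →₀ ℕ) :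
    l1 (slice S e p) ≤ l1 p := by
  classical
  conv_lhs => rw [as_sum p, map_sum]
  refine (l1_sum_le _ _).trans ?_
  refine Finset.sum_le_sum fun a ha => ?_
  rw [slice_monomial]
  split_ifs
  · rw [l1_monomial]
  · simp

lemma slice_mul (S : Set σ) (e : σ →₀ ℕ) {f g : MvPolynomial σ ℤ} (hf : f ∈ supported ℤ Sᶜ)
    (hg : g ∈ supported ℤ S) : slice S e (f * g) = coeff e g • f := by
  classical
  conv_lhs => rw [as_sum f, as_sum g, Finset.sum_mul_sum]
  conv_rhs => rw [as_sum f]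
  rw [map_sum, Finset.smul_sum]
  refine Finset.sum_congr rfl fun a ha => ?_
  rw [map_sum]
  have h1 : ∀ b ∈ g.support, slice S e (monomial a (coeff a f) * monomial b (coeff b g)) =
      if b = e then monomial a (coeff e g * coeff a f) else 0 := by
    intro b hb
    have ha' := fun i h => mem_supported_iff.1 hf a ha i h
    have hb' := fun i h => mem_supported_iff.1 hg b hb i h
    have e1 : (a + b).filter (· ∈ S) = b := by
      ext i
      rw [Finsupp.filter_apply]
      by_cases hi : i ∈ S
      · have : a i = 0 := by by_contra h; exact ha' i h hi
        simp [hi, this]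
      · have : b i = 0 := by by_contra h; exact hi (hb' i h)
        simp [hi, this]
    have e2 : (a + b).filter (· ∉ S) = a := by
      ext i
      rw [Finsupp.filter_apply]
      by_cases hi : i ∈ S
      · have : a i = 0 := by by_contra h; exact ha' i h hi
        simp [hi, this]
      · have : b i = 0 := by by_contra h; exact hi (hb' i h)
        simp [hi, this]
    rw [monomial_mul, slice_monomial, e1, e2]
    split_ifs with h
    · rw [h, mul_comm]
    · rfl
  rw [Finset.sum_congr rfl h1, Finset.sum_ite_eq' , smul_monomial]
  split_ifs with h
  · rfl
  · rw [notMem_support_iff] at h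
    simp [h]

end Norm

section Index
variable {σ : Type*} [Fintype σ] {K : Type*} [Field K]

/-- `p` vanishes at `ξ` to weighted order at least `θ`. -/
def IndexGE (ξ : σ → K) (w : σ → ℝ) (p : MvPolynomial σ ℤ) (θ : ℝ) : Prop :=
  ∀ J : σ →₀ ℕ, ∑ i, J i * w i < θ → coeff J (tr ξ p) = 0

variable {ξ : σ → K} {w : σ → ℝ} {p q : MvPolynomial σ ℤ} {θ η : ℝ}

lemma IndexGE.mono (h : IndexGE ξ w p θ) (hη : η ≤ θ) : IndexGE ξ w p η :=
  fun J hJ => h J (hJ.trans_le hη)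

lemma IndexGE.mul (hp : IndexGE ξ w p θ) (hq : IndexGE ξ w q η) :
    IndexGE ξ w (p * q) (θ + η) := by
  classical
  intro J hJ
  rw [map_mul, coeff_mul]
  refine Finset.sum_eq_zero ?_
  rintro ⟨a, b⟩ hab
  rw [Finset.HasAntidiagonal.mem_antidiagonal] at hab
  by_cases ha : ∑ i, a i * w i < θ
  · rw [hp a ha, zero_mul]
  by_cases hb : ∑ i, b i * w i < η
  · rw [hq b hb, mul_zero]
  exfalso
  rw [← hab] at hJ
  simp only [Finsupp.coe_add, Pi.add_apply, Nat.cast_add, add_mul, Finset.sum_add_distrib] at hJ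
  linarith

lemma indexGE_of_nonpos (hw : ∀ i, 0 ≤ w i) (hθ : θ ≤ 0) : IndexGE ξ w p θ := by
  intro J hJ
  have : 0 ≤ ∑ i, (J i : ℝ) * w i := Finset.sum_nonneg fun i _ => mul_nonneg (by positivity) (hw i)
  linarith

lemma IndexGE.sum {ι : Type*} {s : Finset ι} {f : ι → MvPolynomial σ ℤ}
    (h : ∀ i ∈ s, IndexGE ξ w (f i) θ) : IndexGE ξ w (∑ i ∈ s, f i) θ := by
  intro J hJ
  rw [map_sum, coeff_sum]
  exact Finset.sum_eq_zero fun i hi => h i hi J hJ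

lemma IndexGE.zsmul (h : IndexGE ξ w p θ) (c : ℤ) : IndexGE ξ w (c • p) θ := by
  intro J hJ
  rw [map_zsmul, coeff_smul, h J hJ, smul_zero]

lemma IndexGE.prod (hw : ∀ i, 0 ≤ w i) {ι : Type*} {s : Finset ι} {f : ι → MvPolynomial σ ℤ}
    {θ : ι → ℝ} (h : ∀ i ∈ s, IndexGE ξ w (f i) (θ i)) :
    IndexGE ξ w (∏ i ∈ s, f i) (∑ i ∈ s, θ i) := by
  classical
  induction s using Finset.induction_on with
  | empty => exact indexGE_of_nonpos hw (by simp)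
  | insert a s ha ih =>
    rw [Finset.prod_insert ha, Finset.sum_insert ha]
    exact (h a (Finset.mem_insert_self _ _)).mul
      (ih fun i hi => h i (Finset.mem_insert_of_mem hi))

lemma IndexGE.det (hw : ∀ i, 0 ≤ w i) {k : ℕ} {M : Matrix (Fin k) (Fin k) (MvPolynomial σ ℤ)}
    {θ : Fin k → ℝ} (h : ∀ i j, IndexGE ξ w (M i j) (θ j)) : IndexGE ξ w M.det (∑ j, θ j) := by
  rw [Matrix.det_apply]
  exact IndexGE.sum fun τ _ => (IndexGE.prod hw fun i _ => h (τ i) i).zsmul _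

lemma IndexGE.hasse (h : IndexGE ξ w p θ) (I : σ →₀ ℕ) :
    IndexGE ξ w (hasse I p) (θ - ∑ i, I i * w i) := by
  intro J hJ
  rw [coeff_tr, hasse_hasse, map_zsmul, ← coeff_tr, h, smul_zero]
  simp only [Finsupp.coe_add, Pi.add_apply, Nat.cast_add, add_mul, Finset.sum_add_distrib]
  linarith

lemma IndexGE.of_zsmul [CharZero K] {c : ℤ} (hc : c ≠ 0) (h : IndexGE ξ w (c • p) θ) :
    IndexGE ξ w p θ := by
  intro J hJ
  have := h J hJ
  rw [map_zsmul, coeff_smul, zsmul_eq_mul] at this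
  exact (mul_eq_zero.1 this).resolve_left (by exact_mod_cast hc)

lemma not_indexGE_mul {S T : Set σ} (hST : Disjoint S T) (hp : p ∈ supported ℤ S)
    (hq : q ∈ supported ℤ T) (h1 : ¬ IndexGE ξ w p θ) (h2 : ¬ IndexGE ξ w q η) :
    ¬ IndexGE ξ w (p * q) (θ + η) := by
  simp only [IndexGE, not_forall] at h1 h2
  obtain ⟨I, hI, hI'⟩ := h1
  obtain ⟨J, hJ, hJ'⟩ := h2
  intro h
  have h3 := h (I + J) (by
    simp only [Finsupp.coe_add, Pi.add_apply, Nat.cast_add, add_mul, Finset.sum_add_distrib]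
    linarith)
  rw [map_mul, coeff_add_mul_of_disjoint hST (tr_mem_supported hp ξ) (tr_mem_supported hq ξ)] at h3
  · exact (mul_ne_zero hI' hJ') h3
  · exact mem_supported_iff.1 (tr_mem_supported hp ξ) I (mem_support_iff.2 hI')
  · exact mem_supported_iff.1 (tr_mem_supported hq ξ) J (mem_support_iff.2 hJ')

end Index
end SUnit

namespace SUnit
open MvPolynomial

section Wronskian
variable {σ : Type*} [Fintype σ]

lemma hasse_eq_C_coeff {p : MvPolynomial σ ℤ} {a : σ →₀ ℕ}
    (h : ∀ b ∈ p.support, ∑ i, b i ≤ ∑ i, a i) : hasse a p = C (coeff a p) := by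
  classical
  conv_lhs => rw [as_sum p, map_sum]
  have h1 : ∀ b ∈ p.support, hasse a (monomial b (coeff b p)) =
      if b = a then C (coeff a p) else 0 := by
    intro b hb
    rw [hasse_monomial]
    split_ifs with hba
    · subst hba
      simp
    · obtain ⟨i, hi⟩ : ∃ i, b i < a i := by
        by_contra hcon
        push Not at hcon
        apply hba
        ext i
        refine le_antisymm ?_ (hcon i)
        by_contra hlt
        push Not at hlt
        have := Finset.sum_lt_sum (fun i _ => hcon i) ⟨i, Finset.mem_univ i, hlt⟩
        exact absurd (h b hb) (not_le.2 this)
      rw [Finset.prod_eq_zero (Finset.mem_univ i) (Nat.choose_eq_zero_of_lt hi)]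
      simp
  rw [Finset.sum_congr rfl h1, Finset.sum_ite_eq']
  split_ifs with h
  · rfl
  · rw [notMem_support_iff] at h
    simp [h]

lemma exists_wronskian_aux {k a : ℕ} (hak : a < k) (f : Fin k → MvPolynomial σ ℤ)
    (hf : LinearIndependent ℤ f) (J : Fin a → (σ →₀ ℕ)) (hJ : ∀ b, ∑ i, J b i ≤ b)
    (H : ∀ x : Fin k → MvPolynomial σ ℤ, (∀ b, ∑ l, x l * hasse (J b) (f l) = 0) →
      ∀ I : σ →₀ ℕ, ∑ i, I i ≤ a → ∑ l, x l * hasse I (f l) = 0) : False := by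
  classical
  let N : (Fin k → MvPolynomial σ ℤ) → Prop := fun x => ∀ b, ∑ l, x l * hasse (J b) (f l) = 0
  obtain ⟨x, hx0, hx⟩ : ∃ x : Fin k → MvPolynomial σ ℤ, x ≠ 0 ∧ N x := by
    let B : Matrix (Fin k) (Fin k) (MvPolynomial σ ℤ) := fun i l =>
      if h : (i : ℕ) < a then hasse (J ⟨i, h⟩) (f l) else 0
    have hB : B.det = 0 := by
      refine Matrix.det_eq_zero_of_row_eq_zero ⟨a, hak⟩ fun j => ?_
      simp [B]
    obtain ⟨v, hv0, hv⟩ := Matrix.exists_mulVec_eq_zero_iff.2 hB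
    refine ⟨v, hv0, fun b => ?_⟩
    have h1 := congrFun hv ⟨b, b.2.trans hak⟩
    simp only [Matrix.mulVec, dotProduct, B, b.2, dif_pos, Pi.zero_apply] at h1
    rw [← h1]
    exact Finset.sum_congr rfl fun l _ => mul_comm _ _
  have hD : ∀ y, N y → ∀ h : σ, N (fun l => pderiv h (y l)) := by
    intro y hy h b
    have h1 := congrArg (pderiv h) (hy b)
    rw [map_sum, map_zero] at h1
    simp only [Derivation.leibniz, smul_eq_mul, Finset.sum_add_distrib, pderiv_hasse] at h1
    have h2 := H y hy (Finsupp.single h 1 + J b) (by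
      simp only [Finsupp.coe_add, Pi.add_apply, Finset.sum_add_distrib]
      rw [show ∑ i, (Finsupp.single h 1 : σ →₀ ℕ) i = 1 by
        simp [Finsupp.single_apply]]
      have := hJ b
      have := b.2
      omega)
    simp only [mul_smul_comm, ← Finset.smul_sum, h2, smul_zero, zero_add] at h1
    rw [← h1]
    exact Finset.sum_congr rfl fun l _ => mul_comm _ _
  have hDJ : ∀ n : ℕ, ∀ I : σ →₀ ℕ, ∑ i, I i = n → N (fun l => hasse I (x l)) := by
    intro n
    induction n with
    | zero =>
      intro I hI
      have : I = 0 := by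
        ext i
        exact (Finset.sum_eq_zero_iff.1 hI) i (Finset.mem_univ i)
      subst this
      simpa only [hasse_zero] using hx
    | succ n ih =>
      intro I hI
      obtain ⟨h, hh⟩ : ∃ h, I h ≠ 0 := by
        by_contra hcon
        push Not at hcon
        simp [hcon] at hI
      obtain ⟨I', rfl⟩ : ∃ I', I = Finsupp.single h 1 + I' := by
        refine ⟨I - Finsupp.single h 1, ?_⟩
        ext i
        by_cases hi : i = h
        · subst hi
          simp
          omega
        · simp [Ne.symm hi]
      have h1 : ∑ i, I' i = n := by
        simp only [Finsupp.coe_add, Pi.add_apply, Finset.sum_add_distrib] at hI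
        rw [show ∑ i, (Finsupp.single h 1 : σ →₀ ℕ) i = 1 by
          simp [Finsupp.single_apply]] at hI
        omega
      have h2 := hD _ (ih I' h1) h
      intro b
      have h3 := h2 b
      simp only [pderiv_hasse, smul_mul_assoc, ← Finset.smul_sum] at h3
      exact (smul_eq_zero.1 h3).resolve_left (Nat.cast_ne_zero.2 (Nat.succ_ne_zero _))
  obtain ⟨l0, hl0⟩ := Function.ne_iff.1 hx0
  let s : Finset (σ →₀ ℕ) := Finset.univ.biUnion fun l => (x l).support
  have hs : s.Nonempty := by
    obtain ⟨a, ha⟩ := ne_zero_iff.1 hl0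
    exact ⟨a, Finset.mem_biUnion.2 ⟨l0, Finset.mem_univ _, mem_support_iff.2 ha⟩⟩
  obtain ⟨e, he, hmax⟩ := s.exists_max_image (fun b => ∑ i, b i) hs
  have h1 := hDJ _ e rfl
  have h2 := H _ h1 0 (by simp)
  have h3 : ∀ l, hasse e (x l) = C (coeff e (x l)) := fun l =>
    hasse_eq_C_coeff fun b hb => hmax b (Finset.mem_biUnion.2 ⟨l, Finset.mem_univ _, hb⟩)
  simp only [h3, hasse_zero, C_mul'] at h2
  obtain ⟨l, -, hl⟩ := Finset.mem_biUnion.1 he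
  exact (mem_support_iff.1 hl) (Fintype.linearIndependent_iff.1 hf _ h2 l)

lemma exists_wronskian_of_isFractionRing (F : Type*) [Field F] [Algebra (MvPolynomial σ ℤ) F]
    [IsFractionRing (MvPolynomial σ ℤ) F] {k : ℕ} (f : Fin k → MvPolynomial σ ℤ) (hf : LinearIndependent ℤ f) :
    ∃ J : Fin k → (σ →₀ ℕ), (∀ a, ∑ i, J a i ≤ a) ∧
      (Matrix.of fun a l => hasse (J a) (f l)).det ≠ 0 := by
  classical
  let v : (σ →₀ ℕ) → Fin k → F := fun I l => algebraMap _ F (hasse I (f l))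
  have key : ∀ a ≤ k, ∃ J : Fin a → (σ →₀ ℕ), (∀ b, ∑ i, J b i ≤ b) ∧
      LinearIndependent F (fun b => v (J b)) := by
    intro a
    induction a with
    | zero => exact fun _ => ⟨fun _ => 0, fun b => b.elim0, linearIndependent_empty_type⟩
    | succ a ih =>
      intro hak
      obtain ⟨J, hJ, hli⟩ := ih (by omega)
      by_contra hcon
      refine exists_wronskian_aux (by omega) f hf J hJ fun x hx I hI => ?_
      have h1 : v I ∈ Submodule.span F (Set.range fun b => v (J b)) := by
        by_contra hI'
        refine hcon ⟨Fin.snoc J I, fun b => ?_, ?_⟩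
        · refine Fin.lastCases ?_ (fun b => ?_) b
          · simpa using hI
          · simpa using hJ b
        · have := linearIndependent_finSnoc.2 ⟨hli, hI'⟩
          have h0 : (fun b => v ((Fin.snoc J I : Fin (a + 1) → (σ →₀ ℕ)) b)) =
              (Fin.snoc (fun b => v (J b)) (v I) : Fin (a + 1) → Fin k → F) := by
            funext b
            refine Fin.lastCases ?_ (fun b => ?_) b
            · simp
            · simp
          rw [h0]
          exact this
      let φ : (Fin k → F) →ₗ[F] F := ∑ l, (algebraMap _ F (x l)) • LinearMap.proj l
      have hφ : ∀ I, φ (v I) = algebraMap _ F (∑ l, x l * hasse I (f l)) := by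
        intro I
        simp only [φ, v, LinearMap.sum_apply, LinearMap.smul_apply, LinearMap.proj_apply,
          Algebra.smul_def, map_sum, map_mul, Algebra.algebraMap_self, RingHom.id_apply]
      have h2 : Submodule.span F (Set.range fun b => v (J b)) ≤ LinearMap.ker φ := by
        rw [Submodule.span_le]
        rintro _ ⟨b, rfl⟩
        change φ (v (J b)) = 0
        rw [hφ, hx b, map_zero]
      have h3 : φ (v I) = 0 := h2 h1
      rw [hφ] at h3
      exact (IsFractionRing.injective (MvPolynomial σ ℤ) F) (by rw [h3, map_zero])
  obtain ⟨J, hJ, hli⟩ := key k le_rfl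
  refine ⟨J, hJ, fun h0 => ?_⟩
  have h1 : IsUnit (Matrix.of fun a => v (J a)) := Matrix.linearIndependent_rows_iff_isUnit.1 hli
  rw [Matrix.isUnit_iff_isUnit_det] at h1
  have h2 : (Matrix.of fun a => v (J a)) =
      (algebraMap (MvPolynomial σ ℤ) F).mapMatrix (Matrix.of fun a l => hasse (J a) (f l)) := rfl
  rw [h2, ← RingHom.map_det, h0, map_zero] at h1
  exact not_isUnit_zero h1

/-- Nonvanishing of some generalised Wronskian of linearly independent polynomials. -/
theorem exists_wronskian {k : ℕ} (f : Fin k → MvPolynomial σ ℤ) (hf : LinearIndependent ℤ f) :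
    ∃ J : Fin k → (σ →₀ ℕ), (∀ a, ∑ i, J a i ≤ a) ∧
      (Matrix.of fun a l => hasse (J a) (f l)).det ≠ 0 :=
  exists_wronskian_of_isFractionRing (FractionRing (MvPolynomial σ ℤ)) f hf

end Wronskian

section MinimalRank
variable {R : Type*} [CommRing R]

/-- Some nonzero integer multiple of `p` is a sum of `k` products of elements of `A` and `B`. -/
def HasRank (A B : Submodule ℤ R) (p : R) (k : ℕ) : Prop :=
  ∃ N : ℤ, N ≠ 0 ∧ ∃ f g : Fin k → R, (∀ l, f l ∈ A) ∧ (∀ l, g l ∈ B) ∧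
    N • p = ∑ l, f l * g l

lemma HasRank.symm {A B : Submodule ℤ R} {p : R} {k : ℕ} (h : HasRank A B p k) :
    HasRank B A p k := by
  obtain ⟨N, hN, f, g, hf, hg, h⟩ := h
  exact ⟨N, hN, g, f, hg, hf, by rw [h]; exact Finset.sum_congr rfl fun l _ => mul_comm _ _⟩

lemma linearIndependent_of_minimal {A B : Submodule ℤ R} {p : R} {k : ℕ} {N : ℤ} (hN : N ≠ 0)
    {f g : Fin k → R} (hf : ∀ l, f l ∈ A) (hg : ∀ l, g l ∈ B) (h : N • p = ∑ l, f l * g l)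
    (hmin : ∀ j < k, ¬ HasRank A B p j) : LinearIndependent ℤ f := by
  rw [Fintype.linearIndependent_iff]
  intro c hc
  by_contra hcon
  push Not at hcon
  obtain ⟨l0, hl0⟩ := hcon
  obtain ⟨k, rfl⟩ : ∃ k', k = k' + 1 := ⟨k - 1, by have := l0.pos; omega⟩
  refine hmin k (Nat.lt_succ_self k) ⟨c l0 * N, mul_ne_zero hl0 hN, fun l => f (l0.succAbove l),
    fun l => c l0 • g (l0.succAbove l) - c (l0.succAbove l) • g l0, fun l => hf _,
    fun l => B.sub_mem (B.smul_mem _ (hg _)) (B.smul_mem _ (hg _)), ?_⟩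
  rw [Fin.sum_univ_succAbove _ l0] at hc h
  rw [mul_smul, h]
  simp only [mul_sub, Finset.sum_sub_distrib, mul_smul_comm, smul_add, Finset.smul_sum]
  have h1 : ∑ l, c (l0.succAbove l) • (f (l0.succAbove l) * g l0) =
      (∑ l, c (l0.succAbove l) • f (l0.succAbove l)) * g l0 := by
    rw [Finset.sum_mul]
    exact Finset.sum_congr rfl fun l _ => by rw [smul_mul_assoc]
  rw [h1, eq_neg_iff_add_eq_zero.2 ((add_comm _ _).trans hc)]
  simp only [neg_mul, sub_neg_eq_add, smul_mul_assoc]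
  ring

end MinimalRank
end SUnit

namespace SUnit
open MvPolynomial

section Roth
variable {K : Type*} [Field K]

/-- Integer polynomials vanishing to order `e` at `ξ` have logarithmic size at least `e * η`. -/
def HtLower (ξ : K) (η : ℝ) : Prop :=
  ∀ u : Polynomial ℤ, u ≠ 0 → ∀ e : ℕ,
    (Polynomial.X - Polynomial.C ξ) ^ e ∣ u.map (Int.castRingHom K) →
    e * η ≤ Real.log (∑ i ∈ u.support, |(u.coeff i : ℝ)|)

section
variable {σ : Type*}

lemma slice_mem_supported_of_mem {p : MvPolynomial σ ℤ} {T : Set σ} (hp : p ∈ supported ℤ T)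
    (S : Set σ) (e : σ →₀ ℕ) : slice S e p ∈ supported ℤ (T \ S) := by
  classical
  rw [as_sum p, map_sum]
  refine Subalgebra.sum_mem _ fun a ha => ?_
  rw [slice_monomial]
  split_ifs
  · refine monomial_mem_supported (fun i hi => ?_) _
    rw [Finsupp.filter_apply] at hi
    split_ifs at hi with h
    · exact absurd rfl hi
    · exact ⟨mem_supported_iff.1 hp a ha i hi, h⟩
  · exact zero_mem _

lemma eq_sum_slice {p : MvPolynomial σ ℤ} {d : σ → ℕ} (hp : Box d p) (m : σ) :
    p = ∑ j : Fin (d m + 1), slice {m} (Finsupp.single m (j : ℕ)) p *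
      monomial (Finsupp.single m (j : ℕ)) 1 := by
  classical
  conv_lhs => rw [as_sum p]
  have h1 : ∀ e, slice {m} e p = ∑ a ∈ p.support, slice {m} e (monomial a (coeff a p)) := by
    intro e
    conv_lhs => rw [as_sum p, map_sum]
  simp only [h1, Finset.sum_mul]
  rw [Finset.sum_comm]
  refine Finset.sum_congr rfl fun a ha => ?_
  have h2 : ∀ j, Finsupp.filter (· ∈ ({m} : Set σ)) a = Finsupp.single m j ↔ a m = j := by
    intro j
    constructor
    · intro h
      have := DFunLike.congr_fun h m
      simpa [Finsupp.filter_apply] using this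
    · rintro rfl
      ext i
      by_cases hi : i = m
      · subst hi; simp
      · simp [hi]
  have hle : a m ≤ d m := hp a ha m
  rw [Finset.sum_eq_single (⟨a m, Nat.lt_succ_of_le hle⟩ : Fin (d m + 1))]
  · rw [slice_monomial]
    split_ifs with h
    · rw [monomial_mul, mul_one]
      congr 2
      ext i
      by_cases hi : i = m
      · subst hi; simp
      · simp [hi]
    · exact absurd ((h2 _).2 rfl) h
  · intro b _ hb
    rw [slice_monomial]
    split_ifs with h
    · exact absurd (Fin.ext ((h2 _).1 h).symm) hb
    · rw [zero_mul]
  · intro h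
    exact absurd (Finset.mem_univ _) h

lemma coeff_single_aeval_X {R : Type*} [CommSemiring R] (m : σ) (v : Polynomial R) (j : ℕ) :
    coeff (Finsupp.single m j) (Polynomial.aeval (X m : MvPolynomial σ R) v) = v.coeff j := by
  classical
  induction v using Polynomial.induction_on' with
  | add p q hp hq => simp [hp, hq]
  | monomial n a =>
    rw [Polynomial.aeval_monomial, X_pow_eq_monomial, algebraMap_eq, C_mul_monomial, mul_one,
      coeff_monomial, Polynomial.coeff_monomial]
    simp only [(Finsupp.single_injective m).eq_iff]

lemma det_mem_supported {k : ℕ} {S : Set σ} {M : Matrix (Fin k) (Fin k) (MvPolynomial σ ℤ)}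
    (h : ∀ i j, M i j ∈ supported ℤ S) : M.det ∈ supported ℤ S := by
  rw [Matrix.det_apply]
  refine Subalgebra.sum_mem _ fun τ _ => ?_
  have h1 : ∏ i, M (τ i) i ∈ supported ℤ S := Subalgebra.prod_mem _ fun i _ => h _ _
  rcases Int.units_eq_one_or (Equiv.Perm.sign τ) with h | h
  · rw [h, one_smul]; exact h1
  · rw [h, Units.neg_smul, one_smul]; exact neg_mem h1

lemma univariate_bound [Fintype σ] {m : σ} {U : MvPolynomial σ ℤ} (hU : U ∈ supported ℤ {m})
    (hU0 : U ≠ 0) {ξ : σ → K} {η θ : ℝ} {w : σ → ℝ} (hξ : HtLower (ξ m) η)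
    (h : IndexGE ξ w U θ) {e : ℕ} (he : ∀ j < e, j * w m < θ) : e * η ≤ Real.log (l1 U) := by
  classical
  rw [supported_eq_adjoin_X, Set.image_singleton, Algebra.adjoin_singleton_eq_range_aeval] at hU
  obtain ⟨u, rfl⟩ := hU
  have hu0 : u ≠ 0 := by
    rintro rfl
    simp at hU0
  change IndexGE ξ w (Polynomial.aeval (X m : MvPolynomial σ ℤ) u) θ at h
  change _ ≤ Real.log (l1 (Polynomial.aeval (X m : MvPolynomial σ ℤ) u))
  have h1 : tr ξ (Polynomial.aeval (X m : MvPolynomial σ ℤ) u) =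
      Polynomial.aeval (X m : MvPolynomial σ K)
        ((u.map (Int.castRingHom K)).comp (Polynomial.X + Polynomial.C (ξ m))) := by
    rw [← Polynomial.aeval_algHom_apply, Polynomial.aeval_comp]
    simp only [tr, aeval_X, map_add, Polynomial.aeval_X, Polynomial.aeval_C, algebraMap_eq]
    rw [← algebraMap_int_eq, Polynomial.aeval_map_algebraMap]
  have h2 := hξ u hu0 e (by
    rw [Polynomial.X_sub_C_pow_dvd_iff, Polynomial.X_pow_dvd_iff]
    intro j hj
    rw [← coeff_single_aeval_X m, ← h1]
    refine h _ ?_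
    rw [Finset.sum_eq_single m]
    · simpa using he j hj
    · intro b _ hb
      simp [hb.symm]
    · simp)
  refine h2.trans (Real.log_le_log ?_ ?_)
  · obtain ⟨i, hi⟩ := Polynomial.nonempty_support_iff.2 hu0
    refine Finset.sum_pos' (fun _ _ => abs_nonneg _) ⟨i, hi, ?_⟩
    rw [abs_pos]
    exact_mod_cast Polynomial.mem_support_iff.1 hi
  · have h3 : ∑ i ∈ u.support, |(u.coeff i : ℝ)| =
        ∑ a ∈ u.support.image (Finsupp.single m),
          |((coeff a (Polynomial.aeval (X m : MvPolynomial σ ℤ) u) : ℤ) : ℝ)| := by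
      rw [Finset.sum_image (fun _ _ _ _ h => Finsupp.single_injective m h)]
      simp only [coeff_single_aeval_X]
    rw [h3, l1]
    refine Finset.sum_le_sum_of_subset_of_nonneg ?_ fun _ _ _ => abs_nonneg _
    intro a ha
    obtain ⟨j, hj, rfl⟩ := Finset.mem_image.1 ha
    rw [mem_support_iff, coeff_single_aeval_X]
    exact Polynomial.mem_support_iff.1 hj

end

lemma sum_max_ge {k d : ℕ} (hk : k ≤ d + 1) (hd : 0 < d) {ε : ℝ} (h0 : 0 < ε) (h1 : ε ≤ 1) :
    k * (ε ^ 2 / 8) ≤ ∑ i : Fin k, max 0 (ε - (i : ℕ) / d) := by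
  rw [Fin.sum_univ_eq_sum_range (fun i => max 0 (ε - (i : ℝ) / d))]
  have hd' : (1 : ℝ) ≤ d := by exact_mod_cast hd
  set t := min k (⌊ε * d / 2⌋₊ + 1) with ht
  have h2 : ∑ i ∈ Finset.range t, max 0 (ε - (i : ℝ) / d) ≤
      ∑ i ∈ Finset.range k, max 0 (ε - (i : ℝ) / d) :=
    Finset.sum_le_sum_of_subset_of_nonneg (Finset.range_mono (min_le_left _ _))
      fun _ _ _ => le_max_left _ _
  have h3 : ∑ i ∈ Finset.range t, ε / 2 ≤ ∑ i ∈ Finset.range t, max 0 (ε - (i : ℝ) / d) := by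
    refine Finset.sum_le_sum fun i hi => le_trans ?_ (le_max_right _ _)
    rw [Finset.mem_range] at hi
    have h4 : i ≤ ⌊ε * d / 2⌋₊ := by
      have := min_le_right k (⌊ε * d / 2⌋₊ + 1)
      omega
    have h5 : (i : ℝ) ≤ ε * d / 2 := (Nat.le_floor_iff (by positivity)).1 h4
    have h6 : (i : ℝ) / d ≤ ε / 2 := by
      rw [div_le_iff₀ (by linarith)]
      linarith
    linarith
  refine le_trans ?_ (h3.trans h2)
  rw [Finset.sum_const, Finset.card_range, nsmul_eq_mul]
  have hk' : (k : ℝ) ≤ d + 1 := by exact_mod_cast hk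
  have h4 : ε * k / 4 ≤ t := by
    rw [ht, Nat.cast_min]
    refine le_min ?_ ?_
    · nlinarith [Nat.cast_nonneg (α := ℝ) k]
    · have := Nat.lt_floor_add_one (ε * d / 2)
      push_cast
      nlinarith
  nlinarith

/-- The combinatorial heart of Roth's lemma: descent on the number of variables. -/
theorem roth_step [CharZero K] {M : ℕ} {n : ℕ} (m : Fin M) (hm : (m : ℕ) = n) {d : Fin M → ℕ}
    (hd : ∀ i, 0 < d i) {ξ : Fin M → K} {p : MvPolynomial (Fin M) ℤ} (hp0 : p ≠ 0)
    (hp : p ∈ supported ℤ {i : Fin M | (i : ℕ) < n + 1}) (hbox : Box d p) {ω ε Λ : ℝ}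
    (hω0 : 0 ≤ ω) (hω : ∀ i j, i < j → (d j : ℝ) ≤ ω * d i) (hεω : 0 < ε - ω) (hε1 : ε ≤ 1)
    (hΛ : ∑ i, (d i : ℝ) ≤ Λ) (hpΛ : Real.log (l1 p) ≤ Λ)
    (hind : IndexGE ξ (fun i => 1 / (d i : ℝ)) p ε) :
    ∃ k : ℕ, 0 < k ∧ ∃ F U : MvPolynomial (Fin M) ℤ, F ≠ 0 ∧ U ≠ 0 ∧
      F ∈ supported ℤ {i : Fin M | (i : ℕ) < n} ∧ U ∈ supported ℤ {m} ∧
      Box (k • d) F ∧ Real.log (l1 F) ≤ 3 * k * Λ ∧ Real.log (l1 U) ≤ 3 * k * Λ ∧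
      IndexGE ξ (fun i => 1 / (d i : ℝ)) (F * U) (k * ((ε - ω) ^ 2 / 8)) := by
  classical
  set S : Set (Fin M) := {i | (i : ℕ) < n} with hS
  have hST : Disjoint S {m} := by
    rw [Set.disjoint_singleton_right, hS, Set.mem_ofPred_eq]
    omega
  have hSc : S ≤ {m}ᶜ := fun i hi h => Set.disjoint_left.1 hST hi h
  set A : Submodule ℤ (MvPolynomial (Fin M) ℤ) := Subalgebra.toSubmodule (supported ℤ S)
  set B : Submodule ℤ (MvPolynomial (Fin M) ℤ) := Subalgebra.toSubmodule (supported ℤ {m})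
  have hrank : HasRank A B p (d m + 1) := by
    refine ⟨1, one_ne_zero, fun j => slice {m} (Finsupp.single m (j : ℕ)) p,
      fun j => monomial (Finsupp.single m (j : ℕ)) 1, fun j => ?_, fun j => ?_, ?_⟩
    · refine supported_mono ?_ (slice_mem_supported_of_mem hp {m} _)
      rintro i ⟨hi, him⟩
      rw [Set.mem_ofPred_eq] at hi ⊢
      have : (i : ℕ) ≠ n := fun h => him (Fin.ext (h.trans hm.symm))
      omega
    · refine monomial_mem_supported (fun i hi => ?_) _
      by_contra h
      rw [Set.mem_singleton_iff] at h
      simp [Ne.symm h] at hi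
    · rw [one_smul]
      exact eq_sum_slice hbox m
  obtain ⟨k, hk, hmin⟩ : ∃ k, HasRank A B p k ∧ ∀ j < k, ¬ HasRank A B p j :=
    ⟨Nat.find ⟨_, hrank⟩, Nat.find_spec ⟨_, hrank⟩, fun j hj => Nat.find_min ⟨_, hrank⟩ hj⟩
  have hkd : k ≤ d m + 1 := by
    by_contra h
    exact hmin _ (not_le.1 h) hrank
  obtain ⟨N, hN, f, g, hf, hg, hfg⟩ := hk
  have hk0 : 0 < k := by
    rcases Nat.eq_zero_or_pos k with rfl | h
    · simp only [Finset.univ_eq_empty, Finset.sum_empty] at hfg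
      exact absurd hfg (smul_ne_zero hN hp0)
    · exact h
  have hfli := linearIndependent_of_minimal hN hf hg hfg hmin
  have hgli := linearIndependent_of_minimal (A := B) (B := A) hN hg hf
    (by rw [hfg]; exact Finset.sum_congr rfl fun l _ => mul_comm _ _)
    fun j hj h => hmin j hj h.symm
  obtain ⟨J, hJ, hF0⟩ := exists_wronskian f hfli
  obtain ⟨j, hj, hU0⟩ := exists_wronskian g hgli
  set MA := (Matrix.of fun a l => hasse (J a) (f l)) with hMA
  set MB := (Matrix.of fun a l => hasse (j a) (g l)) with hMB
  have hJS : ∀ a i, J a i ≠ 0 → i ∈ S := by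
    intro a i hi
    by_contra h
    refine hF0 (Matrix.det_eq_zero_of_row_eq_zero a fun l => ?_)
    exact hasse_eq_zero_of_supported (hf l) h hi
  have hjS : ∀ a i, j a i ≠ 0 → i ∈ ({m} : Set (Fin M)) := by
    intro a i hi
    by_contra h
    refine hU0 (Matrix.det_eq_zero_of_row_eq_zero a fun l => ?_)
    exact hasse_eq_zero_of_supported (hg l) h hi
  have hFs : MA.det ∈ supported ℤ S := det_mem_supported fun a l => hasse_mem_supported _ (hf l)
  have hUs : MB.det ∈ supported ℤ {m} := det_mem_supported fun a l => hasse_mem_supported _ (hg l)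
  set MP : Matrix (Fin k) (Fin k) (MvPolynomial (Fin M) ℤ) :=
    Matrix.of fun b i => hasse (J b + j i) p with hMP
  have hdet : N ^ k • MP.det = MA.det * MB.det := by
    have h1 : N • MP = MA * MB.transpose := by
      ext1 b i
      rw [Matrix.smul_apply, Matrix.mul_apply, hMP, Matrix.of_apply, ← map_smul, hfg, map_sum]
      refine Finset.sum_congr rfl fun l _ => ?_
      exact hasse_mul_of_disjoint hST (hf l) (hg l) (hJS b) (hjS i)
    have h2 := congrArg Matrix.det h1
    rw [Matrix.det_mul, Matrix.det_transpose] at h2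
    rw [← h2]
    have h3 : N • MP = (C N : MvPolynomial (Fin M) ℤ) • MP := by
      ext1 b i
      rw [Matrix.smul_apply, Matrix.smul_apply, smul_eq_mul, C_mul']
    rw [h3, Matrix.det_smul, Fintype.card_fin, ← map_pow, C_mul']
  have hNk : N ^ k ≠ 0 := pow_ne_zero _ hN
  obtain ⟨e, he⟩ := ne_zero_iff.1 hU0
  obtain ⟨e', he'⟩ := ne_zero_iff.1 hF0
  have hFt : N ^ k • slice {m} e MP.det = coeff e MB.det • MA.det := by
    rw [← map_smul, hdet, slice_mul _ _ (supported_mono hSc hFs) hUs]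
  have hUt : N ^ k • slice {m}ᶜ e' MP.det = coeff e' MA.det • MB.det := by
    rw [← map_smul, hdet, mul_comm, slice_mul _ _ (by rwa [compl_compl])
      (supported_mono hSc hFs)]
  have hsupp : ∀ (T : Set (Fin M)) (q : MvPolynomial (Fin M) ℤ), N ^ k • q ∈ supported ℤ T →
      q ∈ supported ℤ T := by
    intro T q hq
    rw [mem_supported_iff] at hq ⊢
    intro a ha
    refine hq a ?_
    rw [mem_support_iff] at ha ⊢
    rw [coeff_smul]
    exact smul_ne_zero hNk ha
  have hd1 : ∀ i, (1 : ℝ) ≤ d i := fun i => by exact_mod_cast hd i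
  have hw : ∀ i, 0 ≤ 1 / (d i : ℝ) := fun i => by have := hd1 i; positivity
  have hkdR : (k : ℝ) ≤ d m + 1 := by exact_mod_cast hkd
  have hdm : (d m : ℝ) ≤ Λ :=
    (Finset.single_le_sum (f := fun i => (d i : ℝ)) (fun _ _ => Nat.cast_nonneg _)
      (Finset.mem_univ m)).trans hΛ
  have hGnorm : Real.log ((k * (2 ^ (∑ i, d i) * l1 p)) ^ k) ≤ 3 * k * Λ := by
    have hkp : (0 : ℝ) < k := by exact_mod_cast hk0
    have hlp : 0 < l1 p := lt_of_lt_of_le one_pos (one_le_l1 hp0)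
    rw [Real.log_pow, Real.log_mul (by positivity) (by positivity),
      Real.log_mul (by positivity) (by positivity), Real.log_pow]
    have h1 := Real.log_le_sub_one_of_pos hkp
    have h2 : ((∑ i, d i : ℕ) : ℝ) * Real.log 2 ≤ Λ := by
      push_cast
      have : Real.log 2 ≤ 1 := (Real.log_le_sub_one_of_pos (by norm_num)).trans (by norm_num)
      refine le_trans ?_ hΛ
      exact mul_le_of_le_one_right (Finset.sum_nonneg fun _ _ => Nat.cast_nonneg _) this
    have h3 : Real.log k + (((∑ i, d i : ℕ) : ℝ) * Real.log 2 + Real.log (l1 p)) ≤ 3 * Λ := by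
      linarith
    calc _ ≤ (k : ℝ) * (3 * Λ) := mul_le_mul_of_nonneg_left h3 hkp.le
      _ = _ := by ring
  have hG1 : l1 MP.det ≤ (k * (2 ^ (∑ i, d i) * l1 p)) ^ k :=
    l1_det_le _ fun a b => l1_hasse_le hbox _
  have hsl : ∀ T (e : Fin M →₀ ℕ), slice T e MP.det ≠ 0 →
      Real.log (l1 (slice T e MP.det)) ≤ 3 * k * Λ := fun T e h =>
    (Real.log_le_log (lt_of_lt_of_le one_pos (one_le_l1 h))
      ((l1_slice_le _ _ _).trans hG1)).trans hGnorm
  have hFt0 : slice {m} e MP.det ≠ 0 := by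
    intro h
    rw [h, smul_zero] at hFt
    exact smul_ne_zero he hF0 hFt.symm
  have hUt0 : slice {m}ᶜ e' MP.det ≠ 0 := by
    intro h
    rw [h, smul_zero] at hUt
    exact smul_ne_zero he' hU0 hUt.symm
  refine ⟨k, hk0, slice {m} e MP.det, slice {m}ᶜ e' MP.det, hFt0, hUt0, ?_, ?_,
    (Box.det fun a b => hbox.hasse _).slice _ _, hsl _ _ hFt0, hsl _ _ hUt0, ?_⟩
  · exact hsupp _ _ (by rw [hFt]; exact Subalgebra.smul_mem _ hFs _)
  · exact hsupp _ _ (by rw [hUt]; exact Subalgebra.smul_mem _ hUs _)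
  refine IndexGE.of_zsmul (mul_ne_zero hNk hNk) ?_
  have h1 : (N ^ k * N ^ k) • (slice {m} e MP.det * slice {m}ᶜ e' MP.det) =
      (coeff e MB.det * coeff e' MA.det * N ^ k) • MP.det := by
    rw [← smul_mul_smul_comm, hFt, hUt, smul_mul_smul_comm, ← hdet, smul_smul]
  rw [h1]
  refine IndexGE.zsmul ?_ _
  refine IndexGE.mono (θ := ∑ i : Fin k, max 0 (ε - ω - (i : ℕ) / d m)) ?_
    (sum_max_ge hkd (hd m) hεω (by linarith))
  refine IndexGE.det hw fun b i => ?_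
  rcases max_choice (0 : ℝ) (ε - ω - (i : ℕ) / d m) with h | h
  · rw [h]
    exact indexGE_of_nonpos hw le_rfl
  rw [h]
  refine (hind.hasse (J b + j i)).mono ?_
  simp only [Finsupp.coe_add, Pi.add_apply, Nat.cast_add, add_mul, Finset.sum_add_distrib]
  have hdm1 := hd1 m
  have e1 : ∑ x, (J b x : ℝ) * (1 / (d x : ℝ)) ≤ ω := by
    have e2 : ∀ x, (J b x : ℝ) * (1 / (d x : ℝ)) ≤ J b x * (ω / d m) := by
      intro x
      by_cases hx : J b x = 0
      · simp [hx]
      refine mul_le_mul_of_nonneg_left ?_ (Nat.cast_nonneg _)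
      have hxS := hJS b x hx
      have := hω x m (by rw [Fin.lt_def, hm]; exact hxS)
      have := hd1 x
      rw [div_le_div_iff₀ (by linarith) (by linarith)]
      linarith
    refine (Finset.sum_le_sum fun x _ => e2 x).trans ?_
    rw [← Finset.sum_mul]
    have e3 : ∑ x, (J b x : ℝ) ≤ d m := by
      have h1 := hJ b
      have h2 := b.2
      have h3 : ∑ x, J b x ≤ d m := by omega
      exact_mod_cast h3
    calc _ ≤ (d m : ℝ) * (ω / d m) := mul_le_mul_of_nonneg_right e3 (by positivity)
      _ = ω := by field_simp
  have e4 : ∑ x, (j i x : ℝ) * (1 / (d x : ℝ)) ≤ (i : ℕ) / d m := by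
    rw [Finset.sum_eq_single m]
    · rw [mul_one_div]
      refine div_le_div_of_nonneg_right ?_ (by linarith)
      have := (Finset.single_le_sum (f := fun x => j i x) (fun _ _ => Nat.zero_le _)
        (Finset.mem_univ m)).trans (hj i)
      exact_mod_cast this
    · intro x _ hx
      have : j i x = 0 := by
        by_contra h
        exact hx (hjS i x h)
      simp [this]
    · simp
  linarith

/-- Roth's lemma. -/
theorem roth_lemma [CharZero K] (n : ℕ) : ∀ ε : ℝ, 0 < ε → ∃ ω : ℝ, 0 < ω ∧ ∃ R : ℝ, 0 < R ∧
    ∀ (M : ℕ) (d : Fin M → ℕ) (ξ : Fin M → K) (η : Fin M → ℝ) (p : MvPolynomial (Fin M) ℤ)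
      (Λ : ℝ), n ≤ M → (∀ i, 0 < d i) → p ≠ 0 → p ∈ supported ℤ {i : Fin M | (i : ℕ) < n} →
      Box d p → (∀ i j, i < j → (d j : ℝ) ≤ ω * d i) → (∀ i, HtLower (ξ i) (η i)) →
      (∀ i, R * Λ ≤ d i * η i) → ∑ i, (d i : ℝ) ≤ Λ → Real.log (l1 p) ≤ Λ →
      ¬ IndexGE ξ (fun i => 1 / (d i : ℝ)) p ε := by
  induction n with
  | zero =>
    intro ε hε
    refine ⟨1, one_pos, 1, one_pos, ?_⟩
    intro M d ξ η p Λ _ _ hp0 hp _ _ _ _ _ _ h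
    obtain ⟨a, ha⟩ := ne_zero_iff.1 hp0
    have ha0 : ∀ b ∈ p.support, b = 0 := by
      intro b hb
      ext i
      by_contra hi
      exact absurd (mem_supported_iff.1 hp b hb i hi) (by simp)
    have hpc : p = C (coeff 0 p) := by
      ext b
      rw [coeff_C]
      split_ifs with hb
      · rw [hb]
      · by_contra hcon
        exact hb (ha0 b (mem_support_iff.2 hcon)).symm
    have h1 := h 0 (by simpa using hε)
    rw [hpc, coeff_tr, hasse_zero, aeval_C, algebraMap_int_eq, eq_intCast, Int.cast_eq_zero] at h1
    rw [ha0 a (mem_support_iff.2 ha)] at ha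
    exact ha h1
  | succ n ih =>
    intro ε' hε'
    obtain ⟨ε, hε, hεε', hε1⟩ : ∃ ε : ℝ, 0 < ε ∧ ε ≤ ε' ∧ ε ≤ 1 :=
      ⟨min ε' 1, lt_min hε' one_pos, min_le_left _ _, min_le_right _ _⟩
    obtain ⟨ω₁, hω₁, R₁, hR₁, H⟩ := ih (ε ^ 2 / 64) (by positivity)
    refine ⟨min ω₁ (ε / 2), lt_min hω₁ (by positivity), max (3 * R₁) (256 / ε ^ 2),
      lt_max_of_lt_left (by positivity), ?_⟩
    intro M d ξ η p Λ hnM hd hp0 hp hbox hω hη hR hΛ hpΛ hind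
    set ω := min ω₁ (ε / 2) with hωdef
    set R := max (3 * R₁) (256 / ε ^ 2) with hRdef
    have hω0 : 0 < ω := lt_min hω₁ (by positivity)
    have hω2 : ω ≤ ε / 2 := min_le_right _ _
    set m : Fin M := ⟨n, by omega⟩ with hm
    obtain ⟨k, hk0, F, U, hF0, hU0, hFs, hUs, hFbox, hFΛ, hUΛ, hFU⟩ :=
      roth_step m rfl hd hp0 hp hbox hω0.le hω (by linarith) hε1 hΛ hpΛ (hind.mono hεε')
    have hk : (0 : ℝ) < k := by exact_mod_cast hk0
    have hΛ0 : 0 < Λ := by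
      refine lt_of_lt_of_le ?_ hΛ
      exact Finset.sum_pos (fun i _ => by exact_mod_cast hd i) ⟨m, Finset.mem_univ m⟩
    have hR0 : 0 < R := lt_max_of_lt_left (by positivity)
    have h1 := H M (k • d) ξ η F (3 * k * Λ) (by omega)
      (fun i => by simpa using ⟨hk0, hd i⟩) hF0 hFs hFbox
      (fun i j hij => by
        simp only [Pi.smul_apply, smul_eq_mul, Nat.cast_mul]
        have h2 := hω i j hij
        have h3 : ω * d i ≤ ω₁ * d i :=
          mul_le_mul_of_nonneg_right (min_le_left _ _) (Nat.cast_nonneg _)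
        nlinarith)
      hη
      (fun i => by
        simp only [Pi.smul_apply, smul_eq_mul, Nat.cast_mul]
        have h2 := hR i
        have h3 : 3 * R₁ * Λ ≤ R * Λ := mul_le_mul_of_nonneg_right (le_max_left _ _) hΛ0.le
        nlinarith)
      (by
        simp only [Pi.smul_apply, smul_eq_mul, Nat.cast_mul, ← Finset.mul_sum]
        nlinarith) hFΛ
    have h1' : ¬ IndexGE ξ (fun i => 1 / (d i : ℝ)) F (k * (ε ^ 2 / 64)) := by
      intro h
      apply h1
      intro J hJ
      refine h J ?_
      have h2 : ∑ i, (J i : ℝ) * (1 / ((k • d) i : ℕ)) =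
          (∑ i, (J i : ℝ) * (1 / (d i : ℝ))) / k := by
        rw [Finset.sum_div]
        refine Finset.sum_congr rfl fun i _ => ?_
        simp only [Pi.smul_apply, smul_eq_mul, Nat.cast_mul]
        have : (0 : ℝ) < d i := by exact_mod_cast hd i
        field_simp
      rw [h2, div_lt_iff₀ hk] at hJ
      linarith
    have h2' : ¬ IndexGE ξ (fun i => 1 / (d i : ℝ)) U (4 * k / R) := by
      intro h
      have hdm : (0 : ℝ) < d m := by exact_mod_cast hd m
      have h3 := univariate_bound hUs hU0 (hη m) h (e := ⌈4 * k / R * d m⌉₊) (by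
        intro j hj
        rw [Nat.lt_ceil] at hj
        rw [mul_one_div, div_lt_iff₀ hdm]
        exact hj)
      have h4 := Nat.le_ceil (4 * k / R * (d m : ℝ))
      have h5 := hR m
      have h6 : 0 < η m := by
        have : 0 < (d m : ℝ) * η m := lt_of_lt_of_le (by positivity) h5
        exact (pos_iff_pos_of_mul_pos this).1 hdm
      have h7 : 4 * k / R * (d m : ℝ) * η m ≤ 3 * k * Λ :=
        (mul_le_mul_of_nonneg_right h4 h6.le).trans (h3.trans hUΛ)
      have h8 : 4 * k / R * (R * Λ) ≤ 4 * k / R * (d m * η m) :=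
        mul_le_mul_of_nonneg_left h5 (by positivity)
      have h9 : 4 * k / R * (R * Λ) = 4 * k * Λ := by field_simp
      nlinarith [mul_pos hk hΛ0]
    have hST : Disjoint {i : Fin M | (i : ℕ) < n} {m} := by
      rw [Set.disjoint_singleton_right, Set.mem_ofPred_eq, hm]
      simp
    refine not_indexGE_mul hST hFs hUs h1' h2' (hFU.mono ?_)
    have h10 : 4 * k / R ≤ k * (ε ^ 2 / 64) := by
      rw [div_le_iff₀ hR0]
      have : 256 / ε ^ 2 ≤ R := le_max_right _ _
      rw [div_le_iff₀ (by positivity)] at this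
      nlinarith
    have h11 : ε ^ 2 / 32 ≤ (ε - ω) ^ 2 / 8 := by nlinarith
    nlinarith

end Roth
end SUnit

namespace SUnit

section Mahler
open Polynomial
variable {K : Type*} [Field K] [NumberField K]

/-- A primitive integral defining polynomial with a simple root. -/
lemma exists_primitive_minpoly (ξ : K) : ∃ f : ℤ[X], f ≠ 0 ∧ aeval ξ f = 0 ∧
    aeval ξ (derivative f) ≠ 0 ∧ ∀ p : ℤ[X], aeval ξ p = 0 → f ∣ p := by
  have hintg : IsIntegral ℚ ξ := Algebra.IsIntegral.isIntegral ξ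
  obtain ⟨b, hbm, hb⟩ := IsLocalization.integerNormalization_spec (nonZeroDivisors ℤ)
    (minpoly ℚ ξ)
  set g := IsLocalization.integerNormalization (nonZeroDivisors ℤ) (minpoly ℚ ξ) with hg
  have hb0 : b ≠ 0 := nonZeroDivisors.ne_zero hbm
  have hmz := minpoly.ne_zero hintg
  have hg0 : g ≠ 0 := by
    intro h
    rw [h, Polynomial.map_zero] at hb
    exact smul_ne_zero hb0 hmz hb.symm
  have hc0 : g.content ≠ 0 := content_eq_zero_iff.not.2 hg0
  have hfac := g.eq_C_content_mul_primPart
  have hmap : C (g.content : ℚ) * g.primPart.map (algebraMap ℤ ℚ) = C (b : ℚ) * minpoly ℚ ξ := by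
    conv_lhs => rw [show C (g.content : ℚ) = (C g.content).map (algebraMap ℤ ℚ) by simp,
      ← Polynomial.map_mul, ← hfac, hb]
    ext i; simp
  have hcQ : (g.content : ℚ) ≠ 0 := by exact_mod_cast hc0
  have hbQ : (b : ℚ) ≠ 0 := by exact_mod_cast hb0
  have hmap' : g.primPart.map (algebraMap ℤ ℚ) =
      C ((g.content : ℚ)⁻¹ * (b : ℚ)) * minpoly ℚ ξ := by
    rw [C_mul, mul_assoc, ← hmap, ← mul_assoc, ← C_mul, inv_mul_cancel₀ hcQ, C_1, one_mul]
  have hu : (g.content : ℚ)⁻¹ * (b : ℚ) ≠ 0 := mul_ne_zero (inv_ne_zero hcQ) hbQ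
  have hroot : aeval ξ (minpoly ℚ ξ) = 0 := minpoly.aeval ℚ ξ
  refine ⟨g.primPart, (isPrimitive_primPart g).ne_zero, ?_, ?_, ?_⟩
  · rw [← aeval_map_algebraMap ℚ, hmap', map_mul, hroot, mul_zero]
  · rw [← aeval_map_algebraMap ℚ, ← derivative_map, hmap', derivative_C_mul, map_mul]
    refine mul_ne_zero ?_ ?_
    · rw [aeval_C]
      exact (_root_.map_ne_zero _).2 hu
    · exact (minpoly.irreducible hintg).separable.aeval_derivative_ne_zero hroot
  · intro p hp
    refine IsPrimitive.dvd_of_fraction_map_dvd_fraction_map (K := ℚ) (isPrimitive_primPart g) ?_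
    rw [hmap']
    have h1 : minpoly ℚ ξ ∣ p.map (algebraMap ℤ ℚ) :=
      minpoly.dvd ℚ ξ (by rw [aeval_map_algebraMap, hp])
    exact (isUnit_C.2 (isUnit_iff_ne_zero.2 hu)).mul_left_dvd.2 h1

omit [NumberField K] in
lemma pow_dvd_of_pow_dvd_map {ξ : K} {f : ℤ[X]} (hf : aeval ξ f = 0)
    (hf' : aeval ξ (derivative f) ≠ 0) (hdvd : ∀ p : ℤ[X], aeval ξ p = 0 → f ∣ p) (e : ℕ) :
    ∀ u : ℤ[X], (X - C ξ) ^ e ∣ u.map (Int.castRingHom K) → f ^ e ∣ u := by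
  induction e with
  | zero => intro u _; simp
  | succ e ih =>
    intro u hu
    have h1 : aeval ξ u = 0 := by
      rw [← eval_map_algebraMap, algebraMap_int_eq, ← IsRoot.def, ← dvd_iff_isRoot]
      exact (dvd_pow_self _ (Nat.succ_ne_zero e)).trans hu
    obtain ⟨v, rfl⟩ := hdvd u h1
    obtain ⟨g, hg⟩ : X - C ξ ∣ f.map (Int.castRingHom K) := by
      rw [dvd_iff_isRoot, IsRoot.def, ← algebraMap_int_eq, eval_map_algebraMap, hf]
    have hg0 : ¬ X - C ξ ∣ g := by
      rw [dvd_iff_isRoot, IsRoot.def]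
      intro h
      apply hf'
      rw [← eval_map_algebraMap, algebraMap_int_eq, ← derivative_map, hg, derivative_mul]
      simp [h]
    rw [Polynomial.map_mul, hg, pow_succ', mul_assoc] at hu
    have h2 : (X - C ξ) ^ e ∣ g * v.map (Int.castRingHom K) :=
      (mul_dvd_mul_iff_left (X_sub_C_ne_zero ξ)).1 hu
    have h3 : IsCoprime ((X - C ξ) ^ e) g :=
      ((irreducible_X_sub_C ξ).coprime_iff_not_dvd.2 hg0).pow_left
    rw [pow_succ']
    exact mul_dvd_mul_left _ (ih v (h3.dvd_of_dvd_mul_left h2))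

/-- Logarithmic height of an element of a number field, in the form needed for Roth's lemma. -/
theorem exists_height (ξ : K) : ∃ η : ℝ, 0 ≤ η ∧ HtLower ξ η ∧ ∃ a : ℤ, a ≠ 0 ∧
    IsIntegral ℤ ((a : K) * ξ) ∧ |(a : ℝ)| ≤ Real.exp η ∧
    ∀ φ : K →+* ℂ, ‖φ ((a : K) * ξ)‖ ≤ Real.exp η := by
  obtain ⟨f, hf0, hf, hf', hdvd⟩ := exists_primitive_minpoly ξ
  have hinj : Function.Injective (Int.castRingHom ℂ) := Int.cast_injective
  set Mf := (f.map (Int.castRingHom ℂ)).mahlerMeasure with hMf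
  have h1 : 1 ≤ Mf := one_le_mahlerMeasure_of_ne_zero hf0
  have hM0 : 0 < Mf := by linarith
  have hlc : ‖(f.map (Int.castRingHom ℂ)).leadingCoeff‖ = |(f.leadingCoeff : ℝ)| := by
    rw [leadingCoeff_map_of_injective hinj, eq_intCast, Complex.norm_intCast]
  refine ⟨Real.log Mf, Real.log_nonneg h1, ?_, f.leadingCoeff, leadingCoeff_ne_zero.2 hf0, ?_, ?_,
    ?_⟩
  · intro u hu0 e he
    obtain ⟨v, rfl⟩ := pow_dvd_of_pow_dvd_map hf hf' hdvd e u he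
    have hv0 : v ≠ 0 := right_ne_zero_of_mul hu0
    have h2 := one_le_mahlerMeasure_of_ne_zero hv0
    have h3 : ∀ n : ℕ, ((f ^ n * v).map (Int.castRingHom ℂ)).mahlerMeasure =
        Mf ^ n * (v.map (Int.castRingHom ℂ)).mahlerMeasure := by
      intro n
      induction n with
      | zero => simp
      | succ n ih =>
        rw [pow_succ', mul_assoc, Polynomial.map_mul, mahlerMeasure_mul, ih, ← hMf]
        ring
    have h4 := mahlerMeasure_le_sum_norm_coeff ((f ^ e * v).map (Int.castRingHom ℂ))
    rw [h3, Polynomial.sum, support_map_of_injective _ hinj] at h4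
    simp only [coeff_map, eq_intCast, Complex.norm_intCast] at h4
    rw [← Real.log_pow]
    refine Real.log_le_log (by positivity) (le_trans ?_ h4)
    exact le_mul_of_one_le_right (by positivity) h2
  · have := isIntegral_leadingCoeff_smul f ξ hf
    rwa [zsmul_eq_mul] at this
  · rw [Real.exp_log hM0, ← hlc]
    exact leadingCoeff_le_mahlerMeasure _
  · intro φ
    rw [Real.exp_log hM0, map_mul, map_intCast, norm_mul, Complex.norm_intCast, ← hlc]
    have hr : (f.map (Int.castRingHom ℂ)).IsRoot (φ ξ) := by
      rw [IsRoot.def, eval_map, show Int.castRingHom ℂ = φ.comp (Int.castRingHom K) from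
        RingHom.ext_int _ _, ← hom_eval₂, ← algebraMap_int_eq, ← aeval_def, hf, map_zero]
    obtain ⟨g, hg⟩ := dvd_iff_isRoot.2 hr
    have h5 : Mf = max 1 ‖φ ξ‖ * g.mahlerMeasure := by
      rw [hMf, hg, mahlerMeasure_mul, mahlerMeasure_X_sub_C]
    have h6 : (f.map (Int.castRingHom ℂ)).leadingCoeff = g.leadingCoeff := by
      rw [hg, leadingCoeff_mul, leadingCoeff_X_sub_C, one_mul]
    rw [h5, h6, mul_comm]
    exact mul_le_mul (le_max_right _ _) (leadingCoeff_le_mahlerMeasure g) (norm_nonneg _)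
      (by positivity)

end Mahler
end SUnit

namespace SUnit
open MvPolynomial

section Chebyshev
variable {η α : Type*} [Fintype η] [DecidableEq η]

lemma sum_sq_piFinset_le (A : η → Finset α) (f : η → α → ℝ)
    (h0 : ∀ h, ∑ c ∈ A h, f h c = 0) (h1 : ∀ h, ∀ c ∈ A h, |f h c| ≤ 1) :
    ∑ b ∈ Fintype.piFinset A, (∑ h, f h (b h)) ^ 2 ≤
      Fintype.card η * (Fintype.piFinset A).card := by
  have h2 : ∀ b : η → α, (∑ h, f h (b h)) ^ 2 = ∑ h, ∑ h', f h (b h) * f h' (b h') := by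
    intro b
    rw [sq, Finset.sum_mul_sum]
  simp only [h2]
  rw [Finset.sum_comm]
  have h3 : ∀ h, ∑ b ∈ Fintype.piFinset A, ∑ h', f h (b h) * f h' (b h') ≤
      (Fintype.piFinset A).card := by
    intro h
    rw [Finset.sum_comm, Finset.sum_eq_single h]
    · rw [Finset.card_eq_sum_ones, Nat.cast_sum]
      refine Finset.sum_le_sum fun b hb => ?_
      have := h1 h (b h) (Fintype.mem_piFinset.1 hb h)
      rw [← sq, ← sq_abs, Nat.cast_one]
      exact pow_le_one₀ (abs_nonneg _) this
    · intro h' _ hne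
      have h4 : ∀ b : η → α, f h (b h) * f h' (b h') =
          ∏ k, (if k = h then f h (b k) else if k = h' then f h' (b k) else 1) := by
        intro b
        rw [← Finset.mul_prod_erase _ _ (Finset.mem_univ h), if_pos rfl,
          ← Finset.mul_prod_erase _ _ (Finset.mem_erase.2 ⟨hne, Finset.mem_univ h'⟩), if_neg hne,
          if_pos rfl, Finset.prod_eq_one, mul_one]
        intro k hk
        simp only [Finset.mem_erase] at hk
        rw [if_neg hk.2.1, if_neg hk.1]
      simp only [h4]
      rw [← Finset.prod_univ_sum A
        (fun k c => if k = h then f h c else if k = h' then f h' c else 1)]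
      refine Finset.prod_eq_zero (Finset.mem_univ h) ?_
      simp [h0]
    · simp
  calc _ ≤ ∑ h : η, ((Fintype.piFinset A).card : ℝ) := Finset.sum_le_sum fun h _ => h3 h
    _ = _ := by rw [Finset.sum_const, nsmul_eq_mul, Finset.card_univ]

lemma card_deviation_le (A : η → Finset α) (f : η → α → ℝ)
    (h0 : ∀ h, ∑ c ∈ A h, f h c = 0) (h1 : ∀ h, ∀ c ∈ A h, |f h c| ≤ 1) {t : ℝ} (ht : 0 ≤ t) :
    (((Fintype.piFinset A).filter fun b => t < |∑ h, f h (b h)|).card : ℝ) * t ^ 2 ≤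
      Fintype.card η * (Fintype.piFinset A).card := by
  refine le_trans ?_ (sum_sq_piFinset_le A f h0 h1)
  rw [← nsmul_eq_mul, ← Finset.sum_const]
  refine (Finset.sum_le_sum fun b hb => ?_).trans (Finset.sum_le_sum_of_subset_of_nonneg
    (Finset.filter_subset _ _) fun _ _ _ => sq_nonneg _)
  rw [← sq_abs (∑ h, f h (b h))]
  have := (Finset.mem_filter.1 hb).2
  gcongr

lemma sum_piAntidiag_coord {κ : Type*} [Fintype κ] [DecidableEq κ] (d : ℕ) (i : κ) :
    (Fintype.card κ : ℝ) * ∑ c ∈ Finset.piAntidiag (Finset.univ : Finset κ) d, (c i : ℝ) =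
      d * (Finset.piAntidiag (Finset.univ : Finset κ) d).card := by
  have h1 : ∀ j, ∑ c ∈ Finset.piAntidiag (Finset.univ : Finset κ) d, (c j : ℝ) =
      ∑ c ∈ Finset.piAntidiag (Finset.univ : Finset κ) d, (c i : ℝ) := by
    intro j
    have hmem : ∀ c ∈ Finset.piAntidiag (Finset.univ : Finset κ) d, c ∘ Equiv.swap i j ∈
        Finset.piAntidiag (Finset.univ : Finset κ) d := by
      intro c hc
      rw [Finset.mem_piAntidiag] at hc ⊢
      refine ⟨?_, fun _ _ => Finset.mem_univ _⟩
      rw [← hc.1]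
      exact Equiv.sum_comp (Equiv.swap i j) c
    refine Finset.sum_bij' (fun c _ => c ∘ Equiv.swap i j) (fun c _ => c ∘ Equiv.swap i j)
      hmem hmem ?_ ?_ ?_
    · intro c _; ext x; simp
    · intro c _; ext x; simp
    · intro c _; simp
  have h2 : ∑ j, ∑ c ∈ Finset.piAntidiag (Finset.univ : Finset κ) d, (c j : ℝ) =
      d * (Finset.piAntidiag (Finset.univ : Finset κ) d).card := by
    rw [Finset.sum_comm, mul_comm, ← nsmul_eq_mul, ← Finset.sum_const]
    refine Finset.sum_congr rfl fun c hc => ?_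
    rw [← (Finset.mem_piAntidiag.1 hc).1]
    push_cast
    rfl
  rw [← h2]
  simp only [h1]
  rw [Finset.sum_const, nsmul_eq_mul, Finset.card_univ]

/-- Exponents whose normalised coordinate sums deviate from the mean are rare. -/
lemma card_bad_le {κ : Type*} [Fintype κ] [DecidableEq κ] [Nonempty κ] {d : η → ℕ}
    (hd : ∀ h, 0 < d h) (i : κ) {t : ℝ} (ht : 0 ≤ t) :
    (((Fintype.piFinset fun h => Finset.piAntidiag (Finset.univ : Finset κ) (d h)).filter
      fun b => t < |∑ h, ((b h i : ℝ) / d h) - Fintype.card η / Fintype.card κ|).card : ℝ) * t ^ 2 ≤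
    Fintype.card η *
      (Fintype.piFinset fun h => Finset.piAntidiag (Finset.univ : Finset κ) (d h)).card := by
  have hN : (0 : ℝ) < Fintype.card κ := by exact_mod_cast Fintype.card_pos
  have hN1 : (1 : ℝ) ≤ Fintype.card κ := by exact_mod_cast Fintype.card_pos (α := κ)
  have h := card_deviation_le (fun h => Finset.piAntidiag (Finset.univ : Finset κ) (d h))
    (fun h c => (c i : ℝ) / d h - 1 / Fintype.card κ) ?_ ?_ ht
  · have e : ∀ b : η → κ → ℕ, ∑ h, ((b h i : ℝ) / d h - 1 / Fintype.card κ) =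
        ∑ h, ((b h i : ℝ) / d h) - Fintype.card η / Fintype.card κ := by
      intro b
      rw [Finset.sum_sub_distrib, Finset.sum_const, nsmul_eq_mul, Finset.card_univ, mul_one_div]
    simp only [e] at h
    exact h
  · intro h
    have hdh : (0 : ℝ) < d h := by exact_mod_cast hd h
    rw [Finset.sum_sub_distrib, ← Finset.sum_div, Finset.sum_const, nsmul_eq_mul, sub_eq_zero,
      mul_one_div, div_eq_div_iff hdh.ne' hN.ne']
    have := sum_piAntidiag_coord (κ := κ) (d h) i
    linarith
  · intro h c hc
    have hdh : (0 : ℝ) < d h := by exact_mod_cast hd h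
    have h1 : (c i : ℝ) ≤ d h := by
      have := (Finset.mem_piAntidiag.1 hc).1
      rw [← this]
      exact_mod_cast Finset.single_le_sum (fun _ _ => Nat.zero_le _) (Finset.mem_univ i)
    have h2 : (c i : ℝ) / d h ≤ 1 := (div_le_one hdh).2 h1
    have h3 : 0 ≤ (c i : ℝ) / d h := by positivity
    have h4 : 1 / (Fintype.card κ : ℝ) ≤ 1 := (div_le_one hN).2 hN1
    have h5 : 0 ≤ 1 / (Fintype.card κ : ℝ) := by positivity
    rw [abs_le]
    constructor <;> linarith

end Chebyshev
end SUnit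

namespace SUnit
open MvPolynomial

section Siegel
attribute [local instance] Matrix.seminormedAddCommGroup

lemma exists_small_kernel {α β : Type*} [Fintype α] [Fintype β] (A : Matrix α β ℤ)
    (h : 2 * Fintype.card α ≤ Fintype.card β) (hβ : 0 < Fintype.card β) {B : ℝ} (hB : 1 ≤ B)
    (hA : ∀ i j, |(A i j : ℝ)| ≤ B) :
    ∃ t : β → ℤ, t ≠ 0 ∧ A.mulVec t = 0 ∧ ∀ b, |(t b : ℝ)| ≤ Fintype.card β * B := by
  have hβ1 : (1 : ℝ) ≤ Fintype.card β := by exact_mod_cast hβ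
  rcases Nat.eq_zero_or_pos (Fintype.card α) with h0 | h0
  · have := Fintype.card_eq_zero_iff.1 h0
    have := Fintype.card_pos_iff.1 hβ
    refine ⟨fun _ => 1, fun h => one_ne_zero (congrFun h (Classical.arbitrary β)),
      Subsingleton.elim _ _, fun b => ?_⟩
    simp only [Int.cast_one, abs_one]
    nlinarith
  · obtain ⟨t, ht0, ht, hn⟩ := Int.Matrix.exists_ne_zero_int_vec_norm_le A (by omega) h0
    refine ⟨t, ht0, ht, fun b => ?_⟩
    have h1 : |(t b : ℝ)| ≤ ‖t‖ := by
      have := norm_le_pi_norm t b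
      rwa [Int.norm_eq_abs] at this
    refine h1.trans (hn.trans ?_)
    have h2 : max 1 ‖A‖ ≤ B := by
      refine max_le hB ((Matrix.norm_le_iff (by linarith)).2 fun i j => ?_)
      rw [Int.norm_eq_abs]
      exact hA i j
    have h3 : (1 : ℝ) ≤ max 1 ‖A‖ := le_max_left _ _
    have h4 : (2 : ℝ) * Fintype.card α ≤ Fintype.card β := by exact_mod_cast h
    have h5 : (1 : ℝ) ≤ Fintype.card α := by exact_mod_cast h0
    calc _ ≤ ((Fintype.card β : ℝ) * max 1 ‖A‖) ^ (1 : ℝ) := by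
          refine Real.rpow_le_rpow_of_exponent_le (by nlinarith) ?_
          rw [div_le_one (by linarith)]
          linarith
      _ = (Fintype.card β : ℝ) * max 1 ‖A‖ := Real.rpow_one _
      _ ≤ _ := by gcongr

end Siegel

section Aux
variable {η κ : Type*} [Fintype η] [DecidableEq η] [Fintype κ] [DecidableEq κ]

/-- Blockwise linear substitution `X (h, i) ↦ ∑ j, L i j * X (h, j)`. -/
noncomputable def linSubst (L : Matrix κ κ ℤ) :
    MvPolynomial (η × κ) ℤ →ₐ[ℤ] MvPolynomial (η × κ) ℤ :=
  aeval fun x => ∑ j, C (L x.2 j) * X (x.1, j)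

omit [Fintype η] [DecidableEq η] [DecidableEq κ] in
lemma linSubst_linSubst (L L' : Matrix κ κ ℤ) (p : MvPolynomial (η × κ) ℤ) :
    linSubst L (linSubst L' p) = linSubst (L' * L) p := by
  rw [← AlgHom.comp_apply]
  congr 1
  refine algHom_ext fun x => ?_
  simp only [linSubst, AlgHom.comp_apply, aeval_X, map_sum, map_mul, Matrix.mul_apply,
    Finset.sum_mul, Finset.mul_sum, algHom_C, algebraMap_eq]
  rw [Finset.sum_comm]
  simp only [mul_assoc]

omit [Fintype η] [DecidableEq η] in
lemma linSubst_one (p : MvPolynomial (η × κ) ℤ) : linSubst (1 : Matrix κ κ ℤ) p = p := by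
  conv_rhs => rw [← AlgHom.id_apply (R := ℤ) p]
  congr 1
  refine algHom_ext fun x => ?_
  rw [linSubst, aeval_X, Finset.sum_eq_single x.2]
  · simp
  · intro j _ hj
    simp [Matrix.one_apply_ne hj.symm]
  · simp

/-- Multihomogeneity of multidegree `d`. -/
def MH (d : η → ℕ) (p : MvPolynomial (η × κ) ℤ) : Prop :=
  ∀ a ∈ p.support, ∀ h, ∑ j, a (h, j) = d h

omit [DecidableEq κ] in
lemma weight_block (a : η × κ →₀ ℕ) :
    Finsupp.weight (fun x : η × κ => Pi.single (M := fun _ => ℕ) x.1 1) a =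
      fun h => ∑ j, a (h, j) := by
  funext h
  rw [Finsupp.weight_apply, Finsupp.sum_fintype _ _ (by simp), Finset.sum_apply,
    Fintype.sum_prod_type, Finset.sum_eq_single h]
  · simp
  · intro b _ hb
    simp [Pi.single_eq_of_ne hb.symm]
  · simp

lemma MH_iff {d : η → ℕ} {p : MvPolynomial (η × κ) ℤ} :
    MH d p ↔ IsWeightedHomogeneous (fun x : η × κ => Pi.single (M := fun _ => ℕ) x.1 1) p d := by
  constructor
  · intro h a ha
    rw [weight_block]
    exact funext (h a (mem_support_iff.2 ha))
  · intro h a ha k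
    have := h (mem_support_iff.1 ha)
    rw [weight_block] at this
    exact congrFun this k

lemma MH.sum {d : η → ℕ} {ι : Type*} {s : Finset ι} {f : ι → MvPolynomial (η × κ) ℤ}
    (h : ∀ i ∈ s, MH d (f i)) : MH d (∑ i ∈ s, f i) :=
  MH_iff.2 (IsWeightedHomogeneous.sum _ _ _ fun i hi => MH_iff.1 (h i hi))

lemma MH.linSubst_monomial {d : η → ℕ} {a : η × κ →₀ ℕ} (ha : ∀ h, ∑ j, a (h, j) = d h) (c : ℤ)
    (L : Matrix κ κ ℤ) : MH d (linSubst L (monomial a c)) := by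
  rw [MH_iff, linSubst, aeval_monomial, algebraMap_eq, Finsupp.prod_fintype _ _ (by simp)]
  have h1 := IsWeightedHomogeneous.prod (w := fun x : η × κ => Pi.single (M := fun _ => ℕ) x.1 1)
    Finset.univ (fun x : η × κ => (∑ j, C (L x.2 j) * X (x.1, j)) ^ (a x) : _ →
      MvPolynomial (η × κ) ℤ) (fun x => a x • Pi.single (M := fun _ => ℕ) x.1 1)
    (fun x _ => IsWeightedHomogeneous.pow (IsWeightedHomogeneous.sum _ _ _ fun j _ => by
      exact (isWeightedHomogeneous_X ℤ
        (fun x : η × κ => Pi.single (M := fun _ => ℕ) x.1 1) (x.1, j)).C_mul _) _)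
  have h2 : ∑ x : η × κ, a x • Pi.single (M := fun _ => ℕ) x.1 1 = d := by
    have := weight_block a
    rw [Finsupp.weight_apply, Finsupp.sum_fintype _ _ (by simp)] at this
    rw [this]
    exact funext ha
  rw [h2] at h1
  exact h1.C_mul c

/-- Size of a linear substitution. -/
noncomputable def matSize (L : Matrix κ κ ℤ) : ℝ := 1 + ∑ i, ∑ j, |(L i j : ℝ)|

omit [DecidableEq κ] in
lemma one_le_matSize (L : Matrix κ κ ℤ) : 1 ≤ matSize L := by
  have : 0 ≤ ∑ i, ∑ j, |(L i j : ℝ)| :=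
    Finset.sum_nonneg fun _ _ => Finset.sum_nonneg fun _ _ => abs_nonneg _
  rw [matSize]; linarith

omit [DecidableEq η] [DecidableEq κ] in
lemma l1_linSubst_monomial_le {d : η → ℕ} {a : η × κ →₀ ℕ} (ha : ∀ h, ∑ j, a (h, j) = d h)
    (L : Matrix κ κ ℤ) : l1 (linSubst L (monomial a 1)) ≤ matSize L ^ (∑ h, d h) := by
  rw [linSubst, aeval_monomial, map_one, one_mul, Finsupp.prod_fintype _ _ (by simp)]
  have h0 : ∀ x : η × κ, l1 (∑ j, C (L x.2 j) * X (x.1, j) : MvPolynomial (η × κ) ℤ) ≤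
      matSize L := by
    intro x
    refine (l1_sum_le _ _).trans ?_
    have h1 : ∀ j, l1 (C (L x.2 j) * X (x.1, j) : MvPolynomial (η × κ) ℤ) = |(L x.2 j : ℝ)| := by
      intro j
      rw [C_mul_X_eq_monomial, l1_monomial]
    simp only [h1]
    have := Finset.single_le_sum (f := fun i => ∑ j, |(L i j : ℝ)|)
      (fun _ _ => Finset.sum_nonneg fun _ _ => abs_nonneg _) (Finset.mem_univ x.2)
    rw [matSize]
    linarith
  have hpow : ∀ (q : MvPolynomial (η × κ) ℤ) (n : ℕ), l1 (q ^ n) ≤ l1 q ^ n := by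
    intro q n
    have := l1_prod_le (Finset.range n) fun _ => q
    simpa using this
  refine (l1_prod_le _ _).trans ?_
  calc _ ≤ ∏ x : η × κ, matSize L ^ a x := by
        refine Finset.prod_le_prod (fun _ _ => l1_nonneg _) fun x _ => (hpow _ _).trans ?_
        exact pow_le_pow_left₀ (l1_nonneg _) (h0 x) _
    _ = _ := by
        rw [Finset.prod_pow_eq_pow_sum, Fintype.sum_prod_type]
        simp only [ha]

/-- The exponent vector attached to a family of block exponents. -/
noncomputable def blockExp (b : η → κ → ℕ) : η × κ →₀ ℕ :=
  Finsupp.equivFunOnFinite.symm fun x => b x.1 x.2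

omit [DecidableEq η] [DecidableEq κ] in
@[simp] lemma blockExp_apply (b : η → κ → ℕ) (x : η × κ) : blockExp b x = b x.1 x.2 := rfl

omit [DecidableEq η] [DecidableEq κ] in
lemma blockExp_injective : Function.Injective (blockExp : (η → κ → ℕ) → η × κ →₀ ℕ) := by
  intro b c h
  funext i j
  exact DFunLike.congr_fun h (i, j)

lemma card_blocks_le (d : η → ℕ) :
    ((Fintype.piFinset fun h => Finset.piAntidiag (Finset.univ : Finset κ) (d h)).card : ℝ) ≤
      (2 ^ Fintype.card κ) ^ (∑ h, d h) := by
  rw [Fintype.card_piFinset]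
  push_cast
  rw [← Finset.prod_pow_eq_pow_sum]
  refine Finset.prod_le_prod (fun _ _ => Nat.cast_nonneg _) fun h _ => ?_
  have h1 : (Finset.piAntidiag (Finset.univ : Finset κ) (d h)).card ≤
      (Fintype.piFinset fun _ : κ => Finset.range (d h + 1)).card := by
    refine Finset.card_le_card fun c hc => Fintype.mem_piFinset.2 fun i => ?_
    rw [Finset.mem_range, Nat.lt_succ_iff, ← (Finset.mem_piAntidiag.1 hc).1]
    exact Finset.single_le_sum (fun _ _ => Nat.zero_le _) (Finset.mem_univ i)
  rw [Fintype.card_piFinset, Finset.prod_const, Finset.card_range, Finset.card_univ] at h1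
  have h2 : (d h + 1) ^ Fintype.card κ ≤ (2 ^ Fintype.card κ) ^ d h := by
    rw [← pow_mul, mul_comm, pow_mul]
    exact Nat.pow_le_pow_left (Nat.lt_two_pow_self) _
  exact_mod_cast h1.trans h2

end Aux
end SUnit

namespace SUnit
open MvPolynomial

section Aux
variable {κ ι : Type*} [Fintype κ] [DecidableEq κ] [Nonempty κ] [Fintype ι]

/-- Existence of the auxiliary polynomial. -/
theorem exists_aux (L Linv : ι → Matrix κ κ ℤ) (hL : ∀ s, Linv s * L s = 1) {ε : ℝ}
    (hε : 0 < ε) : ∃ m : ℕ, 0 < m ∧ ∃ c : ℝ, 1 ≤ c ∧ ∀ d : Fin m → ℕ, (∀ h, 0 < d h) →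
      ∃ P : MvPolynomial (Fin m × κ) ℤ, P ≠ 0 ∧ MH d P ∧ l1 P ≤ c ^ (∑ h, d h) ∧
        ∀ s, ∃ q : MvPolynomial (Fin m × κ) ℤ, linSubst (L s) q = P ∧ MH d q ∧
          l1 q ≤ c ^ (∑ h, d h) ∧ ∀ b ∈ q.support, ∀ i,
            |∑ h, ((b (h, i) : ℝ) / d h) - m / Fintype.card κ| ≤ m * ε := by
  classical
  set N := Fintype.card κ with hN
  have hNpos : 0 < N := Fintype.card_pos
  obtain ⟨m, hm⟩ := exists_nat_ge (2 * (Fintype.card ι : ℝ) * N / ε ^ 2 + 1)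
  have hm0 : 0 < m := by
    have : (0 : ℝ) < m := lt_of_lt_of_le (by positivity) hm
    exact_mod_cast this
  have hm1 : 2 * (Fintype.card ι : ℝ) * N ≤ m * ε ^ 2 := by
    have : 2 * (Fintype.card ι : ℝ) * N / ε ^ 2 ≤ m := by linarith
    rwa [div_le_iff₀ (by positivity)] at this
  set c0 : ℝ := 1 + ∑ s, matSize (Linv s) with hc0
  have hc0s : ∀ s, matSize (Linv s) ≤ c0 := by
    intro s
    have := Finset.single_le_sum (f := fun s => matSize (Linv s))
      (fun s _ => zero_le_one.trans (one_le_matSize _)) (Finset.mem_univ s)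
    rw [hc0]
    linarith
  have hc01 : 1 ≤ c0 := by
    have : 0 ≤ ∑ s, matSize (Linv s) :=
      Finset.sum_nonneg fun s _ => zero_le_one.trans (one_le_matSize _)
    linarith
  have hw1 : (1 : ℝ) ≤ 2 ^ N := one_le_pow₀ (by norm_num)
  have hw0 : (0 : ℝ) < 2 ^ N := by positivity
  refine ⟨m, hm0, 2 ^ N * 2 ^ N * (c0 * c0), one_le_mul_of_one_le_of_one_le
    (one_le_mul_of_one_le_of_one_le hw1 hw1) (one_le_mul_of_one_le_of_one_le hc01 hc01), ?_⟩
  intro d hd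
  set D := ∑ h, d h with hD
  set A := Fintype.piFinset fun h => Finset.piAntidiag (Finset.univ : Finset κ) (d h) with hA
  have hAmem : ∀ b, b ∈ A ↔ ∀ h, ∑ j, b h j = d h := by
    intro b
    simp [hA, Fintype.mem_piFinset, Finset.mem_piAntidiag]
  have hApos : 0 < A.card := by
    rw [Finset.card_pos]
    refine ⟨fun h => Pi.single (Classical.arbitrary κ) (d h), (hAmem _).2 fun h => ?_⟩
    simp
  set dev : (Fin m → κ → ℕ) → κ → ℝ := fun b i =>
    |∑ h, ((b h i : ℝ) / d h) - m / N| with hdev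
  set bad := A.filter fun b => ∃ i, m * ε < dev b i with hbad
  have hbadcard : (bad.card : ℝ) * (m * ε) ^ 2 ≤ N * (m * A.card) := by
    have h1 : bad ⊆ Finset.univ.biUnion fun i => A.filter fun b => m * ε < dev b i := by
      intro b hb
      obtain ⟨hb, i, hi⟩ := Finset.mem_filter.1 hb
      exact Finset.mem_biUnion.2 ⟨i, Finset.mem_univ i, Finset.mem_filter.2 ⟨hb, hi⟩⟩
    have h2 : (bad.card : ℝ) ≤ ∑ i, ((A.filter fun b => m * ε < dev b i).card : ℝ) := by
      exact_mod_cast (Finset.card_le_card h1).trans Finset.card_biUnion_le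
    calc _ ≤ (∑ i, ((A.filter fun b => m * ε < dev b i).card : ℝ)) * (m * ε) ^ 2 := by gcongr
      _ = ∑ i, ((A.filter fun b => m * ε < dev b i).card : ℝ) * (m * ε) ^ 2 := by
          rw [Finset.sum_mul]
      _ ≤ ∑ i : κ, ((m : ℝ) * A.card) := by
          refine Finset.sum_le_sum fun i _ => ?_
          have := card_bad_le (κ := κ) hd i (t := m * ε) (by positivity)
          rw [Fintype.card_fin] at this
          exact this
      _ = _ := by rw [Finset.sum_const, nsmul_eq_mul, Finset.card_univ]
  have hbad2 : 2 * (Fintype.card ι * bad.card) ≤ A.card := by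
    have hmR : (0 : ℝ) < m := by exact_mod_cast hm0
    have hNR : (0 : ℝ) < N := by exact_mod_cast hNpos
    have h1 : (bad.card : ℝ) * (m * ε ^ 2) ≤ N * A.card := by
      have : m * ((bad.card : ℝ) * (m * ε ^ 2)) ≤ m * (N * A.card) := by nlinarith
      exact le_of_mul_le_mul_left this hmR
    have h2 : (bad.card : ℝ) * (2 * (Fintype.card ι : ℝ) * N) ≤ bad.card * (m * ε ^ 2) :=
      mul_le_mul_of_nonneg_left hm1 (Nat.cast_nonneg _)
    have h3 : N * (2 * ((Fintype.card ι : ℝ) * bad.card)) ≤ N * A.card := by linarith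
    exact_mod_cast le_of_mul_le_mul_left h3 hNR
  set Mat : Matrix (ι × bad) A ℤ := Matrix.of fun sb a =>
    coeff (blockExp sb.2.1) (linSubst (Linv sb.1) (monomial (blockExp a.1) 1)) with hMat
  have hlin : ∀ s (a : A), l1 (linSubst (Linv s) (monomial (blockExp a.1) 1)) ≤ c0 ^ D := by
    intro s a
    refine (l1_linSubst_monomial_le (d := d) (fun h => ?_) _).trans ?_
    · exact (hAmem _).1 a.2 h
    · exact pow_le_pow_left₀ (zero_le_one.trans (one_le_matSize _)) (hc0s s) _
  have hc0D : 1 ≤ c0 ^ D := one_le_pow₀ hc01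
  obtain ⟨t, ht0, htker, htle⟩ := exists_small_kernel Mat (by simpa using hbad2)
    (by simpa using hApos) hc0D (fun sb a => by
      refine le_trans ?_ (hlin sb.1 a)
      rw [hMat, Matrix.of_apply]
      by_cases h : blockExp sb.2.1 ∈
          (linSubst (Linv sb.1) (monomial (blockExp a.1) 1)).support
      · exact Finset.single_le_sum (f := fun e => |((coeff e
          (linSubst (Linv sb.1) (monomial (blockExp a.1) 1)) : ℤ) : ℝ)|)
          (fun _ _ => abs_nonneg _) h
      · rw [notMem_support_iff.1 h]
        simpa using l1_nonneg _)
  rw [Fintype.card_coe] at htle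
  have hAcard : (A.card : ℝ) ≤ (2 ^ N) ^ D := card_blocks_le d
  have hAc1 : (1 : ℝ) ≤ (2 ^ N) ^ D := one_le_pow₀ hw1
  set P : MvPolynomial (Fin m × κ) ℤ := ∑ a : A, monomial (blockExp a.1) (t a) with hP
  have hPlin : ∀ s, linSubst (Linv s) P =
      ∑ a : A, t a • linSubst (Linv s) (monomial (blockExp a.1) 1) := by
    intro s
    rw [hP, map_sum]
    refine Finset.sum_congr rfl fun a _ => ?_
    rw [← map_smul, smul_monomial, smul_eq_mul, mul_one]
  have hPcoeff : ∀ a : A, coeff (blockExp a.1) P = t a := by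
    intro a
    rw [hP, coeff_sum, Finset.sum_eq_single a]
    · simp
    · intro b _ hb
      rw [coeff_monomial, if_neg]
      exact fun h => hb (Subtype.ext (blockExp_injective h))
    · simp
  have hsize : (A.card : ℝ) * (A.card * c0 ^ D) * c0 ^ D ≤ (2 ^ N * 2 ^ N * (c0 * c0)) ^ D := by
    rw [mul_pow, mul_pow, mul_pow]
    have h0 : (0 : ℝ) ≤ A.card := Nat.cast_nonneg _
    have h1 : (A.card : ℝ) * A.card ≤ (2 ^ N) ^ D * (2 ^ N) ^ D := by gcongr
    have h2 : 0 ≤ c0 ^ D * c0 ^ D := by positivity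
    nlinarith [mul_le_mul_of_nonneg_right h1 h2]
  refine ⟨P, ?_, ?_, ?_, ?_⟩
  · intro h
    apply ht0
    funext a
    rw [← hPcoeff a, h]
    simp
  · refine MH.sum fun a _ b hb h => ?_
    rw [Finset.mem_singleton.1 (support_monomial_subset hb)]
    exact (hAmem _).1 a.2 h
  · refine (l1_sum_le _ _).trans (le_trans ?_ hsize)
    calc _ ≤ ∑ a : A, (A.card * c0 ^ D) := by
          refine Finset.sum_le_sum fun a _ => ?_
          rw [l1_monomial]
          exact htle a
      _ = (A.card : ℝ) * (A.card * c0 ^ D) := by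
          rw [Finset.sum_const, nsmul_eq_mul, Finset.card_univ, Fintype.card_coe]
      _ ≤ _ := le_mul_of_one_le_right (by positivity) hc0D
  · intro s
    have hMHq : MH d (linSubst (Linv s) P) := by
      rw [hP, map_sum]
      exact MH.sum fun a _ => MH.linSubst_monomial (fun h => (hAmem _).1 a.2 h) _ _
    refine ⟨linSubst (Linv s) P, ?_, hMHq, ?_, ?_⟩
    · rw [linSubst_linSubst, hL, linSubst_one]
    · rw [hPlin]
      refine (l1_sum_le _ _).trans (le_trans ?_ hsize)
      calc _ ≤ ∑ a : A, (A.card * c0 ^ D) * c0 ^ D := by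
            refine Finset.sum_le_sum fun a _ => ?_
            have h1 := l1_mul_le (C (t a)) (linSubst (Linv s) (monomial (blockExp a.1) 1))
            rw [C_mul', show l1 (C (t a) : MvPolynomial (Fin m × κ) ℤ) = |(t a : ℝ)| from
              l1_monomial 0 _] at h1
            refine h1.trans ?_
            exact mul_le_mul (htle a) (hlin s a) (l1_nonneg _) (by positivity)
        _ = _ := by
            rw [Finset.sum_const, nsmul_eq_mul, Finset.card_univ, Fintype.card_coe]
            ring
    · intro b hb i
      by_contra hcon
      rw [not_le] at hcon
      set b' : Fin m → κ → ℕ := fun h j => b (h, j) with hb'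
      have hbb : blockExp b' = b := by ext x; rfl
      have hb'A : b' ∈ A := (hAmem _).2 (hMHq b hb)
      have hb'bad : b' ∈ bad := Finset.mem_filter.2 ⟨hb'A, i, hcon⟩
      have h1 := congrFun htker (s, ⟨b', hb'bad⟩)
      rw [mem_support_iff, hPlin, coeff_sum] at hb
      apply hb
      rw [← hbb]
      simp only [Matrix.mulVec, dotProduct, hMat, Matrix.of_apply, Pi.zero_apply] at h1
      rw [← h1]
      refine Finset.sum_congr rfl fun a _ => ?_
      rw [coeff_smul, smul_eq_mul, mul_comm]

end Aux
end SUnit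

namespace SUnit

/-- The arithmetic input: finitely many absolute values on a field together with a ring of
integers satisfying the product inequality, finiteness of boxes and a Minkowski-type theorem. -/
structure SData (K : Type*) [Field K] (ι : Type*) [Fintype ι] where
  v : ι → AbsoluteValue K ℝ
  n : ι → ℕ
  n_pos : ∀ s, 0 < n s
  O : Subring K
  one_le : ∀ x ∈ O, x ≠ 0 → 1 ≤ ∏ s, v s x ^ n s
  finite_le : ∀ R : ℝ, {x : K | x ∈ O ∧ ∀ s, v s x ≤ R}.Finite
  integral_mem : ∀ x : K, IsIntegral ℤ x → x ∈ O
  arch_or : ∀ s, (∃ φ : K →+* ℂ, ∀ x, v s x = ‖φ x‖) ∨ ∀ x, IsIntegral ℤ x → v s x ≤ 1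
  minkowski : ∀ (N : ℕ) (L Linv : ι → Matrix (Fin N) (Fin N) ℤ),
    (∀ s, Linv s * L s = 1) → ∃ c : ℝ, 0 < c ∧ ∀ A : ι → Fin N → ℝ, (∀ s i, 0 < A s i) →
      c ≤ ∏ s, ∏ i, A s i ^ n s → ∃ x : Fin N → K, x ≠ 0 ∧ (∀ i, x i ∈ O) ∧
        ∀ s i, v s (∑ j, (L s i j : K) * x j) ≤ A s i

section Basic
variable {K : Type*} [Field K]

lemma abv_intCast_le (v : AbsoluteValue K ℝ) (z : ℤ) : v (z : K) ≤ |(z : ℝ)| := by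
  have h : ∀ n : ℕ, v (n : K) ≤ n := by
    intro n
    induction n with
    | zero => simp
    | succ n ih =>
      push_cast
      refine (v.add_le _ _).trans ?_
      rw [v.map_one]
      linarith
  obtain ⟨n, rfl | rfl⟩ := z.eq_nat_or_neg
  · simpa using h n
  · rw [Int.cast_neg, v.map_neg, Int.cast_neg, abs_neg]
    simpa using h n

lemma abv_sum_le {α : Type*} (v : AbsoluteValue K ℝ) (s : Finset α) (f : α → K) :
    v (∑ i ∈ s, f i) ≤ ∑ i ∈ s, v (f i) := by
  classical
  induction s using Finset.induction_on with
  | empty => simp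
  | insert a s ha ih =>
    rw [Finset.sum_insert ha, Finset.sum_insert ha]
    exact (v.add_le _ _).trans (by linarith)

variable {κ : Type*} [Fintype κ] [DecidableEq κ]

lemma abv_det_le (v : AbsoluteValue K ℝ) (M : Matrix κ κ K) (ρ γ : κ → ℝ)
    (h : ∀ i j, v (M i j) ≤ ρ i * γ j) :
    v M.det ≤ (Fintype.card κ).factorial * ((∏ i, ρ i) * ∏ j, γ j) := by
  rw [Matrix.det_apply]
  refine (abv_sum_le v _ _).trans ?_
  rw [← Fintype.card_perm, ← nsmul_eq_mul, ← Finset.card_univ, ← Finset.sum_const]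
  refine Finset.sum_le_sum fun σ _ => ?_
  have h1 : v (Equiv.Perm.sign σ • ∏ i, M (σ i) i) = v (∏ i, M (σ i) i) := by
    rcases Int.units_eq_one_or (Equiv.Perm.sign σ) with h | h
    · rw [h, one_smul]
    · rw [h, Units.neg_smul, one_smul, v.map_neg]
  rw [h1, map_prod]
  calc _ ≤ ∏ i, (ρ (σ i) * γ i) := Finset.prod_le_prod (fun _ _ => v.nonneg _) fun i _ => h _ _
    _ = _ := by rw [Finset.prod_mul_distrib, Equiv.prod_comp σ ρ]

/-- An integral matrix acting on vectors over `K`. -/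
def ev (L : Matrix κ κ ℤ) : (κ → K) →ₗ[K] (κ → K) := (L.map (Int.cast : ℤ → K)).mulVecLin

omit [DecidableEq κ] in
lemma ev_apply (L : Matrix κ κ ℤ) (x : κ → K) (i : κ) : ev L x i = ∑ j, (L i j : K) * x j := rfl

lemma ev_ev {L L' : Matrix κ κ ℤ} (h : L' * L = 1) (x : κ → K) : ev L' (ev L x) = x := by
  have h1 : (L'.map (Int.cast : ℤ → K)) * (L.map (Int.cast : ℤ → K)) = 1 := by
    have := Matrix.map_mul (L := L') (M := L) (f := Int.castRingHom K)
    rw [h] at this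
    simpa using this.symm
  change (L'.map _).mulVec ((L.map _).mulVec x) = x
  rw [Matrix.mulVec_mulVec, h1, Matrix.one_mulVec]

omit [DecidableEq κ] in
lemma ev_mem (O : Subring K) (L : Matrix κ κ ℤ) {x : κ → K} (hx : ∀ i, x i ∈ O) (i : κ) :
    ev L x i ∈ O := by
  rw [ev_apply]
  exact O.sum_mem fun j _ => O.mul_mem (intCast_mem O _) (hx j)

omit [DecidableEq κ] in
lemma abv_ev_le (v : AbsoluteValue K ℝ) (L : Matrix κ κ ℤ) {x : κ → K} {B : ℝ} (hB : 0 ≤ B)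
    (hx : ∀ i, v (x i) ≤ B) (i : κ) : v (ev L x i) ≤ matSize L * B := by
  rw [ev_apply]
  refine (abv_sum_le v _ _).trans ?_
  have h1 : ∑ j, |(L i j : ℝ)| ≤ matSize L := by
    have := Finset.single_le_sum (f := fun i => ∑ j, |(L i j : ℝ)|)
      (fun _ _ => Finset.sum_nonneg fun _ _ => abs_nonneg _) (Finset.mem_univ i)
    rw [matSize]
    linarith
  refine le_trans ?_ (mul_le_mul_of_nonneg_right h1 hB)
  rw [Finset.sum_mul]
  refine Finset.sum_le_sum fun j _ => ?_
  rw [v.map_mul]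
  exact mul_le_mul (abv_intCast_le v _) (hx j) (v.nonneg _) (abs_nonneg _)

/-- The determinant of an integrally invertible matrix has absolute value one. -/
lemma abv_det_intCast (v : AbsoluteValue K ℝ) {L L' : Matrix κ κ ℤ} (h : L' * L = 1) :
    v (L.map (Int.cast : ℤ → K)).det = 1 := by
  have h1 : (L.map (Int.cast : ℤ → K)).det = ((L.det : ℤ) : K) :=
    ((Int.castRingHom K).map_det L).symm
  have h2 : IsUnit L.det := by
    have := congrArg Matrix.det h
    rw [Matrix.det_mul, Matrix.det_one] at this
    exact IsUnit.of_mul_eq_one _ ((mul_comm _ _).trans this)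
  rw [h1]
  rcases Int.isUnit_iff.1 h2 with h | h
  · rw [h]; simp
  · rw [h]; simp

variable {ι : Type*} [Fintype ι] (S : SData K ι)

/-- Small elements of `O` vanish. -/
lemma SData.eq_zero_of_lt {x : K} (hx : x ∈ S.O) (B : ι → ℝ) (h : ∀ s, S.v s x ≤ B s)
    (hB : ∏ s, B s ^ S.n s < 1) : x = 0 := by
  by_contra h0
  have := S.one_le x hx h0
  refine absurd (this.trans ?_) (not_le.2 hB)
  exact Finset.prod_le_prod (fun s _ => pow_nonneg ((S.v s).nonneg _) _) fun s _ =>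
    pow_le_pow_left₀ ((S.v s).nonneg _) (h s) _

/-- Lower bound for one absolute value of an element of bounded size. -/
lemma SData.lower_bound {x : K} (hx : x ∈ S.O) (hx0 : x ≠ 0) {B : ℝ} (hB : 1 ≤ B)
    (h : ∀ s, S.v s x ≤ B) (s : ι) : (B ^ (∑ s, S.n s))⁻¹ ≤ S.v s x := by
  classical
  have h1 := S.one_le x hx hx0
  have hv : 0 < S.v s x := (S.v s).pos hx0
  have hB0 : 0 < B := by linarith
  rw [← Finset.mul_prod_erase _ _ (Finset.mem_univ s)] at h1
  have h2 : ∏ t ∈ Finset.univ.erase s, S.v t x ^ S.n t ≤ B ^ (∑ s, S.n s) := by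
    calc _ ≤ ∏ t ∈ Finset.univ.erase s, B ^ S.n t :=
          Finset.prod_le_prod (fun t _ => pow_nonneg ((S.v t).nonneg _) _) fun t _ =>
            pow_le_pow_left₀ ((S.v t).nonneg _) (h t) _
      _ = B ^ (∑ t ∈ Finset.univ.erase s, S.n t) := Finset.prod_pow_eq_pow_sum _ _ _
      _ ≤ _ := pow_le_pow_right₀ hB (Finset.sum_le_sum_of_subset (Finset.erase_subset _ _))
  have hBn : 1 ≤ B ^ (∑ s, S.n s) := one_le_pow₀ hB
  rw [inv_le_iff_one_le_mul₀ (by positivity)]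
  rcases le_or_gt 1 (S.v s x) with h3 | h3
  · nlinarith
  · have h4 : S.v s x ^ S.n s ≤ S.v s x :=
      pow_le_of_le_one hv.le h3.le (S.n_pos s).ne'
    have h5 : S.v s x ^ S.n s * ∏ t ∈ Finset.univ.erase s, S.v t x ^ S.n t ≤
        S.v s x * B ^ (∑ s, S.n s) :=
      mul_le_mul h4 h2 (Finset.prod_nonneg fun t _ => pow_nonneg ((S.v t).nonneg _) _) hv.le
    linarith

end Basic
end SUnit

namespace SUnit
variable {K : Type*} [Field K] {κ lam : Type*} [Fintype κ] [DecidableEq κ] [Fintype lam]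

omit [DecidableEq κ] in
lemma option_equiv_of_card (hcard : Fintype.card lam + 1 = Fintype.card κ) :
    Nonempty (κ ≃ Option lam) := by
  classical
  refine ⟨Fintype.equivOfCardEq ?_⟩
  rw [Fintype.card_option, hcard]

/-- The determinant against `card κ - 1` given independent vectors. -/
lemma exists_det_functional (O : Subring K) (hcard : Fintype.card lam + 1 = Fintype.card κ)
    {g : lam → κ → K} (hg : LinearIndependent K g) (hO : ∀ l i, g l i ∈ O) :
    ∃ D : (κ → K) →ₗ[K] K, D ≠ 0 ∧ (∀ l, D (g l) = 0) ∧ (∀ x, (∀ i, x i ∈ O) → D x ∈ O) ∧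
      ∀ (v : AbsoluteValue K ℝ) (L L' : Matrix κ κ ℤ), L' * L = 1 → ∀ (x : κ → K) (a : ℝ)
        (b : κ → ℝ), (∀ i, v (ev L x i) ≤ a * b i) → (∀ l i, v (ev L (g l) i) ≤ b i) →
        v (D x) ≤ (Fintype.card κ).factorial * (a * ∏ i, b i) := by
  classical
  obtain ⟨e⟩ := option_equiv_of_card hcard
  set M : (κ → K) → Matrix κ κ K := fun y a => (e a).elim y g with hM
  have hupd : ∀ y, Function.update (M 0) (e.symm none) y = M y := by
    intro y
    funext a
    by_cases ha : a = e.symm none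
    · subst ha; simp [hM]
    · rw [Function.update_of_ne ha]
      have : e a ≠ none := fun h => ha (by rw [← h, e.symm_apply_apply])
      obtain ⟨l, hl⟩ := Option.ne_none_iff_exists'.1 this
      simp [hM, hl]
  set D : (κ → K) →ₗ[K] K :=
    (Matrix.detRowAlternating (R := K) (n := κ)).toMultilinearMap.toLinearMap (M 0) (e.symm none)
    with hD
  have hDe : ∀ y, D y = (M y).det := by
    intro y
    rw [← hupd y]
    rfl
  refine ⟨D, ?_, ?_, ?_, ?_⟩
  · have hlt : Submodule.span K (Set.range g) ≠ ⊤ := by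
      intro htop
      have h1 := finrank_span_eq_card hg
      rw [htop, finrank_top, Module.finrank_fintype_fun_eq_card] at h1
      omega
    obtain ⟨y, -, hy⟩ := SetLike.exists_of_lt (lt_top_iff_ne_top.2 hlt)
    have h2 : LinearIndependent K (fun o : Option lam => o.elim y g) := by
      rw [linearIndependent_option]
      exact ⟨hg, hy⟩
    have h3 : LinearIndependent K (M y) := h2.comp e e.injective
    have h4 : IsUnit (M y) := Matrix.linearIndependent_rows_iff_isUnit.1 h3
    intro h0
    have h5 := ((Matrix.isUnit_iff_isUnit_det _).1 h4).ne_zero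
    rw [← hDe, h0] at h5
    exact h5 rfl
  · intro l
    rw [hDe]
    refine Matrix.det_zero_of_row_eq (i := e.symm none) (j := e.symm (some l)) (by simp) ?_
    funext i
    simp [hM]
  · intro x hx
    rw [hDe, Matrix.det_apply]
    refine O.sum_mem fun σ _ => ?_
    have : ∏ i, M x (σ i) i ∈ O := O.prod_mem fun i _ => by
      rcases h : e (σ i) with _ | l
      · simpa [hM, h] using hx i
      · simpa [hM, h] using hO l i
    rcases Int.units_eq_one_or (Equiv.Perm.sign σ) with h | h
    · rwa [h, one_smul]
    · rw [h, Units.neg_smul, one_smul]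
      exact O.neg_mem this
  · intro v L L' hL x a b hx hgb
    have h1 : v (D x) = v (M x * (L.map (Int.cast : ℤ → K)).transpose).det := by
      rw [Matrix.det_mul, v.map_mul, Matrix.det_transpose, abv_det_intCast v hL, mul_one, hDe]
    rw [h1]
    have h2 := abv_det_le v (M x * (L.map (Int.cast : ℤ → K)).transpose)
      (fun r => (e r).elim a fun _ => 1) b ?_
    · refine h2.trans_eq ?_
      rw [← Equiv.prod_comp e.symm]
      simp [Fintype.prod_option]
    · intro r i
      have h3 : (M x * (L.map (Int.cast : ℤ → K)).transpose) r i = ev L (M x r) i := by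
        rw [Matrix.mul_apply, ev_apply]
        refine Finset.sum_congr rfl fun j _ => ?_
        rw [Matrix.transpose_apply, Matrix.map_apply, mul_comm]
      rw [h3]
      rcases h : e r with _ | l
      · simpa [hM, h] using hx i
      · simpa [hM, h] using hgb l i

omit [DecidableEq κ] in
lemma span_eq_ker (hcard : Fintype.card lam + 1 = Fintype.card κ)
    {g : lam → κ → K} (hg : LinearIndependent K g) {l : (κ → K) →ₗ[K] K} (hl : l ≠ 0)
    (h : ∀ t, l (g t) = 0) : Submodule.span K (Set.range g) = LinearMap.ker l := by
  refine Submodule.eq_of_le_of_finrank_eq ?_ ?_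
  · rw [Submodule.span_le]
    rintro _ ⟨t, rfl⟩
    exact h t
  · rw [finrank_span_eq_card hg]
    have := Module.Dual.finrank_ker_add_one_of_ne_zero (f := l) hl
    rw [Module.finrank_fintype_fun_eq_card] at this
    omega

omit [DecidableEq κ] in
lemma functional_cross (hcard : Fintype.card lam + 1 = Fintype.card κ)
    {g : lam → κ → K} (hg : LinearIndependent K g) {l D : (κ → K) →ₗ[K] K} (hl : l ≠ 0)
    (h : ∀ t, l (g t) = 0) (hD : ∀ t, D (g t) = 0) (x y : κ → K) : l y * D x = l x * D y := by
  have h1 : l y • x - l x • y ∈ LinearMap.ker l := by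
    rw [LinearMap.mem_ker, map_sub, map_smul, map_smul, smul_eq_mul, smul_eq_mul, mul_comm, sub_self]
  rw [← span_eq_ker hcard hg hl h] at h1
  have h2 : Submodule.span K (Set.range g) ≤ LinearMap.ker D := by
    rw [Submodule.span_le]
    rintro _ ⟨t, rfl⟩
    exact hD t
  have h3 := h2 h1
  rw [LinearMap.mem_ker, map_sub, map_smul, map_smul, smul_eq_mul, smul_eq_mul] at h3
  exact sub_eq_zero.1 h3

lemma functional_apply_ev {L L' : Matrix κ κ ℤ} (h : L' * L = 1) (l : (κ → K) →ₗ[K] K) (y : κ → K) :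
    l y = ∑ i, ev L y i * l (ev L' (Pi.single i 1)) := by
  conv_lhs => rw [← ev_ev h y]
  have := LinearMap.pi_apply_eq_sum_univ (l ∘ₗ ev L') (ev L y)
  simp only [LinearMap.comp_apply, smul_eq_mul] at this
  rw [this]
  refine Finset.sum_congr rfl fun i _ => ?_
  congr 3
  funext j
  simp [Pi.single_apply, eq_comm]

lemma exists_coord_ne_zero {L L' : Matrix κ κ ℤ} (h : L' * L = 1) {l : (κ → K) →ₗ[K] K}
    (hl : l ≠ 0) : ∃ i, l (ev L' (Pi.single i 1)) ≠ 0 := by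
  by_contra! h0
  refine hl (LinearMap.ext fun y => ?_)
  rw [functional_apply_ev h l y]
  simp [h0]

lemma functional_mem (O : Subring K) {l : (κ → K) →ₗ[K] K}
    (hl : ∀ i, l (Pi.single i 1) ∈ O) (x : κ → K) (hx : ∀ i, x i ∈ O) : l x ∈ O := by
  have := LinearMap.pi_apply_eq_sum_univ l x
  rw [this]
  refine O.sum_mem fun i _ => O.mul_mem (hx i) ?_
  convert hl i using 2
  funext j
  simp [Pi.single_apply, eq_comm]

lemma abv_functional_single_le (v : AbsoluteValue K ℝ) (L : Matrix κ κ ℤ) {l : (κ → K) →ₗ[K] K}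
    {B : ℝ} (hB : 0 ≤ B) (hl : ∀ i, v (l (Pi.single i 1)) ≤ B) (i : κ) :
    v (l (ev L (Pi.single i 1))) ≤ matSize L * B := by
  rw [LinearMap.pi_apply_eq_sum_univ l]
  refine (abv_sum_le v _ _).trans ?_
  have h1 : ∑ j, |(L j i : ℝ)| ≤ matSize L := by
    have : ∑ j, |(L j i : ℝ)| ≤ ∑ j, ∑ i, |(L j i : ℝ)| := Finset.sum_le_sum fun j _ =>
      Finset.single_le_sum (f := fun i => |(L j i : ℝ)|) (fun _ _ => abs_nonneg _)
        (Finset.mem_univ i)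
    rw [matSize]
    linarith
  refine le_trans ?_ (mul_le_mul_of_nonneg_right h1 hB)
  rw [Finset.sum_mul]
  refine Finset.sum_le_sum fun j _ => ?_
  rw [smul_eq_mul, v.map_mul]
  refine mul_le_mul ?_ ?_ (v.nonneg _) (abs_nonneg _)
  · have : ev L (Pi.single i 1) j = ((L j i : ℤ) : K) := by
      rw [ev_apply]; simp [Pi.single_apply]
    rw [this]
    exact abv_intCast_le v _
  · have : (fun t => if j = t then (1 : K) else 0) = Pi.single j 1 := by
      funext t
      simp [Pi.single_apply, eq_comm]
    rw [this]
    exact hl j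

end SUnit

namespace SUnit
open Filter

lemma exists_infinite_fiber {α β : Type*} [Finite β] {T : Set α} (hT : T.Infinite) (f : α → β) :
    ∃ b, {a | a ∈ T ∧ f a = b}.Infinite := by
  by_contra! h
  refine hT ((Set.finite_iUnion h).subset fun a ha => ?_)
  rw [Set.mem_iUnion]
  exact ⟨f a, ha, rfl⟩

lemma infinite_and_eventually {T : Set ℕ} (hT : T.Infinite) {p : ℕ → Prop}
    (hp : ∀ᶠ j in atTop, p j) : {j | j ∈ T ∧ p j}.Infinite :=
  Nat.frequently_atTop_iff_infinite.1
    ((Nat.frequently_atTop_iff_infinite.2 hT).and_eventually hp)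

lemma prod_mul_exp_pow {ι : Type*} [Fintype ι] (n : ι → ℕ) (C : ℝ) (b : ι → ℝ) :
    ∏ s, (C * Real.exp (b s)) ^ n s = C ^ (∑ s, n s) * Real.exp (∑ s, n s * b s) := by
  rw [Real.exp_sum, ← Finset.prod_pow_eq_pow_sum, ← Finset.prod_mul_distrib]
  refine Finset.prod_congr rfl fun s _ => ?_
  rw [mul_pow, ← Real.exp_nat_mul]

variable {K : Type*} [Field K] {κ lam : Type*} [Fintype κ] [DecidableEq κ] [Fintype lam]
  {ι : Type*} [Fintype ι] (S : SData K ι)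

lemma exists_common_span (hcard : Fintype.card lam + 1 = Fintype.card κ)
    (L L' : ι → Matrix κ κ ℤ) (hL : ∀ s, L' s * L s = 1) (c : ι → κ → ℝ) {ε δ : ℝ} (hε : 0 < ε)
    (hδ : (∑ s, (S.n s : ℝ)) * ((∑ s, (S.n s : ℝ)) + 1) * ε < δ)
    (hc : ∑ s, (S.n s : ℝ) * ∑ i, c s i ≤ -δ)
    (q : ℕ → ℝ) (hq : Tendsto q atTop atTop) (g : ℕ → lam → κ → K)
    (hg : ∀ j, LinearIndependent K (g j)) (hO : ∀ j t i, g j t i ∈ S.O)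
    (hv : ∀ j t s i, S.v s (ev (L s) (g j t) i) ≤ Real.exp (c s i * q j))
    {T : Set ℕ} (hT : T.Infinite) (l : ℕ → (κ → K) →ₗ[K] K)
    (hl : ∀ j ∈ T, l j ≠ 0) (hlg : ∀ j ∈ T, ∀ t, l j (g j t) = 0)
    (hlO : ∀ j ∈ T, ∀ i, l j (Pi.single i 1) ∈ S.O)
    (hlv : ∀ j ∈ T, ∀ s i, S.v s (l j (Pi.single i 1)) ≤ Real.exp (ε * q j)) :
    ∃ H : Submodule K (κ → K), {j | Submodule.span K (Set.range (g j)) = H}.Infinite := by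
  classical
  set n : ℕ := ∑ s, S.n s with hn
  have hn' : (∑ s, (S.n s : ℝ)) = (n : ℝ) := by rw [hn]; push_cast; rfl
  rw [hn'] at hδ
  have hL2 : ∀ s, L s * L' s = 1 := fun s => mul_eq_one_comm.1 (hL s)
  have hmemL' : ∀ s i a, ev (L' s) (Pi.single i (1 : K)) a ∈ S.O := fun s i a => by
    refine ev_mem S.O _ (fun b => ?_) a
    rw [Pi.single_apply]
    split_ifs
    · exact S.O.one_mem
    · exact S.O.zero_mem
  obtain ⟨I, hI⟩ := exists_infinite_fiber hT fun j (s : ι) =>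
    Finset.univ.filter fun i => l j (ev (L' s) (Pi.single i 1)) ≠ 0
  set T' := {a | a ∈ T ∧ (fun (s : ι) =>
    Finset.univ.filter fun i => l a (ev (L' s) (Pi.single i 1)) ≠ 0) = I} with hT'
  have hmemI : ∀ j ∈ T', ∀ s i, i ∈ I s ↔ l j (ev (L' s) (Pi.single i 1)) ≠ 0 := by
    intro j hj s i
    rw [← hj.2]
    simp
  obtain ⟨j0, hj0⟩ := hI.nonempty
  have hIne : ∀ s, (I s).Nonempty := fun s => by
    obtain ⟨i, hi⟩ := exists_coord_ne_zero (hL s) (hl j0 hj0.1)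
    exact ⟨i, (hmemI j0 hj0 s i).2 hi⟩
  choose i0 hi0 hmax using fun s => Finset.exists_max_image (I s) (c s) (hIne s)
  have hqlarge : ∀ X : ℝ, {j | j ∈ T' ∧ X ≤ q j}.Infinite := fun X =>
    infinite_and_eventually hI (hq.eventually_ge_atTop X)
  have hmx : ∑ s, (S.n s : ℝ) * c s (i0 s) < 0 := by
    by_contra! hmx
    set C : ℝ := 1 + ∑ s, matSize (L' s) with hC
    have hCs : ∀ s, matSize (L' s) ≤ C := fun s => by
      have := Finset.single_le_sum (f := fun s => matSize (L' s))
        (fun s _ => zero_le_one.trans (one_le_matSize (L' s))) (Finset.mem_univ s)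
      rw [hC]; linarith
    have hC1 : 1 ≤ C := by
      have := Finset.sum_nonneg (f := fun s => matSize (L' s)) (s := Finset.univ)
        (fun s _ => zero_le_one.trans (one_le_matSize (L' s)))
      rw [hC]; linarith
    set N : ℝ := ((Fintype.card κ).factorial : ℝ) with hN
    have hN1 : 1 ≤ N := by
      rw [hN]; exact_mod_cast Nat.succ_le_of_lt (Nat.factorial_pos _)
    set η : ℝ := δ - n * (n + 1) * ε with hη
    have hη0 : 0 < η := by rw [hη]; linarith
    obtain ⟨j, hj, hqj⟩ := (hqlarge (max 0 (Real.log ((N * C ^ n) ^ n) / η + 1))).nonempty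
    have hq0 : 0 ≤ q j := (le_max_left _ _).trans hqj
    have hq1 : Real.log ((N * C ^ n) ^ n) < η * q j := by
      have : Real.log ((N * C ^ n) ^ n) / η < q j := by
        have := (le_max_right _ _).trans hqj
        linarith
      rwa [div_lt_iff₀ hη0, mul_comm (q j)] at this
    obtain ⟨D, hD0, hDg, hDO, hDv⟩ := exists_det_functional S.O hcard (hg j) (hO j)
    obtain ⟨e, he⟩ : ∃ e, D (Pi.single e 1) ≠ 0 := by
      obtain ⟨e, he⟩ := exists_coord_ne_zero (L := (1 : Matrix κ κ ℤ)) (L' := 1) (by simp) hD0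
      refine ⟨e, ?_⟩
      have h1 : ev (1 : Matrix κ κ ℤ) (Pi.single e (1 : K)) = Pi.single e 1 := by
        have := ev_ev (L := (1 : Matrix κ κ ℤ)) (L' := 1) (by simp)
          (ev (1 : Matrix κ κ ℤ) (Pi.single e (1 : K)))
        funext a
        rw [ev_apply]
        simp [Matrix.one_apply]
      rwa [h1] at he
    have hDe : D (Pi.single e 1) ∈ S.O := hDO _ fun i => by
      rw [Pi.single_apply]
      split_ifs
      · exact S.O.one_mem
      · exact S.O.zero_mem
    have hbound : ∀ s, S.v s (D (Pi.single e 1)) ≤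
        (N * C ^ n) * Real.exp (((∑ i, c s i) - c s (i0 s) + (n + 1) * ε) * q j) := by
      intro s
      set x := ev (L' s) (Pi.single (i0 s) (1 : K)) with hx
      have hα : l j x ≠ 0 := (hmemI j hj s _).1 (hi0 s)
      have hcross := functional_cross hcard (hg j) (hl j hj.1) (hlg j hj.1) hDg x (Pi.single e 1)
      have hB : 1 ≤ C * Real.exp (ε * q j) := by
        have : 1 ≤ Real.exp (ε * q j) := Real.one_le_exp (by positivity)
        nlinarith
      have hαlow : ((C * Real.exp (ε * q j)) ^ n)⁻¹ ≤ S.v s (l j x) := by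
        refine S.lower_bound ?_ hα hB (fun s' => ?_) s
        · exact functional_mem S.O (hlO j hj.1) _ (hmemL' s _)
        · refine (abv_functional_single_le _ _ (Real.exp_pos _).le
            (fun i => hlv j hj.1 s' i) _).trans ?_
          exact mul_le_mul_of_nonneg_right (hCs s) (Real.exp_pos _).le
      have hDx : S.v s (D x) ≤ N * (Real.exp (-c s (i0 s) * q j) * ∏ i, Real.exp (c s i * q j)) := by
        refine hDv (S.v s) (L s) (L' s) (hL s) x _ _ (fun i => ?_) fun t i => hv j t s i
        rw [hx, ev_ev (hL2 s), Pi.single_apply]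
        split_ifs with h
        · rw [h, ← Real.exp_add, (S.v s).map_one]
          simp
        · rw [(S.v s).map_zero]; positivity
      have h1 : S.v s (l j x) * S.v s (D (Pi.single e 1)) ≤ Real.exp (ε * q j) *
          (N * (Real.exp (-c s (i0 s) * q j) * ∏ i, Real.exp (c s i * q j))) := by
        rw [← (S.v s).map_mul, ← hcross, (S.v s).map_mul]
        exact mul_le_mul (hlv j hj.1 s e) hDx ((S.v s).nonneg _) (Real.exp_pos _).le
      have hP : 0 < (C * Real.exp (ε * q j)) ^ n := by positivity
      have h2 : S.v s (D (Pi.single e 1)) ≤ (C * Real.exp (ε * q j)) ^ n * (Real.exp (ε * q j) *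
          (N * (Real.exp (-c s (i0 s) * q j) * ∏ i, Real.exp (c s i * q j)))) := by
        rw [← inv_mul_le_iff₀ hP]
        exact (mul_le_mul_of_nonneg_right hαlow ((S.v s).nonneg _)).trans h1
      refine h2.trans_eq ?_
      rw [← Real.exp_sum, mul_pow, ← Real.exp_nat_mul]
      have : Real.exp (((∑ i, c s i) - c s (i0 s) + (n + 1) * ε) * q j) =
          Real.exp (n * (ε * q j)) * (Real.exp (ε * q j) *
            (Real.exp (-c s (i0 s) * q j) * Real.exp (∑ i, c s i * q j))) := by
        rw [← Real.exp_add, ← Real.exp_add, ← Real.exp_add, ← Finset.sum_mul]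
        congr 1
        ring
      rw [this]
      ring
    refine he (S.eq_zero_of_lt hDe _ hbound ?_)
    rw [prod_mul_exp_pow]
    have h3 : ∑ s, (S.n s : ℝ) * (((∑ i, c s i) - c s (i0 s) + (n + 1) * ε) * q j) ≤ -η * q j := by
      have : ∑ s, (S.n s : ℝ) * (((∑ i, c s i) - c s (i0 s) + (n + 1) * ε) * q j) =
          ((∑ s, (S.n s : ℝ) * ∑ i, c s i) - (∑ s, (S.n s : ℝ) * c s (i0 s)) +
            (∑ s, (S.n s : ℝ)) * ((n + 1) * ε)) * q j := by
        rw [Finset.sum_mul Finset.univ (fun s => (S.n s : ℝ)), ← Finset.sum_sub_distrib,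
          ← Finset.sum_add_distrib, Finset.sum_mul]
        exact Finset.sum_congr rfl fun s _ => by ring
      rw [this, hn']
      refine mul_le_mul_of_nonneg_right ?_ hq0
      rw [hη]
      linarith
    have h4 : (N * C ^ n) ^ n = Real.exp (Real.log ((N * C ^ n) ^ n)) :=
      (Real.exp_log (by positivity)).symm
    rw [← hn, h4, ← Real.exp_add, Real.exp_lt_one_iff]
    linarith
  obtain ⟨B, hB1, hB⟩ : ∃ B : ℝ, 1 ≤ B ∧ ∀ s i,
      S.v s (l j0 (ev (L' s) (Pi.single i 1))) ≤ B := by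
    refine ⟨1 + ∑ s, ∑ i, S.v s (l j0 (ev (L' s) (Pi.single i 1))), ?_, fun s i => ?_⟩
    · have : 0 ≤ ∑ s, ∑ i, S.v s (l j0 (ev (L' s) (Pi.single i 1))) :=
        Finset.sum_nonneg fun s _ => Finset.sum_nonneg fun i _ => (S.v s).nonneg _
      linarith
    · have h1 := Finset.single_le_sum
        (f := fun s => ∑ i, S.v s (l j0 (ev (L' s) (Pi.single i 1))))
        (fun s _ => Finset.sum_nonneg fun i _ => (S.v s).nonneg _) (Finset.mem_univ s)
      have h2 := Finset.single_le_sum (f := fun i => S.v s (l j0 (ev (L' s) (Pi.single i 1))))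
        (fun i _ => (S.v s).nonneg _) (Finset.mem_univ i)
      linarith
  set E : ℝ := (Fintype.card κ + 1) * B with hE
  have hE0 : 0 < E := by positivity
  set mx : ℝ := ∑ s, (S.n s : ℝ) * c s (i0 s) with hmxdef
  refine ⟨LinearMap.ker (l j0), (hqlarge (max 0 (Real.log (E ^ n) / -mx + 1))).mono ?_⟩
  rintro j ⟨hj, hqj⟩
  have hq0 : 0 ≤ q j := (le_max_left _ _).trans hqj
  have hq1 : Real.log (E ^ n) < -mx * q j := by
    have : Real.log (E ^ n) / -mx < q j := by
      have := (le_max_right _ _).trans hqj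
      linarith
    rwa [div_lt_iff₀ (by linarith), mul_comm (q j)] at this
  refine span_eq_ker hcard (hg j) (hl j0 hj0.1) fun t => ?_
  refine S.eq_zero_of_lt (functional_mem S.O (hlO j0 hj0.1) _ (hO j t))
    (fun s => E * Real.exp (c s (i0 s) * q j)) (fun s => ?_) ?_
  · rw [functional_apply_ev (hL s)]
    refine (abv_sum_le _ _ _).trans ?_
    have : ∀ i ∈ Finset.univ, S.v s (ev (L s) (g j t) i * l j0 (ev (L' s) (Pi.single i 1))) ≤
        B * Real.exp (c s (i0 s) * q j) := by
      intro i _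
      by_cases hi : i ∈ I s
      · rw [(S.v s).map_mul, mul_comm]
        refine mul_le_mul (hB s i) ((hv j t s i).trans ?_) ((S.v s).nonneg _) (by linarith)
        exact Real.exp_le_exp.2 (mul_le_mul_of_nonneg_right (hmax s i hi) hq0)
      · have := (hmemI j0 hj0 s i).not.1 hi
        rw [not_not.1 this, mul_zero, (S.v s).map_zero]
        positivity
    refine (Finset.sum_le_sum this).trans ?_
    rw [Finset.sum_const, Finset.card_univ, nsmul_eq_mul, ← mul_assoc]
    refine mul_le_mul_of_nonneg_right ?_ (Real.exp_pos _).le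
    rw [hE]
    nlinarith
  · rw [prod_mul_exp_pow, ← hn]
    have h4 : E ^ n = Real.exp (Real.log (E ^ n)) := (Real.exp_log (by positivity)).symm
    have h5 : ∑ s, (S.n s : ℝ) * (c s (i0 s) * q j) = mx * q j := by
      rw [hmxdef, Finset.sum_mul]
      exact Finset.sum_congr rfl fun s _ => by ring
    rw [h4, h5, ← Real.exp_add, Real.exp_lt_one_iff]
    linarith

end SUnit

namespace SUnit
open MvPolynomial

section Height
variable {K : Type*} [Field K] {ι : Type*} [Fintype ι] (S : SData K ι)

lemma exists_height_of_sData [NumberField K] (ξ : K) : ∃ η : ℝ, 0 ≤ η ∧ HtLower ξ η ∧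
    ∃ a : K, a ≠ 0 ∧ a ∈ S.O ∧ a * ξ ∈ S.O ∧
      ∀ s, S.v s a ≤ Real.exp η ∧ S.v s (a * ξ) ≤ Real.exp η := by
  obtain ⟨η, hη, hH, a, ha, hintg, habs, hφ⟩ := exists_height ξ
  have h1 : (1 : ℝ) ≤ Real.exp η := Real.one_le_exp hη
  refine ⟨η, hη, hH, a, by exact_mod_cast ha, intCast_mem S.O a, S.integral_mem _ hintg,
    fun s => ?_⟩
  rcases S.arch_or s with ⟨φ, h⟩ | h
  · refine ⟨?_, (h _).trans_le (hφ φ)⟩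
    exact (abv_intCast_le _ _).trans habs
  · exact ⟨(h _ isIntegral_algebraMap).trans h1, (h _ hintg).trans h1⟩

variable {κ : Type*} [Fintype κ] [DecidableEq κ]

/-- The linear form `x i₀ - ∑_{i ≠ i₀} ξ i * x i`. -/
def affForm (i0 : κ) (ξ : κ → K) : (κ → K) →ₗ[K] K :=
  LinearMap.proj i0 - ∑ i ∈ Finset.univ.erase i0, ξ i • (LinearMap.proj i : (κ → K) →ₗ[K] K)

lemma affForm_apply (i0 : κ) (ξ x : κ → K) :
    affForm i0 ξ x = x i0 - ∑ i ∈ Finset.univ.erase i0, ξ i * x i := by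
  simp only [affForm, LinearMap.sub_apply, LinearMap.sum_apply, LinearMap.smul_apply,
    LinearMap.proj_apply, smul_eq_mul]

lemma affForm_single_self (i0 : κ) (ξ : κ → K) : affForm i0 ξ (Pi.single i0 1) = 1 := by
  rw [affForm_apply, Pi.single_eq_same, Finset.sum_eq_zero, sub_zero]
  intro i hi
  rw [Pi.single_eq_of_ne (Finset.ne_of_mem_erase hi), mul_zero]

lemma affForm_single_of_ne {i0 i : κ} (h : i ≠ i0) (ξ : κ → K) :
    affForm i0 ξ (Pi.single i 1) = -ξ i := by
  rw [affForm_apply, Pi.single_eq_of_ne h.symm, Finset.sum_eq_single i, Pi.single_eq_same, zero_sub,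
    mul_one]
  · intro b _ hb
    rw [Pi.single_eq_of_ne hb, mul_zero]
  · intro hmem
    exact absurd (Finset.mem_erase.2 ⟨h, Finset.mem_univ _⟩) hmem

/-- Every nonzero form is proportional to a normalised one. -/
lemma exists_affForm {l : (κ → K) →ₗ[K] K} (hl : l ≠ 0) :
    ∃ i0 ξ, LinearMap.ker (affForm i0 ξ) = LinearMap.ker l := by
  obtain ⟨i0, hi0⟩ : ∃ i, l (Pi.single i 1) ≠ 0 := by
    by_contra! h
    exact hl (LinearMap.pi_ext' fun i => by ext; simpa using h i)
  refine ⟨i0, fun i => -(l (Pi.single i 1) / l (Pi.single i0 1)), ?_⟩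
  have : l = (l (Pi.single i0 1)) •
      affForm i0 fun i => -(l (Pi.single i 1) / l (Pi.single i0 1)) := by
    refine LinearMap.pi_ext' fun i => ?_
    ext
    by_cases h : i = i0
    · subst h
      simp [affForm_single_self]
    · simp [affForm_single_of_ne h, mul_div_cancel₀ _ hi0]
  conv_rhs => rw [this]
  rw [LinearMap.ker_smul _ _ hi0]

/-- Clearing denominators in a normalised form with coefficients of small height. -/
lemma exists_small_multiple (i0 : κ) (ξ a : κ → K) {E : ℝ} (hE : 1 ≤ E) (ha0 : ∀ i, a i ≠ 0)
    (ha : ∀ i, a i ∈ S.O) (haξ : ∀ i, a i * ξ i ∈ S.O)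
    (hv : ∀ i, i ≠ i0 → ∀ s, S.v s (a i) ≤ E ∧ S.v s (a i * ξ i) ≤ E) :
    ∃ A : K, A ≠ 0 ∧ (∀ i, (A • affForm i0 ξ) (Pi.single i 1) ∈ S.O) ∧
      ∀ s i, S.v s ((A • affForm i0 ξ) (Pi.single i 1)) ≤ E ^ Fintype.card κ := by
  have hprod : ∀ s (t : Finset κ), (∀ i ∈ t, i ≠ i0) → S.v s (∏ i ∈ t, a i) ≤ E ^ t.card := by
    intro s t ht
    rw [map_prod, ← Finset.prod_const]
    exact Finset.prod_le_prod (fun _ _ => (S.v s).nonneg _) fun i hi => (hv i (ht i hi) s).1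
  refine ⟨∏ i ∈ Finset.univ.erase i0, a i, Finset.prod_ne_zero_iff.2 fun i _ => ha0 i, ?_, ?_⟩
  · intro i
    rw [LinearMap.smul_apply, smul_eq_mul]
    by_cases h : i = i0
    · subst h
      rw [affForm_single_self, mul_one]
      exact S.O.prod_mem fun i _ => ha i
    · rw [affForm_single_of_ne h, ← Finset.mul_prod_erase _ _
        (Finset.mem_erase.2 ⟨h, Finset.mem_univ i⟩), mul_neg, mul_right_comm]
      exact S.O.neg_mem (S.O.mul_mem (haξ i) (S.O.prod_mem fun i _ => ha i))
  · intro s i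
    rw [LinearMap.smul_apply, smul_eq_mul]
    by_cases h : i = i0
    · subst h
      rw [affForm_single_self, mul_one]
      refine (hprod s _ fun i hi => Finset.ne_of_mem_erase hi).trans ?_
      exact pow_le_pow_right₀ hE (Finset.card_le_univ _)
    · rw [affForm_single_of_ne h, ← Finset.mul_prod_erase _ _
        (Finset.mem_erase.2 ⟨h, Finset.mem_univ i⟩), mul_neg, mul_right_comm, (S.v s).map_neg,
        (S.v s).map_mul]
      have h1 := hprod s ((Finset.univ.erase i0).erase i) fun j hj =>
        Finset.ne_of_mem_erase (Finset.mem_of_mem_erase hj)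
      refine (mul_le_mul (hv i h s).2 h1 ((S.v s).nonneg _) (by linarith)).trans ?_
      rw [← pow_succ']
      refine pow_le_pow_right₀ hE ?_
      rw [Finset.card_erase_of_mem (Finset.mem_erase.2 ⟨h, Finset.mem_univ i⟩),
        Finset.card_erase_of_mem (Finset.mem_univ i0), Finset.card_univ]
      have : 1 < Fintype.card κ := Fintype.one_lt_card_iff.2 ⟨i, i0, h⟩
      omega

end Height

section Majorant
variable {K : Type*} [Field K] {σ : Type*}

/-- Coefficientwise domination of a polynomial by a real one with respect to an absolute value. -/
def Maj (v : AbsoluteValue K ℝ) (F : MvPolynomial σ K) (G : MvPolynomial σ ℝ) : Prop :=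
  ∀ a, v (coeff a F) ≤ coeff a G

variable {v : AbsoluteValue K ℝ} {F F' : MvPolynomial σ K} {G G' : MvPolynomial σ ℝ}

lemma Maj.nonneg (h : Maj v F G) (a : σ →₀ ℕ) : 0 ≤ coeff a G := (v.nonneg _).trans (h a)

lemma Maj.add (h : Maj v F G) (h' : Maj v F' G') : Maj v (F + F') (G + G') := fun a => by
  rw [coeff_add, coeff_add]
  exact (v.add_le _ _).trans (add_le_add (h a) (h' a))

lemma Maj.mul (h : Maj v F G) (h' : Maj v F' G') : Maj v (F * F') (G * G') := fun a => by
  classical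
  rw [coeff_mul, coeff_mul]
  refine (abv_sum_le v _ _).trans (Finset.sum_le_sum fun x _ => ?_)
  rw [v.map_mul]
  exact mul_le_mul (h _) (h' _) (v.nonneg _) (h.nonneg _)

lemma Maj.C {z : K} {r : ℝ} (h : v z ≤ r) : Maj v (C z : MvPolynomial σ K) (C r) := fun a => by
  classical
  rw [coeff_C, coeff_C]
  split_ifs
  · exact h
  · simp

lemma Maj.X (i : σ) : Maj v (X i : MvPolynomial σ K) (X i) := fun a => by
  classical
  rw [coeff_X, coeff_X]
  split_ifs <;> simp

lemma Maj.one : Maj v (1 : MvPolynomial σ K) 1 := by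
  have := Maj.C (σ := σ) (v := v) (z := 1) (r := 1) (by simp)
  rwa [C_1, C_1] at this

lemma Maj.zero : Maj v (0 : MvPolynomial σ K) 0 := fun a => by simp

lemma Maj.sum {α : Type*} {s : Finset α} {F : α → MvPolynomial σ K} {G : α → MvPolynomial σ ℝ}
    (h : ∀ i ∈ s, Maj v (F i) (G i)) : Maj v (∑ i ∈ s, F i) (∑ i ∈ s, G i) := by
  classical
  induction s using Finset.induction_on with
  | empty => simpa using Maj.zero
  | insert a s ha ih =>
    rw [Finset.sum_insert ha, Finset.sum_insert ha]
    exact (h a (Finset.mem_insert_self _ _)).add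
      (ih fun i hi => h i (Finset.mem_insert_of_mem hi))

lemma Maj.prod {α : Type*} {s : Finset α} {F : α → MvPolynomial σ K} {G : α → MvPolynomial σ ℝ}
    (h : ∀ i ∈ s, Maj v (F i) (G i)) : Maj v (∏ i ∈ s, F i) (∏ i ∈ s, G i) := by
  classical
  induction s using Finset.induction_on with
  | empty => simpa using Maj.one
  | insert a s ha ih =>
    rw [Finset.prod_insert ha, Finset.prod_insert ha]
    exact (h a (Finset.mem_insert_self _ _)).mul
      (ih fun i hi => h i (Finset.mem_insert_of_mem hi))

lemma Maj.pow (h : Maj v F G) (n : ℕ) : Maj v (F ^ n) (G ^ n) := by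
  induction n with
  | zero => simpa using Maj.one
  | succ n ih => rw [pow_succ, pow_succ]; exact ih.mul h

lemma Maj.aeval {τ : Type*} [Fintype τ] {Φ : τ → MvPolynomial σ K} {Ψ : τ → MvPolynomial σ ℝ}
    (h : ∀ i, Maj v (Φ i) (Ψ i)) (p : MvPolynomial τ ℤ) :
    Maj v (MvPolynomial.aeval Φ p)
      (∑ a ∈ p.support, MvPolynomial.C |((coeff a p : ℤ) : ℝ)| * ∏ i, Ψ i ^ a i) := by
  rw [aeval_def, eval₂_eq']
  refine Maj.sum fun a _ => Maj.mul ?_ (Maj.prod fun i _ => (h i).pow _)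
  have : (algebraMap ℤ (MvPolynomial σ K)) (coeff a p) = MvPolynomial.C ((coeff a p : ℤ) : K) := by
    simp
  rw [this]
  exact Maj.C (abv_intCast_le v _)

lemma Maj.le_eval [Fintype σ] (h : Maj v F G) {r : σ → ℝ} (hr : ∀ i, 0 ≤ r i) (a : σ →₀ ℕ) :
    v (coeff a F) * ∏ i, r i ^ a i ≤ eval r G := by
  have hp : ∀ b : σ →₀ ℕ, 0 ≤ ∏ i, r i ^ b i := fun b =>
    Finset.prod_nonneg fun i _ => pow_nonneg (hr i) _
  refine (mul_le_mul_of_nonneg_right (h a) (hp a)).trans ?_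
  rw [eval_eq']
  by_cases ha : a ∈ G.support
  · exact Finset.single_le_sum (f := fun d => coeff d G * ∏ i, r i ^ d i)
      (fun b _ => mul_nonneg (h.nonneg b) (hp b)) ha
  · rw [notMem_support_iff.1 ha, zero_mul]
    exact Finset.sum_nonneg fun b _ => mul_nonneg (h.nonneg b) (hp b)

end Majorant
end SUnit

namespace SUnit
open MvPolynomial

variable {K : Type*} [Field K] {κ lam η : Type*} [Fintype κ] [Fintype lam] [Fintype η]

/-- Generic point of a product of spans, translated by a generic vector. -/
noncomputable def genPt {R : Type*} [CommRing R] (g : η → lam → κ → R) (x : η × κ) :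
    MvPolynomial ((η × lam) ⊕ (η × κ)) R :=
  ∑ t, C (g x.1 t x.2) * X (Sum.inl (x.1, t)) + X (Sum.inr x)

omit [Fintype κ] [Fintype η] in
lemma genPt_coeff_mem (O : Subring K) {g : η → lam → κ → K} (hg : ∀ h t i, g h t i ∈ O)
    (P : MvPolynomial (η × κ) ℤ) (a) : coeff a (aeval (genPt g) P) ∈ O := by
  set g' : η → lam → κ → O := fun h t i => ⟨g h t i, hg h t i⟩
  have h1 : map O.subtype (aeval (genPt g') P) = aeval (genPt g) P := by
    have h2 : ((map O.subtype : MvPolynomial ((η × lam) ⊕ (η × κ)) O →+* _).comp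
        (aeval (genPt g') : MvPolynomial (η × κ) ℤ →ₐ[ℤ] _).toRingHom) =
        (aeval (genPt g) : MvPolynomial (η × κ) ℤ →ₐ[ℤ] _).toRingHom := by
      refine MvPolynomial.ringHom_ext (fun r => by simp) fun i => ?_
      simp [genPt, g']
    exact congrArg (fun f => f P) h2
  rw [← h1, coeff_map]
  exact (coeff a (aeval (genPt g') P)).2

omit [Fintype η] in
lemma genPt_linSubst (g : η → lam → κ → K) (L : Matrix κ κ ℤ) (x : η × κ) :
    aeval (genPt g) (∑ j, C (L x.2 j) * X (x.1, j) : MvPolynomial (η × κ) ℤ) =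
      ∑ t, C (ev L (g x.1 t) x.2) * X (Sum.inl (x.1, t)) +
        ∑ j, C ((L x.2 j : ℤ) : K) * X (Sum.inr (x.1, j)) := by
  simp only [map_sum, map_mul, aeval_X, genPt, ev_apply, Finset.sum_mul, mul_add,
    Finset.sum_add_distrib, Finset.mul_sum]
  congr 1
  · rw [Finset.sum_comm]
    refine Finset.sum_congr rfl fun t _ => Finset.sum_congr rfl fun j _ => ?_
    simp [mul_assoc]
  · refine Finset.sum_congr rfl fun j _ => ?_
    simp

/-- Size estimate at one place for the coefficients of a polynomial at a generic point. -/
lemma genPt_coeff_le (v : AbsoluteValue K ℝ) (L : Matrix κ κ ℤ) (c : κ → ℝ) (y : η → ℝ)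
    (hy : ∀ h, 0 ≤ y h) {C1 C' : ℝ} (hC1 : Fintype.card lam + matSize L ≤ C1)
    (hC' : ∀ i, -C' ≤ c i) (g : η → lam → κ → K)
    (hg : ∀ h t i, v (ev L (g h t) i) ≤ Real.exp (c i * y h))
    (d : η → ℕ) (P q : MvPolynomial (η × κ) ℤ) (hq : linSubst L q = P) (hMH : MH d q) {Y : ℝ}
    (hY : ∀ b ∈ q.support, ∑ x : η × κ, (b x : ℝ) * (c x.2 * y x.1) ≤ Y) (a) :
    v (coeff a (aeval (genPt g) P)) ≤
      l1 q * C1 ^ (∑ h, d h) * Real.exp (Y + C' * ∑ x : η × κ, a (Sum.inr x) * y x.1) := by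
  set Ψ : η × κ → MvPolynomial ((η × lam) ⊕ (η × κ)) ℝ := fun x =>
    ∑ t : lam, C (Real.exp (c x.2 * y x.1)) * X (Sum.inl (x.1, t)) +
        ∑ j, C |((L x.2 j : ℤ) : ℝ)| * X (Sum.inr (x.1, j)) with hΨ
  have hP : aeval (genPt g) P = aeval (fun x => ∑ t, C (ev L (g x.1 t) x.2) * X (Sum.inl (x.1, t)) +
        ∑ j, C ((L x.2 j : ℤ) : K) * X (Sum.inr (x.1, j))) q := by
    rw [← hq, linSubst, ← AlgHom.comp_apply, comp_aeval]
    congr 2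
    funext x
    exact genPt_linSubst g L x
  have hmaj := Maj.aeval (v := v) (Φ := fun x : η × κ =>
    ∑ t, C (ev L (g x.1 t) x.2) * X (Sum.inl (x.1, t)) +
        ∑ j, C ((L x.2 j : ℤ) : K) * X (Sum.inr (x.1, j))) (Ψ := Ψ) (fun x => by
      refine Maj.add (Maj.sum fun t _ => ?_) (Maj.sum fun j _ => ?_)
      · exact (Maj.C (hg _ _ _)).mul (Maj.X _)
      · exact (Maj.C (abv_intCast_le _ _)).mul (Maj.X _)) q
  rw [← hP] at hmaj
  set r : (η × lam) ⊕ (η × κ) → ℝ := Sum.elim (fun _ => 1) fun x => Real.exp (-(C' * y x.1)) with hr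
  have hr0 : ∀ i, 0 ≤ r i := by
    rintro (i | i)
    · simp [hr]
    · simp only [hr, Sum.elim_inr]; positivity
  have h1 := hmaj.le_eval hr0 a
  have hC10 : 0 ≤ C1 := by
    have := one_le_matSize L
    have : (0 : ℝ) ≤ Fintype.card lam := Nat.cast_nonneg _
    linarith
  have hev : ∀ x, eval r (Ψ x) ≤ C1 * Real.exp (c x.2 * y x.1) := by
    intro x
    have h2 : eval r (Ψ x) = Fintype.card lam * Real.exp (c x.2 * y x.1) +
        (∑ j, |((L x.2 j : ℤ) : ℝ)|) * Real.exp (-(C' * y x.1)) := by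
      simp [hΨ, hr, Finset.sum_mul]
    have h3 : Real.exp (-(C' * y x.1)) ≤ Real.exp (c x.2 * y x.1) := by
      refine Real.exp_le_exp.2 ?_
      nlinarith [hC' x.2, hy x.1]
    have h4 : ∑ j, |(L x.2 j : ℝ)| ≤ matSize L := by
      have := Finset.single_le_sum (f := fun i => ∑ j, |(L i j : ℝ)|)
        (fun _ _ => Finset.sum_nonneg fun _ _ => abs_nonneg _) (Finset.mem_univ x.2)
      rw [matSize]
      linarith
    rw [h2]
    have h5 := mul_le_mul h4 h3 (Real.exp_pos _).le (zero_le_one.trans (one_le_matSize L))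
    have h6 := mul_le_mul_of_nonneg_right hC1 (Real.exp_pos (c x.2 * y x.1)).le
    linarith
  have hev0 : ∀ x, 0 ≤ eval r (Ψ x) := by
    intro x
    simp only [hΨ, map_add, map_sum, map_mul, eval_C, eval_X]
    refine add_nonneg (Finset.sum_nonneg fun t _ => mul_nonneg (Real.exp_pos _).le (hr0 _))
      (Finset.sum_nonneg fun t _ => mul_nonneg (abs_nonneg _) (hr0 _))
  have h7 : eval r (∑ b ∈ q.support, C |((coeff b q : ℤ) : ℝ)| * ∏ x, Ψ x ^ b x) ≤
      l1 q * C1 ^ (∑ h, d h) * Real.exp Y := by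
    rw [map_sum, l1, mul_assoc, Finset.sum_mul]
    refine Finset.sum_le_sum fun b hb => ?_
    rw [map_mul, eval_C, map_prod]
    refine mul_le_mul_of_nonneg_left ?_ (abs_nonneg _)
    calc ∏ x, eval r (Ψ x ^ b x) ≤ ∏ x : η × κ, (C1 * Real.exp (c x.2 * y x.1)) ^ b x := by
          refine Finset.prod_le_prod (fun x _ => ?_) fun x _ => ?_
          · rw [map_pow]; exact pow_nonneg (hev0 x) _
          · rw [map_pow]; exact pow_le_pow_left₀ (hev0 x) (hev x) _
      _ = C1 ^ (∑ x, b x) * Real.exp (∑ x : η × κ, (b x : ℝ) * (c x.2 * y x.1)) :=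
          prod_mul_exp_pow _ _ _
      _ = C1 ^ (∑ h, d h) * Real.exp (∑ x : η × κ, (b x : ℝ) * (c x.2 * y x.1)) := by
          rw [Fintype.sum_prod_type]
          simp only [hMH b hb]
      _ ≤ _ := mul_le_mul_of_nonneg_left (Real.exp_le_exp.2 (hY b hb)) (pow_nonneg hC10 _)
  have h8 : ∏ i, r i ^ a i = Real.exp (-(C' * ∑ x : η × κ, a (Sum.inr x) * y x.1)) := by
    rw [Fintype.prod_sum_type]
    simp only [hr, Sum.elim_inl, Sum.elim_inr, one_pow, Finset.prod_const_one, one_mul]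
    rw [Finset.mul_sum, ← Finset.sum_neg_distrib, Real.exp_sum]
    refine Finset.prod_congr rfl fun x _ => ?_
    rw [← Real.exp_nat_mul]
    congr 1
    ring
  rw [h8, Real.exp_neg, ← div_eq_mul_inv, div_le_iff₀ (Real.exp_pos _)] at h1
  refine h1.trans ?_
  rw [Real.exp_add, ← mul_assoc]
  exact mul_le_mul_of_nonneg_right h7 (Real.exp_pos _).le

/-- Vanishing of the low order coefficients at a generic point forces a large index along the
spans. -/
lemma indexGE_of_genPt (g : η → lam → κ → K) (P : MvPolynomial (η × κ) ℤ) (w : η × κ → ℝ) {θ : ℝ}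
    (h0 : ∀ a : (η × lam) ⊕ (η × κ) →₀ ℕ, ∑ x, a (Sum.inr x) * w x < θ →
      coeff a (aeval (genPt g) P) = 0)
    (x : η × κ → K) (hx : ∀ h, (fun i => x (h, i)) ∈ Submodule.span K (Set.range (g h))) :
    IndexGE x w P θ := by
  classical
  intro J hJ
  have hy : ∀ h, ∃ y : lam → K, ∑ t, y t • g h t = fun i => x (h, i) := fun h =>
    (Submodule.mem_span_range_iff_exists_fun K).1 (hx h)
  choose y hy using hy
  have htr : tr x P = aeval (Sum.elim (fun z : η × lam => C (y z.1 z.2)) X) (aeval (genPt g) P) := by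
    have : (tr x : MvPolynomial (η × κ) ℤ →ₐ[ℤ] _) = ((aeval (R := K)
        (Sum.elim (fun z : η × lam => C (y z.1 z.2)) X)).restrictScalars ℤ).comp
          (aeval (genPt g)) := by
      refine MvPolynomial.algHom_ext fun z => ?_
      rw [tr, aeval_X, AlgHom.comp_apply, aeval_X, genPt, AlgHom.restrictScalars_apply, map_add,
        aeval_X, Sum.elim_inr, map_sum, add_comm]
      congr 1
      have h2 := congrFun (hy z.1) z.2
      simp only [Finset.sum_apply, Pi.smul_apply, smul_eq_mul] at h2
      rw [← show x (z.1, z.2) = x z from rfl, ← h2, map_sum]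
      refine Finset.sum_congr rfl fun t _ => ?_
      simp [mul_comm]
    rw [this]
    rfl
  rw [htr, aeval_def, eval₂_eq', coeff_sum]
  refine Finset.sum_eq_zero fun a _ => ?_
  by_cases ha : ∑ x, (a (Sum.inr x) : ℝ) * w x < θ
  · rw [h0 a ha]; simp
  · rw [Fintype.prod_sum_type]
    have h3 : ∏ z : η × κ, (Sum.elim (fun z : η × lam => C (y z.1 z.2)) X (Sum.inr z) :
        MvPolynomial (η × κ) K) ^ a (Sum.inr z) =
        monomial (Finsupp.equivFunOnFinite.symm fun z => a (Sum.inr z)) 1 := by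
      rw [monomial_eq, Finsupp.prod_fintype _ _ (by simp)]
      simp
    have h4 : ∏ z : η × lam, (Sum.elim (fun z : η × lam => C (y z.1 z.2)) X (Sum.inl z) :
        MvPolynomial (η × κ) K) ^ a (Sum.inl z) =
        C (∏ z : η × lam, y z.1 z.2 ^ a (Sum.inl z)) := by
      simp
    rw [h3, h4, algebraMap_eq, coeff_C_mul, coeff_C_mul, coeff_monomial, if_neg, mul_zero, mul_zero]
    rintro rfl
    exact ha (by simpa using hJ)

end SUnit

namespace SUnit
open MvPolynomial

variable {K : Type*} [Field K] {κ lam η : Type*} [Fintype κ] [Fintype lam] [Fintype η]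

omit [Fintype κ] in
/-- A balanced exponent has almost constant weighted partial sums. -/
lemma balanced_sum_le {y : η → ℝ} {d : η → ℕ} {D ε μ : ℝ} (hd : ∀ h, 0 < d h) (hD : 0 ≤ D)
    (hlow : ∀ h, D - y h ≤ d h * y h) (hup : ∀ h, d h * y h ≤ D)
    {b : η × κ → ℕ} {i : κ} (hbd : ∀ h, b (h, i) ≤ d h)
    (hb : |∑ h, ((b (h, i) : ℝ) / d h) - μ| ≤ ε) (c : ℝ) :
    c * ∑ h, (b (h, i) : ℝ) * y h ≤ c * (D * μ) + |c| * (D * ε + ∑ h, y h) := by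
  have h1 : |(∑ h, (b (h, i) : ℝ) * y h) - D * ∑ h, ((b (h, i) : ℝ) / d h)| ≤ ∑ h, y h := by
    rw [Finset.mul_sum, ← Finset.sum_sub_distrib]
    refine (Finset.abs_sum_le_sum_abs _ _).trans (Finset.sum_le_sum fun h _ => ?_)
    have hd' : (0 : ℝ) < d h := by exact_mod_cast hd h
    have hb' : (b (h, i) : ℝ) / d h ≤ 1 := by
      rw [div_le_one hd']; exact_mod_cast hbd h
    have hb0 : 0 ≤ (b (h, i) : ℝ) / d h := by positivity
    have : (b (h, i) : ℝ) * y h - D * ((b (h, i) : ℝ) / d h) =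
        -((b (h, i) : ℝ) / d h * (D - d h * y h)) := by
      field_simp
      ring
    have h2 : 0 ≤ D - d h * y h := by linarith [hup h]
    rw [this, abs_neg, abs_of_nonneg (mul_nonneg hb0 h2)]
    nlinarith [hlow h]
  have h2 : |(∑ h, (b (h, i) : ℝ) * y h) - D * μ| ≤ D * ε + ∑ h, y h := by
    have h3 : |D * ∑ h, ((b (h, i) : ℝ) / d h) - D * μ| ≤ D * ε := by
      rw [← mul_sub, abs_mul, abs_of_nonneg hD]
      exact mul_le_mul_of_nonneg_left hb hD
    have := abs_sub_le (∑ h, (b (h, i) : ℝ) * y h) (D * ∑ h, ((b (h, i) : ℝ) / d h)) (D * μ)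
    linarith
  have h3 : c * ((∑ h, (b (h, i) : ℝ) * y h) - D * μ) ≤ |c| * (D * ε + ∑ h, y h) :=
    (le_abs_self _).trans (by rw [abs_mul]; exact mul_le_mul_of_nonneg_left h2 (abs_nonneg _))
  linarith

variable [DecidableEq κ] [Nonempty κ] {ι : Type*} [Fintype ι] (S : SData K ι)

omit [DecidableEq κ] in
lemma genPt_coeff_eq_zero (L : ι → Matrix κ κ ℤ) (c : ι → κ → ℝ) {δ : ℝ}
    (hc : ∑ s, (S.n s : ℝ) * ∑ i, c s i ≤ -δ) {q0 D ε ε' C1 C' c0 : ℝ} (hδ : 0 < δ)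
    (hC1 : ∀ s, Fintype.card lam + matSize (L s) ≤ C1) (hC11 : 1 ≤ C1) (hc0 : 1 ≤ c0)
    (hC'0 : 0 ≤ C') (hC' : ∀ s i, -C' ≤ c s i)
    (h1 : (∑ s, (S.n s : ℝ)) * C' * ε' ≤ δ / (4 * Fintype.card κ))
    (h2 : (∑ s, (S.n s : ℝ)) * Real.log (c0 * C1) ≤ q0 * (δ / (4 * Fintype.card κ)))
    (h3 : (∑ s, (S.n s : ℝ) * ∑ i, |c s i|) * ε ≤ δ / (4 * Fintype.card κ))
    {y : η → ℝ} (hq0 : 0 < q0) (hy : ∀ h, q0 ≤ y h) (d : η → ℕ) (hd : ∀ h, 0 < d h)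
    (hD : 0 ≤ D) (hlow : ∀ h, D - y h ≤ d h * y h) (hup : ∀ h, d h * y h ≤ D)
    (h4 : (∑ s, (S.n s : ℝ) * ∑ i, |c s i|) * ∑ h, y h <
      D * (Fintype.card η : ℝ) * (δ / (4 * Fintype.card κ)))
    (g : η → lam → κ → K) (hO : ∀ h t i, g h t i ∈ S.O)
    (hg : ∀ h t s i, S.v s (ev (L s) (g h t) i) ≤ Real.exp (c s i * y h))
    (P : MvPolynomial (η × κ) ℤ)
    (hP : ∀ s, ∃ q, linSubst (L s) q = P ∧ MH d q ∧ l1 q ≤ c0 ^ (∑ h, d h) ∧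
      ∀ b ∈ q.support, ∀ i, |∑ h, ((b (h, i) : ℝ) / d h) -
        (Fintype.card η : ℝ) / Fintype.card κ| ≤ Fintype.card η * ε)
    (a : (η × lam) ⊕ (η × κ) →₀ ℕ)
    (ha : ∑ x, (a (Sum.inr x) : ℝ) * (1 / d x.1) < Fintype.card η * ε') :
    coeff a (aeval (genPt g) P) = 0 := by
  set m : ℝ := (Fintype.card η : ℝ) with hm
  set N : ℝ := (Fintype.card κ : ℝ) with hN
  have hN0 : 0 < N := by rw [hN]; exact_mod_cast Fintype.card_pos
  have hm0 : 0 ≤ m := Nat.cast_nonneg _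
  have hy0 : ∀ h, 0 < y h := fun h => hq0.trans_le (hy h)
  have hD' : 0 ≤ D * m := mul_nonneg hD hm0
  set A : ℝ := ∑ x : η × κ, a (Sum.inr x) * y x.1 with hA
  have hAle : A ≤ D * m * ε' := by
    calc A ≤ ∑ x : η × κ, D * ((a (Sum.inr x) : ℝ) * (1 / d x.1)) := by
          refine Finset.sum_le_sum fun x _ => ?_
          have hd' : (0 : ℝ) < d x.1 := by exact_mod_cast hd x.1
          have h5 : y x.1 ≤ D * (1 / d x.1) := by
            rw [mul_one_div, le_div_iff₀ hd', mul_comm]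
            exact hup x.1
          calc (a (Sum.inr x) : ℝ) * y x.1 ≤ a (Sum.inr x) * (D * (1 / d x.1)) :=
                mul_le_mul_of_nonneg_left h5 (Nat.cast_nonneg _)
            _ = _ := by ring
      _ ≤ _ := by
          rw [← Finset.mul_sum, mul_assoc]
          exact mul_le_mul_of_nonneg_left ha.le hD
  set Y : ι → ℝ := fun s =>
    (∑ i, c s i) * (D * (m / N)) + (∑ i, |c s i|) * (D * (m * ε) + ∑ h, y h) with hY
  have hK : 1 ≤ c0 * C1 := one_le_mul_of_one_le_of_one_le hc0 hC11
  refine S.eq_zero_of_lt (genPt_coeff_mem S.O hO P a)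
    (fun s => (c0 * C1) ^ (∑ h, d h) * Real.exp (Y s + C' * A)) (fun s => ?_) ?_
  · obtain ⟨q, hq, hMH, hl1, hbal⟩ := hP s
    refine (genPt_coeff_le (S.v s) (L s) (c s) y (fun h => (hy0 h).le) (hC1 s) (hC' s) g
      (fun h t i => hg h t s i) d P q hq hMH (Y := Y s) (fun b hb => ?_) a).trans ?_
    · rw [Fintype.sum_prod_type, Finset.sum_comm, hY]
      simp only []
      rw [Finset.sum_mul, Finset.sum_mul, ← Finset.sum_add_distrib]
      refine Finset.sum_le_sum fun i _ => ?_
      refine le_trans (le_of_eq ?_) (balanced_sum_le (κ := κ) (b := b) (i := i) hd hD hlow hup (fun h => ?_)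
        (hbal b hb i) (c s i))
      · rw [Finset.mul_sum]
        exact Finset.sum_congr rfl fun h _ => by ring
      · rw [← hMH b hb h]
        exact Finset.single_le_sum (f := fun j => b (h, j)) (fun _ _ => Nat.zero_le _)
          (Finset.mem_univ i)
    · rw [mul_pow]
      gcongr
  · have h5 : (∑ h, (d h : ℝ)) * q0 ≤ m * D := by
      rw [Finset.sum_mul, hm, ← nsmul_eq_mul, ← Finset.card_univ, ← Finset.sum_const]
      refine Finset.sum_le_sum fun h _ => le_trans ?_ (hup h)
      exact mul_le_mul_of_nonneg_left (hy h) (Nat.cast_nonneg _)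
    rw [prod_mul_exp_pow]
    have h6 : (c0 * C1) ^ (∑ h, d h) =
        Real.exp ((∑ h, (d h : ℝ)) * Real.log (c0 * C1)) := by
      rw [← Real.exp_log (show 0 < c0 * C1 by linarith), ← Real.exp_nat_mul, Real.log_exp]
      push_cast
      rfl
    rw [h6, ← Real.exp_nat_mul, ← Real.exp_add, Real.exp_lt_one_iff]
    push_cast
    have h7 : ∑ s, (S.n s : ℝ) * (Y s + C' * A) =
        (∑ s, (S.n s : ℝ) * ∑ i, c s i) * (D * (m / N)) +
        (∑ s, (S.n s : ℝ) * ∑ i, |c s i|) * (D * (m * ε) + ∑ h, y h) +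
        (∑ s, (S.n s : ℝ)) * (C' * A) := by
      rw [Finset.sum_mul, Finset.sum_mul, Finset.sum_mul, ← Finset.sum_add_distrib,
        ← Finset.sum_add_distrib]
      refine Finset.sum_congr rfl fun s _ => ?_
      rw [hY]
      ring
    have hn0 : 0 ≤ ∑ s, (S.n s : ℝ) := Finset.sum_nonneg fun s _ => Nat.cast_nonneg _
    rw [h7]
    set n : ℝ := ∑ s, (S.n s : ℝ) with hn
    set cst : ℝ := ∑ s, (S.n s : ℝ) * ∑ i, |c s i|
    set ρ : ℝ := δ / (4 * N) with hρ
    have hρ0 : 0 < ρ := by positivity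
    have e1 : n * ((∑ h, (d h : ℝ)) * Real.log (c0 * C1)) ≤ D * m * ρ := by
      have hd0 : 0 ≤ ∑ h, (d h : ℝ) := Finset.sum_nonneg fun h _ => Nat.cast_nonneg _
      calc n * ((∑ h, (d h : ℝ)) * Real.log (c0 * C1)) =
            (∑ h, (d h : ℝ)) * (n * Real.log (c0 * C1)) := by ring
        _ ≤ (∑ h, (d h : ℝ)) * (q0 * ρ) := mul_le_mul_of_nonneg_left h2 hd0
        _ = ((∑ h, (d h : ℝ)) * q0) * ρ := by ring
        _ ≤ (m * D) * ρ := mul_le_mul_of_nonneg_right h5 hρ0.le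
        _ = _ := by ring
    have e2 : (∑ s, (S.n s : ℝ) * ∑ i, c s i) * (D * (m / N)) ≤ -(4 * (D * m * ρ)) := by
      calc _ ≤ (-δ) * (D * (m / N)) := mul_le_mul_of_nonneg_right hc (by positivity)
        _ = _ := by rw [hρ]; field_simp
    have e3 : cst * (D * (m * ε)) ≤ D * m * ρ := by
      calc cst * (D * (m * ε)) = (D * m) * (cst * ε) := by ring
        _ ≤ _ := mul_le_mul_of_nonneg_left h3 hD'
    have e4 : n * (C' * A) ≤ D * m * ρ := by
      calc n * (C' * A) ≤ n * (C' * (D * m * ε')) :=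
            mul_le_mul_of_nonneg_left (mul_le_mul_of_nonneg_left hAle hC'0) hn0
        _ = (D * m) * (n * C' * ε') := by ring
        _ ≤ _ := mul_le_mul_of_nonneg_left h1 hD'
    linarith

end SUnit

namespace SUnit
open MvPolynomial

section
variable {K : Type*} [Field K] {κ η : Type*} [Fintype κ] [DecidableEq κ] [Fintype η]

omit [Fintype η] in
lemma MH.eq_of_agree {d : η → ℕ} {P : MvPolynomial (η × κ) ℤ} (hP : MH d P) {i1 : κ}
    {a a' : η × κ →₀ ℕ} (ha : a ∈ P.support) (ha' : a' ∈ P.support)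
    (h : ∀ x : η × κ, x.2 ≠ i1 → a x = a' x) : a = a' := by
  ext ⟨k, i⟩
  by_cases hi : i = i1
  · subst hi
    have h1 := (hP a ha k).trans (hP a' ha' k).symm
    rw [← Finset.add_sum_erase _ _ (Finset.mem_univ i),
      ← Finset.add_sum_erase _ (fun j => a' (k, j)) (Finset.mem_univ i)] at h1
    have h2 : ∑ j ∈ Finset.univ.erase i, a (k, j) = ∑ j ∈ Finset.univ.erase i, a' (k, j) :=
      Finset.sum_congr rfl fun j hj => h (k, j) (Finset.ne_of_mem_erase hj)
    omega
  · exact h _ hi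

/-- Dehomogenising and extracting a minimal coefficient turns a multihomogeneous polynomial of
large index along hyperplanes into a polynomial in one variable per block of large index at the
point formed by one coefficient of each hyperplane. -/
lemma exists_slice_indexGE [CharZero K] {i0 i1 : κ} (hi : i1 ≠ i0) (ξ : η → κ → K) {d : η → ℕ}
    {P : MvPolynomial (η × κ) ℤ} (hP0 : P ≠ 0) (hP : MH d P) {θ : ℝ}
    (hV : ∀ x : η × κ → K, (∀ h, affForm i0 (ξ h) (fun i => x (h, i)) = 0) →
      IndexGE x (fun x => 1 / (d x.1 : ℝ)) P θ) :
    ∃ p : MvPolynomial η ℤ, p ≠ 0 ∧ Box d p ∧ l1 p ≤ l1 P ∧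
      IndexGE (fun h => ξ h i1) (fun h => 1 / (d h : ℝ)) p θ := by
  classical
  set r : (η × κ →₀ ℕ) → η × κ →₀ ℕ := fun a => a.filter fun x => x.2 ≠ i0 ∧ x.2 ≠ i1 with hr
  set π : (η × κ →₀ ℕ) → η →₀ ℕ := fun a => Finsupp.equivFunOnFinite.symm fun h => a (h, i0)
    with hπ
  have hne : (P.support.image r).Nonempty := (support_nonempty.2 hP0).image _
  obtain ⟨e, he⟩ := Finset.exists_minimal hne
  set A := P.support.filter fun a => r a = e with hA
  set p : MvPolynomial η ℤ := ∑ a ∈ A, monomial (π a) (coeff a P) with hp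
  have hinj : ∀ a ∈ A, ∀ a' ∈ A, π a = π a' → a = a' := by
    intro a ha a' ha' h
    rw [hA, Finset.mem_filter] at ha ha'
    refine hP.eq_of_agree (i1 := i1) ha.1 ha'.1 fun x hx => ?_
    by_cases hx0 : x.2 = i0
    · have := DFunLike.congr_fun h x.1
      simp only [hπ, Finsupp.equivFunOnFinite_symm_apply_apply] at this
      rwa [← hx0] at this
    · have := DFunLike.congr_fun (ha.2.trans ha'.2.symm) x
      simpa [hr, Finsupp.filter_apply, hx, hx0] using this
  refine ⟨p, ?_, ?_, ?_, ?_⟩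
  · obtain ⟨a0, ha0, hae⟩ := Finset.mem_image.1 he.1
    have ha0A : a0 ∈ A := Finset.mem_filter.2 ⟨ha0, hae⟩
    intro h0
    have h1 : coeff (π a0) p = coeff a0 P := by
      rw [hp, coeff_sum, Finset.sum_eq_single a0]
      · rw [coeff_monomial, if_pos rfl]
      · intro b hb hne
        rw [coeff_monomial, if_neg fun h => hne (hinj b hb a0 ha0A h)]
      · exact fun h => absurd ha0A h
    rw [h0, coeff_zero] at h1
    exact mem_support_iff.1 ha0 h1.symm
  · refine Box.sum fun a ha b hb h => ?_
    have hb' := Finset.mem_singleton.1 (support_monomial_subset hb)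
    rw [hb', hπ, Finsupp.equivFunOnFinite_symm_apply_apply,
      ← hP a (Finset.mem_filter.1 ha).1 h]
    exact Finset.single_le_sum (f := fun j => a (h, j)) (fun _ _ => Nat.zero_le _)
      (Finset.mem_univ i0)
  · refine (l1_sum_le _ _).trans ?_
    simp only [l1_monomial]
    exact Finset.sum_le_sum_of_subset_of_nonneg (Finset.filter_subset _ _)
      fun _ _ _ => abs_nonneg _
  · intro J hJ
    rw [coeff_tr]
    set J' : η × κ →₀ ℕ := Finsupp.equivFunOnFinite.symm fun x => if x.2 = i0 then J x.1 else 0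
      with hJ'
    have hJ'0 : ∀ h, J' (h, i0) = J h := fun h => by simp [hJ']
    have hJ'1 : ∀ h i, i ≠ i0 → J' (h, i) = 0 := fun h i hi => by simp [hJ', hi]
    set Θ : η × κ → MvPolynomial (η × κ) K := fun x => if x.2 = i0 then C (ξ x.1 i1) +
      ∑ i ∈ (Finset.univ.erase i0).erase i1, C (ξ x.1 i) * X (x.1, i) else
        if x.2 = i1 then 1 else X x with hΘ
    have hZ : aeval Θ (hasse J' P) = 0 := by
      refine MvPolynomial.funext fun y => ?_
      have h1 : eval y (aeval Θ (hasse J' P)) = aeval (fun x => eval y (Θ x)) (hasse J' P) := by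
        have := congrArg (fun f => f (hasse J' P)) (comp_aeval (R := ℤ) Θ
          ((aeval y : MvPolynomial (η × κ) K →ₐ[K] K).restrictScalars ℤ))
        simpa [coe_aeval_eq_eval] using this
      rw [h1, map_zero, ← coeff_tr]
      refine hV _ (fun h => ?_) J' ?_
      · rw [affForm_apply, sub_eq_zero, ← Finset.add_sum_erase _ _
          (Finset.mem_erase.2 ⟨hi, Finset.mem_univ i1⟩)]
        simp only [hΘ, if_true, if_neg hi, map_add, map_one, mul_one, eval_C, map_sum, map_mul, eval_X]
        congr 1
        refine Finset.sum_congr rfl fun i hi' => ?_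
        rw [if_neg (Finset.ne_of_mem_erase (Finset.mem_of_mem_erase hi')),
          if_neg (Finset.ne_of_mem_erase hi'), eval_X]
      · refine lt_of_eq_of_lt ?_ hJ
        rw [Fintype.sum_prod_type]
        refine Finset.sum_congr rfl fun h _ => ?_
        rw [Finset.sum_eq_single i0, hJ'0]
        · intro b _ hb
          rw [hJ'1 h b hb]; simp
        · simp
    have hsplit : ∀ a, ∏ x, Θ x ^ (a - J') x =
        (∏ h, Θ (h, i0) ^ (a (h, i0) - J h)) * monomial (r a) 1 := by
      intro a
      rw [Fintype.prod_prod_type, monomial_eq, Finsupp.prod_fintype _ _ (by simp),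
        Fintype.prod_prod_type, C_1, one_mul, ← Finset.prod_mul_distrib]
      refine Finset.prod_congr rfl fun h _ => ?_
      rw [← Finset.mul_prod_erase _ _ (Finset.mem_univ i0),
        ← Finset.mul_prod_erase _ (fun i => (X (h, i) : MvPolynomial (η × κ) K) ^ r a (h, i))
          (Finset.mem_univ i0)]
      have h1 : r a (h, i0) = 0 := by simp [hr, Finsupp.filter_apply]
      rw [h1, pow_zero, one_mul, Finsupp.tsub_apply, hJ'0]
      congr 1
      refine Finset.prod_congr rfl fun i hi' => ?_
      have hi0 := Finset.ne_of_mem_erase hi'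
      rw [Finsupp.tsub_apply, hJ'1 h i hi0, Nat.sub_zero]
      by_cases h1 : i = i1
      · simp [hΘ, hr, hi0, h1, hi, Finsupp.filter_apply]
      · simp [hΘ, hr, hi0, h1, Finsupp.filter_apply]
    have hZe : coeff e (aeval Θ (hasse J' P)) = aeval (fun h => ξ h i1) (hasse J p) := by
      have hhasse : hasse J' P = ∑ a ∈ P.support,
          monomial (a - J') (coeff a P * ((∏ x, (a x).choose (J' x) : ℕ) : ℤ)) := by
        conv_lhs => rw [P.as_sum]
        rw [map_sum]
        exact Finset.sum_congr rfl fun a _ => hasse_monomial _ _ _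
      have hch : ∀ a : η × κ →₀ ℕ, ∏ x, (a x).choose (J' x) = ∏ h, (π a h).choose (J h) := by
        intro a
        rw [Fintype.prod_prod_type]
        refine Finset.prod_congr rfl fun h _ => ?_
        rw [Finset.prod_eq_single i0, hJ'0]
        · rfl
        · intro b _ hb
          rw [hJ'1 h b hb, Nat.choose_zero_right]
        · simp
      rw [hhasse, map_sum, coeff_sum, hp, map_sum, map_sum, hA, Finset.sum_filter]
      refine Finset.sum_congr rfl fun a ha => ?_
      rw [aeval_monomial, Finsupp.prod_fintype _ _ (by simp), hsplit, ← mul_assoc,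
        coeff_mul_monomial']
      have hintg : ∀ z : ℤ, (algebraMap ℤ (MvPolynomial (η × κ) K)) z = C ((z : ℤ) : K) := by
        intro z; simp
      by_cases hae : r a = e
      · rw [if_pos hae, if_pos hae.le, hae, tsub_self, mul_one, hintg, coeff_C_mul,
          hasse_monomial, aeval_monomial, Finsupp.prod_fintype _ _ (by simp), hch]
        congr 1
        rw [← constantCoeff_eq, map_prod]
        refine Finset.prod_congr rfl fun h _ => ?_
        rw [map_pow]
        congr 1
        simp [hΘ]
      · rw [if_neg hae, if_neg]
        intro hle
        exact hae (le_antisymm hle (he.2 (Finset.mem_image_of_mem r ha) hle))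
    rw [← hZe, hZ, coeff_zero]

end
end SUnit

namespace SUnit
open MvPolynomial Filter

variable {K : Type*} [Field K] {κ lam : Type*} [Fintype κ] [DecidableEq κ] [Fintype lam]
  {ι : Type*} [Fintype ι] (S : SData K ι)

/-- Hyperplanes spanned by small points cannot have large height along a rapidly increasing finite
sequence. -/
lemma exists_no_large_height [CharZero K] [Nonempty κ] (L L' : ι → Matrix κ κ ℤ)
    (hL : ∀ s, L' s * L s = 1) (c : ι → κ → ℝ) {δ ε0 : ℝ} (hδ : 0 < δ) (hε0 : 0 < ε0)
    (hc : ∑ s, (S.n s : ℝ) * ∑ i, c s i ≤ -δ) :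
    ∃ (m : ℕ) (A q0 : ℝ), ∀ (y : Fin m → ℝ) (g : Fin m → lam → κ → K) (i0 i1 : κ)
      (ξ : Fin m → κ → K) (η : Fin m → ℝ), (∀ h, q0 ≤ y h) → (∀ i j, i < j → A * y i ≤ y j) →
      (∀ h t i, g h t i ∈ S.O) →
      (∀ h t s i, S.v s (ev (L s) (g h t) i) ≤ Real.exp (c s i * y h)) → i1 ≠ i0 →
      (∀ h, LinearMap.ker (affForm i0 (ξ h)) = Submodule.span K (Set.range (g h))) →
      (∀ h, HtLower (ξ h i1) (η h)) → (∀ h, ε0 * y h ≤ η h) → False := by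
  classical
  set ρ : ℝ := δ / (4 * Fintype.card κ) with hρ
  have hN0 : (0 : ℝ) < Fintype.card κ := by exact_mod_cast Fintype.card_pos
  have hρ0 : 0 < ρ := by positivity
  set cst : ℝ := ∑ s, (S.n s : ℝ) * ∑ i, |c s i| with hcst
  have hcst0 : 0 ≤ cst := Finset.sum_nonneg fun s _ => mul_nonneg (Nat.cast_nonneg _)
    (Finset.sum_nonneg fun i _ => abs_nonneg _)
  set n : ℝ := ∑ s, (S.n s : ℝ) with hn
  have hn0 : 0 ≤ n := Finset.sum_nonneg fun s _ => Nat.cast_nonneg _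
  set εB : ℝ := ρ / (cst + 1) with hεB
  have hεB0 : 0 < εB := by positivity
  obtain ⟨m, hm, c0, hc0, haux⟩ := exists_aux L L' hL hεB0
  have hm0 : (0 : ℝ) < m := by exact_mod_cast hm
  set C1 : ℝ := 1 + Fintype.card lam + ∑ s, matSize (L s) with hC1
  have hms : ∀ s, 0 ≤ matSize (L s) := fun s => zero_le_one.trans (one_le_matSize (L s))
  have hC1s : ∀ s, Fintype.card lam + matSize (L s) ≤ C1 := fun s => by
    have := Finset.single_le_sum (f := fun s => matSize (L s)) (fun s _ => hms s)
      (Finset.mem_univ s)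
    rw [hC1]; linarith
  have hC11 : 1 ≤ C1 := by
    have := Finset.sum_nonneg (s := Finset.univ) (f := fun s => matSize (L s)) fun s _ => hms s
    have h2 : (0 : ℝ) ≤ Fintype.card lam := Nat.cast_nonneg _
    rw [hC1]; linarith
  set C' : ℝ := ∑ s, ∑ i, |c s i| with hC'
  have hC'0 : 0 ≤ C' := Finset.sum_nonneg fun s _ => Finset.sum_nonneg fun i _ => abs_nonneg _
  have hC's : ∀ s i, -C' ≤ c s i := fun s i => by
    have h1 := Finset.single_le_sum (f := fun s => ∑ i, |c s i|)
      (fun s _ => Finset.sum_nonneg fun i _ => abs_nonneg _) (Finset.mem_univ s)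
    have h2 := Finset.single_le_sum (f := fun i => |c s i|) (fun i _ => abs_nonneg _)
      (Finset.mem_univ i)
    have h3 := neg_abs_le (c s i)
    rw [hC']; linarith
  set ε' : ℝ := ρ / (n * C' + 1) with hε'
  have hε'0 : 0 < ε' := by positivity
  obtain ⟨ω, hω, R, hR, hroth⟩ := roth_lemma (K := K) m (m * ε') (by positivity)
  have hlogc0 : 0 ≤ Real.log c0 := Real.log_nonneg hc0
  set q0 : ℝ := 1 + n * Real.log (c0 * C1) / ρ + 2 * R * (1 + Real.log c0) * m / ε0 with hq0
  have hlogK : 0 ≤ Real.log (c0 * C1) :=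
    Real.log_nonneg (one_le_mul_of_one_le_of_one_le hc0 hC11)
  have hq1 : n * Real.log (c0 * C1) ≤ q0 * ρ := by
    have h1 : n * Real.log (c0 * C1) / ρ ≤ q0 := by
      have : 0 ≤ 2 * R * (1 + Real.log c0) * m / ε0 := by positivity
      rw [hq0]; linarith
    rwa [div_le_iff₀ hρ0] at h1
  have hq2 : 2 * R * (1 + Real.log c0) * m ≤ q0 * ε0 := by
    have h1 : 2 * R * (1 + Real.log c0) * m / ε0 ≤ q0 := by
      have : 0 ≤ n * Real.log (c0 * C1) / ρ := by positivity
      rw [hq0]; linarith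
    rwa [div_le_iff₀ hε0] at h1
  have hq00 : 0 < q0 := by
    have h1 : 0 ≤ 2 * R * (1 + Real.log c0) * m / ε0 := by positivity
    have h2 : 0 ≤ n * Real.log (c0 * C1) / ρ := by positivity
    rw [hq0]; linarith
  refine ⟨m, 2 / ω, q0, ?_⟩
  intro y g i0 i1 ξ η hy hyA hgO hgv hi hker hη hηy
  have hy0 : ∀ h, 0 < y h := fun h => hq00.trans_le (hy h)
  set Y : ℝ := ∑ h, y h with hY
  have hY0 : 0 ≤ Y := Finset.sum_nonneg fun h _ => (hy0 h).le
  have hyY : ∀ h, y h ≤ Y := fun h =>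
    Finset.single_le_sum (fun h _ => (hy0 h).le) (Finset.mem_univ h)
  set D : ℝ := 2 * Y + (cst * Y + 1) / (m * ρ) with hD
  have hD2 : 2 * Y ≤ D := by
    have : 0 ≤ (cst * Y + 1) / (m * ρ) := by positivity
    rw [hD]; linarith
  have hD0 : 0 ≤ D := by linarith
  have hD3 : cst * Y < D * m * ρ := by
    have h1 : (cst * Y + 1) / (m * ρ) ≤ D := by rw [hD]; linarith
    rw [div_le_iff₀ (by positivity)] at h1
    linarith
  set d : Fin m → ℕ := fun h => ⌊D / y h⌋₊ with hd
  have hup : ∀ h, d h * y h ≤ D := fun h => by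
    rw [← le_div_iff₀ (hy0 h)]
    exact Nat.floor_le (div_nonneg hD0 (hy0 h).le)
  have hlow : ∀ h, D - y h ≤ d h * y h := fun h => by
    have := Nat.lt_floor_add_one (D / y h)
    rw [div_lt_iff₀ (hy0 h)] at this
    simp only [hd]
    linarith
  have hdpos : ∀ h, 0 < d h := fun h => by
    refine Nat.floor_pos.2 ?_
    rw [le_div_iff₀ (hy0 h)]
    linarith [hyY h, hy0 h]
  obtain ⟨P, hP0, hPMH, hPl1, hP⟩ := haux d hdpos
  have hvan := genPt_coeff_eq_zero (η := Fin m) (lam := lam) S L c hc (q0 := q0) (D := D) (ε := εB)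
    (ε' := ε') (C1 := C1) (C' := C') (c0 := c0) hδ hC1s hC11 hc0 hC'0 hC's
    (by
      rw [hε', ← hn, ← hρ, mul_div_assoc', div_le_iff₀ (by positivity)]
      nlinarith [mul_nonneg hn0 hC'0])
    hq1
    (by
      rw [hεB, ← hρ, mul_div_assoc', div_le_iff₀ (by positivity)]
      nlinarith)
    hq00 hy d hdpos hD0 hlow hup (by simpa using hD3) g hgO hgv P (by simpa using hP)
  have hV : ∀ x : Fin m × κ → K, (∀ h, affForm i0 (ξ h) (fun i => x (h, i)) = 0) →
      IndexGE x (fun x => 1 / (d x.1 : ℝ)) P (m * ε') := by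
    intro x hx
    refine indexGE_of_genPt g P _ (fun a ha => hvan a (by simpa using ha)) x fun h => ?_
    rw [← hker h]
    exact hx h
  obtain ⟨p, hp0, hpBox, hpl1, hpI⟩ := exists_slice_indexGE hi ξ hP0 hPMH hV
  have hsum0 : 0 ≤ ∑ h, (d h : ℝ) := Finset.sum_nonneg fun h _ => Nat.cast_nonneg _
  have hsumq : (∑ h, (d h : ℝ)) * q0 ≤ m * D := by
    calc (∑ h, (d h : ℝ)) * q0 ≤ ∑ h : Fin m, D := by
          rw [Finset.sum_mul]
          exact Finset.sum_le_sum fun h _ =>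
            (mul_le_mul_of_nonneg_left (hy h) (Nat.cast_nonneg _)).trans (hup h)
      _ = m * D := by simp
  have hdy : ∀ h, D / 2 ≤ d h * y h := fun h => by linarith [hlow h, hyY h]
  refine hroth m d (fun h => ξ h i1) η p ((1 + Real.log c0) * ∑ h, (d h : ℝ)) le_rfl hdpos hp0
    (mem_supported_iff.2 fun a _ i _ => i.2) hpBox ?_ hη ?_ ?_ ?_ hpI
  · intro i j hij
    have h1 := hyA i j hij
    rw [div_mul_eq_mul_div, div_le_iff₀ hω] at h1
    have h2 := hup j
    have h3 := hdy i
    have hyi := hy0 i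
    have hdj : (0 : ℝ) ≤ d j := Nat.cast_nonneg _
    have h4 : (d j : ℝ) * (2 * y i) ≤ ω * D := by
      calc (d j : ℝ) * (2 * y i) ≤ d j * (y j * ω) := mul_le_mul_of_nonneg_left h1 hdj
        _ = ω * (d j * y j) := by ring
        _ ≤ _ := mul_le_mul_of_nonneg_left h2 hω.le
    have h5 : (d j : ℝ) * y i ≤ (ω * d i) * y i := by
      have := mul_le_mul_of_nonneg_left h3 hω.le
      linarith
    exact le_of_mul_le_mul_right h5 hyi
  · intro i
    have h1 : ε0 * (D / 2) ≤ d i * η i := by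
      calc ε0 * (D / 2) ≤ ε0 * (d i * y i) := mul_le_mul_of_nonneg_left (hdy i) hε0.le
        _ = d i * (ε0 * y i) := by ring
        _ ≤ _ := mul_le_mul_of_nonneg_left (hηy i) (Nat.cast_nonneg _)
    refine le_trans ?_ h1
    refine le_of_mul_le_mul_right ?_ hq00
    calc R * ((1 + Real.log c0) * ∑ h, (d h : ℝ)) * q0 =
          R * (1 + Real.log c0) * ((∑ h, (d h : ℝ)) * q0) := by ring
      _ ≤ R * (1 + Real.log c0) * (m * D) := mul_le_mul_of_nonneg_left hsumq (by positivity)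
      _ = (2 * R * (1 + Real.log c0) * m) * (D / 2) := by ring
      _ ≤ (q0 * ε0) * (D / 2) := mul_le_mul_of_nonneg_right hq2 (by linarith)
      _ = _ := by ring
  · rw [add_mul, one_mul]
    linarith [mul_nonneg hlogc0 hsum0]
  · have hl1pos : 0 < l1 p := lt_of_lt_of_le one_pos (one_le_l1 hp0)
    have h1 : Real.log (l1 p) ≤ (∑ h, (d h : ℝ)) * Real.log c0 := by
      refine (Real.log_le_log hl1pos (hpl1.trans hPl1)).trans_eq ?_
      rw [Real.log_pow]
      push_cast
      rfl
    rw [add_mul, one_mul]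
    linarith [mul_comm (Real.log c0) (∑ h, (d h : ℝ))]

/-- The penultimate-minimum theorem: hyperplanes spanned by integral points that are small with
respect to a fixed system of exponents with negative total weight take some value infinitely
often. -/
theorem exists_span_infinite [NumberField K] (hcard : Fintype.card lam + 1 = Fintype.card κ)
    (L L' : ι → Matrix κ κ ℤ) (hL : ∀ s, L' s * L s = 1) (c : ι → κ → ℝ)
    (hc : ∑ s, (S.n s : ℝ) * ∑ i, c s i < 0)
    (q : ℕ → ℝ) (hq : Tendsto q atTop atTop) (g : ℕ → lam → κ → K)
    (hg : ∀ j, LinearIndependent K (g j)) (hO : ∀ j t i, g j t i ∈ S.O)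
    (hv : ∀ j t s i, S.v s (ev (L s) (g j t) i) ≤ Real.exp (c s i * q j)) :
    ∃ H : Submodule K (κ → K), {j | Submodule.span K (Set.range (g j)) = H}.Infinite := by
  classical
  have : Nonempty κ := Fintype.card_pos_iff.1 (by omega)
  have hN0 : (0 : ℝ) < Fintype.card κ := by exact_mod_cast Fintype.card_pos
  obtain ⟨δ, hδ, hcδ⟩ : ∃ δ : ℝ, 0 < δ ∧ ∑ s, (S.n s : ℝ) * ∑ i, c s i ≤ -δ :=
    ⟨-∑ s, (S.n s : ℝ) * ∑ i, c s i, by linarith, by linarith⟩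
  set n : ℝ := ∑ s, (S.n s : ℝ) with hn
  have hn0 : 0 ≤ n := Finset.sum_nonneg fun s _ => Nat.cast_nonneg _
  obtain ⟨ε1, hε1, hε1δ⟩ : ∃ ε : ℝ, 0 < ε ∧ n * (n + 1) * ε < δ := by
    refine ⟨δ / (n * (n + 1) + 1), by positivity, ?_⟩
    rw [mul_div_assoc', div_lt_iff₀ (by positivity)]
    nlinarith
  set ε0 : ℝ := ε1 / Fintype.card κ with hε0
  have hε00 : 0 < ε0 := by positivity
  obtain ⟨m, A, q0, hno⟩ := exists_no_large_height (lam := lam) S L L' hL c hδ hε00 hcδ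
  have hform : ∀ j, ∃ i0 ξ, LinearMap.ker (affForm i0 ξ) = Submodule.span K (Set.range (g j)) := by
    intro j
    obtain ⟨D, hD, hDg, -⟩ := exists_det_functional S.O hcard (hg j) (hO j)
    obtain ⟨i0, ξ, h⟩ := exists_affForm hD
    exact ⟨i0, ξ, by rw [h, span_eq_ker hcard (hg j) hD hDg]⟩
  choose i0 ξ hker using hform
  choose η hη0 hη a ha0 haO haξ hav using fun j i => exists_height_of_sData S (ξ j i)
  set T0 : Set ℕ := {j | 0 ≤ q j ∧ ∀ i, i ≠ i0 j → η j i ≤ ε0 * q j} with hT0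
  by_cases hT : T0.Infinite
  · have hsm : ∀ j, j ∈ T0 → ∃ B : K, B ≠ 0 ∧
        (∀ i, (B • affForm (i0 j) (ξ j)) (Pi.single i 1) ∈ S.O) ∧
        ∀ s i, S.v s ((B • affForm (i0 j) (ξ j)) (Pi.single i 1)) ≤ Real.exp (ε1 * q j) := by
      intro j hj
      obtain ⟨B, hB0, hBO, hBv⟩ := exists_small_multiple S (i0 j) (ξ j) (a j)
        (E := Real.exp (ε0 * q j)) (Real.one_le_exp (mul_nonneg hε00.le hj.1)) (ha0 j) (haO j)
        (haξ j) (fun i hi s => ⟨(hav j i s).1.trans (Real.exp_le_exp.2 (hj.2 i hi)),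
          (hav j i s).2.trans (Real.exp_le_exp.2 (hj.2 i hi))⟩)
      refine ⟨B, hB0, hBO, fun s i => (hBv s i).trans_eq ?_⟩
      rw [← Real.exp_nat_mul, hε0]
      congr 1
      field_simp
    choose! B hB0 hBO hBv using hsm
    refine exists_common_span S hcard L L' hL c hε1 (by rwa [← hn]) hcδ q hq g hg hO hv hT
      (fun j => B j • affForm (i0 j) (ξ j)) (fun j hj h0 => ?_) (fun j hj t => ?_) hBO
      (fun j hj => hBv j hj)
    · have := congrArg (fun f => f (Pi.single (i0 j) 1)) h0
      simp [affForm_single_self, hB0 j hj] at this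
    · have h1 : g j t ∈ LinearMap.ker (affForm (i0 j) (ξ j)) := by
        rw [hker]
        exact Submodule.subset_span ⟨t, rfl⟩
      rw [LinearMap.smul_apply, LinearMap.mem_ker.1 h1, smul_zero]
  · exfalso
    have hT1 : T0ᶜ.Infinite := (Set.not_infinite.1 hT).infinite_compl
    have hU := infinite_and_eventually hT1 (hq.eventually_ge_atTop 0)
    set U := {j | j ∈ T0ᶜ ∧ 0 ≤ q j} with hUdef
    have hex : ∀ j, ∃ i, j ∈ U → i ≠ i0 j ∧ ε0 * q j < η j i := by
      intro j
      by_cases hj : j ∈ U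
      · have h1 := hj.1
        rw [hT0, Set.mem_compl_iff, Set.mem_ofPred_eq] at h1
        push Not at h1
        obtain ⟨i, hi⟩ := h1 hj.2
        exact ⟨i, fun _ => hi⟩
      · exact ⟨Classical.arbitrary κ, fun h => absurd h hj⟩
    choose i1 hi1 using hex
    obtain ⟨⟨b0, b1⟩, hb⟩ := exists_infinite_fiber hU fun j => (i0 j, i1 j)
    set V := {j | j ∈ U ∧ (i0 j, i1 j) = (b0, b1)} with hV
    obtain ⟨t, htV, htA⟩ := exists_seq_of_forall_finset_exists (fun j => j ∈ V ∧ q0 ≤ q j)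
      (fun i j => A * q i ≤ q j) (fun s _ => by
        have h1 : ∀ᶠ j in atTop, q0 ≤ q j ∧ ∀ i ∈ s, A * q i ≤ q j :=
          (hq.eventually_ge_atTop _).and
            ((Finset.eventually_all s).2 fun i _ => hq.eventually_ge_atTop _)
        obtain ⟨j, hj, hj'⟩ := (infinite_and_eventually hb h1).nonempty
        exact ⟨j, ⟨hj, hj'.1⟩, hj'.2⟩)
    have hte : ∀ h, i0 (t h) = b0 ∧ i1 (t h) = b1 := fun h => by
      simpa using (htV h).1.2
    obtain ⟨h0i, h1i⟩ := hte 0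
    refine hno (fun h => q (t h)) (fun h => g (t h)) b0 b1 (fun h => ξ (t h))
      (fun h => η (t h) b1) (fun h => (htV h).2) (fun i j hij => htA i j hij)
      (fun h => hO (t h)) (fun h => hv (t h)) ?_ (fun h => ?_) (fun h => hη _ _) fun h => ?_
    · rw [← h0i, ← h1i]
      exact (hi1 _ (htV 0).1.1).1
    · rw [← (hte h).1]; exact hker _
    · have := (hi1 _ (htV h).1.1).2.le
      rwa [(hte h).2] at this

end SUnit

namespace SUnit

variable {K : Type*} [Field K]

lemma exists_flag {V : Type*} [AddCommGroup V] [Module K V] (F : Submodule K V → V) :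
    ∃ g : ℕ → V, ∀ n, g n = F (Submodule.span K (g '' Set.Iio n)) := by
  let W : ℕ → Submodule K V := fun n => Nat.rec ⊥ (fun _ W => W ⊔ Submodule.span K {F W}) n
  refine ⟨fun n => F (W n), fun n => congrArg F ?_⟩
  induction n with
  | zero => simp [W]
  | succ n ih =>
    have h : Set.Iio (n + 1) = insert n (Set.Iio n) := by
      ext m
      simp only [Set.mem_Iio, Set.mem_insert_iff]
      omega
    rw [h, Set.image_insert_eq, Submodule.span_insert, ← ih, sup_comm]

lemma flag_mono {V : Type*} [AddCommGroup V] [Module K V] (g : ℕ → V) {m n : ℕ} (h : m ≤ n) :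
    Submodule.span K (g '' Set.Iio m) ≤ Submodule.span K (g '' Set.Iio n) :=
  Submodule.span_mono (Set.image_mono (Set.Iio_subset_Iio h))

lemma finrank_flag_le {V : Type*} [AddCommGroup V] [Module K V] (g : ℕ → V) (n : ℕ) :
    Module.finrank K (Submodule.span K (g '' Set.Iio n)) ≤ n := by
  classical
  have := finrank_span_finset_le_card (R := K) ((Finset.range n).image g)
  rw [Finset.coe_image, Finset.coe_range] at this
  exact this.trans (Finset.card_image_le.trans_eq (Finset.card_range n))

lemma flag_ne_top {V : Type*} [AddCommGroup V] [Module K V] (g : ℕ → V) {n : ℕ}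
    (hn : n < Module.finrank K V) : Submodule.span K (g '' Set.Iio n) ≠ ⊤ := fun h => by
  have := finrank_flag_le (K := K) g n
  rw [h, finrank_top] at this
  omega

lemma finrank_flag_eq {V : Type*} [AddCommGroup V] [Module K V] [FiniteDimensional K V] (g : ℕ → V)
    {N : ℕ} (h : ∀ l < N, g l ∉ Submodule.span K (g '' Set.Iio l)) {n : ℕ} (hn : n ≤ N) :
    Module.finrank K (Submodule.span K (g '' Set.Iio n)) = n := by
  refine (finrank_flag_le g n).antisymm ?_
  induction n with
  | zero => simp
  | succ n ih =>
    refine Nat.succ_le_of_lt ((ih (by omega)).trans_lt (Submodule.finrank_lt_finrank_of_lt ?_))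
    refine lt_of_le_of_ne (flag_mono g n.le_succ) fun he => h n hn ?_
    rw [he]
    exact Submodule.subset_span ⟨n, by simp, rfl⟩

lemma flag_top {V : Type*} [AddCommGroup V] [Module K V] [FiniteDimensional K V] (g : ℕ → V)
    {N : ℕ} (hN : Module.finrank K V = N)
    (h : ∀ l < N, g l ∉ Submodule.span K (g '' Set.Iio l)) :
    Submodule.span K (g '' Set.Iio N) = ⊤ ∧ LinearIndependent K (fun i : Fin N => g i) := by
  have h2 : Submodule.span K (g '' Set.Iio N) = ⊤ :=
    Submodule.eq_top_of_finrank_eq ((finrank_flag_eq g h le_rfl).trans hN.symm)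
  refine ⟨h2, linearIndependent_of_top_le_span_of_card_eq_finrank ?_ (by simp [hN])⟩
  rw [← h2]
  refine Submodule.span_mono ?_
  rintro _ ⟨i, hi, rfl⟩
  exact ⟨⟨i, hi⟩, rfl⟩

/-- Davenport's lemma for one absolute value: the coordinates can be ordered so that on the
`l`-th member of a flag the first `l` coordinates dominate all the others. -/
lemma davenport {V κ : Type*} [AddCommGroup V] [Module K V] [FiniteDimensional K V] [DecidableEq κ]
    (v : AbsoluteValue K ℝ) (φ : κ → Module.Dual K V) (A : κ → ℝ) (hA : ∀ i, 0 < A i)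
    (W : ℕ → Submodule K V) (hW : Monotone W) (hdim : ∀ l, Module.finrank K (W l) ≤ l) (m : ℕ) :
    ∀ J : Finset κ, J.card = m → ∃ τ : Fin m → κ, (∀ i, i ∈ J ↔ ∃ a, τ a = i) ∧
      ∀ l : ℕ, ∀ x ∈ W l, ∀ B : ℝ, 0 ≤ B →
        (∀ a : Fin m, a.1 < l → v (φ (τ a) x) ≤ B * A (τ a)) →
        ∀ i ∈ J, v (φ i x) ≤ m.factorial * (B * A i) := by
  induction m with
  | zero =>
    intro J hJ
    rw [Finset.card_eq_zero] at hJ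
    subst hJ
    exact ⟨Fin.elim0, by simp, by simp⟩
  | succ m ih =>
    intro J hJ
    have hdep : ∃ α : κ → K, (∃ i ∈ J, α i ≠ 0) ∧ ∀ x ∈ W m, ∑ i ∈ J, α i * φ i x = 0 := by
      have h1 : ¬ LinearIndependent K (fun i : J => (φ i).comp (W m).subtype) := fun hli => by
        have h2 := hli.fintype_card_le_finrank
        rw [Subspace.dual_finrank_eq, Fintype.card_coe, hJ] at h2
        have := hdim m
        omega
      rw [Fintype.linearIndependent_iff] at h1
      push Not at h1
      obtain ⟨α, hα, i, hi⟩ := h1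
      refine ⟨fun i => if h : i ∈ J then α ⟨i, h⟩ else 0, ⟨i, i.2, by simpa using hi⟩,
        fun x hx => ?_⟩
      have := congrArg (fun f => f ⟨x, hx⟩) hα
      simp only [LinearMap.coe_sum, Finset.sum_apply, LinearMap.smul_apply, LinearMap.comp_apply,
        Submodule.coe_subtype, smul_eq_mul, LinearMap.zero_apply] at this
      rw [← Finset.sum_coe_sort]
      simpa using this
    obtain ⟨α, ⟨i1, hi1, hα1⟩, hα⟩ := hdep
    obtain ⟨i0, hi0, hmax⟩ := Finset.exists_max_image J (fun i => v (α i) * A i) ⟨i1, hi1⟩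
    have hα0 : 0 < v (α i0) := by
      have h1 := hmax i1 hi1
      have h2 : 0 < v (α i1) * A i1 := mul_pos (v.pos hα1) (hA _)
      exact pos_of_mul_pos_left (h2.trans_le h1) (hA i0).le
    obtain ⟨τ, hτ, hτW⟩ := ih (J.erase i0) (by rw [Finset.card_erase_of_mem hi0, hJ]; rfl)
    refine ⟨Fin.snoc τ i0, fun i => ?_, fun l x hx B hB h i hi => ?_⟩
    · constructor
      · intro hi
        by_cases hii : i = i0
        · exact ⟨Fin.last m, by simp [hii]⟩
        · obtain ⟨a, ha⟩ := (hτ i).1 (Finset.mem_erase.2 ⟨hii, hi⟩)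
          exact ⟨a.castSucc, by simp [ha]⟩
      · rintro ⟨a, rfl⟩
        induction a using Fin.lastCases with
        | last => simpa using hi0
        | cast a => 
          rw [Fin.snoc_castSucc]
          exact Finset.mem_of_mem_erase ((hτ _).2 ⟨a, rfl⟩)
    · have hBA : 0 ≤ B * A i := mul_nonneg hB (hA i).le
      have h' : ∀ a : Fin m, a.1 < l → v (φ (τ a) x) ≤ B * A (τ a) := fun a ha => by
        have := h a.castSucc ha
        rwa [Fin.snoc_castSucc] at this
      by_cases hii : i = i0
      · subst hii
        by_cases hl : m < l
        · have := h (Fin.last m) (by simpa using hl)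
          rw [Fin.snoc_last] at this
          refine this.trans (le_mul_of_one_le_left hBA ?_)
          exact_mod_cast Nat.one_le_iff_ne_zero.2 (Nat.factorial_ne_zero _)
        · have hxm := hW (not_lt.1 hl) hx
          have h1 := hα x hxm
          rw [← Finset.add_sum_erase _ _ hi0] at h1
          have h2 : v (α i) * v (φ i x) ≤ ∑ t ∈ J.erase i, v (α t) * v (φ t x) := by
            rw [← v.map_mul, eq_neg_of_add_eq_zero_left h1, v.map_neg]
            refine (abv_sum_le v _ _).trans_eq ?_
            simp_rw [v.map_mul]
          have h3 : ∑ t ∈ J.erase i, v (α t) * v (φ t x) ≤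
              ∑ t ∈ J.erase i, v (α i) * (m.factorial * (B * A i)) := by
            refine Finset.sum_le_sum fun t ht => ?_
            have h4 := hτW l x hx B hB h' t ht
            have h5 := hmax t (Finset.mem_of_mem_erase ht)
            calc v (α t) * v (φ t x) ≤ v (α t) * (m.factorial * (B * A t)) :=
                  mul_le_mul_of_nonneg_left h4 (v.nonneg _)
              _ = (v (α t) * A t) * (m.factorial * B) := by ring
              _ ≤ (v (α i) * A i) * (m.factorial * B) := by gcongr
              _ = _ := by ring
          rw [Finset.sum_const, Finset.card_erase_of_mem hi0, hJ, nsmul_eq_mul] at h3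
          have h4 : v (φ i x) ≤ m * (m.factorial * (B * A i)) := by
            refine le_of_mul_le_mul_left ((h2.trans h3).trans_eq ?_) hα0
            simp only [Nat.add_sub_cancel]
            ring
          refine h4.trans ?_
          rw [Nat.factorial_succ]
          push_cast
          have : 0 ≤ m.factorial * (B * A i) := by positivity
          nlinarith
      · refine (hτW l x hx B hB h' i (Finset.mem_erase.2 ⟨hii, hi⟩)).trans ?_
        refine mul_le_mul_of_nonneg_right ?_ hBA
        exact_mod_cast Nat.factorial_le m.le_succ

section BoxNorm

variable {κ : Type*} [Fintype κ] [DecidableEq κ] {ι : Type*} [Fintype ι] (S : SData K ι)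
  (L L' : ι → Matrix κ κ ℤ) (A : ι → κ → ℝ)

/-- The gauge of the box with side lengths `A`. -/
noncomputable def boxNorm (x : κ → K) : ℝ := ‖fun p : ι × κ => S.v p.1 (ev (L p.1) x p.2) / A p.1 p.2‖

variable {A}

omit [DecidableEq κ] in
lemma boxNorm_le_iff (hA : ∀ s i, 0 < A s i) {x : κ → K} {r : ℝ} (hr : 0 ≤ r) :
    boxNorm S L A x ≤ r ↔ ∀ s i, S.v s (ev (L s) x i) ≤ r * A s i := by
  rw [boxNorm, pi_norm_le_iff_of_nonneg hr, Prod.forall]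
  refine forall_congr' fun s => forall_congr' fun i => ?_
  rw [Real.norm_of_nonneg (div_nonneg ((S.v s).nonneg _) (hA s i).le), div_le_iff₀ (hA s i)]

omit [DecidableEq κ] in
lemma boxNorm_nonneg (x : κ → K) : 0 ≤ boxNorm S L A x := norm_nonneg _

omit [DecidableEq κ] in
lemma abv_le_boxNorm (hA : ∀ s i, 0 < A s i) (x : κ → K) (s : ι) (i : κ) :
    S.v s (ev (L s) x i) ≤ boxNorm S L A x * A s i :=
  (boxNorm_le_iff S L hA (boxNorm_nonneg S L x)).1 le_rfl s i

variable {L L'}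

lemma finite_boxNorm_le (hL : ∀ s, L' s * L s = 1) (hA : ∀ s i, 0 < A s i) (R : ℝ) :
    {x : κ → K | (∀ i, x i ∈ S.O) ∧ boxNorm S L A x ≤ R}.Finite := by
  set M : ℝ := ∑ s, matSize (L' s) * (|R| * ∑ i, A s i) with hM
  have hms : ∀ s, 0 ≤ matSize (L' s) := fun s => zero_le_one.trans (one_le_matSize (L' s))
  refine (Set.Finite.pi' fun _ : κ => S.finite_le M).subset fun x hx i => ⟨hx.1 i, fun s => ?_⟩
  have hsum : ∀ s, 0 ≤ ∑ i, A s i := fun s => Finset.sum_nonneg fun i _ => (hA s i).le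
  have h1 : ∀ i, S.v s (ev (L s) x i) ≤ |R| * ∑ i, A s i := fun i => by
    refine (abv_le_boxNorm S L hA x s i).trans ?_
    exact mul_le_mul (hx.2.trans (le_abs_self R))
      (Finset.single_le_sum (fun i _ => (hA s i).le) (Finset.mem_univ i)) (hA s i).le (abs_nonneg _)
  have h2 := abv_ev_le (S.v s) (L' s) (by have := hsum s; positivity) h1 i
  rw [ev_ev (hL s)] at h2
  refine h2.trans ?_
  exact Finset.single_le_sum (f := fun s => matSize (L' s) * (|R| * ∑ i, A s i))
    (fun s _ => mul_nonneg (hms s) (mul_nonneg (abs_nonneg _) (hsum s))) (Finset.mem_univ s)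

lemma exists_minimal (hL : ∀ s, L' s * L s = 1) (hA : ∀ s i, 0 < A s i)
    (W : Submodule K (κ → K)) (hW : W ≠ ⊤) :
    ∃ x : κ → K, (∀ i, x i ∈ S.O) ∧ x ∉ W ∧ ∀ y : κ → K, (∀ i, y i ∈ S.O) → y ∉ W →
      boxNorm S L A x ≤ boxNorm S L A y := by
  have hex : ∃ i : κ, (Pi.single i 1 : κ → K) ∉ W := by
    by_contra! hcon
    refine hW (top_le_iff.1 fun x _ => ?_)
    rw [pi_eq_sum_univ' x]
    refine W.sum_mem fun i _ => W.smul_mem _ ?_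
    convert hcon i using 1
  obtain ⟨i, hi⟩ := hex
  set e : κ → K := Pi.single i 1
  have heO : ∀ j, e j ∈ S.O := fun j => by
    by_cases h : j = i
    · subst h; simp [e]
    · simp [e, h]
  have hfin : {x : κ → K | (∀ i, x i ∈ S.O) ∧ x ∉ W ∧ boxNorm S L A x ≤ boxNorm S L A e}.Finite :=
    (finite_boxNorm_le S hL hA (boxNorm S L A e)).subset fun x hx => ⟨hx.1, hx.2.2⟩
  obtain ⟨x, hx, hmin⟩ := Set.exists_min_image _ (boxNorm S L A) hfin ⟨e, heO, hi, le_rfl⟩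
  refine ⟨x, hx.1, hx.2.1, fun y hyO hyW => ?_⟩
  by_cases h : boxNorm S L A y ≤ boxNorm S L A e
  · exact hmin y ⟨hyO, hyW, h⟩
  · exact hx.2.2.trans (not_le.1 h).le

end BoxNorm

end SUnit

namespace SUnit

variable {K : Type*} [Field K] {ι : Type*} [Fintype ι] (S : SData K ι) {N : ℕ}

/-- Successive minima of the box `A`, with vectors `g`, minima `lam`, and for every place a ranking
`r` of the coordinates such that the `C`-comparison with the box `lam (r s j) * A s j` holds. -/
structure Minima (L : ι → Matrix (Fin N) (Fin N) ℤ) (A : ι → Fin N → ℝ) (C : ℝ) where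
  g : ℕ → Fin N → K
  lam : ℕ → ℝ
  r : ι → Fin N ≃ Fin N
  mem : ∀ l < N, ∀ i, g l i ∈ S.O
  notMem : ∀ l < N, g l ∉ Submodule.span K (g '' Set.Iio l)
  pos : ∀ l < N, 0 < lam l
  mono : ∀ l m, l ≤ m → m < N → lam l ≤ lam m
  le : ∀ l < N, ∀ s i, S.v s (ev (L s) (g l) i) ≤ lam l * A s i
  ge : ∀ l < N, ∀ x : Fin N → K, (∀ i, x i ∈ S.O) → x ∉ Submodule.span K (g '' Set.Iio l) →
    lam l ≤ boxNorm S L A x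
  one_le : 1 ≤ C * ∏ s, ∏ j, (lam (r s j) * A s j) ^ S.n s
  le_const : ∏ s, ∏ j, (lam (r s j) * A s j) ^ S.n s ≤ C
  exists_large : ∀ x : Fin N → K, (∀ i, x i ∈ S.O) → x ≠ 0 → ∃ l < N,
    x ∈ Submodule.span K (g '' Set.Iio (l + 1)) ∧ x ∉ Submodule.span K (g '' Set.Iio l) ∧
      ∃ s j, (r s j : ℕ) ≤ l ∧ lam l * A s j ≤ C * S.v s (ev (L s) x j)

lemma det_matrix_ne_zero {h : Fin N → Fin N → K} (hli : LinearIndependent K h) :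
    (Matrix.of fun j l => h l j).det ≠ 0 := by
  have h1 : IsUnit (Matrix.of fun j l => h l j) :=
    Matrix.linearIndependent_cols_iff_isUnit.1 hli
  exact ((Matrix.isUnit_iff_isUnit_det _).1 h1).ne_zero

/-- Lower bound in the second theorem on successive minima. -/
lemma one_le_of_linearIndependent (L L' : ι → Matrix (Fin N) (Fin N) ℤ)
    (hL : ∀ s, L' s * L s = 1) {h : Fin N → Fin N → K} (hli : LinearIndependent K h)
    (hO : ∀ l i, h l i ∈ S.O) {A : ι → Fin N → ℝ} {lam : Fin N → ℝ}
    (hv : ∀ l s j, S.v s (ev (L s) (h l) j) ≤ A s j * lam l) :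
    1 ≤ ∏ s, ((N.factorial : ℝ) * ((∏ j, A s j) * ∏ l, lam l)) ^ S.n s := by
  set H : Matrix (Fin N) (Fin N) K := Matrix.of fun j l => h l j with hH
  have hD : H.det ∈ S.O := by
    rw [Matrix.det_apply]
    refine S.O.sum_mem fun σ _ => ?_
    rw [Units.smul_def]
    exact S.O.zsmul_mem (S.O.prod_mem fun i _ => hO _ _) _
  refine (S.one_le _ hD (det_matrix_ne_zero hli)).trans ?_
  refine Finset.prod_le_prod (fun s _ => pow_nonneg ((S.v s).nonneg _) _) fun s _ =>
    pow_le_pow_left₀ ((S.v s).nonneg _) ?_ _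
  have h1 := abv_det_le (S.v s) ((L s).map (Int.cast : ℤ → K) * H) (A s) lam
    fun j l => hv l s j
  rwa [Matrix.det_mul, (S.v s).map_mul, abv_det_intCast (S.v s) (hL s), one_mul,
    Fintype.card_fin] at h1

/-- Minkowski's second theorem together with Davenport's lemma. -/
theorem exists_minima [Nonempty ι] (L L' : ι → Matrix (Fin N) (Fin N) ℤ) (hL : ∀ s, L' s * L s = 1) :
    ∃ C : ℝ, 1 ≤ C ∧ ∀ A : ι → Fin N → ℝ, (∀ s i, 0 < A s i) → Nonempty (Minima S L A C) := by
  classical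
  obtain ⟨c, hc, hmink⟩ := S.minkowski N L L' hL
  set C1 : ℝ := 2 * N.factorial with hC1
  have hfac : (1 : ℝ) ≤ N.factorial := by
    exact_mod_cast Nat.one_le_iff_ne_zero.2 (Nat.factorial_ne_zero _)
  set C2 : ℝ := c * ∏ s, ∏ _j : Fin N, (2 * C1) ^ S.n s with hC2
  set C3 : ℝ := ∏ s, (N.factorial : ℝ) ^ S.n s with hC3
  have hC20 : 0 ≤ C2 := by positivity
  have hC31 : 1 ≤ C3 := by
    rw [hC3, Finset.prod_pow_eq_pow_sum]
    exact one_le_pow₀ hfac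
  refine ⟨C1 + C2 + C3, by linarith, fun A hA => ?_⟩
  have hex : ∀ W : Submodule K (Fin N → K), ∃ x : Fin N → K, W ≠ ⊤ → (∀ i, x i ∈ S.O) ∧ x ∉ W ∧
      ∀ y : Fin N → K, (∀ i, y i ∈ S.O) → y ∉ W → boxNorm S L A x ≤ boxNorm S L A y := by
    intro W
    by_cases hW : W = ⊤
    · exact ⟨0, fun h => absurd hW h⟩
    · obtain ⟨x, hx⟩ := exists_minimal S hL hA W hW
      exact ⟨x, fun _ => hx⟩
  choose F hF using hex
  obtain ⟨g, hg⟩ := exists_flag F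
  set W : ℕ → Submodule K (Fin N → K) := fun l => Submodule.span K (g '' Set.Iio l) with hW
  have hWmono : Monotone W := fun _ _ h => flag_mono g h
  have hmin : ∀ l < N, (∀ i, g l i ∈ S.O) ∧ g l ∉ W l ∧
      ∀ y : Fin N → K, (∀ i, y i ∈ S.O) → y ∉ W l → boxNorm S L A (g l) ≤ boxNorm S L A y := by
    intro l hl
    rw [hg l]
    exact hF _ (flag_ne_top g (by simpa using hl))
  obtain ⟨htop, hli⟩ := flag_top g (N := N) (by simp) fun l hl => (hmin l hl).2.1
  set lam : ℕ → ℝ := fun l => boxNorm S L A (g l) with hlam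
  have hle : ∀ l s i, S.v s (ev (L s) (g l) i) ≤ lam l * A s i := fun l s i =>
    abv_le_boxNorm S L hA _ _ _
  have hpos : ∀ l < N, 0 < lam l := fun l hl => by
    refine lt_of_le_of_ne (boxNorm_nonneg S L _) fun h0 => (hmin l hl).2.1 ?_
    have h1 : ∀ s i, ev (L s) (g l) i = 0 := fun s i => by
      have := hle l s i
      rw [← h0, zero_mul] at this
      exact (S.v s).eq_zero.1 (this.antisymm ((S.v s).nonneg _))
    obtain ⟨s⟩ := ‹Nonempty ι›
    rw [← ev_ev (hL s) (g l), show ev (L s) (g l) = 0 from funext (h1 s), map_zero]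
    exact zero_mem _
  have hmono : ∀ l m, l ≤ m → m < N → lam l ≤ lam m := fun l m h hm =>
    (hmin l (by omega)).2.2 _ (hmin m hm).1 fun hx => (hmin m hm).2.1 (hWmono h hx)
  have hdav : ∀ s, ∃ σ : Fin N ≃ Fin N, ∀ l : ℕ, ∀ x ∈ W l, ∀ B : ℝ, 0 ≤ B →
        (∀ a : Fin N, a.1 < l → S.v s (ev (L s) x (σ a)) ≤ B * A s (σ a)) →
        ∀ i, S.v s (ev (L s) x i) ≤ N.factorial * (B * A s i) := by
    intro s
    obtain ⟨τ, hτ, h⟩ := davenport (S.v s) (fun i => (LinearMap.proj i).comp (ev (L s))) (A s)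
      (hA s) W hWmono (finrank_flag_le g) N Finset.univ (by simp)
    have hsurj : Function.Surjective τ := fun i => (hτ i).1 (Finset.mem_univ i)
    exact ⟨Equiv.ofBijective τ (Finite.injective_iff_surjective.2 hsurj |>.bijective_of_finite),
      fun l x hx B hB hb i => h l x hx B hB hb i (Finset.mem_univ i)⟩
  choose σ hσ using hdav
  have hlarge : ∀ x : Fin N → K, (∀ i, x i ∈ S.O) → x ≠ 0 → ∃ l < N, x ∈ W (l + 1) ∧ x ∉ W l ∧
      ∃ s j, ((σ s).symm j : ℕ) ≤ l ∧ lam l * A s j ≤ C1 * S.v s (ev (L s) x j) := by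
    intro x hxO hx0
    have hex : ∃ l, x ∈ W l := ⟨N, by rw [hW]; simp only [htop]; trivial⟩
    obtain ⟨l, hl⟩ : ∃ l, Nat.find hex = l + 1 := by
      refine Nat.exists_eq_succ_of_ne_zero fun h0 => hx0 ?_
      have := Nat.find_spec hex
      rw [h0] at this
      simpa [hW] using this
    have hxl : x ∈ W (l + 1) := hl ▸ Nat.find_spec hex
    have hxl' : x ∉ W l := Nat.find_min hex (by omega)
    have hlN : l < N := by
      by_contra hcon
      exact hxl' (hWmono (not_lt.1 hcon) (by rw [hW]; simp only [htop]; trivial))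
    refine ⟨l, hlN, hxl, hxl', ?_⟩
    by_contra! hcon
    have hl0 := hpos l hlN
    have h1 : boxNorm S L A x ≤ lam l / 2 := by
      rw [boxNorm_le_iff S L hA (by positivity)]
      intro s i
      have h2 := hσ s (l + 1) x hxl (lam l / C1) (by positivity) (fun a ha => ?_) i
      · refine h2.trans_eq ?_
        rw [hC1]
        field_simp
      · have h3 := hcon s (σ s a) (by simpa using Nat.lt_succ_iff.1 ha)
        rw [div_mul_eq_mul_div, le_div_iff₀ (by positivity)]
        linarith
    have := (hmin l hlN).2.2 x hxO hxl'
    simp only [hlam] at h1 hl0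
    linarith
  have hB0 : ∀ s j, 0 < lam ((σ s).symm j) * A s j := fun s j => mul_pos (hpos _ (Fin.is_lt _)) (hA s j)
  have hP0 : 0 < ∏ s, ∏ j, (lam ((σ s).symm j) * A s j) ^ S.n s :=
    Finset.prod_pos fun s _ => Finset.prod_pos fun j _ => pow_pos (hB0 s j) _
  refine ⟨⟨g, lam, fun s => (σ s).symm, fun l hl => (hmin l hl).1, fun l hl => (hmin l hl).2.1, hpos,
    hmono, fun l _ => hle l, fun l hl => (hmin l hl).2.2, ?_, ?_, ?_⟩⟩
  · have h1 := one_le_of_linearIndependent S L L' hL hli (fun l => (hmin l l.2).1)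
      (A := A) (lam := fun l : Fin N => lam l) (fun l s j => (hle l s j).trans_eq (mul_comm _ _))
    have h2 : ∏ s, ((N.factorial : ℝ) * ((∏ j, A s j) * ∏ l : Fin N, lam l)) ^ S.n s =
        C3 * ∏ s, ∏ j, (lam ((σ s).symm j) * A s j) ^ S.n s := by
      rw [hC3, ← Finset.prod_mul_distrib]
      refine Finset.prod_congr rfl fun s _ => ?_
      rw [mul_pow, Finset.prod_pow, Finset.prod_mul_distrib,
        Equiv.prod_comp (σ s).symm (fun l : Fin N => lam l), mul_comm (∏ l : Fin N, lam l)]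
    rw [h2] at h1
    refine h1.trans (mul_le_mul_of_nonneg_right ?_ hP0.le)
    linarith
  · by_contra! hcon
    obtain ⟨x, hx0, hxO, hx⟩ := hmink (fun s j => lam ((σ s).symm j) * A s j / (2 * C1))
      (fun s j => div_pos (hB0 s j) (by positivity)) (by
        simp_rw [div_pow, Finset.prod_div_distrib]
        rw [le_div_iff₀ (by positivity)]
        linarith)
    obtain ⟨l, hlN, -, -, s, j, hj, hlj⟩ := hlarge x hxO hx0
    have h1 := hx s j
    rw [← ev_apply, le_div_iff₀ (by positivity)] at h1
    have h2 := mul_le_mul_of_nonneg_right (hmono _ _ hj hlN) (hA s j).le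
    have h3 : 0 < lam l * A s j := mul_pos (hpos l hlN) (hA s j)
    linarith
  · intro x hxO hx0
    obtain ⟨l, hlN, h1, h2, s, j, h3, h4⟩ := hlarge x hxO hx0
    refine ⟨l, hlN, h1, h2, s, j, h3, h4.trans (mul_le_mul_of_nonneg_right ?_ ((S.v s).nonneg _))⟩
    linarith

end SUnit

namespace SUnit

variable {K : Type*} [Field K] {ι : Type*} [Fintype ι] (S : SData K ι) {N : ℕ}

variable {S} in
/-- The box given by the successive minima with the sides of rank at least `k` shrunk by `t`. -/
noncomputable def Minima.gapBox {L : ι → Matrix (Fin N) (Fin N) ℤ} {A : ι → Fin N → ℝ} {C : ℝ}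
    (M : Minima S L A C) (k : ℕ) (t : ℝ) (s : ι) (j : Fin N) : ℝ :=
  if (M.r s j : ℕ) < k then M.lam (M.r s j) * A s j else M.lam (M.r s j) * A s j / t

section
variable {S} {L L' : ι → Matrix (Fin N) (Fin N) ℤ} {A : ι → Fin N → ℝ} {C : ℝ}
  (M : Minima S L A C)

lemma Minima.ne_zero {l : ℕ} (hl : l < N) : M.g l ≠ 0 := fun h => M.notMem l hl (by
  rw [h]; exact zero_mem _)

lemma Minima.side_pos (hA : ∀ s i, 0 < A s i) (s : ι) (j : Fin N) :
    0 < M.lam (M.r s j) * A s j := mul_pos (M.pos _ (Fin.is_lt _)) (hA s j)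

lemma Minima.gapBox_pos (hA : ∀ s i, 0 < A s i) {k : ℕ} {t : ℝ} (ht : 0 < t) (s : ι) (j : Fin N) :
    0 < M.gapBox k t s j := by
  have := M.side_pos hA s j
  unfold Minima.gapBox
  split_ifs
  · exact this
  · positivity

lemma Minima.gapBox_le (hA : ∀ s i, 0 < A s i) {k : ℕ} {t : ℝ} (ht : 1 ≤ t) (s : ι) (j : Fin N) :
    M.gapBox k t s j ≤ M.lam (M.r s j) * A s j := by
  have := M.side_pos hA s j
  unfold Minima.gapBox
  split_ifs
  · exact le_rfl
  · exact div_le_self this.le ht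

lemma Minima.le_boxNorm_gapBox (hA : ∀ s i, 0 < A s i) (hC : 1 ≤ C) {k : ℕ} (hk0 : 0 < k) {t : ℝ}
    (ht : 1 ≤ t) (hgap : k < N → t * M.lam (k - 1) ≤ M.lam k) {x : Fin N → K}
    (hxO : ∀ i, x i ∈ S.O) (hx0 : x ≠ 0) :
    1 ≤ C * boxNorm S L (M.gapBox k t) x ∧ (x ∉ Submodule.span K (M.g '' Set.Iio k) →
      t ≤ C * boxNorm S L (M.gapBox k t) x) := by
  have ht0 : 0 < t := by linarith
  obtain ⟨l, hlN, hx1, hx2, s, j, hrj, hle⟩ := M.exists_large x hxO hx0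
  have hν := abv_le_boxNorm S L (M.gapBox_pos hA (k := k) ht0) x s j
  set ν := boxNorm S L (M.gapBox k t) x
  have hν0 : 0 ≤ ν := boxNorm_nonneg S L x
  have hCν : 0 ≤ C * ν := by positivity
  have hlA : 0 < M.lam l * A s j := mul_pos (M.pos l hlN) (hA s j)
  have h1 : M.lam l * A s j ≤ C * ν * M.gapBox k t s j := by
    refine hle.trans ?_
    rw [mul_assoc]
    exact mul_le_mul_of_nonneg_left hν (by linarith)
  have h2 : M.lam (M.r s j) * A s j ≤ M.lam l * A s j :=
    mul_le_mul_of_nonneg_right (M.mono _ _ hrj hlN) (hA s j).le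
  refine ⟨?_, fun hxk => ?_⟩
  · refine le_of_mul_le_mul_right ?_ hlA
    rw [one_mul]
    exact h1.trans (mul_le_mul_of_nonneg_left ((M.gapBox_le hA ht s j).trans h2) hCν)
  · have hkl : k ≤ l := by
      by_contra hcon
      exact hxk (flag_mono M.g (by omega) hx1)
    have h3 : M.gapBox k t s j ≤ M.lam l * A s j / t := by
      unfold Minima.gapBox
      split_ifs with hr
      · rw [le_div_iff₀ ht0]
        have h4 := M.mono (M.r s j) (k - 1) (by omega) (by omega)
        have h5 := hgap (by omega)
        have h6 := M.mono k l hkl hlN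
        have h7 : M.lam (M.r s j) * t ≤ M.lam l := by
          have := mul_le_mul_of_nonneg_left h4 ht0.le
          linarith
        have := mul_le_mul_of_nonneg_right h7 (hA s j).le
        linarith
      · exact div_le_div_of_nonneg_right h2 ht0.le
    have h4 := h1.trans (mul_le_mul_of_nonneg_left h3 hCν)
    rw [mul_div_assoc', le_div_iff₀ ht0] at h4
    refine le_of_mul_le_mul_right ?_ hlA
    linarith

lemma le_of_pow_le {y C : ℝ} {n : ℕ} (hn : 0 < n) (hC : 1 ≤ C) (h : y ^ n ≤ C) : y ≤ C := by
  by_contra! hcon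
  have : y ≤ y ^ n := le_self_pow₀ (by linarith) hn.ne'
  linarith

lemma card_rank_ge (e : Fin N ≃ Fin N) {k : ℕ} (hk : k ≤ N) :
    (Finset.univ.filter fun j => ¬ (e j : ℕ) < k).card = N - k := by
  have h1 : (Finset.univ.filter fun j => ¬ (e j : ℕ) < k).card =
      (Finset.univ.filter fun j : Fin N => ¬ (j : ℕ) < k).card := by
    refine Finset.card_equiv e fun j => by simp
  have h2 := Finset.card_filter_add_card_filter_not (s := (Finset.univ : Finset (Fin N)))
    (fun j : Fin N => (j : ℕ) < k)
  have h3 : (Finset.univ.filter fun j : Fin N => (j : ℕ) < k).card = k := by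
    rw [Fin.card_filter_val_lt]
    omega
  rw [Finset.card_univ, Fintype.card_fin] at h2
  omega

lemma Minima.prod_lam_gapBox_le [Nonempty ι] (hC : 1 ≤ C) {k : ℕ}
    (hk : k ≤ N) {t : ℝ} (ht : 1 ≤ t) (M' : Minima S L (M.gapBox k t) C) :
    ∏ l : Fin N, M'.lam l ≤ C ^ 2 * t ^ (N - k) := by
  classical
  have ht0 : 0 < t := by linarith
  set P := ∏ l : Fin N, M'.lam l with hP
  have hP0 : 0 < P := Finset.prod_pos fun l _ => M'.pos _ l.2
  have h1 : ∀ s, ∏ j, (M'.lam (M'.r s j) * M.gapBox k t s j) ^ S.n s =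
      (P / t ^ (N - k)) ^ S.n s * ∏ j, (M.lam (M.r s j) * A s j) ^ S.n s := by
    intro s
    rw [Finset.prod_pow, Finset.prod_pow, Finset.prod_mul_distrib,
      Equiv.prod_comp (M'.r s) (fun l : Fin N => M'.lam l), ← mul_pow]
    congr 1
    have h2 : ∏ j, M.gapBox k t s j = (∏ j, M.lam (M.r s j) * A s j) / t ^ (N - k) := by
      rw [← card_rank_ge (M.r s) hk, ← Finset.prod_const, Finset.prod_filter,
        ← Finset.prod_div_distrib]
      refine Finset.prod_congr rfl fun j _ => ?_
      unfold Minima.gapBox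
      split_ifs
      · simp
      · rfl
    rw [h2]
    ring
  have h2 := M'.le_const
  simp_rw [h1] at h2
  rw [Finset.prod_mul_distrib, Finset.prod_pow_eq_pow_sum] at h2
  set n := ∑ s, S.n s with hn
  have hn0 : 0 < n := Finset.sum_pos (fun s _ => S.n_pos s) Finset.univ_nonempty
  set Q := ∏ s, ∏ j, (M.lam (M.r s j) * A s j) ^ S.n s
  have h3 : 1 ≤ C * Q := M.one_le
  have hy : 0 ≤ P / t ^ (N - k) := by positivity
  have h4 : (P / t ^ (N - k)) ^ n ≤ C ^ 2 := by
    calc (P / t ^ (N - k)) ^ n ≤ (P / t ^ (N - k)) ^ n * (C * Q) :=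
          le_mul_of_one_le_right (by positivity) h3
      _ = C * ((P / t ^ (N - k)) ^ n * Q) := by ring
      _ ≤ C * C := mul_le_mul_of_nonneg_left h2 (by linarith)
      _ = C ^ 2 := by ring
  have h5 := le_of_pow_le hn0 (one_le_pow₀ hC) h4
  rwa [div_le_iff₀ (by positivity)] at h5

/-- Across a gap in the successive minima, the space spanned by the first `k` minimal vectors is
spanned by integral points of the box with shrunk sides. -/
lemma Minima.span_gapBox [Nonempty ι] (hA : ∀ s i, 0 < A s i) (hC : 1 ≤ C) {k : ℕ} (hk0 : 0 < k)
    (hk : k ≤ N) {t : ℝ} (ht : 1 ≤ t) (hgap : k < N → t * M.lam (k - 1) ≤ M.lam k)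
    (htC : k < N → C ^ (N + 2) < t) (M' : Minima S L (M.gapBox k t) C) :
    Submodule.span K (M.g '' Set.Iio k) ≤ Submodule.span K
      {x | x ∈ Submodule.span K (M.g '' Set.Iio k) ∧ (∀ i, x i ∈ S.O) ∧
        ∀ s j, S.v s (ev (L s) x j) ≤ C ^ (N + 1) * M.gapBox k t s j} := by
  classical
  have ht0 : 0 < t := by linarith
  have hC0 : 0 < C := by linarith
  set W := Submodule.span K (M.g '' Set.Iio k) with hW
  have hBpos := M.gapBox_pos hA (k := k) ht0
  set f : Fin N → ℝ := fun l => if M'.g l ∈ W then C⁻¹ else t * C⁻¹ with hf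
  have hf0 : ∀ l, 0 < f l := fun l => by
    simp only [hf]
    split_ifs <;> positivity
  have hfμ : ∀ l : Fin N, f l ≤ M'.lam l := by
    intro l
    have h1 := M.le_boxNorm_gapBox hA hC hk0 ht hgap (M'.mem l l.2) (M'.ne_zero l.2)
    have h2 : boxNorm S L (M.gapBox k t) (M'.g l) ≤ M'.lam l :=
      (boxNorm_le_iff S L hBpos (M'.pos l l.2).le).2 (M'.le l l.2)
    have h3 := mul_le_mul_of_nonneg_left h2 hC0.le
    simp only [hf]
    split_ifs with h
    · rw [inv_le_iff_one_le_mul₀ hC0]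
      linarith [h1.1]
    · rw [← div_eq_mul_inv, div_le_iff₀ hC0]
      linarith [h1.2 h]
  set T := Finset.univ.filter fun l : Fin N => M'.g l ∈ W with hT
  have hli' := (flag_top M'.g (N := N) (by simp) M'.notMem).2
  have hliT : LinearIndependent K (fun l : T => M'.g l) := hli'.comp _ Subtype.val_injective
  have hspan : Submodule.span K (Set.range fun l : T => M'.g l) ≤ W := by
    rw [Submodule.span_le]
    rintro _ ⟨l, rfl⟩
    exact (Finset.mem_filter.1 l.2).2
  have hfr : Module.finrank K (Submodule.span K (Set.range fun l : T => M'.g l)) = T.card := by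
    rw [finrank_span_eq_card hliT, Fintype.card_coe]
  have hTk : T.card ≤ k := by
    rw [← hfr]
    exact (Submodule.finrank_mono hspan).trans (finrank_flag_le M.g k)
  have hTN : T.card ≤ N := hTk.trans hk
  have hprodf : ∏ l, f l = t ^ (N - T.card) * C⁻¹ ^ N := by
    have h1 : ∀ l, f l = (if M'.g l ∈ W then 1 else t) * C⁻¹ := fun l => by
      simp only [hf]
      split_ifs
      · rw [one_mul]
      · rfl
    simp_rw [h1]
    rw [Finset.prod_mul_distrib, Finset.prod_const, Finset.card_univ, Fintype.card_fin,
      Finset.prod_ite, Finset.prod_const_one, one_mul, Finset.prod_const]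
    congr 2
    have := Finset.card_filter_add_card_filter_not (s := (Finset.univ : Finset (Fin N)))
      (fun l : Fin N => M'.g l ∈ W)
    rw [Finset.card_univ, Fintype.card_fin] at this
    change T.card + _ = N at this
    omega
  have hP := M.prod_lam_gapBox_le hC hk ht M'
  have hfP : ∏ l, f l ≤ ∏ l : Fin N, M'.lam l :=
    Finset.prod_le_prod (fun l _ => (hf0 l).le) fun l _ => hfμ l
  have hTeq : T.card = k := by
    refine hTk.antisymm ?_
    by_contra! hlt
    rcases hk.lt_or_eq with hkN | hkN
    · have h1 := hfP.trans hP
      rw [hprodf, inv_pow, ← div_eq_mul_inv, div_le_iff₀ (by positivity)] at h1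
      have h2 : t * t ^ (N - k) ≤ t ^ (N - T.card) := by
        rw [← pow_succ']
        exact pow_le_pow_right₀ ht (by omega)
      have h3 : t * t ^ (N - k) ≤ C ^ (N + 2) * t ^ (N - k) := by
        refine (h2.trans h1).trans_eq ?_
        ring
      have h4 := le_of_mul_le_mul_right h3 (by positivity)
      linarith [htC hkN]
    · have : W = ⊤ := by
        rw [hW, hkN]
        exact (flag_top M.g (N := N) (by simp) M.notMem).1
      rw [hT, Finset.filter_true_of_mem (fun l _ => by rw [this]; trivial), Finset.card_univ,
        Fintype.card_fin] at hlt
      omega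
  have hμ : ∀ l ∈ T, M'.lam l ≤ C ^ (N + 1) := by
    intro l hl
    have h1 : M'.lam l * ∏ l, f l ≤ C⁻¹ * ∏ l : Fin N, M'.lam l := by
      have hfl : f l = C⁻¹ := by
        simp only [hf]
        rw [if_pos (Finset.mem_filter.1 hl).2]
      rw [← Finset.mul_prod_erase _ _ (Finset.mem_univ l),
        ← Finset.mul_prod_erase Finset.univ (fun l : Fin N => M'.lam l) (Finset.mem_univ l), hfl]
      have : ∏ l ∈ Finset.univ.erase l, f l ≤ ∏ l ∈ Finset.univ.erase l, M'.lam l :=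
        Finset.prod_le_prod (fun l _ => (hf0 l).le) fun l _ => hfμ l
      have h2 := mul_le_mul_of_nonneg_left this (mul_pos (M'.pos l l.2) (inv_pos.2 hC0)).le
      linarith
    have h2 := h1.trans (mul_le_mul_of_nonneg_left hP (inv_pos.2 hC0).le)
    rw [hprodf, hTeq, inv_pow] at h2
    have h3 : M'.lam l * t ^ (N - k) ≤ C ^ (N + 1) * t ^ (N - k) := by
      have h4 := mul_le_mul_of_nonneg_right h2 (pow_pos hC0 N).le
      calc _ = M'.lam l * (t ^ (N - k) * (C ^ N)⁻¹) * C ^ N := by field_simp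
        _ ≤ _ := h4
        _ = _ := by field_simp; ring
    exact le_of_mul_le_mul_right h3 (by positivity)
  have hWT : Submodule.span K (Set.range fun l : T => M'.g l) = W :=
    Submodule.eq_of_le_of_finrank_le hspan (by rw [hfr, hTeq]; exact finrank_flag_le M.g k)
  rw [← hWT]
  refine Submodule.span_mono ?_
  rintro _ ⟨l, rfl⟩
  refine ⟨Submodule.subset_span ⟨l, rfl⟩, M'.mem l l.1.2, fun s j => (M'.le l l.1.2 s j).trans ?_⟩
  exact mul_le_mul_of_nonneg_right (hμ l l.2) (hBpos s j).le

end

/-- Existence of reduced bases adapted to a gap in the successive minima. -/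
theorem exists_gap_basis [Nonempty ι] (L L' : ι → Matrix (Fin N) (Fin N) ℤ)
    (hL : ∀ s, L' s * L s = 1) : ∃ C : ℝ, 1 ≤ C ∧ ∃ C' : ℝ, 1 ≤ C' ∧ ∀ A : ι → Fin N → ℝ,
      (∀ s i, 0 < A s i) → ∃ M : Minima S L A C, ∀ (k : ℕ) (t : ℝ), 0 < k → k < N → C' < t →
        t * M.lam (k - 1) ≤ M.lam k → ∃ h : ℕ → Fin N → K, (∀ l < N, ∀ i, h l i ∈ S.O) ∧
          (∀ l < N, h l ∉ Submodule.span K (h '' Set.Iio l)) ∧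
          Submodule.span K (h '' Set.Iio k) = Submodule.span K (M.g '' Set.Iio k) ∧
          (∀ l < N, ∀ s j, S.v s (ev (L s) (h l) j) ≤ C' * (M.lam (M.r s j) * A s j)) ∧
          ∀ l < k, ∀ s j, S.v s (ev (L s) (h l) j) ≤ C' * M.gapBox k t s j := by
  classical
  obtain ⟨C, hC, hmin⟩ := exists_minima S L L' hL
  refine ⟨C, hC, C ^ (N + 2), one_le_pow₀ hC, fun A hA => ?_⟩
  obtain ⟨M⟩ := hmin A hA
  refine ⟨M, fun k t hk0 hkN ht hgap => ?_⟩
  have ht1 : 1 ≤ t := (one_le_pow₀ hC).trans ht.le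
  have ht0 : 0 < t := by linarith
  obtain ⟨M1⟩ := hmin _ (M.gapBox_pos hA (k := k) ht0)
  obtain ⟨M2⟩ := hmin _ (M.gapBox_pos hA (k := N) (one_pos : (0 : ℝ) < 1))
  have h1 := M.span_gapBox hA hC hk0 hkN.le ht1 (fun _ => hgap) (fun _ => ht) M1
  have h2 := M.span_gapBox hA hC (hk0.trans hkN) le_rfl le_rfl (fun h => absurd h (lt_irrefl _))
    (fun h => absurd h (lt_irrefl _)) M2
  set W := Submodule.span K (M.g '' Set.Iio k) with hW
  set T1 := {x | x ∈ W ∧ (∀ i, x i ∈ S.O) ∧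
        ∀ s j, S.v s (ev (L s) x j) ≤ C ^ (N + 1) * M.gapBox k t s j} with hT1
  set T2 : Set (Fin N → K) := {x | (∀ i, x i ∈ S.O) ∧
        ∀ s j, S.v s (ev (L s) x j) ≤ C ^ (N + 2) * (M.lam (M.r s j) * A s j)} with hT2
  have hCC : C ^ (N + 1) ≤ C ^ (N + 2) := pow_le_pow_right₀ hC (by omega)
  have hC0 : 0 < C := by linarith
  have hT12 : T1 ⊆ T2 := fun x hx => ⟨hx.2.1, fun s j => (hx.2.2 s j).trans
    (mul_le_mul hCC (M.gapBox_le hA ht1 s j) (M.gapBox_pos hA ht0 s j).le (by positivity))⟩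
  have hT2top : Submodule.span K T2 = ⊤ := by
    rw [← top_le_iff, ← (flag_top M.g (N := N) (by simp) M.notMem).1]
    refine h2.trans (Submodule.span_mono ?_)
    rintro x ⟨-, hxO, hx⟩
    exact ⟨hxO, fun s j => (hx s j).trans
      (mul_le_mul hCC (M.gapBox_le hA le_rfl s j) (M.gapBox_pos hA one_pos s j).le (by positivity))⟩
  have hfrW : Module.finrank K W = k := finrank_flag_eq M.g M.notMem hkN.le
  have hex : ∀ X : Submodule K (Fin N → K), ∃ x, X ≠ ⊤ → x ∈ T2 ∧ x ∉ X ∧ (¬ W ≤ X → x ∈ T1) := by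
    intro X
    by_cases hX : W ≤ X
    · by_cases hXt : X = ⊤
      · exact ⟨0, fun h => absurd hXt h⟩
      · obtain ⟨x, hx, hxX⟩ : ∃ x ∈ T2, x ∉ X := by
          by_contra! hcon
          exact hXt (top_le_iff.1 (hT2top ▸ Submodule.span_le.2 hcon))
        exact ⟨x, fun _ => ⟨hx, hxX, fun h => absurd hX h⟩⟩
    · obtain ⟨x, hx, hxX⟩ : ∃ x ∈ T1, x ∉ X := by
        by_contra! hcon
        exact hX (h1.trans (Submodule.span_le.2 hcon))
      exact ⟨x, fun _ => ⟨hT12 hx, hxX, fun _ => hx⟩⟩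
  choose F hF using hex
  obtain ⟨h, hh⟩ := exists_flag F
  have hN : ∀ l < N, h l ∈ T2 ∧ h l ∉ Submodule.span K (h '' Set.Iio l) := fun l hl => by
    have := hF _ (flag_ne_top (K := K) h (n := l) (by simpa using hl))
    rw [← hh] at this
    exact ⟨this.1, this.2.1⟩
  have hk : ∀ l < k, h l ∈ T1 := fun l hl => by
    have := hF _ (flag_ne_top (K := K) h (n := l) (by simpa using hl.trans hkN))
    rw [← hh] at this
    refine this.2.2 fun hle => ?_
    have h3 := (Submodule.finrank_mono hle).trans (finrank_flag_le h l)
    omega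
  refine ⟨h, fun l hl => (hN l hl).1.1, fun l hl => (hN l hl).2, ?_, fun l hl => (hN l hl).1.2,
    fun l hl s j => ((hk l hl).2.2 s j).trans
      (mul_le_mul_of_nonneg_right hCC (M.gapBox_pos hA ht0 s j).le)⟩
  refine Submodule.eq_of_le_of_finrank_le ?_ ?_
  · rw [Submodule.span_le]
    rintro _ ⟨l, hl, rfl⟩
    exact (hk l hl).1
  · rw [hfrW, finrank_flag_eq h (fun l hl => (hN l hl).2) hkN.le]

end SUnit

namespace SUnit

section Compound
variable {R : Type*} [CommRing R] {N p : ℕ}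

/-- Order embedding attached to a `p`-element subset. -/
def subsetEmb (I : {I : Finset (Fin N) // I.card = p}) : Fin p ↪o Fin N := I.1.orderEmbOfFin I.2

lemma exists_subsetEmb_iff (I : {I : Finset (Fin N) // I.card = p}) (i : Fin N) :
    (∃ a, subsetEmb I a = i) ↔ i ∈ I.1 := by
  have := Finset.range_orderEmbOfFin I.1 I.2
  rw [← Finset.mem_coe, ← this]
  rfl

lemma subsetEmb_mem (I : {I : Finset (Fin N) // I.card = p}) (a : Fin p) : subsetEmb I a ∈ I.1 :=
  (exists_subsetEmb_iff I _).1 ⟨a, rfl⟩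

/-- Every injective family of indices is a rearrangement of a subset. -/
lemma exists_eq_subsetEmb_comp {f : Fin p → Fin N} (hf : Function.Injective f) :
    ∃ (I : {I : Finset (Fin N) // I.card = p}) (σ : Equiv.Perm (Fin p)), f = subsetEmb I ∘ σ := by
  classical
  set I : {I : Finset (Fin N) // I.card = p} :=
    ⟨Finset.univ.image f, by rw [Finset.card_image_of_injective _ hf]; simp⟩ with hI
  have h : ∀ a, ∃ b, subsetEmb I b = f a := fun a =>
    (exists_subsetEmb_iff I _).2 (Finset.mem_image_of_mem f (Finset.mem_univ a))
  choose σ hσ using h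
  have hinj : Function.Injective σ := fun a b hab => hf (by rw [← hσ, ← hσ, hab])
  exact ⟨I, Equiv.ofBijective σ (Finite.injective_iff_bijective.1 hinj), funext fun a => (hσ a).symm⟩

/-- The `p`-th compound matrix, whose entries are the `p × p` minors. -/
def compound (p : ℕ) (M : Matrix (Fin N) (Fin N) R) :
    Matrix {I : Finset (Fin N) // I.card = p} {I : Finset (Fin N) // I.card = p} R :=
  Matrix.of fun I J => (M.submatrix (subsetEmb I) (subsetEmb J)).det

lemma compound_apply (M : Matrix (Fin N) (Fin N) R) (I J : {I : Finset (Fin N) // I.card = p}) :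
    compound p M I J = (M.submatrix (subsetEmb I) (subsetEmb J)).det := rfl

lemma det_mul_eq_sum (A : Matrix (Fin p) (Fin N) R) (B : Matrix (Fin N) (Fin p) R) :
    (A * B).det = ∑ f : Fin p → Fin N, (∏ i, A i (f i)) * (B.submatrix f id).det := by
  have h1 : (A * B) = fun i => ∑ j, A i j • B j := by
    ext i k
    simp [Matrix.mul_apply]
  have h2 : (A * B).det = Matrix.detRowAlternating fun i => ∑ j, A i j • B j := by
    rw [← h1]; rfl
  rw [h2]
  change (Matrix.detRowAlternating (R := R) (n := Fin p)).toMultilinearMap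
    (fun i => ∑ j, A i j • B j) = _
  rw [MultilinearMap.map_sum]
  refine Finset.sum_congr rfl fun f _ => ?_
  rw [MultilinearMap.map_smul_univ, smul_eq_mul]
  rfl

/-- The Cauchy-Binet formula. -/
lemma cauchy_binet (A : Matrix (Fin p) (Fin N) R) (B : Matrix (Fin N) (Fin p) R) :
    (A * B).det = ∑ I : {I : Finset (Fin N) // I.card = p},
      (A.submatrix id (subsetEmb I)).det * (B.submatrix (subsetEmb I) id).det := by
  classical
  rw [det_mul_eq_sum]
  rw [← Fintype.sum_of_injective
    (fun x : {I : Finset (Fin N) // I.card = p} × Equiv.Perm (Fin p) => subsetEmb x.1 ∘ x.2)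
    (f := fun x => (∏ i, A i (subsetEmb x.1 (x.2 i))) *
      (B.submatrix (subsetEmb x.1 ∘ x.2) id).det) ?_ _ ?_ fun x => rfl]
  · rw [Fintype.sum_prod_type]
    refine Finset.sum_congr rfl fun I _ => ?_
    have h1 : ∀ σ : Equiv.Perm (Fin p), (B.submatrix (subsetEmb I ∘ σ) id).det =
        Equiv.Perm.sign σ * (B.submatrix (subsetEmb I) id).det := fun σ =>
      Matrix.det_permute σ (B.submatrix (subsetEmb I) id)
    simp_rw [h1]
    rw [← Matrix.det_transpose (A.submatrix id (subsetEmb I)),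
      Matrix.det_apply' (A.submatrix id (subsetEmb I)).transpose, Finset.sum_mul]
    refine Finset.sum_congr rfl fun σ _ => ?_
    simp only [Matrix.transpose_apply, Matrix.submatrix_apply, id]
    ring
  · rintro ⟨I, σ⟩ ⟨J, τ⟩ h
    have hIJ : I = J := by
      refine Subtype.ext (Finset.ext fun i => ?_)
      rw [← exists_subsetEmb_iff, ← exists_subsetEmb_iff]
      constructor
      · rintro ⟨a, rfl⟩
        have := congrFun h (σ.symm a)
        simp only [Function.comp_apply, Equiv.apply_symm_apply] at this
        exact ⟨_, this.symm⟩
      · rintro ⟨a, rfl⟩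
        have := congrFun h (τ.symm a)
        simp only [Function.comp_apply, Equiv.apply_symm_apply] at this
        exact ⟨_, this⟩
    subst hIJ
    congr 1
    ext a : 1
    exact (subsetEmb I).injective (congrFun h a)
  · intro f hf
    have : ¬ Function.Injective f := fun hinj => by
      obtain ⟨I, σ, h⟩ := exists_eq_subsetEmb_comp hinj
      exact hf ⟨(I, σ), h.symm⟩
    rw [Function.Injective] at this
    push Not at this
    obtain ⟨a, b, hab, hne⟩ := this
    rw [Matrix.det_zero_of_row_eq hne, mul_zero]
    ext k
    simp [hab]

lemma compound_mul (A B : Matrix (Fin N) (Fin N) R) :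
    compound p (A * B) = compound p A * compound p B := by
  ext I J
  rw [compound_apply, Matrix.mul_apply, Matrix.submatrix_mul A B _ id _ Function.bijective_id,
    cauchy_binet]
  rfl

lemma compound_one : compound p (1 : Matrix (Fin N) (Fin N) R) = 1 := by
  classical
  ext I J
  rw [compound_apply]
  by_cases h : I = J
  · subst h
    rw [Matrix.submatrix_one _ (subsetEmb I).injective, Matrix.det_one, Matrix.one_apply_eq]
  · rw [Matrix.one_apply_ne h]
    obtain ⟨i, hi, hiJ⟩ : ∃ i ∈ I.1, i ∉ J.1 := by
      by_contra! hcon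
      exact h (Subtype.ext (Finset.eq_of_subset_of_card_le hcon (by rw [I.2, J.2])))
    obtain ⟨a, rfl⟩ := (exists_subsetEmb_iff I i).2 hi
    refine Matrix.det_eq_zero_of_row_eq_zero a fun b => ?_
    rw [Matrix.submatrix_apply, Matrix.one_apply_ne]
    intro hab
    exact hiJ (hab ▸ subsetEmb_mem J b)

lemma compound_map {R' : Type*} [CommRing R'] (f : R →+* R') (M : Matrix (Fin N) (Fin N) R) :
    compound p (M.map f) = (compound p M).map f := by
  ext I J
  rw [compound_apply, Matrix.map_apply, compound_apply, f.map_det]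
  rfl

lemma det_submatrix_eq_zero {T : Matrix (Fin N) (Fin N) R} {I0 : {I : Finset (Fin N) // I.card = p}}
    (h : ∀ I, I ≠ I0 → compound p T I0 I = 0) (f : Fin p → Fin N) (hf : ∃ a, f a ∉ I0.1) :
    (T.submatrix (subsetEmb I0) f).det = 0 := by
  by_cases hinj : Function.Injective f
  · obtain ⟨I, σ, rfl⟩ := exists_eq_subsetEmb_comp hinj
    have h1 : (T.submatrix (subsetEmb I0) (subsetEmb I ∘ σ)).det =
        Equiv.Perm.sign σ * (T.submatrix (subsetEmb I0) (subsetEmb I)).det :=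
      Matrix.det_permute' σ (T.submatrix (subsetEmb I0) (subsetEmb I))
    rw [h1, ← compound_apply, h I, mul_zero]
    rintro rfl
    obtain ⟨a, ha⟩ := hf
    exact ha (subsetEmb_mem I _)
  · rw [Function.Injective] at hinj
    push Not at hinj
    obtain ⟨a, b, hab, hne⟩ := hinj
    exact Matrix.det_zero_of_column_eq hne fun k => by simp [hab]

end Compound

section
variable {K : Type*} [Field K] {N p : ℕ}

/-- If only the `I0` minor of the rows `I0` of an invertible matrix is nonzero, then these rows vanish
outside the columns `I0`. -/
lemma eq_zero_of_compound {T T' : Matrix (Fin N) (Fin N) K} (hT : T * T' = 1)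
    {I0 : {I : Finset (Fin N) // I.card = p}} (h : ∀ I, I ≠ I0 → compound p T I0 I = 0)
    {i l : Fin N} (hi : i ∈ I0.1) (hl : l ∉ I0.1) : T i l = 0 := by
  classical
  set P := T.submatrix (subsetEmb I0) (subsetEmb I0) with hP
  have hdet : P.det ≠ 0 := by
    intro h0
    have h1 := compound_mul (p := p) T T'
    rw [hT, compound_one] at h1
    have h2 := congrFun (congrFun h1 I0) I0
    rw [Matrix.one_apply_eq, Matrix.mul_apply, Finset.sum_eq_zero] at h2
    · exact one_ne_zero h2
    · intro I _
      by_cases hI : I = I0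
      · subst hI
        rw [compound_apply, ← hP, h0, zero_mul]
      · rw [h I hI, zero_mul]
  set u : Fin p → K := fun a => T (subsetEmb I0 a) l with hu
  have hc : P.cramer u = 0 := by
    ext b
    rw [Matrix.cramer_apply, Pi.zero_apply]
    have h1 : P.updateCol b u = T.submatrix (subsetEmb I0) (Function.update (subsetEmb I0) b l) := by
      ext a c
      rw [Matrix.updateCol_apply]
      by_cases hcb : c = b
      · subst hcb; simp [hu]
      · simp [hcb, hP]
    rw [h1]
    exact det_submatrix_eq_zero h _ ⟨b, by simpa using hl⟩
  have h1 := Matrix.mulVec_cramer P u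
  rw [hc, Matrix.mulVec_zero] at h1
  obtain ⟨a, rfl⟩ := (exists_subsetEmb_iff I0 i).2 hi
  have h2 := congrFun h1 a
  simp only [Pi.zero_apply, Pi.smul_apply, smul_eq_mul, zero_eq_mul] at h2
  exact h2.resolve_left hdet

/-- The subset of the indices that are at least `k`. -/
def topSubset (N k : ℕ) (r : Fin N ≃ Fin N) (hk : k ≤ N) :
    {I : Finset (Fin N) // I.card = N - k} :=
  ⟨Finset.univ.filter fun j => ¬ (r j : ℕ) < k, card_rank_ge r hk⟩

lemma isUnit_of_notMem {h : ℕ → Fin N → K}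
    (hh : ∀ l < N, h l ∉ Submodule.span K (h '' Set.Iio l)) :
    IsUnit (Matrix.of fun j l : Fin N => h l j) :=
  Matrix.linearIndependent_cols_iff_isUnit.1 (flag_top h (N := N) (by simp) hh).2

lemma compound_cols_linearIndependent {H : Matrix (Fin N) (Fin N) K} (hH : IsUnit H) :
    LinearIndependent K (fun I J => compound p H J I) := by
  obtain ⟨⟨H, H', h1, h2⟩, rfl⟩ := hH
  have h3 : IsUnit (compound p H) :=
    IsUnit.of_mul_eq_one (compound p H') (by rw [← compound_mul, h1, compound_one])
  exact Matrix.linearIndependent_cols_iff_isUnit.2 h3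

/-- The hyperplane spanned by all exterior products except the last determines the span of the first
`k` vectors. -/
lemma span_eq_of_compound {k : ℕ} (hk : k ≤ N) {h h' : ℕ → Fin N → K}
    (hh : ∀ l < N, h l ∉ Submodule.span K (h '' Set.Iio l))
    (hh' : ∀ l < N, h' l ∉ Submodule.span K ((h') '' Set.Iio l))
    (hspan : Submodule.span K (Set.range fun (I : {I // I ≠ topSubset N k (Equiv.refl _) hk}) J =>
        compound (N - k) (Matrix.of fun j l : Fin N => h l j) J I.1) =
      Submodule.span K (Set.range fun (I : {I // I ≠ topSubset N k (Equiv.refl _) hk}) J =>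
        compound (N - k) (Matrix.of fun j l : Fin N => h' l j) J I.1)) :
    Submodule.span K ((h') '' Set.Iio k) ≤ Submodule.span K (h '' Set.Iio k) := by
  classical
  obtain ⟨⟨H, Hi, h1, h2⟩, hH⟩ := isUnit_of_notMem hh
  obtain ⟨⟨H', Hi', h1', h2'⟩, hH'⟩ := isUnit_of_notMem hh'
  simp only at hH hH'
  rw [← hH, ← hH'] at hspan
  set I0 := topSubset N k (Equiv.refl _) hk with hI0
  have hvan : ∀ I, I ≠ I0 → compound (N - k) (Hi * H') I0 I = 0 := by
    intro I hI
    set ψ : ({I : Finset (Fin N) // I.card = N - k} → K) →ₗ[K] K :=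
      (LinearMap.proj I0).comp (compound (N - k) Hi).mulVecLin with hψ
    have h3 : Submodule.span K (Set.range fun (I : {I // I ≠ I0}) J => compound (N - k) H J I.1) ≤
        LinearMap.ker ψ := by
      rw [Submodule.span_le]
      rintro _ ⟨I, rfl⟩
      have : (compound (N - k) Hi * compound (N - k) H) I0 I.1 = 0 := by
        rw [← compound_mul, h2, compound_one, Matrix.one_apply_ne I.2.symm]
      exact this
    rw [hspan] at h3
    have h4 : ψ (fun J => compound (N - k) H' J I) = 0 :=
      h3 (Submodule.subset_span ⟨⟨I, hI⟩, rfl⟩)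
    rw [compound_mul]
    exact h4
  have hT : (Hi * H') * (Hi' * H) = 1 := by
    rw [Matrix.mul_assoc, ← Matrix.mul_assoc H', h1', Matrix.one_mul, h2]
  rw [Submodule.span_le]
  rintro _ ⟨l, hl, rfl⟩
  have hl : l < k := hl
  have hlN : l < N := by omega
  have h5 : h' l = ∑ i : Fin N, (Hi * H') i ⟨l, hlN⟩ • h i := by
    have h6 : H' = H * (Hi * H') := by rw [← Matrix.mul_assoc, h1, Matrix.one_mul]
    ext j
    have h7 : h' l j = H' j ⟨l, hlN⟩ := by rw [hH']; rfl
    rw [h7]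
    conv_lhs => rw [h6]
    rw [Matrix.mul_apply, Finset.sum_apply]
    refine Finset.sum_congr rfl fun i _ => ?_
    rw [Pi.smul_apply, smul_eq_mul, mul_comm, hH]
    rfl
  rw [SetLike.mem_coe, h5]
  refine Submodule.sum_mem _ fun i _ => ?_
  by_cases hi : (i : ℕ) < k
  · exact Submodule.smul_mem _ _ (Submodule.subset_span ⟨i, hi, rfl⟩)
  · rw [eq_zero_of_compound hT hvan (by simpa [hI0, topSubset] using hi)
      (by simpa [hI0, topSubset] using hl), zero_smul]
    exact zero_mem _

end

end SUnit

namespace SUnit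

open Filter

section Counting
variable {N p : ℕ}

lemma prod_subsetEmb (J : {I : Finset (Fin N) // I.card = p}) (f : Fin N → ℝ) :
    ∏ a, f (subsetEmb J a) = ∏ j ∈ J.1, f j := by
  have h : J.1 = Finset.univ.map (subsetEmb J).toEmbedding := by
    ext i
    rw [← exists_subsetEmb_iff]
    simp
  rw [h, Finset.prod_map]
  rfl

/-- Every index lies in the same number of `p`-element subsets. -/
lemma exists_sum_subsets (N p : ℕ) : ∃ e : ℕ, ∀ b : Fin N → ℝ,
    ∑ J : {I : Finset (Fin N) // I.card = p}, ∑ j ∈ J.1, b j = e * ∑ j, b j := by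
  classical
  rcases isEmpty_or_nonempty (Fin N) with hN | ⟨⟨j0⟩⟩
  · exact ⟨0, fun b => by simp [Finset.eq_empty_of_isEmpty]⟩
  set e : Fin N → ℕ := fun j =>
    (Finset.univ.filter fun J : {I : Finset (Fin N) // I.card = p} => j ∈ J.1).card with he
  have h1 : ∀ j, e j = e j0 := by
    intro j
    set σ : Equiv.Perm (Fin N) := Equiv.swap j j0
    refine Finset.card_bij' (fun J _ => ⟨J.1.map σ.toEmbedding, by rw [Finset.card_map, J.2]⟩)
      (fun J _ => ⟨J.1.map σ.toEmbedding, by rw [Finset.card_map, J.2]⟩) ?_ ?_ ?_ ?_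
    · intro J hJ
      rw [Finset.mem_filter_univ] at hJ ⊢
      exact Finset.mem_map.2 ⟨j, hJ, Equiv.swap_apply_left _ _⟩
    · intro J hJ
      rw [Finset.mem_filter_univ] at hJ ⊢
      exact Finset.mem_map.2 ⟨j0, hJ, Equiv.swap_apply_right _ _⟩
    · intro J _
      refine Subtype.ext (Finset.ext fun i => ?_)
      simp [σ]
    · intro J _
      refine Subtype.ext (Finset.ext fun i => ?_)
      simp [σ]
  refine ⟨e j0, fun b => ?_⟩
  have h2 : ∀ J : {I : Finset (Fin N) // I.card = p}, ∑ j ∈ J.1, b j =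
      ∑ j, if j ∈ J.1 then b j else 0 := fun J => by simp
  simp_rw [h2]
  rw [Finset.sum_comm, Finset.mul_sum]
  refine Finset.sum_congr rfl fun j _ => ?_
  rw [← Finset.sum_filter, Finset.sum_const, nsmul_eq_mul, ← h1 j]

lemma exists_lt_of_ne_topSubset {k : ℕ} (hk : k ≤ N) {I : {I : Finset (Fin N) // I.card = N - k}}
    (hI : I ≠ topSubset N k (Equiv.refl _) hk) : ∃ a, (subsetEmb I a : ℕ) < k := by
  by_contra! h
  refine hI (Subtype.ext (Finset.eq_of_subset_of_card_le (fun i hi => ?_) ?_))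
  · obtain ⟨a, rfl⟩ := (exists_subsetEmb_iff I i).2 hi
    exact Finset.mem_filter.2 ⟨Finset.mem_univ _, not_lt.2 (h a)⟩
  · rw [I.2, (topSubset N k (Equiv.refl _) hk).2]

end Counting

variable {K : Type*} [Field K]

lemma ev_compound {N p : ℕ} (L : Matrix (Fin N) (Fin N) ℤ) (H : Matrix (Fin N) (Fin N) K)
    (I J : {I : Finset (Fin N) // I.card = p}) :
    ev (compound p L) (fun J => compound p H J I) J =
      (Matrix.of fun a b => ev L (fun i => H i (subsetEmb I b)) (subsetEmb J a)).det := by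
  have h := compound_map (p := p) (Int.castRingHom K) L
  have h1 : ev (compound p L) (fun J => compound p H J I) J =
      ((compound p L).map (Int.castRingHom K) * compound p H) J I := rfl
  rw [h1, ← h, ← compound_mul]
  rfl

lemma compound_mem (O : Subring K) {N p : ℕ} {H : Matrix (Fin N) (Fin N) K}
    (hO : ∀ i l, H i l ∈ O) (I J : {I : Finset (Fin N) // I.card = p}) :
    compound p H I J ∈ O := by
  rw [compound_apply, Matrix.det_apply]
  refine O.sum_mem fun σ _ => ?_
  rw [Units.smul_def]
  exact O.zsmul_mem (O.prod_mem fun i _ => hO _ _) _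

lemma abv_ev_compound_le (v : AbsoluteValue K ℝ) {N k : ℕ} (hk : k ≤ N)
    (L : Matrix (Fin N) (Fin N) ℤ) {H : Matrix (Fin N) (Fin N) K} (r : Fin N ≃ Fin N)
    {B : Fin N → ℝ} (hB : ∀ j, 0 < B j) {t : ℝ} (ht : 1 ≤ t)
    (hv : ∀ l j, v (ev L (fun i => H i l) j) ≤ B j)
    (hv' : ∀ l : Fin N, (l : ℕ) < k → ∀ j, ¬ (r j : ℕ) < k → v (ev L (fun i => H i l) j) ≤ B j / t)
    {I : {I : Finset (Fin N) // I.card = N - k}} (hI : I ≠ topSubset N k (Equiv.refl _) hk)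
    (J : {I : Finset (Fin N) // I.card = N - k}) :
    v (ev (compound (N - k) L) (fun J => compound (N - k) H J I) J) ≤
      ((N - k).factorial : ℝ) * (∏ j ∈ J.1, B j) *
        (if J = topSubset N k r hk then t⁻¹ else 1) := by
  have ht0 : 0 < t := by linarith
  have hti : t⁻¹ ≤ 1 := inv_le_one_of_one_le₀ ht
  set γ : Fin (N - k) → ℝ := fun b =>
    if J = topSubset N k r hk ∧ (subsetEmb I b : ℕ) < k then t⁻¹ else 1 with hγ
  have hγ1 : ∀ b, γ b ≤ 1 := fun b => by
    simp only [hγ]; split_ifs <;> [exact hti; exact le_rfl]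
  have hγ0 : ∀ b, 0 < γ b := fun b => by
    simp only [hγ]; split_ifs <;> positivity
  have h1 := abv_det_le v (Matrix.of fun a b => ev L (fun i => H i (subsetEmb I b)) (subsetEmb J a))
    (fun a => B (subsetEmb J a)) γ ?_
  · rw [ev_compound]
    refine h1.trans ?_
    rw [prod_subsetEmb J B, Fintype.card_fin, mul_assoc]
    have hp : 0 ≤ ∏ j ∈ J.1, B j := Finset.prod_nonneg fun j _ => (hB j).le
    refine mul_le_mul_of_nonneg_left (mul_le_mul_of_nonneg_left ?_ hp) (by positivity)
    split_ifs with hJ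
    · obtain ⟨b, hb⟩ := exists_lt_of_ne_topSubset hk hI
      rw [← Finset.mul_prod_erase _ _ (Finset.mem_univ b)]
      have h2 : γ b = t⁻¹ := if_pos ⟨hJ, hb⟩
      rw [h2]
      exact mul_le_of_le_one_right (by positivity)
        (Finset.prod_le_one (fun c _ => (hγ0 c).le) fun c _ => hγ1 c)
    · exact Finset.prod_le_one (fun c _ => (hγ0 c).le) fun c _ => hγ1 c
  · intro a b
    rw [Matrix.of_apply]
    simp only [hγ]
    split_ifs with h
    · rw [← div_eq_mul_inv]
      refine hv' _ h.2 _ ?_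
      have := subsetEmb_mem J a
      rw [congrArg Subtype.val h.1] at this
      exact (Finset.mem_filter.1 this).2
    · rw [mul_one]
      exact hv _ _

end SUnit

namespace SUnit

open Filter

lemma exists_tendsto_subseq {α : Type*} [Finite α] (f : ℕ → α → ℝ) {R : ℝ}
    (hf : ∀ j a, |f j a| ≤ R) : ∃ (c : α → ℝ) (φ : ℕ → ℕ), StrictMono φ ∧
      ∀ a, Tendsto (fun j => f (φ j) a) atTop (nhds (c a)) := by
  have := Fintype.ofFinite α
  have hR : 0 ≤ max R 0 := le_max_right _ _
  obtain ⟨c, -, φ, hφ, h⟩ := tendsto_subseq_of_bounded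
    (Metric.isBounded_closedBall (x := (0 : α → ℝ)) (r := max R 0)) (x := f) fun j => by
      rw [mem_closedBall_zero_iff, pi_norm_le_iff_of_nonneg hR]
      exact fun a => (hf j a).trans (le_max_left _ _)
  exact ⟨c, φ, hφ, fun a => (tendsto_pi_nhds.1 h) a⟩

/-- Replacing varying sides by fixed exponents along a subsequence. -/
lemma exists_exponents {ι κ : Type*} [Fintype ι] [Fintype κ] (n : ι → ℕ)
    {F : ℕ → ι → κ → ℝ} {q : ℕ → ℝ}
    (hq : Tendsto q atTop atTop) {R δ c : ℝ} (hδ : 0 < δ)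
    (hF : ∀ j s i, |F j s i| ≤ R * q j)
    (hsum : ∀ j, ∑ s, (n s : ℝ) * ∑ i, F j s i ≤ c - δ * q j) :
    ∃ (e : ι → κ → ℝ) (φ : ℕ → ℕ), StrictMono φ ∧ (∑ s, (n s : ℝ) * ∑ i, e s i < 0) ∧
      ∀ j s i, F (φ j) s i ≤ e s i * q (φ j) := by
  obtain ⟨j1, hj1⟩ := eventually_atTop.1 (hq.eventually_ge_atTop 1)
  have hbd : ∀ j (a : ι × κ), |F (j + j1) a.1 a.2 / q (j + j1)| ≤ R := by
    intro j a
    have hq1 := hj1 (j + j1) (by omega)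
    rw [abs_div, abs_of_pos (a := q _) (by linarith), div_le_iff₀ (by linarith)]
    exact hF _ _ _
  obtain ⟨e0, φ, hφ, hlim⟩ := exists_tendsto_subseq (fun j (a : ι × κ) =>
    F (j + j1) a.1 a.2 / q (j + j1)) hbd
  have hshift : Tendsto (fun j => φ j + j1) atTop atTop :=
    tendsto_atTop_mono (fun j => Nat.le_add_right _ _) hφ.tendsto_atTop
  have hq' : Tendsto (fun j => q (φ j + j1)) atTop atTop := hq.comp hshift
  have hsum0 : ∑ s, (n s : ℝ) * ∑ i, e0 (s, i) ≤ -δ := by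
    have h1 : Tendsto (fun j => ∑ s, (n s : ℝ) * ∑ i, F (φ j + j1) s i / q (φ j + j1)) atTop
        (nhds (∑ s, (n s : ℝ) * ∑ i, e0 (s, i))) :=
      tendsto_finsetSum _ fun s _ => Tendsto.const_mul _ (tendsto_finsetSum _ fun i _ => hlim (s, i))
    have h2 : Tendsto (fun j => c / q (φ j + j1) - δ) atTop (nhds (0 - δ)) :=
      (hq'.const_div_atTop c).sub_const δ
    rw [zero_sub] at h2
    refine le_of_tendsto_of_tendsto' h1 h2 fun j => ?_
    have hq1 := hj1 (φ j + j1) (by omega)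
    have hq0 : 0 < q (φ j + j1) := by linarith
    have h3 := hsum (φ j + j1)
    simp_rw [← Finset.sum_div, ← mul_div_assoc]
    rw [← Finset.sum_div, div_le_iff₀ hq0, sub_mul, div_mul_cancel₀ _ hq0.ne']
    exact h3
  set m : ℝ := ∑ s, (n s : ℝ) * ∑ _i : κ, 1 with hm
  have hm0 : 0 ≤ m := Finset.sum_nonneg fun s _ => mul_nonneg (Nat.cast_nonneg _)
    (Finset.sum_nonneg fun i _ => zero_le_one)
  set ε : ℝ := δ / (m + 1) with hε
  have hε0 : 0 < ε := by positivity
  have hev : ∀ᶠ j in atTop, ∀ a : ι × κ, F (φ j + j1) a.1 a.2 / q (φ j + j1) ≤ e0 a + ε := by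
    rw [eventually_all]
    intro a
    filter_upwards [(hlim a).eventually_lt_const (show e0 a < e0 a + ε by linarith)] with j hj
    exact hj.le
  obtain ⟨j2, hj2⟩ := eventually_atTop.1 hev
  refine ⟨fun s i => e0 (s, i) + ε, fun j => φ (j + j2) + j1, ?_, ?_, ?_⟩
  · intro a b hab
    have : φ (a + j2) < φ (b + j2) := hφ (by omega)
    simp only
    omega
  · have h1 : ∑ s, (n s : ℝ) * ∑ i, (e0 (s, i) + ε) =
        ∑ s, (n s : ℝ) * ∑ i, e0 (s, i) + m * ε := by
      rw [hm, Finset.sum_mul, ← Finset.sum_add_distrib]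
      refine Finset.sum_congr rfl fun s _ => ?_
      rw [Finset.sum_add_distrib, mul_add, mul_assoc, Finset.sum_mul]
      simp_rw [one_mul]
    have h2 : m * ε < δ := by
      rw [hε, mul_div_assoc', div_lt_iff₀ (by positivity)]
      nlinarith
    simp only
    rw [h1]
    linarith
  · intro j s i
    have hq1 := hj1 (φ (j + j2) + j1) (by omega)
    exact (div_le_iff₀ (by linarith)).1 (hj2 (j + j2) (by omega) (s, i))

variable {K : Type*} [Field K] {ι : Type*} [Fintype ι] (S : SData K ι) {N : ℕ}

/-- If the bases `h j` have a uniform gap after the first `k` vectors then the span of these takes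
some value infinitely often. -/
lemma exists_span_infinite_of_gap [NumberField K] [Nonempty ι] (L L' : ι → Matrix (Fin N) (Fin N) ℤ)
    (hL : ∀ s, L' s * L s = 1) {k : ℕ} (hk : k ≤ N) (r : ι → Fin N ≃ Fin N)
    {B : ℕ → ι → Fin N → ℝ} (hB : ∀ j s i, 0 < B j s i) {q : ℕ → ℝ}
    (hq : Tendsto q atTop atTop) (hq1 : ∀ j, 1 ≤ q j) {R δ C : ℝ} (hδ : 0 < δ)
    (hBR : ∀ j s i, |Real.log (B j s i)| ≤ R * q j)
    (hBC : ∀ j, ∏ s, ∏ i, B j s i ^ S.n s ≤ C) {h : ℕ → ℕ → Fin N → K}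
    (hO : ∀ j, ∀ l < N, ∀ i, h j l i ∈ S.O)
    (hh : ∀ j, ∀ l < N, h j l ∉ Submodule.span K (h j '' Set.Iio l))
    (hv : ∀ j, ∀ l < N, ∀ s i, S.v s (ev (L s) (h j l) i) ≤ B j s i)
    (hv' : ∀ j, ∀ l < k, ∀ s i, ¬ (r s i : ℕ) < k →
      S.v s (ev (L s) (h j l) i) ≤ B j s i / Real.exp (δ * q j)) :
    ∃ W : Submodule K (Fin N → K), {j | Submodule.span K (h j '' Set.Iio k) = W}.Infinite := by
  classical
  set p := N - k with hp
  set I0 := topSubset N k (Equiv.refl _) hk with hI0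
  set J0 := fun s => topSubset N k (r s) hk with hJ0
  set F : ℕ → ι → {I : Finset (Fin N) // I.card = p} → ℝ := fun j s J =>
    Real.log p.factorial + ∑ i ∈ J.1, Real.log (B j s i) - if J = J0 s then δ * q j else 0 with hF
  have hpf : (0 : ℝ) < p.factorial := by exact_mod_cast Nat.factorial_pos p
  obtain ⟨e, he⟩ := exists_sum_subsets N p
  set n : ℝ := ∑ s, (S.n s : ℝ) with hn
  have hn0 : 0 < n := Finset.sum_pos (fun s _ => by exact_mod_cast S.n_pos s) Finset.univ_nonempty
  have hlogB : ∀ j, ∑ s, (S.n s : ℝ) * ∑ i, Real.log (B j s i) ≤ Real.log C := by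
    intro j
    have h1 : 0 < ∏ s, ∏ i, B j s i ^ S.n s :=
      Finset.prod_pos fun s _ => Finset.prod_pos fun i _ => pow_pos (hB _ _ _) _
    refine le_trans (le_of_eq ?_) (Real.log_le_log h1 (hBC j))
    rw [Real.log_prod fun s _ => (Finset.prod_pos fun i _ => pow_pos (hB _ _ _) _).ne']
    refine Finset.sum_congr rfl fun s _ => ?_
    rw [Real.log_prod fun i _ => (pow_pos (hB _ _ _) _).ne', Finset.mul_sum]
    exact Finset.sum_congr rfl fun i _ => (Real.log_pow _ _).symm
  have hsum : ∀ j, ∑ s, (S.n s : ℝ) * ∑ J, F j s J ≤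
      (n * (Fintype.card {I : Finset (Fin N) // I.card = p} * Real.log p.factorial) +
        e * Real.log C) - (n * δ) * q j := by
    intro j
    have h1 : ∀ s, ∑ J, F j s J = Fintype.card {I : Finset (Fin N) // I.card = p} *
        Real.log p.factorial + e * ∑ i, Real.log (B j s i) - δ * q j := by
      intro s
      simp only [hF]
      rw [Finset.sum_sub_distrib, Finset.sum_add_distrib, he, Finset.sum_const, nsmul_eq_mul,
        Finset.card_univ, Finset.sum_ite_eq' Finset.univ (J0 s), if_pos (Finset.mem_univ _)]
    have h2 : ∑ s, (S.n s : ℝ) * ∑ J, F j s J =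
        n * (Fintype.card {I : Finset (Fin N) // I.card = p} * Real.log p.factorial) +
          e * (∑ s, (S.n s : ℝ) * ∑ i, Real.log (B j s i)) - (n * δ) * q j := by
      rw [hn, mul_assoc (∑ s, (S.n s : ℝ)), Finset.sum_mul, Finset.sum_mul, Finset.mul_sum,
        ← Finset.sum_add_distrib, ← Finset.sum_sub_distrib]
      refine Finset.sum_congr rfl fun s _ => ?_
      rw [h1]
      ring
    rw [h2]
    have := mul_le_mul_of_nonneg_left (hlogB j) (Nat.cast_nonneg (α := ℝ) e)
    linarith
  have hFR : ∀ j s J, |F j s J| ≤ (Real.log p.factorial + p * R + δ) * q j := by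
    intro j s J
    have hq0 : 0 < q j := by linarith [hq1 j]
    have hlp : 0 ≤ Real.log p.factorial := Real.log_natCast_nonneg _
    have h1 : |∑ i ∈ J.1, Real.log (B j s i)| ≤ p * (R * q j) := by
      refine (Finset.abs_sum_le_sum_abs _ _).trans ?_
      refine (Finset.sum_le_sum fun i _ => hBR j s i).trans ?_
      rw [Finset.sum_const, J.2, nsmul_eq_mul]
    have h2 : |if J = J0 s then δ * q j else 0| ≤ δ * q j := by
      split_ifs
      · rw [abs_of_pos (by positivity)]
      · rw [abs_zero]; positivity
    have h3 : Real.log p.factorial ≤ Real.log p.factorial * q j := le_mul_of_one_le_right hlp (hq1 j)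
    simp only [hF]
    rw [abs_le] at h1 h2 ⊢
    constructor <;> nlinarith
  obtain ⟨c, φ, hφ, hc, hFc⟩ := exists_exponents S.n hq (mul_pos hn0 hδ) hFR hsum
  have hcard : Fintype.card {I : {I : Finset (Fin N) // I.card = p} // I ≠ I0} + 1 =
      Fintype.card {I : Finset (Fin N) // I.card = p} := by
    have h1 : Fintype.card {I : {I : Finset (Fin N) // I.card = p} | I ≠ I0} =
      Fintype.card {I : Finset (Fin N) // I.card = p} - 1 := Set.card_ne_eq I0
    have h2 : 0 < Fintype.card {I : Finset (Fin N) // I.card = p} := Fintype.card_pos_iff.2 ⟨I0⟩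
    have h3 : Fintype.card {I : {I : Finset (Fin N) // I.card = p} // I ≠ I0} =
      Fintype.card {I : {I : Finset (Fin N) // I.card = p} | I ≠ I0} := Fintype.card_congr (Equiv.refl _)
    omega
  set H : ℕ → Matrix (Fin N) (Fin N) K := fun j => Matrix.of fun a l : Fin N => h j l a with hH
  obtain ⟨V, hV⟩ := exists_span_infinite S hcard (fun s => compound p (L s))
    (fun s => compound p (L' s)) (fun s => by rw [← compound_mul, hL, compound_one]) c hc
    (fun j => q (φ j)) (hq.comp hφ.tendsto_atTop) (fun j I J => compound p (H (φ j)) J I.1)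
    (fun j => (compound_cols_linearIndependent (isUnit_of_notMem (hh (φ j)))).comp _
      Subtype.val_injective)
    (fun j I J => compound_mem S.O (fun i l => hO _ _ l.2 _) _ _) (fun j I s J => by
      refine (abv_ev_compound_le (S.v s) hk (L s) (r s) (hB (φ j) s) (t := Real.exp (δ * q (φ j)))
        (Real.one_le_exp (by have := hq1 (φ j); positivity)) (fun l i => hv _ _ l.2 _ _)
        (fun l hl i hi => hv' _ _ hl _ _ hi) I.2 J).trans ?_
      rw [← Real.log_le_iff_le_exp]
      · refine le_trans (le_of_eq ?_) (hFc j s J)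
        have hpos : 0 < ∏ i ∈ J.1, B (φ j) s i := Finset.prod_pos fun i _ => hB _ _ _
        have hif : (0 : ℝ) < if J = J0 s then (Real.exp (δ * q (φ j)))⁻¹ else 1 := by
          split_ifs <;> positivity
        rw [Real.log_mul (mul_pos hpf hpos).ne' hif.ne', Real.log_mul hpf.ne' hpos.ne',
          Real.log_prod fun i _ => (hB _ _ _).ne']
        simp only [hF]
        rw [sub_eq_add_neg]
        congr 1
        split_ifs
        · rw [Real.log_inv, Real.log_exp]
        · rw [Real.log_one, neg_zero]
      · refine mul_pos (mul_pos hpf (Finset.prod_pos fun i _ => hB _ _ _)) ?_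
        split_ifs <;> positivity)
  obtain ⟨j0, hj0⟩ := hV.nonempty
  refine ⟨Submodule.span K (h (φ j0) '' Set.Iio k), (hV.image hφ.injective.injOn).mono ?_⟩
  rintro _ ⟨j, hj, rfl⟩
  have h1 : Submodule.span K (Set.range fun (I : {I // I ≠ I0}) J => compound p (H (φ j)) J I.1) =
    Submodule.span K (Set.range fun (I : {I // I ≠ I0}) J => compound p (H (φ j0)) J I.1) :=
    Eq.trans hj hj0.symm
  exact le_antisymm (span_eq_of_compound hk (hh _) (hh _) h1.symm)
    (span_eq_of_compound hk (hh _) (hh _) h1)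

end SUnit

namespace SUnit

open Filter

variable {K : Type*} [Field K] {ι : Type*} [Fintype ι] (S : SData K ι) {N : ℕ}

/-- A system of matrices is bounded. -/
lemma exists_matSize_le (L L' : ι → Matrix (Fin N) (Fin N) ℤ) :
    ∃ m : ℝ, 1 ≤ m ∧ ∀ s, matSize (L s) ≤ m ∧ matSize (L' s) ≤ m := by
  have h0 : ∀ s, 0 ≤ matSize (L s) + matSize (L' s) := fun s => by
    linarith [one_le_matSize (L s), one_le_matSize (L' s)]
  refine ⟨1 + ∑ s, (matSize (L s) + matSize (L' s)), ?_, fun s => ?_⟩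
  · linarith [Finset.sum_nonneg fun s (_ : s ∈ Finset.univ) => h0 s]
  · have := Finset.single_le_sum (f := fun s => matSize (L s) + matSize (L' s))
      (fun s _ => h0 s) (Finset.mem_univ s)
    constructor <;> linarith [one_le_matSize (L s), one_le_matSize (L' s)]

variable {S} in
/-- The successive minima of a moderate box are moderate. -/
lemma Minima.lam_bounds [Nonempty ι] {L L' : ι → Matrix (Fin N) (Fin N) ℤ}
    (hL : ∀ s, L' s * L s = 1) {A : ι → Fin N → ℝ} (hA : ∀ s i, 0 < A s i) {C : ℝ}
    (M : Minima S L A C) {m : ℝ} (hm : 1 ≤ m) (hmL : ∀ s, matSize (L s) ≤ m ∧ matSize (L' s) ≤ m)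
    {E : ℝ} (hlo : ∀ s i, E⁻¹ ≤ A s i) (hhi : ∀ s i, A s i ≤ E) (hE : 0 < E) {l : ℕ} (hl : l < N) :
    (m * E)⁻¹ ≤ M.lam l ∧ M.lam l ≤ m * E := by
  classical
  constructor
  · refine le_trans ?_ (M.mono 0 l (Nat.zero_le _) hl)
    have h0 : 0 < N := by omega
    have hg : M.g 0 ≠ 0 := fun h => M.notMem 0 h0 (by rw [h]; exact Submodule.zero_mem _)
    obtain ⟨i, hi⟩ := Function.ne_iff.1 hg
    have hi : M.g 0 i ≠ 0 := hi
    have hlam := M.pos 0 h0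
    have h1 : ∀ s, S.v s (M.g 0 i) ≤ m * (M.lam 0 * E) := by
      intro s
      have h2 := abv_ev_le (S.v s) (L' s) (x := ev (L s) (M.g 0)) (B := M.lam 0 * E)
        (by positivity) (fun i => (M.le 0 h0 s i).trans
          (mul_le_mul_of_nonneg_left (hhi s i) hlam.le)) i
      rw [ev_ev (hL s)] at h2
      exact h2.trans (mul_le_mul_of_nonneg_right (hmL s).2 (by positivity))
    by_contra! hlt
    refine hi (S.eq_zero_of_lt (M.mem 0 h0 i) (fun _ => m * (M.lam 0 * E)) h1 ?_)
    rw [Finset.prod_pow_eq_pow_sum]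
    refine pow_lt_one₀ (by positivity) ?_ ?_
    · rw [lt_inv_comm₀ hlam (by positivity), ← one_div, lt_div_iff₀ hlam] at hlt
      linarith
    · exact (Finset.sum_pos (fun s _ => S.n_pos s) Finset.univ_nonempty).ne'
  · refine (M.mono l (N - 1) (by omega) (by omega)).trans ?_
    obtain ⟨i, hi⟩ : ∃ i : Fin N, (Pi.single i 1 : Fin N → K) ∉
        Submodule.span K (M.g '' Set.Iio (N - 1)) := by
      by_contra! hcon
      refine flag_ne_top (K := K) M.g (n := N - 1)
        (by rw [Module.finrank_fin_fun]; omega) ?_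
      rw [eq_top_iff, ← (Pi.basisFun K (Fin N)).span_eq, Submodule.span_le]
      rintro _ ⟨i, rfl⟩
      rw [Pi.basisFun_apply]
      exact hcon i
    have hO : ∀ j, (Pi.single i 1 : Fin N → K) j ∈ S.O := fun j => by
      rw [Pi.single_apply]
      split_ifs
      exacts [S.O.one_mem, S.O.zero_mem]
    refine (M.ge (N - 1) (by omega) _ hO hi).trans ?_
    rw [boxNorm_le_iff S L hA (by positivity)]
    intro s j
    refine (abv_ev_le (S.v s) (L s) (B := 1) zero_le_one (fun j => ?_) j).trans ?_
    · rw [Pi.single_apply]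
      split_ifs
      · rw [map_one]
      · rw [map_zero]; exact zero_le_one
    · rw [mul_one, mul_assoc]
      refine (hmL s).1.trans (le_mul_of_one_le_right (by linarith) ?_)
      rw [← mul_inv_cancel₀ hE.ne']
      exact mul_le_mul_of_nonneg_left (hlo s j) hE.le

variable {S} in
/-- A box of small volume containing an integral point has a large gap in its minima, and the point
lies in the subspace below the gap. -/
lemma Minima.exists_gap [Nonempty ι] {L : ι → Matrix (Fin N) (Fin N) ℤ}
    {A : ι → Fin N → ℝ} (hA : ∀ s i, 0 < A s i) {C : ℝ} (hC : 1 ≤ C)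
    (M : Minima S L A C) {δ q : ℝ} (hδ : (∑ s, (S.n s : ℝ)) * N ^ 2 * δ ≤ 1 / 2) (hδ0 : 0 < δ)
    (hq : 2 * Real.log C < q) (hprod : ∏ s, ∏ i, A s i ^ S.n s ≤ Real.exp (-q))
    {x : Fin N → K} (hxO : ∀ i, x i ∈ S.O) (hx0 : x ≠ 0)
    (hxA : ∀ s i, S.v s (ev (L s) x i) ≤ A s i) :
    ∃ k, 0 < k ∧ k < N ∧ Real.exp (δ * q) * M.lam (k - 1) ≤ M.lam k ∧
      x ∈ Submodule.span K (M.g '' Set.Iio k) := by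
  classical
  have hN : 0 < N := by
    obtain ⟨i, -⟩ := Function.ne_iff.1 hx0
    exact i.pos
  have hq0 : 0 < q := lt_of_le_of_lt (by have := Real.log_nonneg hC; linarith) hq
  have hbox : boxNorm S L A x ≤ 1 := (boxNorm_le_iff S L hA zero_le_one).2 fun s i => by
    rw [one_mul]; exact hxA s i
  have hlam0 : M.lam 0 ≤ 1 := (M.ge 0 hN x hxO (by simpa using hx0)).trans hbox
  set n := ∑ s, S.n s with hn
  have hbig : Real.exp (N * δ * q) ≤ M.lam (N - 1) := by
    by_contra! hlt
    have h1 : ∏ s, ∏ j, (M.lam (M.r s j) * A s j) ^ S.n s ≤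
        (Real.exp (N * δ * q) ^ N) ^ n * Real.exp (-q) := by
      calc _ ≤ ∏ s, ∏ j, (Real.exp (N * δ * q) * A s j) ^ S.n s := by
            refine Finset.prod_le_prod (fun s _ => Finset.prod_nonneg fun j _ => pow_nonneg
              (mul_nonneg (M.pos _ (M.r s j).2).le (hA s j).le) _) fun s _ =>
              Finset.prod_le_prod (fun j _ => pow_nonneg
              (mul_nonneg (M.pos _ (M.r s j).2).le (hA s j).le) _) fun j _ => ?_
            refine pow_le_pow_left₀ (mul_nonneg (M.pos _ (M.r s j).2).le (hA s j).le)
              (mul_le_mul_of_nonneg_right ?_ (hA s j).le) _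
            exact (M.mono _ (N - 1) (by omega) (by omega)).trans hlt.le
        _ = (Real.exp (N * δ * q) ^ N) ^ n * ∏ s, ∏ i, A s i ^ S.n s := by
            simp_rw [mul_pow, Finset.prod_mul_distrib]
            congr 1
            rw [hn, ← Finset.prod_pow_eq_pow_sum]
            refine Finset.prod_congr rfl fun s _ => ?_
            rw [Finset.prod_const, Finset.card_univ, Fintype.card_fin, ← pow_mul, ← pow_mul,
              mul_comm N]
        _ ≤ _ := mul_le_mul_of_nonneg_left hprod (by positivity)
    have h2 : 1 ≤ C * ((Real.exp (N * δ * q) ^ N) ^ n * Real.exp (-q)) :=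
      M.one_le.trans (mul_le_mul_of_nonneg_left h1 (by linarith))
    have h3 : 0 ≤ Real.log C + ((n * N ^ 2 * δ) * q + -q) := by
      have h4 := Real.log_nonneg h2
      rw [Real.log_mul (by positivity) (by positivity), Real.log_mul (by positivity) (by positivity),
        Real.log_exp, Real.log_pow, Real.log_pow, Real.log_exp] at h4
      refine h4.trans (le_of_eq ?_)
      ring
    have h4 : ((n : ℕ) : ℝ) * N ^ 2 * δ ≤ 1 / 2 := by rw [hn]; push_cast; exact hδ
    have h5 := mul_le_mul_of_nonneg_right h4 hq0.le
    linarith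
  have hP : Real.exp ((N - 1 : ℕ) * δ * q) < M.lam (N - 1) := by
    refine lt_of_lt_of_le (Real.exp_lt_exp.2 ?_) hbig
    have : ((N - 1 : ℕ) : ℝ) < N := by exact_mod_cast Nat.sub_lt hN one_pos
    have := mul_lt_mul_of_pos_right this (mul_pos hδ0 hq0)
    linarith
  have hex : ∃ k : ℕ, Real.exp (k * δ * q) < M.lam k := ⟨_, hP⟩
  obtain ⟨k, hkP, hkmin⟩ : ∃ k : ℕ, Real.exp (k * δ * q) < M.lam k ∧
    ∀ l < k, ¬ Real.exp (l * δ * q) < M.lam l := ⟨Nat.find hex, Nat.find_spec hex,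
      fun l hl => Nat.find_min hex hl⟩
  have hkN : k < N := by
    by_contra! hcon
    exact hkmin (N - 1) (by omega) hP
  have hk0 : 0 < k := by
    rcases Nat.eq_zero_or_pos k with rfl | h
    · rw [Nat.cast_zero, zero_mul, zero_mul, Real.exp_zero] at hkP
      linarith
    · exact h
  refine ⟨k, hk0, hkN, ?_, ?_⟩
  · have h1 := not_lt.1 (hkmin (k - 1) (by omega))
    refine le_trans ?_ hkP.le
    refine (mul_le_mul_of_nonneg_left h1 (Real.exp_pos _).le).trans (le_of_eq ?_)
    rw [← Real.exp_add, Nat.cast_sub hk0]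
    congr 1
    push_cast
    ring
  · by_contra hx
    have h1 := (M.ge k hkN x hxO hx).trans hbox
    have h2 : 1 ≤ Real.exp (k * δ * q) := Real.one_le_exp (by positivity)
    linarith

end SUnit

namespace SUnit

open Filter

variable {K : Type*} [Field K] {ι : Type*} [Fintype ι] (S : SData K ι) {N : ℕ}

/-- For an integral point in a box of small volume, a basis adapted to a gap in the minima. -/
lemma exists_gap_data [Nonempty ι] (L L' : ι → Matrix (Fin N) (Fin N) ℤ)
    (hL : ∀ s, L' s * L s = 1) (Cb : ℝ) : ∃ C R δ q0 : ℝ, 0 < δ ∧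
      ∀ (A : ι → Fin N → ℝ) (x : Fin N → K) (q : ℝ), q0 ≤ q →
        (∀ s i, Real.exp (-(Cb * q)) ≤ A s i) → (∀ s i, A s i ≤ Real.exp (Cb * q)) →
        ∏ s, ∏ i, A s i ^ S.n s ≤ Real.exp (-q) → (∀ i, x i ∈ S.O) → x ≠ 0 →
        (∀ s i, S.v s (ev (L s) x i) ≤ A s i) →
        ∃ (k : Fin N) (r : ι → Fin N ≃ Fin N) (B : ι → Fin N → ℝ) (h : ℕ → Fin N → K),
          (∀ s i, 0 < B s i) ∧ (∀ s i, |Real.log (B s i)| ≤ R * q) ∧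
          (∏ s, ∏ i, B s i ^ S.n s ≤ C) ∧ (∀ l < N, ∀ i, h l i ∈ S.O) ∧
          (∀ l < N, h l ∉ Submodule.span K (h '' Set.Iio l)) ∧
          (∀ l < N, ∀ s i, S.v s (ev (L s) (h l) i) ≤ B s i) ∧
          (∀ l < k.1, ∀ s i, ¬ (r s i : ℕ) < k →
            S.v s (ev (L s) (h l) i) ≤ B s i / Real.exp (δ * q)) ∧
          x ∈ Submodule.span K (h '' Set.Iio k.1) := by
  classical
  obtain ⟨C, hC, C', hC', hM⟩ := exists_gap_basis S L L' hL
  obtain ⟨m, hm, hmL⟩ := exists_matSize_le L L'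
  set n : ℝ := ∑ s, (S.n s : ℝ) with hn
  have hn0 : 0 < n := Finset.sum_pos (fun s _ => by exact_mod_cast S.n_pos s) Finset.univ_nonempty
  set δ : ℝ := 1 / (2 * (n * N ^ 2 + 1)) with hδ
  have hδ0 : 0 < δ := by positivity
  have hnδ : n * N ^ 2 * δ ≤ 1 / 2 := by
    rw [hδ, mul_one_div, div_le_div_iff₀ (by positivity) (by norm_num)]
    linarith
  refine ⟨(∏ s, ∏ _i : Fin N, C' ^ S.n s) * C, Real.log C' + Real.log m + 2 * Cb, δ,
    1 + 2 * Real.log C + (C' + 1) / δ, hδ0, fun A x q hq hlo hhi hprod hxO hx0 hxA => ?_⟩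
  have hlC := Real.log_nonneg hC
  have hlC' := Real.log_nonneg hC'
  have hlm := Real.log_nonneg hm
  have hq1 : 1 ≤ q := by
    have : 0 ≤ (C' + 1) / δ := by positivity
    linarith
  have hA : ∀ s i, 0 < A s i := fun s i => (Real.exp_pos _).trans_le (hlo s i)
  have ht : C' < Real.exp (δ * q) := by
    have h1 : (C' + 1) / δ ≤ q := by linarith
    rw [div_le_iff₀ hδ0] at h1
    have := Real.add_one_le_exp (δ * q)
    linarith
  obtain ⟨M, hM⟩ := hM A hA
  obtain ⟨k, hk0, hkN, hgap, hxk⟩ := M.exists_gap hA hC hnδ hδ0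
    (by have : 0 ≤ (C' + 1) / δ := by positivity
        linarith) hprod hxO hx0 hxA
  obtain ⟨h, hO, hh, hspan, hv, hv'⟩ := hM k _ hk0 hkN ht hgap
  have hC'0 : 0 < C' := by linarith
  have hpos : ∀ s i, 0 < M.lam (M.r s i) * A s i := fun s i => mul_pos (M.pos _ (M.r s i).2) (hA s i)
  refine ⟨⟨k, hkN⟩, M.r, fun s i => C' * (M.lam (M.r s i) * A s i), h,
    fun s i => mul_pos hC'0 (hpos s i), fun s i => ?_, ?_, hO, hh, hv, fun l hl s i hi => ?_, ?_⟩
  · obtain ⟨h1, h2⟩ := M.lam_bounds hL hA hm hmL (E := Real.exp (Cb * q))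
      (fun s i => by rw [← Real.exp_neg]; exact hlo s i) hhi (Real.exp_pos _) (M.r s i).2
    have hm0 : 0 < m := by linarith
    have hl0 := M.pos _ (M.r s i).2
    have h3 := Real.log_le_log (by positivity) h1
    have h4 := Real.log_le_log hl0 h2
    rw [Real.log_inv, Real.log_mul hm0.ne' (Real.exp_ne_zero _), Real.log_exp] at h3
    rw [Real.log_mul hm0.ne' (Real.exp_ne_zero _), Real.log_exp] at h4
    have h5 := Real.log_le_log (Real.exp_pos _) (hlo s i)
    have h6 := Real.log_le_log (hA s i) (hhi s i)
    rw [Real.log_exp] at h5 h6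
    rw [Real.log_mul hC'0.ne' (hpos s i).ne', Real.log_mul hl0.ne' (hA s i).ne', abs_le]
    have h7 := le_mul_of_one_le_right hlC' hq1
    have h8 := le_mul_of_one_le_right hlm hq1
    constructor <;> linarith
  · simp_rw [mul_pow C', Finset.prod_mul_distrib]
    exact mul_le_mul_of_nonneg_left M.le_const (Finset.prod_nonneg fun s _ =>
      Finset.prod_nonneg fun i _ => by positivity)
  · refine (hv' l hl s i).trans (le_of_eq ?_)
    rw [Minima.gapBox, if_neg hi]
    exact (mul_div_assoc _ _ _).symm
  · rw [hspan]
    exact hxk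

/-- The subspace theorem for forms defined over the integers. -/
theorem exists_submodule_infinite [NumberField K] [Nonempty ι]
    (L L' : ι → Matrix (Fin N) (Fin N) ℤ) (hL : ∀ s, L' s * L s = 1) {A : ℕ → ι → Fin N → ℝ}
    {q : ℕ → ℝ} (hq : Tendsto q atTop atTop) {Cb : ℝ}
    (hlo : ∀ j s i, Real.exp (-(Cb * q j)) ≤ A j s i) (hhi : ∀ j s i, A j s i ≤ Real.exp (Cb * q j))
    (hprod : ∀ j, ∏ s, ∏ i, A j s i ^ S.n s ≤ Real.exp (-q j)) {x : ℕ → Fin N → K}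
    (hxO : ∀ j i, x j i ∈ S.O) (hx0 : ∀ j, x j ≠ 0)
    (hxA : ∀ j s i, S.v s (ev (L s) (x j) i) ≤ A j s i) :
    ∃ W : Submodule K (Fin N → K), W ≠ ⊤ ∧ {j | x j ∈ W}.Infinite := by
  classical
  obtain ⟨C, R, δ, q0, hδ, H⟩ := exists_gap_data S L L' hL Cb
  obtain ⟨j1, hj1⟩ := eventually_atTop.1 (hq.eventually_ge_atTop (max q0 1))
  have H' := fun j => H (A (j + j1)) (x (j + j1)) (q (j + j1))
    ((le_max_left _ _).trans (hj1 _ (by omega))) (hlo _) (hhi _) (hprod _) (hxO _) (hx0 _) (hxA _)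
  choose k r B h hB hBR hBC hO hh hv hv' hx using H'
  obtain ⟨⟨k0, r0⟩, hinf⟩ := exists_infinite_fiber (Set.infinite_univ (α := ℕ)) fun j => (k j, r j)
  set φ := Nat.nth fun j => j ∈ {a | a ∈ Set.univ ∧ (k a, r a) = (k0, r0)} with hφ
  have hφm : StrictMono φ := Nat.nth_strictMono hinf
  have hφk : ∀ j, k (φ j) = k0 ∧ r (φ j) = r0 := fun j =>
    Prod.mk.inj (Nat.nth_mem_of_infinite hinf j).2
  have hshift : Tendsto (fun j => φ j + j1) atTop atTop :=
    tendsto_atTop_mono (fun j => Nat.le_add_right _ _) hφm.tendsto_atTop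
  obtain ⟨W, hW⟩ := exists_span_infinite_of_gap S L L' hL k0.2.le r0 (fun j => hB (φ j))
    (hq.comp hshift) (fun j => (le_max_right _ _).trans (hj1 (φ j + j1) (Nat.le_add_left _ _))) hδ
    (fun j => hBR (φ j)) (fun j => hBC (φ j)) (fun j => hO (φ j)) (fun j => hh (φ j))
    (fun j => hv (φ j)) (fun j l hl s i hi => by
      have h1 := hv' (φ j) l
      rw [(hφk j).1, (hφk j).2] at h1
      exact h1 hl s i hi)
  obtain ⟨j0, hj0⟩ := hW.nonempty
  refine ⟨W, ?_, (hW.image (f := fun j => φ j + j1) fun a _ b _ hab =>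
    hφm.injective (Nat.add_right_cancel hab)).mono ?_⟩
  · rw [← show _ = W from hj0]
    exact flag_ne_top _ (by rw [Module.finrank_fin_fun]; exact k0.2)
  · rintro _ ⟨j, hj, rfl⟩
    have h1 := hx (φ j)
    rw [(hφk j).1] at h1
    rw [← show _ = W from hj]
    exact h1

end SUnit

namespace SUnit

open Filter

/-- The identity with row `a` replaced by a row of ones. -/
def sumMatrix {N : ℕ} (a : Fin N) : Matrix (Fin N) (Fin N) ℤ :=
  Matrix.of fun i j => if i = a then 1 else if i = j then 1 else 0

/-- The inverse of `sumMatrix a`. -/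
def sumMatrixInv {N : ℕ} (a : Fin N) : Matrix (Fin N) (Fin N) ℤ :=
  Matrix.of fun i j => if i = j then 1 else if i = a then -1 else 0

lemma sumMatrixInv_mul {N : ℕ} (a : Fin N) : sumMatrixInv a * sumMatrix a = 1 := by
  refine mul_eq_one_comm.1 ?_
  ext i j
  rw [Matrix.mul_apply]
  by_cases hi : i = a
  · subst hi
    simp only [sumMatrix, sumMatrixInv, Matrix.of_apply, if_true, one_mul]
    by_cases hj : i = j
    · subst hj
      rw [Finset.sum_eq_single i]
      · simp
      · intro b _ hb
        rw [if_neg hb, if_neg hb]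
      · simp
    · rw [Matrix.one_apply_ne hj, Finset.sum_eq_add i j hj]
      · simp [hj]
      · rintro b - ⟨hb, hb'⟩
        rw [if_neg hb', if_neg hb]
      · simp
      · simp
  · rw [Finset.sum_eq_single i]
    · simp [sumMatrix, sumMatrixInv, hi, Matrix.one_apply]
    · intro b _ hb
      simp [sumMatrix, hi, hb.symm]
    · simp

lemma ev_sumMatrix {K : Type*} [Field K] {N : ℕ} (a : Fin N) (x : Fin N → K) (i : Fin N) :
    ev (sumMatrix a) x i = if i = a then ∑ j, x j else x i := by
  rw [ev_apply]
  by_cases hi : i = a <;> simp [sumMatrix, hi]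

lemma le_of_weighted_sum_eq {ι : Type*} [Fintype ι] {n : ι → ℕ} (hn : ∀ s, 0 < n s) {b : ι → ℝ}
    (hb : ∀ s, 0 ≤ b s) {T : ℝ} (h : ∑ s, (n s : ℝ) * b s = T) (s : ι) : b s ≤ T := by
  rw [← h]
  have h1 : (1 : ℝ) ≤ n s := by exact_mod_cast hn s
  refine (le_mul_of_one_le_left (hb s) h1).trans ?_
  exact Finset.single_le_sum (f := fun s => (n s : ℝ) * b s)
    (fun s _ => mul_nonneg (Nat.cast_nonneg _) (hb s)) (Finset.mem_univ s)

variable {K : Type*} [Field K] {ι : Type*} [Fintype ι] (S : SData K ι) {N : ℕ}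

lemma SData.sum_log_eq_zero {x : K} (hx : x ∈ S.O) (hx' : x⁻¹ ∈ S.O) (hx0 : x ≠ 0) :
    ∑ s, (S.n s : ℝ) * Real.log (S.v s x) = 0 := by
  have hpos : ∀ s, 0 < S.v s x := fun s => (S.v s).pos hx0
  have h1 := S.one_le x hx hx0
  have h2 := S.one_le x⁻¹ hx' (inv_ne_zero hx0)
  simp_rw [map_inv₀, inv_pow] at h2
  rw [Finset.prod_inv_distrib] at h2
  have h3 : ∏ s, S.v s x ^ S.n s = 1 := le_antisymm
    ((one_le_inv₀ (Finset.prod_pos fun s _ => pow_pos (hpos s) _)).1 h2) h1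
  have h4 := congrArg Real.log h3
  rw [Real.log_one, Real.log_prod fun s _ => (pow_pos (hpos s) _).ne'] at h4
  simpa only [Real.log_pow] using h4

section
variable {u : Fin N → K} (hO : ∀ i, u i ∈ S.O) (hO' : ∀ i, (u i)⁻¹ ∈ S.O) (h0 : ∀ i, u i ≠ 0)
  (hsum : ∑ i, u i = 1) {a : ι → Fin N} (ha : ∀ s i, S.v s (u i) ≤ S.v s (u (a s)))

include hsum ha h0 in
lemma log_max_le {q : ℝ} (hq : ∑ s, (S.n s : ℝ) * Real.log (S.v s (u (a s))) = q) (s : ι)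
    (i : Fin N) : Real.log (S.v s (u i)) ≤ q + (∑ s, (S.n s : ℝ)) * Real.log N := by
  have hN : 0 < N := i.pos
  have hlN : 0 ≤ Real.log N := Real.log_natCast_nonneg _
  have hpos : ∀ s i, 0 < S.v s (u i) := fun s i => (S.v s).pos (h0 i)
  have h1 : ∀ s, 0 ≤ Real.log (S.v s (u (a s))) + Real.log N := by
    intro s
    rw [← Real.log_mul (hpos _ _).ne' (by positivity)]
    refine Real.log_nonneg ?_
    calc (1 : ℝ) = S.v s (∑ i, u i) := by rw [hsum, map_one]
      _ ≤ ∑ i, S.v s (u i) := abv_sum_le _ _ _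
      _ ≤ ∑ _i : Fin N, S.v s (u (a s)) := Finset.sum_le_sum fun i _ => ha s i
      _ = _ := by rw [Finset.sum_const, Finset.card_univ, Fintype.card_fin, nsmul_eq_mul, mul_comm]
  have h2 := le_of_weighted_sum_eq S.n_pos h1
    (T := q + (∑ s, (S.n s : ℝ)) * Real.log N) (by
      rw [← hq, Finset.sum_mul, ← Finset.sum_add_distrib]
      exact Finset.sum_congr rfl fun s _ => by ring) s
  have h3 := Real.log_le_log (hpos s i) (ha s i)
  linarith

include hO hO' hsum ha h0 in
lemma le_log_abv {q : ℝ} (hq : ∑ s, (S.n s : ℝ) * Real.log (S.v s (u (a s))) = q) (s : ι)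
    (i : Fin N) : -((∑ s, (S.n s : ℝ)) * (q + (∑ s, (S.n s : ℝ)) * Real.log N)) +
      (q + (∑ s, (S.n s : ℝ)) * Real.log N) ≤ Real.log (S.v s (u i)) := by
  set E := q + (∑ s, (S.n s : ℝ)) * Real.log N with hE
  have h1 : ∀ s, 0 ≤ E - Real.log (S.v s (u i)) := fun s =>
    sub_nonneg.2 (log_max_le S h0 hsum ha hq s i)
  have h2 := le_of_weighted_sum_eq S.n_pos h1 (T := (∑ s, (S.n s : ℝ)) * E) (by
    simp_rw [mul_sub]
    rw [Finset.sum_sub_distrib, S.sum_log_eq_zero (hO i) (hO' i) (h0 i), sub_zero, Finset.sum_mul]) s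
  linarith

end

/-- An infinite set of solutions of the unit equation has an infinite subset satisfying a further
linear relation. -/
lemma exists_linear_relation [NumberField K] [Nonempty ι] {U : Set (Fin N → K)} (hU : U.Infinite)
    (hO : ∀ u ∈ U, ∀ i, u i ∈ S.O) (hO' : ∀ u ∈ U, ∀ i, (u i)⁻¹ ∈ S.O)
    (h0 : ∀ u ∈ U, ∀ i, u i ≠ 0) (hsum : ∀ u ∈ U, ∑ i, u i = 1) :
    ∃ b : Fin N → K, b ≠ 0 ∧ {u | u ∈ U ∧ ∑ i, b i * u i = 0}.Infinite := by
  classical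
  have hN : Nonempty (Fin N) := by
    by_contra hcon
    rw [not_nonempty_iff] at hcon
    obtain ⟨u, hu⟩ := hU.nonempty
    simpa using hsum u hu
  have hmax : ∀ (u : Fin N → K) (s : ι), ∃ a, ∀ i, S.v s (u i) ≤ S.v s (u a) := fun u s =>
    Finite.exists_max fun i => S.v s (u i)
  choose am ham using hmax
  obtain ⟨a, hinf⟩ := exists_infinite_fiber hU am
  set V := {u | u ∈ U ∧ am u = a} with hV
  have hVa : ∀ u ∈ V, ∀ s i, S.v s (u i) ≤ S.v s (u (a s)) := fun u hu s i => by
    rw [← hu.2]; exact ham u s i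
  set Q : (Fin N → K) → ℝ := fun u => ∑ s, (S.n s : ℝ) * Real.log (S.v s (u (a s))) with hQ
  set n : ℝ := ∑ s, (S.n s : ℝ) with hn
  have hfin : ∀ R : ℝ, {u | u ∈ V ∧ Q u ≤ R}.Finite := by
    intro R
    refine (Set.Finite.pi' fun _ : Fin N => S.finite_le (Real.exp (R + n * Real.log N))).subset
      fun u hu i => ⟨hO u hu.1.1 i, fun s => ?_⟩
    rw [← Real.log_le_iff_le_exp ((S.v s).pos (h0 u hu.1.1 i))]
    refine (log_max_le S (h0 u hu.1.1) (hsum u hu.1.1) (hVa u hu.1) rfl s i).trans ?_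
    have := hu.2
    simp only [hQ] at this
    linarith
  set emb := Set.Infinite.natEmbedding V hinf with hemb
  set y : ℕ → Fin N → K := fun j => (emb j).1 with hy
  have hyV : ∀ j, y j ∈ V := fun j => (emb j).2
  have hyinj : Function.Injective y := fun i j hij => emb.injective (Subtype.ext hij)
  have hQy : Tendsto (fun j => Q (y j)) atTop atTop := by
    rw [tendsto_atTop]
    intro R
    rw [← Nat.cofinite_eq_atTop, eventually_cofinite]
    refine ((hfin R).preimage (f := y) hyinj.injOn).subset fun j hj => ?_
    exact ⟨hyV j, (not_le.1 hj).le⟩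
  obtain ⟨j1, hj1⟩ := eventually_atTop.1 (hQy.eventually_ge_atTop (1 + n * Real.log N))
  have hn0 : 0 ≤ n := Finset.sum_nonneg fun s _ => Nat.cast_nonneg _
  have hlN : 0 ≤ n * Real.log N := mul_nonneg hn0 (Real.log_natCast_nonneg _)
  have hVU : ∀ j, y (j + j1) ∈ U := fun j => (hyV _).1
  have hq1 : ∀ j, 1 + n * Real.log N ≤ Q (y (j + j1)) := fun j => hj1 _ (Nat.le_add_left _ _)
  obtain ⟨W, hW, hWinf⟩ := exists_submodule_infinite S (fun s => sumMatrix (a s))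
    (fun s => sumMatrixInv (a s)) (fun s => sumMatrixInv_mul (a s))
    (A := fun j s i => if i = a s then 1 else S.v s (y (j + j1) i)) (q := fun j => Q (y (j + j1)))
    (hQy.comp (tendsto_add_atTop_nat j1)) (Cb := 2 * (n + 1)) (fun j s i => by
      have h1 := hq1 j
      have h2 : 0 ≤ n * Q (y (j + j1)) := mul_nonneg hn0 (by linarith)
      split_ifs with h
      · rw [Real.exp_le_one_iff]
        linarith
      · rw [← Real.le_log_iff_exp_le ((S.v s).pos (h0 _ (hVU j) i))]
        refine le_trans ?_ (le_log_abv S (hO _ (hVU j)) (hO' _ (hVU j)) (h0 _ (hVU j))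
          (hsum _ (hVU j)) (hVa _ (hyV _)) rfl s i)
        have h3 : n * (Q (y (j + j1)) + n * Real.log N) ≤ n * (2 * Q (y (j + j1))) :=
          mul_le_mul_of_nonneg_left (by linarith) hn0
        change _ ≤ -(n * (Q (y (j + j1)) + n * Real.log N)) + (Q (y (j + j1)) + n * Real.log N)
        linarith) (fun j s i => by
      have h1 := hq1 j
      have h2 : 0 ≤ n * Q (y (j + j1)) := mul_nonneg hn0 (by linarith)
      split_ifs with h
      · exact Real.one_le_exp (by linarith)
      · rw [← Real.log_le_iff_le_exp ((S.v s).pos (h0 _ (hVU j) i))]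
        refine (log_max_le S (h0 _ (hVU j)) (hsum _ (hVU j)) (hVa _ (hyV _)) rfl s i).trans ?_
        change Q (y (j + j1)) + n * Real.log N ≤ _
        linarith) (fun j => by
      have hpos : ∀ s i, 0 < S.v s (y (j + j1) i) := fun s i => (S.v s).pos (h0 _ (hVU j) i)
      have hpos' : ∀ s i, 0 < if i = a s then 1 else S.v s (y (j + j1) i) := fun s i => by
        split_ifs
        exacts [one_pos, hpos s i]
      rw [← Real.log_le_iff_le_exp (Finset.prod_pos fun s _ => Finset.prod_pos fun i _ =>
        pow_pos (hpos' s i) _), Real.log_prod fun s _ => (Finset.prod_pos fun i _ =>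
        pow_pos (hpos' s i) _).ne']
      have h1 : ∀ s, Real.log (∏ i, (if i = a s then 1 else S.v s (y (j + j1) i)) ^ S.n s) =
          ∑ i, S.n s * Real.log (S.v s (y (j + j1) i)) -
            S.n s * Real.log (S.v s (y (j + j1) (a s))) := by
        intro s
        rw [Real.log_prod fun i _ => (pow_pos (hpos' s i) _).ne', eq_sub_iff_add_eq,
          ← Finset.sum_erase_add _ _ (Finset.mem_univ (a s)),
          ← Finset.sum_erase_add _ (fun i => S.n s * Real.log (S.v s (y (j + j1) i)))
            (Finset.mem_univ (a s)), if_pos rfl, one_pow, Real.log_one, add_zero]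
        congr 1
        refine Finset.sum_congr rfl fun i hi => ?_
        rw [if_neg (Finset.ne_of_mem_erase hi), Real.log_pow]
      simp_rw [h1]
      rw [Finset.sum_sub_distrib, Finset.sum_comm, Finset.sum_eq_zero fun i _ =>
        S.sum_log_eq_zero (hO _ (hVU j) i) (hO' _ (hVU j) i) (h0 _ (hVU j) i), zero_sub])
    (x := fun j => y (j + j1)) (fun j => hO _ (hVU j))
    (fun j h => h0 _ (hVU j) (Classical.arbitrary _) (congrFun h _)) (fun j s i => by
      rw [ev_sumMatrix]
      split_ifs
      · rw [hsum _ (hVU j), map_one]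
      · exact le_rfl)
  obtain ⟨f, hf, hfW⟩ := Submodule.exists_le_ker_of_lt_top W (lt_top_iff_ne_top.2 hW)
  have hfx : ∀ x : Fin N → K, f x = ∑ i, f (Pi.single i 1) * x i := fun x => by
    rw [LinearMap.pi_apply_eq_sum_univ f x]
    refine Finset.sum_congr rfl fun i _ => ?_
    rw [smul_eq_mul, mul_comm]
    congr 2
    ext j
    rw [Pi.single_apply]
    simp only [eq_comm]
  refine ⟨fun i => f (Pi.single i 1), fun h => hf (LinearMap.ext fun x => ?_),
    (hWinf.image (f := fun j => y (j + j1)) fun _ _ _ _ hab =>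
      Nat.add_right_cancel (hyinj hab)).mono ?_⟩
  · rw [hfx]
    exact Finset.sum_eq_zero fun i _ => by rw [congrFun h i, Pi.zero_apply, zero_mul]
  · rintro _ ⟨j, hj, rfl⟩
    exact ⟨hVU j, (hfx _).symm.trans (hfW hj)⟩

end SUnit

namespace SUnit

variable {K : Type*} [Field K]

/-- Nondegenerate solutions of the unit equation in `Γ`. -/
def unitSolutions (Γ : Subgroup Kˣ) (α : Type*) [Fintype α] : Set (α → Kˣ) :=
  {u | (∀ i, u i ∈ Γ) ∧ (∑ i, ((u i : Kˣ) : K)) = 1 ∧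
    ¬ ∃ I : Finset α, I.Nonempty ∧ (∑ i ∈ I, ((u i : Kˣ) : K)) = 0}

lemma unitSolutions_finite_of_equiv {Γ : Subgroup Kˣ} {α β : Type*} [Fintype α] [Fintype β]
    (e : α ≃ β) (h : (unitSolutions Γ β).Finite) : (unitSolutions Γ α).Finite := by
  classical
  refine Set.Finite.of_finite_image (f := fun u => u ∘ e.symm) (h.subset ?_) ?_
  · rintro _ ⟨u, ⟨h1, h2, h3⟩, rfl⟩
    refine ⟨fun i => h1 _, ?_, ?_⟩
    · rw [← h2]
      exact Equiv.sum_comp e.symm fun i => ((u i : Kˣ) : K)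
    · rintro ⟨I, hI, hI0⟩
      refine h3 ⟨I.map e.symm.toEmbedding, hI.map, ?_⟩
      rw [Finset.sum_map]
      exact hI0
  · intro u _ u' _ huu'
    ext i
    have := congrFun huu' (e i)
    simpa using congrArg Units.val this

lemma unitSolutions_mono {Γ Γ' : Subgroup Kˣ} (h : Γ ≤ Γ') {α : Type*} [Fintype α] :
    unitSolutions Γ α ⊆ unitSolutions Γ' α := fun _ hu => ⟨fun i => h (hu.1 i), hu.2⟩

lemma Subgroup.FG.sup_closure_range {Γ : Subgroup Kˣ} (hΓ : Γ.FG) {α : Type*} [Finite α]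
    (c : α → Kˣ) : (Γ ⊔ Subgroup.closure (Set.range c)).FG :=
  hΓ.sup ((Subgroup.fg_iff _).2 ⟨_, rfl, Set.finite_range c⟩)

/-- Merging the terms of a solution along the fibres of a surjection. -/
lemma merge_mem {Γ : Subgroup Kˣ} {α β : Type*} [Fintype α] [Fintype β] [DecidableEq β] {π : α → β}
    (hπ : Function.Surjective π) {u : α → Kˣ} (hu : u ∈ unitSolutions Γ α) {v : β → Kˣ}
    (hv : ∀ b, (v b : K) = ∑ i with π i = b, (u i : K)) (hvΓ : ∀ b, v b ∈ Γ) :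
    v ∈ unitSolutions Γ β := by
  classical
  refine ⟨hvΓ, ?_, ?_⟩
  · simp_rw [hv]
    rw [← hu.2.1]
    exact Finset.sum_fiberwise Finset.univ π fun i => (u i : K)
  · rintro ⟨I, ⟨b, hb⟩, hI⟩
    simp_rw [hv] at hI
    rw [Finset.sum_fiberwise_eq_sum_filter] at hI
    obtain ⟨a, rfl⟩ := hπ b
    exact hu.2.2 ⟨_, ⟨a, Finset.mem_filter.2 ⟨Finset.mem_univ _, hb⟩⟩, hI⟩

variable {N : ℕ}

/-- Solutions with some fixed ratios of terms reduce to solutions with fewer terms. -/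
lemma finite_of_proportional
    (IH : ∀ (β : Type) [Fintype β], Fintype.card β < N → ∀ Γ : Subgroup Kˣ, Γ.FG →
      (unitSolutions Γ β).Finite) {Γ : Subgroup Kˣ} (hΓ : Γ.FG) {T : Set (Fin N → Kˣ)}
    (hT : T ⊆ unitSolutions Γ (Fin N)) {J : Finset (Fin N)} {i0 i1 : Fin N} (hi0 : i0 ∈ J)
    (hi1 : i1 ∈ J) (hne : i1 ≠ i0) (r : Fin N → Kˣ) (hr : ∀ u ∈ T, ∀ i ∈ J, u i = r i * u i0) :
    T.Finite := by
  classical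
  rcases T.eq_empty_or_nonempty with hT0 | ⟨u0, hu0⟩
  · rw [hT0]; exact Set.finite_empty
  have hsum : ∀ u ∈ T, ∑ i ∈ J, (u i : K) = (∑ i ∈ J, (r i : K)) * u i0 := fun u hu => by
    rw [Finset.sum_mul]
    exact Finset.sum_congr rfl fun i hi => by rw [hr u hu i hi, Units.val_mul]
  have hc0 : ∑ i ∈ J, (r i : K) ≠ 0 := fun h =>
    (hT hu0).2.2 ⟨J, ⟨i0, hi0⟩, by rw [hsum u0 hu0, h, zero_mul]⟩
  set c := Units.mk0 _ hc0 with hc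
  set β := {i // i ∉ J.erase i0} with hβ
  have hi0β : i0 ∉ J.erase i0 := Finset.notMem_erase _ _
  set π : Fin N → β := fun i => if h : i ∈ J.erase i0 then ⟨i0, hi0β⟩ else ⟨i, h⟩ with hπ
  have hcard : Fintype.card β < N := by
    have := Fintype.card_subtype_lt (p := fun i => i ∉ J.erase i0) (x := i1)
      (by simp [hne, hi1])
    rwa [Fintype.card_fin] at this
  set v : (Fin N → Kˣ) → β → Kˣ := fun u b => if b.1 = i0 then c * u i0 else u b.1 with hv
  have hπb : ∀ b : β, π b.1 = b := fun b => dif_neg b.2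
  refine Set.Finite.of_finite_image (f := v) ((IH β hcard (Γ ⊔ Subgroup.closure (Set.range
    fun _ : Unit => c)) (Subgroup.FG.sup_closure_range hΓ _)).subset ?_) ?_
  · rintro _ ⟨u, hu, rfl⟩
    refine merge_mem (π := π) (fun b => ⟨b.1, hπb b⟩) (unitSolutions_mono le_sup_left (hT hu))
      (fun b => ?_) fun b => ?_
    · by_cases hb : b.1 = i0
      · have h1 : (Finset.univ.filter fun i => π i = b) = J := by
          ext i
          rw [Finset.mem_filter_univ]
          by_cases hi : i ∈ J.erase i0
          · rw [show π i = ⟨i0, hi0β⟩ from dif_pos hi]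
            exact ⟨fun _ => Finset.mem_of_mem_erase hi, fun _ => Subtype.ext hb.symm⟩
          · rw [show π i = ⟨i, hi⟩ from dif_neg hi]
            constructor
            · rintro rfl
              simp only at hb
              rwa [hb]
            · intro hiJ
              refine Subtype.ext ?_
              rw [hb]
              by_contra hcon
              exact hi (Finset.mem_erase.2 ⟨hcon, hiJ⟩)
        rw [h1, hsum u hu]
        simp only [hv, if_pos hb]
        rw [Units.val_mul, hc, Units.val_mk0]
      · have h1 : (Finset.univ.filter fun i => π i = b) = {b.1} := by
          ext i
          rw [Finset.mem_filter_univ, Finset.mem_singleton]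
          by_cases hi : i ∈ J.erase i0
          · rw [show π i = ⟨i0, hi0β⟩ from dif_pos hi]
            refine ⟨fun h => absurd (congrArg Subtype.val h).symm hb, ?_⟩
            rintro rfl
            exact absurd hi b.2
          · rw [show π i = ⟨i, hi⟩ from dif_neg hi]
            exact ⟨fun h => congrArg Subtype.val h, fun h => Subtype.ext h⟩
        rw [h1, Finset.sum_singleton]
        simp only [hv, if_neg hb]
    · simp only [hv]
      split_ifs
      · exact Subgroup.mul_mem _ (Subgroup.mem_sup_right (Subgroup.subset_closure ⟨(), rfl⟩))
          (Subgroup.mem_sup_left ((hT hu).1 _))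
      · exact Subgroup.mem_sup_left ((hT hu).1 _)
  · intro u hu u' hu' huu'
    have h0 : u i0 = u' i0 := by
      have := congrFun huu' ⟨i0, hi0β⟩
      simpa [hv] using this
    funext i
    by_cases hi : i ∈ J.erase i0
    · have hi := Finset.mem_of_mem_erase hi
      rw [hr u hu i hi, hr u' hu' i hi, h0]
    · by_cases hi' : i = i0
      · rw [hi', h0]
      · have := congrFun huu' ⟨i, hi⟩
        simpa [hv, hi'] using this

/-- Solutions satisfying a fixed minimal linear relation reduce to solutions with fewer terms. -/
lemma finite_of_minimal_relation
    (IH : ∀ (β : Type) [Fintype β], Fintype.card β < N → ∀ Γ : Subgroup Kˣ, Γ.FG →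
      (unitSolutions Γ β).Finite) {Γ : Subgroup Kˣ} (hΓ : Γ.FG) {T : Set (Fin N → Kˣ)}
    (hT : T ⊆ unitSolutions Γ (Fin N)) {J : Finset (Fin N)} (hJ : J.Nonempty) (b : Fin N → Kˣ)
    (hb : ∀ u ∈ T, ∑ i ∈ J, (b i * u i : K) = 0)
    (hmin : ∀ u ∈ T, ∀ I ⊂ J, I.Nonempty → ∑ i ∈ I, (b i * u i : K) ≠ 0) : T.Finite := by
  classical
  rcases T.eq_empty_or_nonempty with hT0 | ⟨u0, hu0⟩
  · rw [hT0]; exact Set.finite_empty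
  obtain ⟨i0, hi0⟩ := hJ
  obtain ⟨i1, hi1, hne⟩ : ∃ i1 ∈ J, i1 ≠ i0 := by
    by_contra! h
    have h1 : J = {i0} := Finset.eq_singleton_iff_unique_mem.2 ⟨hi0, h⟩
    have := hb u0 hu0
    rw [h1, Finset.sum_singleton] at this
    exact mul_ne_zero (Units.ne_zero _) (Units.ne_zero _) this
  set β := {i // i ∈ J.erase i0} with hβ
  have hcard : Fintype.card β < N := by
    have := Fintype.card_subtype_lt (p := fun i => i ∈ J.erase i0) (x := i0) (by simp)
    rwa [Fintype.card_fin] at this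
  set c : Fin N → Kˣ := fun i => -(b i / b i0) with hc
  set w : (Fin N → Kˣ) → β → Kˣ := fun u i => c i.1 * (u i.1 / u i0) with hw
  have hwK : ∀ u : Fin N → Kˣ, ∀ i : β, (w u i : K) = -(b i0 * u i0 : K)⁻¹ * (b i.1 * u i.1) := by
    intro u i
    simp only [hw, hc, Units.val_mul, Units.val_neg, Units.val_div_eq_div_val]
    field_simp
  have hbu : ∀ u : Fin N → Kˣ, (b i0 * u i0 : K) ≠ 0 := fun u =>
    mul_ne_zero (Units.ne_zero _) (Units.ne_zero _)
  refine Set.Finite.of_finite_fibers w ((IH β hcard (Γ ⊔ Subgroup.closure (Set.range c))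
    (Subgroup.FG.sup_closure_range hΓ _)).subset ?_) ?_
  · rintro _ ⟨u, hu, rfl⟩
    refine ⟨fun i => ?_, ?_, ?_⟩
    · exact Subgroup.mul_mem _ (Subgroup.mem_sup_right (Subgroup.subset_closure ⟨_, rfl⟩))
        (Subgroup.mem_sup_left (Subgroup.div_mem _ ((hT hu).1 _) ((hT hu).1 _)))
    · simp_rw [hwK]
      rw [← Finset.mul_sum, Finset.sum_coe_sort (J.erase i0) fun i => (b i * u i : K)]
      have := hb u hu
      rw [← Finset.sum_erase_add _ _ hi0] at this
      rw [eq_neg_of_add_eq_zero_left this, neg_mul_neg, inv_mul_cancel₀ (hbu u)]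
    · rintro ⟨I, hI, hI0⟩
      simp_rw [hwK] at hI0
      rw [← Finset.mul_sum] at hI0
      refine hmin u hu (I.map (Function.Embedding.subtype _)) ?_ hI.map ?_
      · refine (Finset.ssubset_iff_of_subset fun i hi => ?_).2 ⟨i0, hi0, ?_⟩
        · obtain ⟨a, -, rfl⟩ := Finset.mem_map.1 hi
          exact Finset.mem_of_mem_erase a.2
        · intro h
          obtain ⟨a, -, ha⟩ := Finset.mem_map.1 h
          exact Finset.ne_of_mem_erase a.2 ha
      · rw [Finset.sum_map]
        exact (mul_eq_zero.1 hI0).resolve_left (neg_ne_zero.2 (inv_ne_zero (hbu u)))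
  · rintro _ ⟨u1, hu1, rfl⟩
    refine finite_of_proportional IH hΓ (fun u hu => hT hu.1) hi0 hi1 hne
      (fun i => u1 i / u1 i0) fun u hu i hi => ?_
    by_cases hii : i = i0
    · rw [hii, div_self', one_mul]
    · have h1 : w u = w u1 := hu.2
      have := congrFun h1 ⟨i, Finset.mem_erase.2 ⟨hii, hi⟩⟩
      simp only [hw, mul_right_inj] at this
      rw [← this, div_mul_cancel]

/-- The `S`-unit theorem, assuming the existence of suitable systems of absolute values. -/
theorem unitSolutions_finite.{u} [NumberField K]
    (H : ∀ Γ : Subgroup Kˣ, Γ.FG → ∃ (ι : Type u) (_ : Fintype ι) (_ : Nonempty ι)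
      (S : SData K ι), ∀ u ∈ Γ, (u : K) ∈ S.O) (N : ℕ) :
    ∀ (α : Type) [Fintype α], Fintype.card α = N → ∀ Γ : Subgroup Kˣ, Γ.FG →
      (unitSolutions Γ α).Finite := by
  classical
  induction N using Nat.strong_induction_on with
  | _ N IH =>
  intro α _ hα Γ hΓ
  refine unitSolutions_finite_of_equiv (Fintype.equivFinOfCardEq hα) ?_
  replace IH : ∀ (β : Type) [Fintype β], Fintype.card β < N → ∀ Γ : Subgroup Kˣ, Γ.FG →
      (unitSolutions Γ β).Finite := fun β _ h => IH _ h β rfl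
  by_contra hinf
  set f : (Fin N → Kˣ) → Fin N → K := fun u i => u i with hf
  have hfinj : Function.Injective f := fun u u' h => funext fun i => Units.ext (congrFun h i)
  obtain ⟨ι, _, _, S, hS⟩ := H Γ hΓ
  obtain ⟨b, hb0, hbinf⟩ := exists_linear_relation S
    (Set.Infinite.image hfinj.injOn hinf)
    (by rintro _ ⟨u, hu, rfl⟩ i; exact hS _ (hu.1 i))
    (by rintro _ ⟨u, hu, rfl⟩ i
        have := hS _ (Γ.inv_mem (hu.1 i))
        rwa [Units.val_inv_eq_inv_val] at this)
    (by rintro _ ⟨u, hu, rfl⟩ i; exact Units.ne_zero _)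
    (by rintro _ ⟨u, hu, rfl⟩; exact hu.2.1)
  set T := {u | u ∈ unitSolutions Γ (Fin N) ∧ ∑ i, b i * (u i : K) = 0} with hT
  have hTinf : T.Infinite := by
    refine fun h => hbinf ((h.image f).subset ?_)
    rintro _ ⟨⟨u, hu, rfl⟩, hbu⟩
    exact ⟨u, ⟨hu, hbu⟩, rfl⟩
  set P : (Fin N → Kˣ) → Finset (Fin N) → Prop := fun u J =>
    J.Nonempty ∧ (∀ i ∈ J, b i ≠ 0) ∧ ∑ i ∈ J, b i * (u i : K) = 0 with hP
  have hex : ∀ u, ∃ J, u ∈ T → P u J ∧ ∀ I ⊂ J, ¬ P u I := by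
    intro u
    by_cases hu : u ∈ T
    · have h1 : ∃ J, P u J := by
        refine ⟨Finset.univ.filter fun i => b i ≠ 0, ?_, fun i hi => (Finset.mem_filter.1 hi).2, ?_⟩
        · obtain ⟨i, hi⟩ := Function.ne_iff.1 hb0
          exact ⟨i, Finset.mem_filter.2 ⟨Finset.mem_univ _, hi⟩⟩
        · refine Eq.trans (Finset.sum_subset (Finset.subset_univ _) fun i _ hi => ?_) hu.2
          rw [Finset.mem_filter_univ, not_not] at hi
          rw [hi, zero_mul]
      obtain ⟨J, hJ, hmin⟩ := WellFounded.has_min (r := fun I J : Finset (Fin N) => I ⊂ J)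
        Finset.isWellFounded_ssubset.wf {J | P u J} h1
      exact ⟨J, fun _ => ⟨hJ, fun I hI hPI => hmin I hPI hI⟩⟩
    · exact ⟨∅, fun h => absurd h hu⟩
  choose J hJ using hex
  obtain ⟨J0, hJ0⟩ := exists_infinite_fiber hTinf J
  obtain ⟨u0, hu0, hu0J⟩ := hJ0.nonempty
  have hb0 := (hJ u0 hu0).1
  rw [hu0J] at hb0
  have hbJ : ∀ i ∈ J0, ((if h : b i = 0 then 1 else Units.mk0 (b i) h : Kˣ) : K) = b i :=
    fun i hi => by rw [dif_neg (hb0.2.1 i hi), Units.val_mk0]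
  refine hJ0 (finite_of_minimal_relation IH hΓ (fun u hu => hu.1.1) hb0.1
    (fun i => if h : b i = 0 then 1 else Units.mk0 (b i) h) (fun u hu => ?_) fun u hu I hI hne h => ?_)
  · have h1 := (hJ u hu.1).1.2.2
    rw [hu.2] at h1
    exact (Finset.sum_congr rfl fun i hi => by rw [hbJ i hi]).trans h1
  · have h1 := (hJ u hu.1).2 I (by rw [hu.2]; exact hI)
    refine h1 ⟨hne, fun i hi => hb0.2.1 i (hI.1 hi), ?_⟩
    exact (Finset.sum_congr rfl fun i hi => by rw [hbJ i (hI.1 hi)]).trans h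

end SUnit

namespace SUnit
open NumberField IsDedekindDomain

variable {K : Type*} [Field K] [NumberField K]

lemma finitePlace_le_one (w : FinitePlace K) (x : 𝓞 K) : w (x : K) ≤ 1 := by
  rw [← FinitePlace.norm_embedding_eq]
  exact FinitePlace.norm_le_one K w.maximalIdeal x

lemma finitePlace_le_one_of_isIntegral (w : FinitePlace K) {x : K} (hx : IsIntegral ℤ x) :
    w x ≤ 1 :=
  finitePlace_le_one w ⟨x, hx⟩

lemma isIntegral_of_finitePlace_le_one {x : K} (h : ∀ w : FinitePlace K, w x ≤ 1) :
    IsIntegral ℤ x := by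
  obtain ⟨y, rfl⟩ := HeightOneSpectrum.mem_integers_of_valuation_le_one (R := 𝓞 K) K x fun v => by
    have h1 := h (FinitePlace.mk v)
    rw [FinitePlace.mk_apply, FinitePlace.norm_embedding'] at h1
    exact (WithZeroMulInt.toNNReal_le_one_iff
      (HeightOneSpectrum.one_lt_absNorm_nnreal v)).1 (by exact_mod_cast h1)
  exact y.isIntegral_coe

lemma finitePlace_le_of_mem_pow (w : FinitePlace K) {x : 𝓞 K} {a : ℕ}
    (hx : x ∈ w.maximalIdeal.asIdeal ^ a) :
    w (x : K) ≤ ((Ideal.absNorm w.maximalIdeal.asIdeal : ℝ) ^ a)⁻¹ := by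
  have hq : (1 : ℝ) < Ideal.absNorm w.maximalIdeal.asIdeal := by
    exact_mod_cast HeightOneSpectrum.one_lt_absNorm w.maximalIdeal
  by_cases h0 : x = 0
  · rw [h0, RingOfIntegers.coe_eq_algebraMap, map_zero, map_zero]
    positivity
  have h1 := w.apply_mul_absNorm_pow_eq_one h0
  rw [eq_inv_of_mul_eq_one_left h1]
  refine inv_anti₀ (by positivity) (pow_le_pow_right₀ hq.le ?_)
  refine FiniteMultiplicity.le_multiplicity_of_pow_dvd ?_ (Ideal.dvd_span_singleton.2 hx)
  exact FiniteMultiplicity.of_prime_left w.maximalIdeal.prime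
    (by rwa [Ne, Ideal.zero_eq_bot, Ideal.span_singleton_eq_bot])

/-- The ring of elements integral outside the finite set `T` of finite places. -/
def sIntegers (T : Finset (FinitePlace K)) : Subring K where
  carrier := {x | ∀ w ∉ T, w x ≤ 1}
  mul_mem' {x y} hx hy w hw := by
    rw [map_mul]
    exact mul_le_one₀ (hx w hw) (apply_nonneg w y) (hy w hw)
  one_mem' w _ := (map_one w).le
  add_mem' {x y} hx hy w hw := (w.add_le x y).trans (max_le (hx w hw) (hy w hw))
  zero_mem' w _ := by rw [map_zero]; exact zero_le_one
  neg_mem' {x} hx w hw := by rw [map_neg_eq_map]; exact hx w hw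

lemma exists_sIntegers_of_fg (Γ : Subgroup Kˣ) (hΓ : Γ.FG) :
    ∃ T : Finset (FinitePlace K), ∀ u ∈ Γ, (u : K) ∈ sIntegers T := by
  classical
  obtain ⟨s, rfl⟩ := hΓ
  have hfin : ∀ u : Kˣ, (Function.mulSupport fun w : FinitePlace K => w (u : K)).Finite := fun u =>
    FinitePlace.hasFiniteMulSupport u.ne_zero
  refine ⟨s.biUnion fun u => (hfin u).toFinset, fun u hu w hw => ?_⟩
  refine le_of_eq ?_
  induction hu using Subgroup.closure_induction with
  | mem x hx =>
    by_contra h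
    exact hw (Finset.mem_biUnion.2 ⟨x, hx, (hfin x).mem_toFinset.2 h⟩)
  | one => rw [Units.val_one, map_one]
  | mul x y _ _ hx hy => rw [Units.val_mul, map_mul, hx, hy, one_mul]
  | inv x _ hx => rw [Units.val_inv_eq_inv_val, map_inv₀, hx, inv_one]

omit [NumberField K] in
lemma isIntegral_natCast (n : ℕ) : IsIntegral ℤ (n : K) := by
  have := isIntegral_algebraMap (R := ℤ) (A := K) (x := n)
  rwa [eq_intCast, Int.cast_natCast] at this

/-- There is a nonzero integer that is small at all places of `T`. -/
lemma exists_nat_small (T : Finset (FinitePlace K)) {ε : ℝ} (hε : 0 < ε) :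
    ∃ D : ℕ, D ≠ 0 ∧ ∀ w ∈ T, w (D : K) ≤ ε := by
  classical
  set q : FinitePlace K → ℕ := fun w => Ideal.absNorm w.maximalIdeal.asIdeal with hqdef
  have hq : ∀ w : FinitePlace K, 1 < q w := fun w => HeightOneSpectrum.one_lt_absNorm w.maximalIdeal
  have hle : ∀ (w : FinitePlace K) (n : ℕ), w (n : K) ≤ 1 := fun w n =>
    finitePlace_le_one_of_isIntegral w (isIntegral_natCast n)
  have hlt : ∀ w : FinitePlace K, w (q w : K) < 1 := fun w => by
    have h1 := finitePlace_le_of_mem_pow w (a := 1) (x := (q w : 𝓞 K))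
      (by rw [pow_one]; exact Ideal.absNorm_mem _)
    rw [pow_one] at h1
    have h2 : w (q w : K) ≤ ((q w : ℝ))⁻¹ := by simpa using h1
    exact h2.trans_lt (inv_lt_one_of_one_lt₀ (by exact_mod_cast hq w))
  have he : ∃ e : ℕ, ∀ w ∈ T, w (q w : K) ^ e ≤ ε := by
    have : ∀ w ∈ T, ∀ᶠ e : ℕ in Filter.atTop, w (q w : K) ^ e ≤ ε := fun w _ =>
      (tendsto_pow_atTop_nhds_zero_of_lt_one (apply_nonneg _ _) (hlt w)).eventually_le_const hε
    exact ((Filter.eventually_all_finset T).2 this).exists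
  obtain ⟨e, he⟩ := he
  refine ⟨∏ w ∈ T, q w ^ e, Finset.prod_ne_zero_iff.2 fun w _ =>
    pow_ne_zero _ (by have := hq w; omega), fun w hw => ?_⟩
  rw [← Finset.mul_prod_erase T _ hw, Nat.cast_mul, map_mul, Nat.cast_pow, map_pow]
  exact (mul_le_of_le_one_right (by positivity) (hle w _)).trans (he w hw)

/-- Every finite set of finite places is contained in one that is the support of an integer. -/
lemma exists_superset_small (T₀ : Finset (FinitePlace K)) :
    ∃ T : Finset (FinitePlace K), T₀ ⊆ T ∧ ∀ ε : ℝ, 0 < ε →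
      ∃ D : ℕ, D ≠ 0 ∧ (∀ w ∈ T, w (D : K) ≤ ε) ∧ ∀ w ∉ T, w (D : K) = 1 := by
  obtain ⟨D, hD0, hD⟩ := exists_nat_small T₀ (ε := 1 / 2) (by norm_num)
  have hfin : (Function.mulSupport fun w : FinitePlace K => w (D : K)).Finite :=
    FinitePlace.hasFiniteMulSupport (Nat.cast_ne_zero.2 hD0)
  have hmem : ∀ w, w ∈ hfin.toFinset ↔ w (D : K) ≠ 1 := fun w => hfin.mem_toFinset
  refine ⟨hfin.toFinset, fun w hw => (hmem w).2 fun h => ?_, fun ε hε => ?_⟩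
  · have := hD w hw
    rw [h] at this
    norm_num at this
  have : ∀ w ∈ hfin.toFinset, ∀ᶠ e : ℕ in Filter.atTop, w (D : K) ^ e ≤ ε := fun w hw =>
    (tendsto_pow_atTop_nhds_zero_of_lt_one (apply_nonneg _ _)
      (lt_of_le_of_ne (finitePlace_le_one_of_isIntegral w (isIntegral_natCast D))
        ((hmem w).1 hw))).eventually_le_const hε
  obtain ⟨e, he⟩ := ((Filter.eventually_all_finset _).2 this).exists
  refine ⟨D ^ e, pow_ne_zero _ hD0, fun w hw => ?_, fun w hw => ?_⟩
  · rw [Nat.cast_pow, map_pow]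
    exact he w hw
  · rw [hmem, not_not] at hw
    rw [Nat.cast_pow, map_pow, hw, one_pow]

/-- Indices of the archimedean places and the places in `T`. -/
abbrev PlaceIdx (T : Finset (FinitePlace K)) := InfinitePlace K ⊕ T

/-- The absolute values at the archimedean places and the places in `T`. -/
noncomputable def placeAbv (T : Finset (FinitePlace K)) : PlaceIdx T → AbsoluteValue K ℝ :=
  Sum.elim (fun w => w.1) fun w => w.1.1

/-- The multiplicities of the archimedean places and the places in `T`. -/
noncomputable def placeMult (T : Finset (FinitePlace K)) : PlaceIdx T → ℕ :=
  Sum.elim (fun w => w.mult) fun _ => 1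

lemma one_le_prod_placeAbv (T : Finset (FinitePlace K)) {x : K} (hx : x ∈ sIntegers T)
    (h0 : x ≠ 0) : 1 ≤ ∏ s, placeAbv T s x ^ placeMult T s := by
  classical
  have hfin := FinitePlace.hasFiniteMulSupport h0
  have h1 := prod_abs_eq_one h0
  rw [finprod_eq_prod_of_mulSupport_subset (s := T ∪ Set.Finite.toFinset hfin) _ fun w hw =>
    Finset.mem_coe.2 (Finset.mem_union_right _ ((Set.Finite.mem_toFinset hfin).2 hw)),
    ← Finset.prod_sdiff Finset.subset_union_left] at h1
  rw [Fintype.prod_sum_type, ← h1]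
  have h2 : ∏ w : T, placeAbv T (Sum.inr w) x ^ placeMult T (Sum.inr w) = ∏ w ∈ T, w x := by
    rw [← Finset.prod_coe_sort T fun w => w x]
    exact Finset.prod_congr rfl fun w _ => pow_one (w.1 x)
  rw [h2]
  refine mul_le_mul_of_nonneg_left ?_ (Finset.prod_nonneg fun w _ => pow_nonneg (apply_nonneg _ _) _)
  exact mul_le_of_le_one_left (Finset.prod_nonneg fun w _ => apply_nonneg _ _)
    (Finset.prod_le_one (fun w _ => apply_nonneg _ _) fun w hw => hx w (Finset.mem_sdiff.1 hw).2)

lemma finite_sIntegers_le (T : Finset (FinitePlace K)) (R : ℝ) :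
    {x : K | x ∈ sIntegers T ∧ ∀ s, placeAbv T s x ≤ R}.Finite := by
  obtain ⟨D, hD0, hD⟩ := exists_nat_small T (ε := (max R 1)⁻¹) (by positivity)
  have hD0' : (D : K) ≠ 0 := Nat.cast_ne_zero.2 hD0
  refine Set.Finite.of_finite_image (f := fun x => (D : K) * x) ?_
    fun x _ y _ h => mul_left_cancel₀ hD0' h
  refine (Embeddings.finite_of_norm_le K ℂ (D * R)).subset ?_
  rintro _ ⟨x, ⟨hx, hR⟩, rfl⟩
  refine ⟨isIntegral_of_finitePlace_le_one fun w => ?_, fun φ => ?_⟩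
  · rw [map_mul]
    by_cases hw : w ∈ T
    · have h1 : w x ≤ R := hR (Sum.inr ⟨w, hw⟩)
      have hm : (0 : ℝ) < max R 1 := by positivity
      calc w (D : K) * w x ≤ (max R 1)⁻¹ * max R 1 :=
            mul_le_mul (hD w hw) (h1.trans (le_max_left _ _)) (apply_nonneg _ _) (by positivity)
        _ = 1 := inv_mul_cancel₀ hm.ne'
    · exact mul_le_one₀ (finitePlace_le_one_of_isIntegral w (isIntegral_natCast D))
        (apply_nonneg _ _) (hx w hw)
  · have h1 : ‖φ x‖ ≤ R := hR (Sum.inl (InfinitePlace.mk φ))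
    rw [map_mul, norm_mul, map_natCast, Complex.norm_natCast]
    exact mul_le_mul_of_nonneg_left h1 (Nat.cast_nonneg _)

end SUnit

namespace SUnit
open NumberField IsDedekindDomain

variable {K : Type*} [Field K] [NumberField K]

omit [NumberField K] in
lemma infinitePlace_cover (w : InfinitePlace K) {A R : ℝ} (hA : 0 < A) (hR : A ≤ R) :
    ∃ (m : ℕ) (κ : K → ℕ), (∀ x, w x ≤ R → κ x < m) ∧
      (∀ x y, w x ≤ R → w y ≤ R → κ x = κ y → w (x - y) ≤ A) ∧
      (m : ℝ) ≤ (7 * R / A) ^ w.mult := by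
  classical
  set φ := w.embedding with hφ
  have hw : ∀ x, w x = ‖φ x‖ := fun x => (w.norm_embedding_eq x).symm
  set M : ℤ := ⌈2 * R / A⌉ with hM
  have hM1 : 2 * R / A ≤ M := Int.le_ceil _
  have hM2 : (M : ℝ) < 2 * R / A + 1 := Int.ceil_lt_add_one _
  have hM0 : 0 ≤ M := Int.ceil_nonneg (by have := hA.trans_le hR; positivity)
  set κ0 : K → ℤ × ℤ := fun x =>
    (⌊2 * (φ x).re / A⌋, if w.IsReal then 0 else ⌊2 * (φ x).im / A⌋) with hκ0
  set F : Finset (ℤ × ℤ) := Finset.Icc (-M) M ×ˢ (if w.IsReal then {0} else Finset.Icc (-M) M)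
    with hF
  have hfl : ∀ t : ℝ, |t| ≤ R → ⌊2 * t / A⌋ ∈ Finset.Icc (-M) M := by
    intro t ht
    have h1 : |2 * t / A| ≤ M := by
      rw [abs_div, abs_mul, abs_of_pos hA, abs_two]
      refine le_trans ?_ hM1
      gcongr
    rw [abs_le] at h1
    rw [Finset.mem_Icc]
    refine ⟨Int.le_floor.2 (by push_cast; exact h1.1), ?_⟩
    exact_mod_cast (Int.floor_le _).trans h1.2
  have hmem : ∀ x, w x ≤ R → κ0 x ∈ F := by
    intro x hx
    rw [hw] at hx
    rw [hF, Finset.mem_product]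
    refine ⟨hfl _ ((Complex.abs_re_le_norm _).trans hx), ?_⟩
    by_cases hr : w.IsReal
    · simp [hκ0, hr]
    · simp only [hκ0, hr, if_false]
      exact hfl _ ((Complex.abs_im_le_norm _).trans hx)
  have hdiff : ∀ s t : ℝ, ⌊2 * s / A⌋ = ⌊2 * t / A⌋ → |s - t| ≤ A / 2 := by
    intro s t h
    have h1 := Int.abs_sub_lt_one_of_floor_eq_floor h
    rw [← sub_div, ← mul_sub, abs_div, abs_mul, abs_of_pos hA, abs_two, div_lt_one hA] at h1
    linarith
  refine ⟨F.card, fun x => if h : κ0 x ∈ F then (F.equivFin ⟨κ0 x, h⟩ : ℕ) else F.card, ?_, ?_, ?_⟩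
  · intro x hx
    simp only [hmem x hx, dif_pos]
    exact Fin.is_lt _
  · intro x y hx hy hxy
    simp only [hmem x hx, hmem y hy, dif_pos] at hxy
    have h1 : κ0 x = κ0 y := by
      have := F.equivFin.injective (Fin.ext hxy)
      exact congrArg Subtype.val this
    have h2 := hdiff _ _ (congrArg Prod.fst h1)
    have h3 : |(φ x).im - (φ y).im| ≤ A / 2 := by
      by_cases hr : w.IsReal
      · have him : ∀ z, (φ z).im = 0 := fun z => by
          rw [hφ, ← InfinitePlace.embedding_of_isReal_apply hr, Complex.ofReal_im]
        rw [him, him, sub_zero, abs_zero]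
        positivity
      · have := congrArg Prod.snd h1
        simp only [hκ0, hr, if_false] at this
        exact hdiff _ _ this
    rw [hw, map_sub]
    refine (Complex.norm_le_abs_re_add_abs_im _).trans ?_
    rw [Complex.sub_re, Complex.sub_im]
    linarith
  · have hcard : ((Finset.Icc (-M) M).card : ℝ) ≤ 7 * R / A := by
      rw [Int.card_Icc]
      have h1 : ((M + 1 - -M).toNat : ℤ) = 2 * M + 1 := by omega
      have h2 : ((M + 1 - -M).toNat : ℝ) = 2 * M + 1 := by exact_mod_cast h1
      rw [h2]
      have h3 : 1 ≤ R / A := (one_le_div hA).2 hR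
      rw [mul_div_assoc] at hM2 ⊢
      linarith
    rw [hF, Finset.card_product, Nat.cast_mul, InfinitePlace.mult]
    by_cases hr : w.IsReal
    · simpa [hr] using hcard
    · simp only [hr, if_false, sq]
      exact mul_self_le_mul_self (Nat.cast_nonneg _) hcard

lemma finitePlace_cover (w : FinitePlace K) {A : ℝ} (hA : 0 < A) (hA1 : A ≤ 1) :
    ∃ (m : ℕ) (κ : 𝓞 K → ℕ), (∀ x, κ x < m) ∧
      (∀ x y, κ x = κ y → w ((x : K) - y) ≤ A) ∧
      (m : ℝ) ≤ Ideal.absNorm w.maximalIdeal.asIdeal / A := by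
  classical
  set P := w.maximalIdeal.asIdeal with hP
  have hq : (1 : ℝ) < Ideal.absNorm P := by
    exact_mod_cast HeightOneSpectrum.one_lt_absNorm w.maximalIdeal
  obtain ⟨n, hn1, hn2⟩ := exists_nat_pow_near ((one_le_inv₀ hA).2 hA1) hq
  have hne : Ideal.absNorm (P ^ (n + 1)) ≠ 0 := by
    rw [map_pow]
    exact pow_ne_zero _ (by rintro h; rw [h] at hq; norm_num at hq)
  have hcard : Nat.card (𝓞 K ⧸ P ^ (n + 1)) = Ideal.absNorm (P ^ (n + 1)) := by
    rw [Ideal.absNorm_apply]; rfl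
  have : Finite (𝓞 K ⧸ P ^ (n + 1)) := Nat.finite_of_card_ne_zero (by rwa [hcard])
  refine ⟨Nat.card (𝓞 K ⧸ P ^ (n + 1)),
    fun x => (Finite.equivFin (𝓞 K ⧸ P ^ (n + 1)) (Ideal.Quotient.mk _ x) : ℕ),
    fun x => Fin.is_lt _, fun x y h => ?_, ?_⟩
  · have h1 := (Finite.equivFin _).injective (Fin.ext h)
    have h2 := finitePlace_le_of_mem_pow w (Ideal.Quotient.eq.1 h1)
    exact h2.trans (inv_le_of_inv_le₀ hA hn2.le)
  · rw [hcard, map_pow, Nat.cast_pow, pow_succ, div_eq_mul_inv, mul_comm]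
    exact mul_le_mul_of_nonneg_left hn1 (by positivity)

/-- The archimedean radius of a box at each place. -/
def placeRadius (T : Finset (FinitePlace K)) (R : ℝ) : PlaceIdx T → ℝ :=
  Sum.elim (fun _ => R) fun _ => 1

lemma exists_place_cover (T : Finset (FinitePlace K)) : ∃ C : ℝ, 1 ≤ C ∧
    ∀ (s : PlaceIdx T) (A R : ℝ), 0 < A → A ≤ placeRadius T R s →
      ∃ (m : ℕ) (κ : 𝓞 K → ℕ),
        (∀ x : 𝓞 K, (∀ w : InfinitePlace K, w x ≤ R) → κ x < m) ∧
        (∀ x y : 𝓞 K, (∀ w : InfinitePlace K, w x ≤ R) → (∀ w : InfinitePlace K, w y ≤ R) →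
          κ x = κ y → placeAbv T s ((x : K) - y) ≤ A) ∧
        (m : ℝ) ≤ (C * placeRadius T R s / A) ^ placeMult T s := by
  set Q : ℝ := ∑ w ∈ T, (Ideal.absNorm w.maximalIdeal.asIdeal : ℝ) with hQ
  have hQ0 : 0 ≤ Q := Finset.sum_nonneg fun _ _ => Nat.cast_nonneg _
  refine ⟨7 + Q, by linarith, ?_⟩
  rintro (w | w) A R hA hAR
  · obtain ⟨m, κ, h1, h2, h3⟩ := infinitePlace_cover w hA hAR
    refine ⟨m, fun x => κ x, fun x hx => h1 _ (hx w), fun x y hx hy => h2 _ _ (hx w) (hy w),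
      h3.trans ?_⟩
    have hR : 0 < R := hA.trans_le hAR
    refine pow_le_pow_left₀ (by positivity) ?_ _
    change 7 * R / A ≤ (7 + Q) * R / A
    gcongr
    linarith
  · obtain ⟨m, κ, h1, h2, h3⟩ := finitePlace_cover w.1 hA hAR
    refine ⟨m, κ, fun x _ => h1 x, fun x y _ _ => h2 x y, h3.trans ?_⟩
    change _ ≤ ((7 + Q) * 1 / A) ^ 1
    rw [pow_one, mul_one]
    have : (Ideal.absNorm w.1.maximalIdeal.asIdeal : ℝ) ≤ Q :=
      Finset.single_le_sum (f := fun w : FinitePlace K =>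
        (Ideal.absNorm w.maximalIdeal.asIdeal : ℝ)) (fun _ _ => Nat.cast_nonneg _) w.2
    gcongr
    linarith

end SUnit

namespace SUnit
open NumberField IsDedekindDomain

variable {K : Type*} [Field K] [NumberField K]

/-- The integral vector with given coordinates in an integral basis. -/
noncomputable def coordVec {N B : ℕ}
    (n : Fin N → Module.Free.ChooseBasisIndex ℤ (𝓞 K) → Fin B) (j : Fin N) : 𝓞 K :=
  ∑ b, ((n j b : ℕ) : ℤ) • RingOfIntegers.basis K b

lemma coordVec_injective {N B : ℕ} : Function.Injective (coordVec (K := K) (N := N) (B := B)) := by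
  intro n n' h
  funext j b
  have h1 := congrArg (fun z => (RingOfIntegers.basis K).repr z b) (congrFun h j)
  simp only [coordVec, Module.Basis.repr_sum_self] at h1
  exact Fin.ext (by exact_mod_cast h1)

omit [NumberField K] in
lemma coe_sum_intCast_mul {ι : Type*} [Fintype ι] (a : ι → ℤ) (y : ι → 𝓞 K) :
    ((∑ j, (a j : 𝓞 K) * y j : 𝓞 K) : K) = ∑ j, (a j : K) * (y j : K) := by
  simp only [RingOfIntegers.coe_eq_algebraMap, map_sum, map_mul, map_intCast]

lemma exists_coordVec_bound {ι : Type*} [Fintype ι] (N : ℕ)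
    (L : ι → Matrix (Fin N) (Fin N) ℤ) : ∃ C : ℝ, 1 ≤ C ∧
    ∀ (B : ℕ) (n : Fin N → Module.Free.ChooseBasisIndex ℤ (𝓞 K) → Fin B)
      (w : InfinitePlace K) (s : ι) (i : Fin N),
      w ((∑ j, (L s i j : 𝓞 K) * coordVec n j : 𝓞 K) : K) ≤ C * B := by
  set f : InfinitePlace K → ι → Fin N → ℝ := fun w s i =>
    ∑ j, |(L s i j : ℝ)| * ∑ b, w (RingOfIntegers.basis K b : K) with hf
  have hf0 : ∀ w s i, 0 ≤ f w s i := fun w s i => Finset.sum_nonneg fun j _ =>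
    mul_nonneg (abs_nonneg _) (Finset.sum_nonneg fun b _ => apply_nonneg _ _)
  refine ⟨1 + ∑ w, ∑ s, ∑ i, f w s i, ?_, fun B n w s i => ?_⟩
  · have := Finset.sum_nonneg fun w (_ : w ∈ Finset.univ) => Finset.sum_nonneg
      fun s (_ : s ∈ Finset.univ) => Finset.sum_nonneg fun i (_ : i ∈ Finset.univ) => hf0 w s i
    linarith
  · have h1 : w ((∑ j, (L s i j : 𝓞 K) * coordVec n j : 𝓞 K) : K) ≤ f w s i * B := by
      rw [coe_sum_intCast_mul, hf, Finset.sum_mul]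
      refine (abv_sum_le w.1 _ _).trans (Finset.sum_le_sum fun j _ => ?_)
      rw [map_mul, mul_assoc]
      refine mul_le_mul (abv_intCast_le w.1 _) ?_ (apply_nonneg _ _) (abs_nonneg _)
      simp only [coordVec, zsmul_eq_mul]
      rw [coe_sum_intCast_mul, Finset.sum_mul]
      refine (abv_sum_le w.1 _ _).trans (Finset.sum_le_sum fun b _ => ?_)
      rw [map_mul, mul_comm]
      refine mul_le_mul_of_nonneg_left ((abv_intCast_le w.1 _).trans ?_) (apply_nonneg _ _)
      rw [Int.cast_natCast, abs_of_nonneg (Nat.cast_nonneg _)]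
      exact_mod_cast (n j b).is_lt.le
    refine h1.trans (mul_le_mul_of_nonneg_right ?_ (Nat.cast_nonneg _))
    have h2 : f w s i ≤ ∑ i, f w s i :=
      Finset.single_le_sum (fun i _ => hf0 w s i) (Finset.mem_univ i)
    have h3 : ∑ i, f w s i ≤ ∑ s, ∑ i, f w s i :=
      Finset.single_le_sum (f := fun s => ∑ i, f w s i)
        (fun s _ => Finset.sum_nonneg fun i _ => hf0 w s i) (Finset.mem_univ s)
    have h4 : ∑ s, ∑ i, f w s i ≤ ∑ w, ∑ s, ∑ i, f w s i :=
      Finset.single_le_sum (f := fun w => ∑ s, ∑ i, f w s i)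
        (fun w _ => Finset.sum_nonneg fun s _ => Finset.sum_nonneg fun i _ => hf0 w s i)
        (Finset.mem_univ w)
    linarith

lemma prod_placeRadius (T : Finset (FinitePlace K)) (C R : ℝ) (N : ℕ) :
    ∏ s, ∏ _i : Fin N, (C * placeRadius T R s) ^ placeMult T s =
      ((∏ s, C ^ placeMult T s) * R ^ Module.finrank ℚ K) ^ N := by
  simp only [Finset.prod_const, Finset.card_univ, Fintype.card_fin]
  rw [Finset.prod_pow]
  congr 1
  simp only [mul_pow]
  rw [Finset.prod_mul_distrib]
  congr 1
  rw [Fintype.prod_sum_type, ← InfinitePlace.sum_mult_eq, ← Finset.prod_pow_eq_pow_sum]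
  have h : ∏ w : T, placeRadius T R (Sum.inr w) ^ placeMult T (Sum.inr w) = 1 :=
    Finset.prod_eq_one fun w _ => one_pow _
  rw [h, mul_one]
  rfl

/-- A Minkowski-type theorem for integral vectors, by the box principle. -/
lemma exists_integral_vector (T : Finset (FinitePlace K)) (N : ℕ)
    (L : PlaceIdx T → Matrix (Fin N) (Fin N) ℤ) : ∃ c : ℝ, 0 < c ∧
      ∀ A : PlaceIdx T → Fin N → ℝ, (∀ s i, 0 < A s i) →
      (∀ w i, A (Sum.inr w) i ≤ 1) → c ≤ ∏ s, ∏ i, A s i ^ placeMult T s →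
      ∃ y : Fin N → 𝓞 K, y ≠ 0 ∧
        ∀ s i, placeAbv T s (∑ j, (L s i j : K) * (y j : K)) ≤ A s i := by
  classical
  obtain ⟨C, hC, hcover⟩ := exists_place_cover T
  obtain ⟨C0, hC0, hbound⟩ := exists_coordVec_bound (K := K) N L
  set d := Module.finrank ℚ K with hd
  set E : ℝ := ((∏ s, C ^ placeMult T s) * C0 ^ d) ^ N with hE
  have hE0 : 0 < E := by positivity
  refine ⟨E + 1, by positivity, fun A hA hA1 hc => ?_⟩
  obtain ⟨B, hB⟩ := exists_nat_ge (1 + ∑ s, ∑ i, A s i)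
  have hAB : ∀ s i, A s i ≤ B := fun s i => by
    have h2 : A s i ≤ ∑ i, A s i :=
      Finset.single_le_sum (fun i _ => (hA s i).le) (Finset.mem_univ i)
    have h3 : ∑ i, A s i ≤ ∑ s, ∑ i, A s i :=
      Finset.single_le_sum (f := fun s => ∑ i, A s i)
        (fun s _ => Finset.sum_nonneg fun i _ => (hA s i).le) (Finset.mem_univ s)
    linarith
  have hB1 : (1 : ℝ) ≤ B := by
    have := Finset.sum_nonneg fun s (_ : s ∈ Finset.univ) => Finset.sum_nonneg
      fun i (_ : i ∈ Finset.univ) => (hA s i).le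
    linarith
  have hAR : ∀ s i, A s i ≤ placeRadius T (C0 * B) s := by
    rintro (w | w) i
    · exact (hAB _ _).trans (le_mul_of_one_le_left (by linarith) hC0)
    · exact hA1 w i
  choose m κ h1 h2 h3 using fun s i => hcover s (A s i) (C0 * B) (hA s i) (hAR s i)
  set ω := Module.Free.ChooseBasisIndex ℤ (𝓞 K)
  set z : (Fin N → ω → Fin B) → PlaceIdx T → Fin N → 𝓞 K := fun n s i =>
    ∑ j, (L s i j : 𝓞 K) * coordVec n j with hz
  have hzb : ∀ n s i, ∀ w : InfinitePlace K, w (z n s i : K) ≤ C0 * B :=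
    fun n s i w => hbound B n w s i
  set g : (Fin N → ω → Fin B) → ∀ p : PlaceIdx T × Fin N, Fin (m p.1 p.2) := fun n p =>
    ⟨κ p.1 p.2 (z n p.1 p.2), h1 _ _ _ (hzb n _ _)⟩ with hg
  have hω : Fintype.card ω = d := by
    rw [← Module.finrank_eq_card_chooseBasisIndex, RingOfIntegers.rank]
  have hP : 0 < ∏ s, ∏ i, A s i ^ placeMult T s :=
    Finset.prod_pos fun s _ => Finset.prod_pos fun i _ => pow_pos (hA s i) _
  have hcard : Fintype.card (∀ p : PlaceIdx T × Fin N, Fin (m p.1 p.2)) <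
      Fintype.card (Fin N → ω → Fin B) := by
    simp only [Fintype.card_pi, Fintype.card_fin, Finset.prod_const, Finset.card_univ, hω]
    rw [Fintype.prod_prod_type]
    have h4 : ((∏ s, ∏ i, m s i : ℕ) : ℝ) < ((B ^ d) ^ N : ℕ) := by
      push_cast
      calc ∏ s, ∏ i, (m s i : ℝ)
          ≤ ∏ s, ∏ i, (C * placeRadius T (C0 * B) s / A s i) ^ placeMult T s :=
            Finset.prod_le_prod (fun s _ => Finset.prod_nonneg fun i _ => Nat.cast_nonneg _)
              fun s _ => Finset.prod_le_prod (fun i _ => Nat.cast_nonneg _) fun i _ => h3 s i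
        _ = E * ((B : ℝ) ^ d) ^ N / ∏ s, ∏ i, A s i ^ placeMult T s := by
            simp only [div_pow, Finset.prod_div_distrib]
            rw [prod_placeRadius, hE, mul_pow C0, ← mul_assoc, mul_pow _ ((B : ℝ) ^ d)]
        _ < ((B : ℝ) ^ d) ^ N := by
            rw [div_lt_iff₀ hP, mul_comm]
            refine mul_lt_mul_of_pos_left (by linarith) (by positivity)
    exact_mod_cast h4
  obtain ⟨n, n', hne, hgn⟩ := Fintype.exists_ne_map_eq_of_card_lt g hcard
  refine ⟨coordVec n - coordVec n', sub_ne_zero.2 fun h => hne (coordVec_injective h),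
    fun s i => ?_⟩
  have h5 := h2 s i (z n s i) (z n' s i) (hzb n s i) (hzb n' s i)
    (congrArg Fin.val (congrFun hgn (s, i)))
  convert h5 using 2
  rw [hz, ← map_sub, ← Finset.sum_sub_distrib, map_sum]
  refine Finset.sum_congr rfl fun j _ => ?_
  rw [← mul_sub, map_mul, map_intCast]
  rfl

lemma exists_sIntegers_vector {T : Finset (FinitePlace K)} (hT : ∀ ε : ℝ, 0 < ε →
      ∃ D : ℕ, D ≠ 0 ∧ (∀ w ∈ T, w (D : K) ≤ ε) ∧ ∀ w ∉ T, w (D : K) = 1) (N : ℕ)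
    (L : PlaceIdx T → Matrix (Fin N) (Fin N) ℤ) : ∃ c : ℝ, 0 < c ∧
      ∀ A : PlaceIdx T → Fin N → ℝ, (∀ s i, 0 < A s i) →
      c ≤ ∏ s, ∏ i, A s i ^ placeMult T s →
      ∃ x : Fin N → K, x ≠ 0 ∧ (∀ i, x i ∈ sIntegers T) ∧
        ∀ s i, placeAbv T s (∑ j, (L s i j : K) * x j) ≤ A s i := by
  obtain ⟨c, hc, h⟩ := exists_integral_vector T N L
  refine ⟨c, hc, fun A hA hcA => ?_⟩
  have hS : 0 ≤ ∑ s, ∑ i, A s i :=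
    Finset.sum_nonneg fun s _ => Finset.sum_nonneg fun i _ => (hA s i).le
  obtain ⟨D, hD0, hD, hD1⟩ := hT (1 + ∑ s, ∑ i, A s i)⁻¹ (by positivity)
  have hDK : (D : K) ≠ 0 := Nat.cast_ne_zero.2 hD0
  have hDv : ∀ s, 0 < placeAbv T s (D : K) := fun s => (placeAbv T s).pos hDK
  have hDT : 1 ≤ ∏ s, placeAbv T s (D : K) ^ placeMult T s :=
    one_le_prod_placeAbv T (fun w _ => finitePlace_le_one_of_isIntegral w (isIntegral_natCast D)) hDK
  have hle : ∀ w i, A (Sum.inr w) i * placeAbv T (Sum.inr w) (D : K) ≤ 1 := fun w i => by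
    have h2 : A (Sum.inr w) i ≤ ∑ i, A (Sum.inr w) i :=
      Finset.single_le_sum (fun i _ => (hA (Sum.inr w) i).le) (Finset.mem_univ i)
    have h3 : ∑ i, A (Sum.inr w) i ≤ ∑ s, ∑ i, A s i :=
      Finset.single_le_sum (f := fun s => ∑ i, A s i)
        (fun s _ => Finset.sum_nonneg fun i _ => (hA s i).le) (Finset.mem_univ _)
    calc A (Sum.inr w) i * placeAbv T (Sum.inr w) (D : K)
        ≤ (1 + ∑ s, ∑ i, A s i) * (1 + ∑ s, ∑ i, A s i)⁻¹ :=
          mul_le_mul (by linarith) (hD w w.2) (hDv _).le (by positivity)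
      _ = 1 := mul_inv_cancel₀ (by positivity)
  have hprod : c ≤ ∏ s, ∏ i, (A s i * placeAbv T s (D : K)) ^ placeMult T s := by
    refine hcA.trans ?_
    simp only [mul_pow, Finset.prod_mul_distrib, Finset.prod_const, Finset.card_univ,
      Fintype.card_fin]
    rw [Finset.prod_pow]
    exact le_mul_of_one_le_right
      (Finset.prod_nonneg fun s _ => Finset.prod_nonneg fun i _ => pow_nonneg (hA s i).le _)
      (one_le_pow₀ hDT)
  obtain ⟨y, hy0, hy⟩ := h (fun s i => A s i * placeAbv T s (D : K))
    (fun s i => mul_pos (hA s i) (hDv s)) hle hprod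
  refine ⟨fun j => (D : K)⁻¹ * y j, fun h0 => hy0 (funext fun j => ?_), fun j w hw => ?_,
    fun s i => ?_⟩
  · have h1 := (mul_eq_zero.1 (congrFun h0 j)).resolve_left (inv_ne_zero hDK)
    exact RingOfIntegers.coe_eq_zero_iff.1 h1
  · rw [map_mul, map_inv₀, hD1 w hw, inv_one, one_mul]
    exact finitePlace_le_one w (y j)
  · have h1 : ∑ j, (L s i j : K) * ((D : K)⁻¹ * y j) =
        (D : K)⁻¹ * ∑ j, (L s i j : K) * y j := by
      rw [Finset.mul_sum]
      exact Finset.sum_congr rfl fun j _ => by ring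
    rw [h1, map_mul, map_inv₀, inv_mul_le_iff₀ (hDv s), mul_comm]
    exact hy s i

/-- The system of absolute values attached to the archimedean places and those in `T`. -/
noncomputable def placeSData {T : Finset (FinitePlace K)} (hT : ∀ ε : ℝ, 0 < ε →
      ∃ D : ℕ, D ≠ 0 ∧ (∀ w ∈ T, w (D : K) ≤ ε) ∧ ∀ w ∉ T, w (D : K) = 1) :
    SData K (PlaceIdx T) where
  v := placeAbv T
  n := placeMult T
  n_pos := by
    rintro (w | w)
    · exact w.mult_pos
    · exact one_pos
  O := sIntegers T
  one_le _ hx h0 := one_le_prod_placeAbv T hx h0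
  finite_le := finite_sIntegers_le T
  integral_mem _ hx w _ := finitePlace_le_one_of_isIntegral w hx
  arch_or := by
    rintro (w | w)
    · exact Or.inl ⟨w.embedding, fun x => (w.norm_embedding_eq x).symm⟩
    · exact Or.inr fun x hx => finitePlace_le_one_of_isIntegral w.1 hx
  minkowski N L _ _ := exists_sIntegers_vector hT N L

/-- The `S`-unit theorem over number fields. -/
theorem unitSolutions_finite_of_fg {α : Type} [Fintype α] {Γ : Subgroup Kˣ} (hΓ : Γ.FG) :
    (unitSolutions Γ α).Finite := by
  refine unitSolutions_finite (fun Γ hΓ => ?_) _ α rfl Γ hΓ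
  obtain ⟨T₀, hT₀⟩ := exists_sIntegers_of_fg Γ hΓ
  obtain ⟨T, hTT, hT⟩ := exists_superset_small T₀
  refine ⟨PlaceIdx T, inferInstance, inferInstance, placeSData hT, fun u hu w hw => ?_⟩
  exact hT₀ u hu w fun h => hw (hTT h)

end SUnit

/-- The `S`-unit lemma: if `Γ` is a finitely generated subgroup of `k^*`, then all but
finitely many solutions `(u₀, …, uₙ) ∈ Γ^{n+1}` of `u₀ + u₁ + ⋯ + uₙ = 1` satisfy a
subsum relation `∑_{i ∈ I} uᵢ = 0` for some nonempty `I ⊆ {0, …, n}`. -/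
theorem s_unit_lemma (k : Type*) [Field k] [NumberField k] (n : ℕ) (hn : 0 < n)
    (Γ : Subgroup kˣ) (hΓ : Γ.FG) :
    {u : Fin (n + 1) → kˣ |
      (∀ i, u i ∈ Γ) ∧ (∑ i, ((u i : kˣ) : k)) = 1 ∧
      ¬ ∃ I : Finset (Fin (n + 1)), I.Nonempty ∧ (∑ i ∈ I, ((u i : kˣ) : k)) = 0}.Finite := by
  exact SUnit.unitSolutions_finite_of_fg hΓ
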